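/- Let ρ ∈ (0, 1). There exists a constant c_ρ > 0 depending only on ρ such that: for each n, if the martingale differences (X_i)_{1≤i≤n} satisfy conditions (A1), (A2) (with exponent ρ), and (A4) (with the same ρ), and (x_n) is a sequence with x_n ≥ 0 and x_n γ_n → 0 (i.e. x_n = o(γ_n^{-1})), then for all sufficiently large n there exists θ_n with |θ_n| ≤ 1 such that P(W_n ≥ x_n)/(1 − Φ(x_n)) = exp{ θ_n c_ρ ( x_n^{2+ρ} ε_n^ρ + x_n² δ_n² + (1 + x_n)( x_n^ρ γ_n^ρ + γ_n^ρ + δ_n + ε̂_n(x_n, ρ) ) ) }, where ε̂_n(x, ρ) = ε_n^{ρ(2−ρ)/4} / (1 + x^{ρ(2+ρ)/4}). The same equality (with possibly different θ_n, |θ_n| ≤ 1) holds with P(W_n ≥ x_n)/(1 − Φ(x_n)) replaced by P(W_n ≤ −x_n)/Φ(−x_n). -/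

import Mathlib

open MeasureTheory Filter
open scoped Topology ENNReal

noncomputable def stdNormalCDF (x : ℝ) : ℝ :=
  (Real.sqrt (2 * Real.pi))⁻¹ * ∫ t in Set.Iic x, Real.exp (-(t ^ 2) / 2)

/-- A finite sequence of square-integrable martingale differences
`X 1, ..., X n` adapted to a filtration `F 0 ⊆ F 1 ⊆ ... ⊆ F n`, with
`F 0` trivial, `E[X i | F (i-1)] = 0` and `0 < E[(X i)^2] < ∞`. -/
structure MDS (Ω : Type) [mΩ : MeasurableSpace Ω] (P : Measure Ω) where
  n : ℕ
  npos : 0 < n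
  F : ℕ → MeasurableSpace Ω
  F_mono : Monotone F
  F_le : ∀ i, F i ≤ mΩ
  F_zero : F 0 = ⊥
  X : ℕ → Ω → ℝ
  meas : ∀ i, 1 ≤ i → i ≤ n → StronglyMeasurable[F i] (X i)
  sq_int : ∀ i, 1 ≤ i → i ≤ n → Integrable (fun ω => (X i ω) ^ 2) P
  mean_zero : ∀ i, 1 ≤ i → i ≤ n → P[X i|F (i - 1)] =ᵐ[P] 0
  var_pos : ∀ i, 1 ≤ i → i ≤ n → 0 < ∫ ω, (X i ω) ^ 2 ∂P

namespace MDS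

variable {Ω : Type} [mΩ : MeasurableSpace Ω] {P : Measure Ω}

/-- `S_n = ∑_{i=1}^n X_i`. -/
noncomputable def S (A : MDS Ω P) : Ω → ℝ := fun ω => ∑ i ∈ Finset.Icc 1 A.n, A.X i ω

/-- `B_n² = ∑_{i=1}^n E[X_i²]`. -/
noncomputable def Bsq (A : MDS Ω P) : ℝ := ∑ i ∈ Finset.Icc 1 A.n, ∫ ω, (A.X i ω) ^ 2 ∂P

/-- `[S]_n = ∑_{i=1}^n X_i²`. -/
noncomputable def QV (A : MDS Ω P) : Ω → ℝ := fun ω => ∑ i ∈ Finset.Icc 1 A.n, (A.X i ω) ^ 2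

/-- `⟨S⟩_n = ∑_{i=1}^n E[X_i² | F_{i-1}]`. -/
noncomputable def CV (A : MDS Ω P) : Ω → ℝ :=
  fun ω => ∑ i ∈ Finset.Icc 1 A.n, (P[fun ω' => (A.X i ω') ^ 2|A.F (i - 1)]) ω

/-- `W_n = S_n / √[S]_n`. -/
noncomputable def W (A : MDS Ω P) : Ω → ℝ := fun ω => A.S ω / Real.sqrt (A.QV ω)

/-- Condition (A1): `|⟨S⟩_n − B_n²| ≤ δ² B_n²` a.s., with `δ ∈ [0, 1/4]`. -/
def CondA1 (A : MDS Ω P) (δ : ℝ) : Prop :=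
  0 ≤ δ ∧ δ ≤ 1 / 4 ∧ ∀ᵐ ω ∂P, |A.CV ω - A.Bsq| ≤ δ ^ 2 * A.Bsq

/-- Condition (A2): `∑_{i=1}^n E[|X_i|^{2+ρ} | F_{i-1}] ≤ ε^ρ B_n^{2+ρ}` a.s.,
with `ε ∈ (0, 1/4]`. -/
def CondA2 (A : MDS Ω P) (ρ ε : ℝ) : Prop :=
  0 < ε ∧ ε ≤ 1 / 4 ∧
    (∀ i, 1 ≤ i → i ≤ A.n → Integrable (fun ω => |A.X i ω| ^ (2 + ρ)) P) ∧
    ∀ᵐ ω ∂P,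
      ∑ i ∈ Finset.Icc 1 A.n, (P[fun ω' => |A.X i ω'| ^ (2 + ρ)|A.F (i - 1)]) ω ≤
        ε ^ ρ * A.Bsq ^ ((2 + ρ) / 2)

/-- Condition (A3): `E[X_i² | F_{i-1}] ≤ κ² B_n²` a.s. for each `i`, with `κ ∈ (0, 1/4]`. -/
def CondA3 (A : MDS Ω P) (κ : ℝ) : Prop :=
  0 < κ ∧ κ ≤ 1 / 4 ∧
    ∀ i, 1 ≤ i → i ≤ A.n →
      ∀ᵐ ω ∂P, (P[fun ω' => (A.X i ω') ^ 2|A.F (i - 1)]) ω ≤ κ ^ 2 * A.Bsq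

/-- Condition (A4): `E[|X_i|^{2+ρ} | F_{i-1}] ≤ (γ B_n)^ρ E[X_i² | F_{i-1}]` a.s.
for each `i`, with `γ ∈ (0, 1/4]`. -/
def CondA4 (A : MDS Ω P) (ρ γ : ℝ) : Prop :=
  0 < γ ∧ γ ≤ 1 / 4 ∧
    (∀ i, 1 ≤ i → i ≤ A.n → Integrable (fun ω => |A.X i ω| ^ (2 + ρ)) P) ∧
    ∀ i, 1 ≤ i → i ≤ A.n →
      ∀ᵐ ω ∂P,
        (P[fun ω' => |A.X i ω'| ^ (2 + ρ)|A.F (i - 1)]) ω ≤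
          (γ * Real.sqrt A.Bsq) ^ ρ * (P[fun ω' => (A.X i ω') ^ 2|A.F (i - 1)]) ω

end MDS

open MeasureTheory Filter
open scoped Topology ENNReal

/-! ### Part A: the normal distribution -/

noncomputable def gpdf (t : ℝ) : ℝ := (Real.sqrt (2 * Real.pi))⁻¹ * Real.exp (-(t ^ 2) / 2)

lemma gpdf_pos (t : ℝ) : 0 < gpdf t := by unfold gpdf; positivity

lemma sqrt_two_pi_ge : 2 ≤ Real.sqrt (2 * Real.pi) := by
  apply Real.le_sqrt_of_sq_le
  nlinarith [Real.pi_gt_three]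

lemma sqrt_two_pi_le : Real.sqrt (2 * Real.pi) ≤ 3 := by
  rw [Real.sqrt_le_left (by norm_num)]
  nlinarith [Real.pi_lt_four]

lemma gpdf_le (t : ℝ) : gpdf t ≤ (1 / 2) * Real.exp (-(t ^ 2) / 2) := by
  unfold gpdf
  have : (Real.sqrt (2 * Real.pi))⁻¹ ≤ 1 / 2 := by
    rw [one_div]; exact inv_anti₀ (by norm_num) sqrt_two_pi_ge
  gcongr

lemma gpdf_ge (t : ℝ) : (1 / 3) * Real.exp (-(t ^ 2) / 2) ≤ gpdf t := by
  unfold gpdf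
  have : 1 / 3 ≤ (Real.sqrt (2 * Real.pi))⁻¹ := by
    rw [one_div]; exact inv_anti₀ (by positivity) sqrt_two_pi_le
  gcongr

lemma gpdf_le_half (t : ℝ) : gpdf t ≤ 1 / 2 := by
  have h := gpdf_le t
  have : Real.exp (-(t ^ 2) / 2) ≤ 1 := by
    rw [Real.exp_le_one_iff]; nlinarith [sq_nonneg t]
  linarith

lemma gpdf_continuous : Continuous gpdf := by unfold gpdf; fun_prop

lemma gpdf_integrable : Integrable gpdf := by
  unfold gpdf
  have := (integrable_exp_neg_mul_sq (b := 1 / 2) (by norm_num)).const_mul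
    ((Real.sqrt (2 * Real.pi))⁻¹)
  refine this.congr (ae_of_all _ fun t => ?_)
  simp only
  congr 2; ring

lemma gpdf_integral : ∫ t, gpdf t = 1 := by
  unfold gpdf
  rw [integral_const_mul]
  have h : (fun t : ℝ => Real.exp (-(t ^ 2) / 2)) = fun t => Real.exp (-(1 / 2) * t ^ 2) := by
    funext t; congr 1; ring
  rw [h, integral_gaussian]
  have : Real.pi / (1 / 2) = 2 * Real.pi := by ring
  rw [this]
  exact inv_mul_cancel₀ (by have := sqrt_two_pi_ge; linarith)

lemma cdf_eq (x : ℝ) : stdNormalCDF x = ∫ t in Set.Iic x, gpdf t := by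
  unfold stdNormalCDF gpdf
  rw [integral_const_mul]

lemma one_sub_cdf_eq (x : ℝ) : 1 - stdNormalCDF x = ∫ t in Set.Ioi x, gpdf t := by
  rw [cdf_eq, ← gpdf_integral, ← integral_add_compl (s := Set.Iic x) measurableSet_Iic gpdf_integrable]
  simp

lemma cdf_sub (a b : ℝ) (hab : a ≤ b) : stdNormalCDF b - stdNormalCDF a = ∫ t in a..b, gpdf t := by
  rw [cdf_eq, cdf_eq, intervalIntegral.integral_Iic_sub_Iic gpdf_integrable.integrableOn
    gpdf_integrable.integrableOn]

lemma cdf_hasDerivAt (x : ℝ) : HasDerivAt stdNormalCDF (gpdf x) x := by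
  have h : ∀ y, stdNormalCDF y = (∫ t in (0:ℝ)..y, gpdf t) + stdNormalCDF 0 := by
    intro y
    rw [cdf_eq, cdf_eq, ← intervalIntegral.integral_Iic_sub_Iic gpdf_integrable.integrableOn
      gpdf_integrable.integrableOn]
    ring
  rw [show stdNormalCDF = fun y => (∫ t in (0:ℝ)..y, gpdf t) + stdNormalCDF 0 from funext h]
  exact (intervalIntegral.integral_hasDerivAt_right (gpdf_integrable.intervalIntegrable)
    (gpdf_continuous.stronglyMeasurableAtFilter _ _) gpdf_continuous.continuousAt).add_const _

lemma cdf_neg (x : ℝ) : stdNormalCDF (-x) = 1 - stdNormalCDF x := by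
  rw [one_sub_cdf_eq, cdf_eq]
  have h := integral_comp_neg_Iic (-x) gpdf
  rw [neg_neg] at h
  rw [← h]
  congr 1
  ext t
  simp [gpdf]

lemma cdf_nonneg (x : ℝ) : 0 ≤ stdNormalCDF x := by
  rw [cdf_eq]; exact integral_nonneg fun t => (gpdf_pos t).le

lemma cdf_le_one (x : ℝ) : stdNormalCDF x ≤ 1 := by
  have := cdf_nonneg (-x); rw [cdf_neg] at this; linarith

lemma cdf_continuous : Continuous stdNormalCDF :=
  continuous_iff_continuousAt.2 fun x => (cdf_hasDerivAt x).continuousAt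

lemma cdf_differentiable : Differentiable ℝ stdNormalCDF := fun x =>
  (cdf_hasDerivAt x).differentiableAt

lemma cdf_deriv : deriv stdNormalCDF = gpdf := funext fun x => (cdf_hasDerivAt x).deriv

lemma cdf_strictMono : StrictMono stdNormalCDF :=
  strictMono_of_deriv_pos (by rw [cdf_deriv]; exact gpdf_pos)

lemma cdf_mono : Monotone stdNormalCDF := cdf_strictMono.monotone

lemma cdf_lt_one (x : ℝ) : stdNormalCDF x < 1 :=
  lt_of_lt_of_le (cdf_strictMono (lt_add_one x)) (cdf_le_one _)

lemma one_sub_cdf_pos (x : ℝ) : 0 < 1 - stdNormalCDF x := by linarith [cdf_lt_one x]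

lemma cdf_zero : stdNormalCDF 0 = 1 / 2 := by
  have := cdf_neg 0; simp at this; linarith

lemma cdf_lipschitz (a b : ℝ) : |stdNormalCDF a - stdNormalCDF b| ≤ |a - b| := by
  have := Convex.norm_image_sub_le_of_norm_deriv_le (f := stdNormalCDF) (C := 1) (s := Set.univ)
    (x := b) (y := a) (fun x _ => cdf_differentiable x) (fun x _ => by
      rw [cdf_deriv, Real.norm_of_nonneg (gpdf_pos x).le]
      linarith [gpdf_le_half x]) convex_univ (Set.mem_univ _) (Set.mem_univ _)
  simpa using this

lemma exists_cdf_sub (a b : ℝ) (hab : a < b) :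
    ∃ c ∈ Set.Ioo a b, stdNormalCDF b - stdNormalCDF a = gpdf c * (b - a) := by
  obtain ⟨c, hc, h⟩ := exists_deriv_eq_slope stdNormalCDF hab cdf_continuous.continuousOn
    cdf_differentiable.differentiableOn
  refine ⟨c, hc, ?_⟩
  rw [cdf_deriv] at h
  rw [h]; field_simp [sub_ne_zero.2 hab.ne']

/-- lower Mills bound -/
lemma mills_lower (x : ℝ) (hx : 0 ≤ x) :
    Real.exp (-(x ^ 2) / 2) ≤ 15 * (1 + x) * (1 - stdNormalCDF x) := by
  set h := 1 / (1 + x) with hh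
  have hpos : 0 < h := by positivity
  have hle : h ≤ 1 := by rw [hh, div_le_one (by linarith)]; linarith
  have hxh : x * h ≤ 1 := by rw [hh]; field_simp; linarith
  obtain ⟨c, hc, hce⟩ := exists_cdf_sub x (x + h) (by linarith)
  have h1 : (1 / 3) * Real.exp (-(x ^ 2) / 2 - 3 / 2) ≤ gpdf c := by
    refine le_trans ?_ (gpdf_ge c)
    gcongr
    have : c ^ 2 ≤ (x + h) ^ 2 := by
      have := hc.1; have := hc.2; gcongr; 
      linarith
    nlinarith
  have h2 : Real.exp (-(x ^ 2) / 2 - 3 / 2) = Real.exp (-(x ^ 2) / 2) * Real.exp (-(3 / 2)) := by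
    rw [← Real.exp_add]; ring_nf
  have h3 : (1 : ℝ) / 5 ≤ Real.exp (-(3 / 2)) := by
    rw [Real.exp_neg, one_div]
    apply inv_anti₀ (Real.exp_pos _)
    have := Real.exp_one_lt_d9
    have h4 : Real.exp (3 / 2) = Real.exp (1 / 2) * Real.exp 1 := by rw [← Real.exp_add]; norm_num
    have h5 : Real.exp (1 / 2) * Real.exp (1 / 2) = Real.exp 1 := by rw [← Real.exp_add]; norm_num
    have h6 : Real.exp (1 / 2) ≤ 1.65 := by
      by_contra hcon; push Not at hcon; nlinarith
    nlinarith [Real.exp_pos 1]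
  have h7 := cdf_le_one (x + h)
  have h8 : (1 / 15) * Real.exp (-(x ^ 2) / 2) ≤ gpdf c := by
    refine le_trans ?_ h1
    rw [h2]
    nlinarith [Real.exp_pos (-(x ^ 2) / 2)]
  have h9 : gpdf c * h ≤ 1 - stdNormalCDF x := by
    have : x + h - x = h := by ring
    rw [this] at hce; linarith
  have h10 : (1 / 15) * Real.exp (-(x ^ 2) / 2) * h ≤ 1 - stdNormalCDF x :=
    le_trans (by gcongr) h9
  have : h * (1 + x) = 1 := by rw [hh]; field_simp
  calc Real.exp (-(x ^ 2) / 2) = 15 * (1 + x) * ((1 / 15) * Real.exp (-(x ^ 2) / 2) * h) := by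
        linear_combination (-1) * Real.exp (-(x ^ 2) / 2) * this
    _ ≤ _ := by gcongr

lemma cdf_tendsto_atTop : Tendsto stdNormalCDF atTop (𝓝 1) := by
  have h := intervalIntegral_tendsto_integral_Ioi (μ := volume) 0
    (gpdf_integrable.integrableOn) tendsto_id
  have h2 : Tendsto (fun y => (∫ t in (0:ℝ)..y, gpdf t) + stdNormalCDF 0) atTop
      (𝓝 ((∫ t in Set.Ioi 0, gpdf t) + stdNormalCDF 0)) := h.add_const _
  rw [← one_sub_cdf_eq] at h2
  simp only [sub_add_cancel] at h2
  refine h2.congr' ?_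
  filter_upwards [eventually_ge_atTop 0] with y hy
  rw [← cdf_sub 0 y hy]; ring

/-- upper Mills bound -/
lemma mills_upper (x : ℝ) (hx : 0 ≤ x) :
    (1 + x) * (1 - stdNormalCDF x) ≤ Real.exp (-(x ^ 2) / 2) := by
  have hanti : AntitoneOn (fun t => Real.exp (-(t ^ 2) / 2) / (1 + t) - (1 - stdNormalCDF t))
      (Set.Ici 0) := by
    have hd : ∀ t, 0 ≤ t → HasDerivAt
        (fun t => Real.exp (-(t ^ 2) / 2) / (1 + t) - (1 - stdNormalCDF t))
        ((Real.exp (-(t ^ 2) / 2) * (-t) * (1 + t) - Real.exp (-(t ^ 2) / 2) * 1) / (1 + t) ^ 2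
          - (0 - gpdf t)) t := by
      intro t ht
      have h1 : HasDerivAt (fun t : ℝ => -(t ^ 2) / 2) (-t) t := by
        exact (((hasDerivAt_pow 2 t).neg).div_const 2).congr_deriv (by norm_num; ring)
      have h2 : HasDerivAt (fun t : ℝ => 1 + t) 1 t := (hasDerivAt_id t).const_add 1
      exact (h1.exp.div h2 (by positivity)).sub ((hasDerivAt_const t (1:ℝ)).sub (cdf_hasDerivAt t))
    apply antitoneOn_of_deriv_nonpos (convex_Ici 0)
    · exact fun t ht => (hd t ht).continuousAt.continuousWithinAt
    · intro t ht
      rw [interior_Ici] at ht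
      exact (hd t (le_of_lt ht)).differentiableAt.differentiableWithinAt
    · intro t ht
      rw [interior_Ici] at ht
      have ht' : 0 < t := ht
      rw [(hd t ht'.le).deriv]
      have := gpdf_le t
      have h3 : (Real.exp (-(t ^ 2) / 2) * (-t) * (1 + t) - Real.exp (-(t ^ 2) / 2) * 1) / (1 + t) ^ 2
          ≤ - (1 / 2 * Real.exp (-(t ^ 2) / 2)) := by
        rw [div_le_iff₀ (by positivity)]
        nlinarith [mul_pos (Real.exp_pos (-(t ^ 2) / 2)) ht', Real.exp_pos (-(t ^ 2) / 2),
          mul_nonneg (Real.exp_pos (-(t ^ 2) / 2)).le (sq_nonneg t)]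
      linarith
  have hlim : Tendsto (fun t => Real.exp (-(t ^ 2) / 2) / (1 + t) - (1 - stdNormalCDF t)) atTop
      (𝓝 (0 - (1 - 1))) := by
    apply Tendsto.sub _ (tendsto_const_nhds.sub cdf_tendsto_atTop)
    have : Tendsto (fun t : ℝ => 1 / (1 + t)) atTop (𝓝 0) :=
      tendsto_const_nhds.div_atTop (tendsto_atTop_add_const_left _ _ tendsto_id)
    refine squeeze_zero' ?_ ?_ this
    · filter_upwards [eventually_ge_atTop 0] with t ht
      positivity
    · filter_upwards [eventually_ge_atTop 0] with t ht
      gcongr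
      rw [Real.exp_le_one_iff]; nlinarith [sq_nonneg t]
  have h0 : 0 ≤ Real.exp (-(x ^ 2) / 2) / (1 + x) - (1 - stdNormalCDF x) := by
    have : (0 : ℝ) = 0 - (1 - 1) := by ring
    rw [this]
    refine le_of_tendsto hlim ?_
    filter_upwards [eventually_ge_atTop x] with t ht
    exact hanti hx (le_trans hx ht) ht
  have h1 : 1 - stdNormalCDF x ≤ Real.exp (-(x ^ 2) / 2) / (1 + x) := by linarith
  rw [le_div_iff₀ (by linarith)] at h1
  linarith

lemma hazard (t x : ℝ) (hx : 0 ≤ x) (htx : t ≤ x) :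
    gpdf t ≤ 8 * (1 + x) * (1 - stdNormalCDF t) := by
  rcases le_or_gt 0 t with ht | ht
  · have h1 := mills_lower t ht
    have h2 := gpdf_le t
    have h3 := one_sub_cdf_pos t
    calc gpdf t ≤ 1 / 2 * (15 * (1 + t) * (1 - stdNormalCDF t)) := by linarith
      _ ≤ 8 * (1 + t) * (1 - stdNormalCDF t) := by nlinarith
      _ ≤ _ := by gcongr
  · have h1 := gpdf_le_half t
    have h2 : stdNormalCDF t ≤ 1 / 2 := by rw [← cdf_zero]; exact cdf_mono ht.le
    nlinarith

lemma cdf_shift (y x : ℝ) (hx : 0 ≤ x) (hyx : y ≤ x) :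
    1 - stdNormalCDF y ≤ (1 - stdNormalCDF x) * Real.exp (8 * (1 + x) * (x - y)) := by
  set K := 8 * (1 + x)
  have hd : ∀ t, HasDerivAt (fun t => (1 - stdNormalCDF t) * Real.exp (K * t))
      ((0 - gpdf t) * Real.exp (K * t) + (1 - stdNormalCDF t) * (Real.exp (K * t) * (K * 1))) t :=
    fun t => ((hasDerivAt_const t (1:ℝ)).sub (cdf_hasDerivAt t)).mul
      (((hasDerivAt_id t).const_mul K).exp)
  have hm : MonotoneOn (fun t => (1 - stdNormalCDF t) * Real.exp (K * t)) (Set.Iic x) := by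
    apply monotoneOn_of_deriv_nonneg (convex_Iic x)
    · exact fun t _ => (hd t).continuousAt.continuousWithinAt
    · exact fun t _ => (hd t).differentiableAt.differentiableWithinAt
    · intro t ht
      rw [interior_Iic] at ht
      rw [(hd t).deriv]
      have := hazard t x hx (le_of_lt ht)
      have h2 := Real.exp_pos (K * t)
      have : 0 ≤ (K * (1 - stdNormalCDF t) - gpdf t) * Real.exp (K * t) :=
        mul_nonneg (by linarith) h2.le
      linarith
  have := hm (Set.mem_Iic.2 hyx) (Set.mem_Iic.2 le_rfl) hyx
  simp only at this
  have e : Real.exp (K * (x - y)) = Real.exp (K * x) / Real.exp (K * y) := by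
    rw [← Real.exp_sub]; congr 1; ring
  rw [e, ← mul_div_assoc, le_div_iff₀ (Real.exp_pos _)]
  exact this

lemma gauss_laplace (a l : ℝ) :
    ∫ t in Set.Ici a, Real.exp (-l * t) * gpdf t = Real.exp (l ^ 2 / 2) * (1 - stdNormalCDF (a + l)) := by
  rw [one_sub_cdf_eq, integral_Ici_eq_integral_Ioi, ← integral_const_mul]
  have h : ∀ t, Real.exp (-l * t) * gpdf t = Real.exp (l ^ 2 / 2) * gpdf (t + l) := by
    intro t
    unfold gpdf
    rw [mul_left_comm, ← Real.exp_add, mul_left_comm, ← Real.exp_add]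
    congr 2; ring
  simp_rw [h]
  rw [← integral_indicator measurableSet_Ioi, ← integral_indicator measurableSet_Ioi]
  refine Eq.trans ?_ (integral_add_right_eq_self _ l)
  congr 1
  ext t
  simp only [Set.indicator, Set.mem_Ioi, add_lt_add_iff_right]

open MeasureTheory Filter
open scoped Topology ENNReal

lemma laplace_fubini (ν : Measure ℝ) [IsProbabilityMeasure ν] (a l : ℝ) (hl : 0 < l) :
    ∫ m in Set.Ici a, Real.exp (-l * m) ∂ν
      = ∫ t in Set.Ioi a, l * Real.exp (-l * t) * ν.real (Set.Ico a t) := by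
  have hInt0 : IntegrableOn (fun t : ℝ => l * Real.exp (-l * t)) (Set.Ioi a) :=
    (integrableOn_exp_mul_Ioi (by linarith) a).const_mul l
  have hval : ∀ m : ℝ, ∫ t in Set.Ioi m, l * Real.exp (-l * t) = Real.exp (-l * m) := by
    intro m
    rw [integral_const_mul, integral_exp_mul_Ioi (by linarith : -l < 0)]
    field_simp
  have hmeas : MeasurableSet {q : ℝ × ℝ | a ≤ q.1 ∧ q.1 < q.2} :=
    (measurableSet_le measurable_const measurable_fst).inter
      (measurableSet_lt measurable_fst measurable_snd)
  have hF : Integrable (Function.uncurry fun (m t : ℝ) =>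
      Set.indicator {q : ℝ × ℝ | a ≤ q.1 ∧ q.1 < q.2} (fun q => l * Real.exp (-l * q.2)) (m, t))
      (ν.prod (volume.restrict (Set.Ioi a))) := by
    have h0 : Integrable (fun q : ℝ × ℝ => l * Real.exp (-l * q.2))
      (ν.prod (volume.restrict (Set.Ioi a))) := hInt0.comp_snd ν
    exact h0.indicator hmeas
  have hsw := integral_integral_swap hF
  have h1 : ∀ m : ℝ, ∫ t in Set.Ioi a, Set.indicator {q : ℝ × ℝ | a ≤ q.1 ∧ q.1 < q.2}
      (fun q => l * Real.exp (-l * q.2)) (m, t) =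
      (Set.Ici a).indicator (fun m => Real.exp (-l * m)) m := by
    intro m
    by_cases hm : a ≤ m
    · rw [Set.indicator_of_mem (by exact hm), ← hval m, ← integral_indicator measurableSet_Ioi,
        ← integral_indicator measurableSet_Ioi]
      congr 1
      ext t
      by_cases h : m < t
      · have : a < t := lt_of_le_of_lt hm h
        simp [Set.indicator, h, this, hm]
      · simp [Set.indicator, h]
    · rw [Set.indicator_of_notMem (by exact hm)]
      simp [Set.indicator, hm]
  have h2 : ∀ t : ℝ, ∫ m, Set.indicator {q : ℝ × ℝ | a ≤ q.1 ∧ q.1 < q.2}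
      (fun q => l * Real.exp (-l * q.2)) (m, t) ∂ν =
      l * Real.exp (-l * t) * ν.real (Set.Ico a t) := by
    intro t
    have : (fun m => Set.indicator {q : ℝ × ℝ | a ≤ q.1 ∧ q.1 < q.2}
      (fun q => l * Real.exp (-l * q.2)) (m, t)) =
      (Set.Ico a t).indicator (fun _ => l * Real.exp (-l * t)) := by
      ext m
      simp [Set.indicator, Set.mem_Ico]
    rw [this, integral_indicator measurableSet_Ico]
    simp [mul_comm]
  rw [← integral_indicator measurableSet_Ici]
  simp_rw [← h1]
  rw [hsw]
  simp_rw [h2]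

noncomputable def gmeas : Measure ℝ := volume.withDensity (fun t => ENNReal.ofReal (gpdf t))

instance : IsProbabilityMeasure gmeas := by
  constructor
  rw [gmeas, withDensity_apply _ MeasurableSet.univ, setLIntegral_univ,
    ← ofReal_integral_eq_lintegral_ofReal gpdf_integrable (ae_of_all _ fun t => (gpdf_pos t).le),
    gpdf_integral]
  simp

lemma gmeas_real (s : Set ℝ) (hs : MeasurableSet s) : gmeas.real s = ∫ t in s, gpdf t := by
  rw [Measure.real, gmeas, withDensity_apply _ hs,
    ← ofReal_integral_eq_lintegral_ofReal gpdf_integrable.integrableOn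
      (ae_of_all _ fun t => (gpdf_pos t).le), ENNReal.toReal_ofReal]
  exact integral_nonneg fun t => (gpdf_pos t).le

lemma gmeas_Ici (a l : ℝ) : ∫ m in Set.Ici a, Real.exp (-l * m) ∂gmeas =
    Real.exp (l ^ 2 / 2) * (1 - stdNormalCDF (a + l)) := by
  rw [← gauss_laplace, gmeas]
  rw [setIntegral_withDensity_eq_setIntegral_toReal_smul (by
    exact gpdf_continuous.measurable.ennreal_ofReal) (by simp) _ measurableSet_Ici]
  congr 1
  ext t
  rw [ENNReal.toReal_ofReal (gpdf_pos t).le, smul_eq_mul, mul_comm]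

lemma laplace_compare (ν : Measure ℝ) [IsProbabilityMeasure ν] (D : ℝ)
    (hD : ∀ z, |ν.real (Set.Iio z) - stdNormalCDF z| ≤ D) (a l : ℝ) (hl : 0 ≤ l) :
    |∫ m in Set.Ici a, Real.exp (-l * m) ∂ν - Real.exp (l ^ 2 / 2) * (1 - stdNormalCDF (a + l))|
      ≤ 2 * D * Real.exp (-l * a) := by
  have hD0 : 0 ≤ D := le_trans (abs_nonneg _) (hD 0)
  rcases hl.eq_or_lt with rfl | hl
  · have h1 : ν.real (Set.Ici a) = 1 - ν.real (Set.Iio a) := by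
      rw [← Set.compl_Iio, probReal_compl_eq_one_sub measurableSet_Iio]
    have := hD a
    rw [abs_le] at this
    simp [h1]
    rw [abs_le]; constructor <;> linarith
  · have hico : ∀ μ : Measure ℝ, [IsProbabilityMeasure μ] → ∀ t, a < t → μ.real (Set.Ico a t) =
        μ.real (Set.Iio t) - μ.real (Set.Iio a) := by
      intro μ _ t hat
      have e : Set.Ico a t = Set.Iio t \ Set.Iio a := by
        ext y; simp [Set.mem_Ico, and_comm]
      rw [e, measureReal_diff (Set.Iio_subset_Iio hat.le) measurableSet_Iio]
    have hg : ∀ z, gmeas.real (Set.Iio z) = stdNormalCDF z := by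
      intro z
      rw [gmeas_real _ measurableSet_Iio, cdf_eq, integral_Iic_eq_integral_Iio]
    rw [← gmeas_Ici, laplace_fubini ν a l hl, laplace_fubini gmeas a l hl]
    have hInt0 : IntegrableOn (fun t : ℝ => l * Real.exp (-l * t)) (Set.Ioi a) :=
      (integrableOn_exp_mul_Ioi (by linarith) a).const_mul l
    have hi : ∀ μ : Measure ℝ, [IsProbabilityMeasure μ] →
        IntegrableOn (fun t => l * Real.exp (-l * t) * μ.real (Set.Ico a t)) (Set.Ioi a) := by
      intro μ _
      refine Integrable.mono' hInt0 ?_ ?_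
      · have hm : Monotone (fun t => μ.real (Set.Ico a t)) := by
          intro t t' h
          exact measureReal_mono (Set.Ico_subset_Ico_right h)
        exact ((by fun_prop : Measurable fun t : ℝ => l * Real.exp (-l * t)).mul
          hm.measurable).aestronglyMeasurable
      · refine ae_of_all _ fun t => ?_
        rw [norm_mul, Real.norm_of_nonneg (by positivity), Real.norm_of_nonneg measureReal_nonneg]
        have : μ.real (Set.Ico a t) ≤ 1 := measureReal_le_one
        have h2 : 0 ≤ l * Real.exp (-l * t) := by positivity
        nlinarith
    rw [← integral_sub (hi ν) (hi gmeas)]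
    have hval : ∫ t in Set.Ioi a, l * Real.exp (-l * t) = Real.exp (-l * a) := by
      rw [integral_const_mul, integral_exp_mul_Ioi (by linarith : -l < 0)]
      field_simp
    rw [← hval, ← integral_const_mul, ← Real.norm_eq_abs]
    refine norm_integral_le_of_norm_le (hInt0.const_mul _) ?_
    filter_upwards [ae_restrict_mem measurableSet_Ioi] with t ht
    rw [hico ν t ht, hico gmeas t ht, hg, hg, ← mul_sub, norm_mul, Real.norm_of_nonneg (by positivity),
      mul_comm]
    gcongr
    have h1 := abs_le.1 (hD t)
    have h2 := abs_le.1 (hD a)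
    rw [Real.norm_eq_abs, abs_le]
    constructor <;> linarith

lemma laplace_compare' {Ω : Type} [MeasurableSpace Ω] (Q : Measure Ω) [IsProbabilityMeasure Q]
    (M : Ω → ℝ) (hM : Measurable M) (D : ℝ)
    (hD : ∀ z, |Q.real {ω | M ω < z} - stdNormalCDF z| ≤ D) (a l : ℝ) (hl : 0 ≤ l) :
    |∫ ω in {ω | a ≤ M ω}, Real.exp (-l * M ω) ∂Q
        - Real.exp (l ^ 2 / 2) * (1 - stdNormalCDF (a + l))|
      ≤ 2 * D * Real.exp (-l * a) := by
  have : IsProbabilityMeasure (Q.map M) := Measure.isProbabilityMeasure_map hM.aemeasurable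
  have h := laplace_compare (Q.map M) D (fun z => by
    rw [map_measureReal_apply hM measurableSet_Iio]; exact hD z) a l hl
  rwa [setIntegral_map measurableSet_Ici (by fun_prop) hM.aemeasurable] at h

open MeasureTheory Filter
open scoped Topology ENNReal

noncomputable def psi (t : ℝ) : ℝ := 1 / (1 + t ^ 2)

lemma psi_pos (t : ℝ) : 0 < psi t := by unfold psi; positivity
lemma psi_le_one (t : ℝ) : psi t ≤ 1 := by
  unfold psi; rw [div_le_one (by positivity)]; nlinarith [sq_nonneg t]

lemma psi_mul (t : ℝ) : psi t * (1 + t ^ 2) = 1 := by unfold psi; field_simp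

lemma psi_continuous : Continuous psi := by
  unfold psi
  exact continuous_const.div (by fun_prop) (fun t => by positivity)

/-- comparison of psi at different points -/
lemma psi_comp (c t u : ℝ) (hc : 0 ≤ c) (h : 1 + t ^ 2 ≤ c * (1 + u ^ 2)) : psi u ≤ c * psi t := by
  unfold psi
  rw [mul_one_div, div_le_div_iff₀ (by positivity) (by positivity)]
  linarith

lemma mvt01 (h h' : ℝ → ℝ) (B x : ℝ) (hx : 0 ≤ x)
    (hd : ∀ u, 0 ≤ u → u ≤ x → HasDerivAt h (h' u) u)
    (hb : ∀ u, 0 ≤ u → u ≤ x → |h' u| ≤ B) : |h x - h 0| ≤ B * x := by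
  have := Convex.norm_image_sub_le_of_norm_hasDerivWithin_le (f := h) (f' := h') (C := B)
    (s := Set.Icc 0 x) (x := 0) (y := x)
    (fun u hu => (hd u hu.1 hu.2).hasDerivWithinAt) (fun u hu => hb u hu.1 hu.2)
    (convex_Icc 0 x) (Set.left_mem_Icc.2 hx) (Set.right_mem_Icc.2 hx)
  simpa [abs_of_nonneg hx] using this

structure Tay (q C : ℝ) (f f1 f2 f3 : ℝ → ℝ) : Prop where
  q0 : 0 ≤ q
  C0 : 0 ≤ C
  d0 : ∀ t, HasDerivAt f (f1 t) t
  d1 : ∀ t, HasDerivAt f1 (f2 t) t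
  d2 : ∀ t, HasDerivAt f2 (f3 t) t
  b0 : ∀ t, |f t| ≤ C
  b1 : ∀ t, |f1 t| ≤ C * psi t
  b2 : ∀ t, |f2 t| ≤ C * psi t
  b3 : ∀ t, |f3 t| ≤ C * psi t
  bt : ∀ t, |(q + 2) * (q * f t + t * f1 t) + t * (q * f1 t + f1 t + t * f2 t)| ≤ C * psi t

lemma tay_pow_le (ρ e : ℝ) (hρ1 : ρ ≤ 1) (he : 0 ≤ e) (he1 : e ≤ 1) :
    e ^ 3 ≤ e ^ (2 + ρ) := by
  rcases he.eq_or_lt with rfl | he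
  · simp; positivity
  rw [← Real.rpow_natCast]
  exact Real.rpow_le_rpow_of_exponent_ge he he1 (by push_cast; linarith)

lemma tay_pow_ge (ρ e : ℝ) (hρ : 0 ≤ ρ) (he1 : 1 ≤ e) :
    e ^ 2 ≤ e ^ (2 + ρ) := by
  rw [← Real.rpow_natCast]
  exact Real.rpow_le_rpow_of_exponent_le he1 (by push_cast; linarith)

lemma Tay.space {q C : ℝ} {f f1 f2 f3 : ℝ → ℝ} (H : Tay q C f f1 f2 f3) (ρ : ℝ) (hρ : 0 ≤ ρ)
    (hρ1 : ρ ≤ 1) (t e : ℝ) :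
    |f (t - e) - f t + f1 t * e - f2 t * e ^ 2 / 2| ≤ 20 * C * |e| ^ (2 + ρ) * psi t := by
  have hC := H.C0
  have hψ := psi_pos t
  have hCψ : 0 ≤ C * psi t := mul_nonneg hC hψ.le
  have hlin : ∀ u : ℝ, HasDerivAt (fun u => t - u * e) (-e) u := by
    intro u
    simpa using ((hasDerivAt_id u).mul_const e).const_sub t
  rcases le_or_gt |e| 1 with he | he
  · -- small increment
    have hpsi : ∀ u : ℝ, 0 ≤ u → u ≤ 1 → psi (t - u * e) ≤ 3 * psi t := by
      intro u hu hu1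
      apply psi_comp _ _ _ (by norm_num)
      have h1 : e ^ 2 ≤ 1 := by rw [← sq_abs]; exact pow_le_one₀ (abs_nonneg e) he
      have h2 : (u * e) ^ 2 ≤ 1 := by
        rw [mul_pow]; exact mul_le_one₀ (pow_le_one₀ hu hu1) (sq_nonneg _) h1
      nlinarith [sq_nonneg (t - u * e - u * e), sq_nonneg (t - 2 * (u * e))]
    have s2 : ∀ u : ℝ, 0 ≤ u → u ≤ 1 → |f2 (t - u * e) - f2 t| ≤ 3 * C * psi t * |e| := by
      intro u hu hu1
      have := mvt01 (fun u => f2 (t - u * e)) (fun u => f3 (t - u * e) * (-e)) (3 * C * psi t * |e|) u hu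
        (fun w _ _ => (H.d2 _).comp w (hlin w)) (fun w hw hw1 => by
          rw [abs_mul, abs_neg]
          have := H.b3 (t - w * e)
          have h2 := hpsi w hw (hw1.trans hu1)
          have : |f3 (t - w * e)| ≤ 3 * C * psi t := by
            calc _ ≤ C * psi (t - w * e) := this
              _ ≤ C * (3 * psi t) := by gcongr
              _ = _ := by ring
          gcongr)
      simp only [zero_mul, sub_zero] at this
      refine this.trans ?_
      have : 0 ≤ 3 * C * psi t * |e| := by positivity
      nlinarith
    have s1 : ∀ u : ℝ, 0 ≤ u → u ≤ 1 →
        |f1 (t - u * e) - f1 t + f2 t * (u * e)| ≤ 3 * C * psi t * |e| ^ 2 := by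
      intro u hu hu1
      have := mvt01 (fun u => f1 (t - u * e) + f2 t * (u * e))
        (fun u => f2 (t - u * e) * (-e) + f2 t * e) (3 * C * psi t * |e| ^ 2) u hu
        (fun w _ _ => ((H.d1 _).comp w (hlin w)).add (by
          simpa using ((hasDerivAt_id w).mul_const e).const_mul (f2 t)))
        (fun w hw hw1 => by
          have e1 : f2 (t - w * e) * (-e) + f2 t * e = (f2 (t - w * e) - f2 t) * (-e) := by ring
          rw [e1, abs_mul, abs_neg, pow_two, ← mul_assoc]
          gcongr
          exact s2 w hw (hw1.trans hu1))
      simp only [zero_mul, sub_zero, mul_zero, add_zero] at this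
      have e2 : f1 (t - u * e) + f2 t * (u * e) - f1 t = f1 (t - u * e) - f1 t + f2 t * (u * e) := by
        ring
      rw [e2] at this
      refine this.trans ?_
      have : 0 ≤ 3 * C * psi t * |e| ^ 2 := by positivity
      nlinarith
    have s0 : |f (t - 1 * e) - f t + f1 t * (1 * e) - f2 t * (1 * e) ^ 2 / 2|
        ≤ 3 * C * psi t * |e| ^ 3 := by
      have := mvt01 (fun u => f (t - u * e) + f1 t * (u * e) - f2 t * (u * e) ^ 2 / 2)
        (fun u => f1 (t - u * e) * (-e) + f1 t * e - f2 t * (u * e) * e) (3 * C * psi t * |e| ^ 3) 1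
        zero_le_one
        (fun w _ _ => (((H.d0 _).comp w (hlin w)).add (by
          simpa using ((hasDerivAt_id w).mul_const e).const_mul (f1 t))).sub (by
          have := (((((hasDerivAt_id w).mul_const e).pow 2).const_mul (f2 t)).div_const 2)
          simp only [id] at this
          refine this.congr_deriv ?_
          norm_num
          ring))
        (fun w hw hw1 => by
          have e1 : f1 (t - w * e) * (-e) + f1 t * e - f2 t * (w * e) * e
            = (f1 (t - w * e) - f1 t + f2 t * (w * e)) * (-e) := by ring
          rw [e1, abs_mul, abs_neg, pow_succ |e| 2, ← mul_assoc (3 * C * psi t)]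
          gcongr
          exact s1 w hw hw1)
      simp only [zero_mul, sub_zero, mul_zero, add_zero, mul_one] at this
      have e2 : f (t - 1 * e) + f1 t * (1 * e) - f2 t * (1 * e) ^ 2 / 2 - (f t - f2 t * 0 ^ 2 / 2)
        = f (t - 1 * e) - f t + f1 t * (1 * e) - f2 t * (1 * e) ^ 2 / 2 := by
        ring
      rw [e2] at this
      exact this
    rw [one_mul] at s0
    refine s0.trans ?_
    have h3 := tay_pow_le ρ |e| hρ1 (abs_nonneg e) he
    have h4 : 0 ≤ |e| ^ 3 := by positivity
    calc 3 * C * psi t * |e| ^ 3 = 3 * (C * psi t) * |e| ^ 3 := by ring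
      _ ≤ 20 * (C * psi t) * |e| ^ (2 + ρ) := by gcongr; norm_num
      _ = _ := by ring
  · -- large increment
    have hpow := tay_pow_ge ρ |e| hρ he.le
    have h1 : |f (t - e) - f t| ≤ 10 * C * |e| ^ 2 * psi t := by
      rcases le_or_gt (|t| / 2) |e| with hte | hte
      · have h5 : |f (t - e) - f t| ≤ 2 * C := by
          refine (abs_sub _ _).trans ?_
          linarith [H.b0 (t - e), H.b0 t]
        refine h5.trans ?_
        have h6 : 1 ≤ 5 * |e| ^ 2 * psi t := by
          have h7 : 1 + t ^ 2 ≤ 5 * |e| ^ 2 := by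
            rw [← sq_abs t]; nlinarith [abs_nonneg t, abs_nonneg e]
          calc (1 : ℝ) = (1 + t ^ 2) * psi t := by rw [mul_comm, psi_mul]
            _ ≤ _ := by gcongr
        nlinarith
      · have := mvt01 (fun u => f (t - u * e)) (fun u => f1 (t - u * e) * (-e)) (4 * C * psi t * |e|)
          1 zero_le_one
          (fun w _ _ => (H.d0 _).comp w (hlin w)) (fun w hw hw1 => by
            rw [abs_mul, abs_neg]
            have h2 := H.b1 (t - w * e)
            have h3 : psi (t - w * e) ≤ 4 * psi t := by
              apply psi_comp _ _ _ (by norm_num)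
              have h4 : |w * e| ≤ |t| / 2 := by
                rw [abs_mul, abs_of_nonneg hw]; nlinarith [abs_nonneg e]
              have h5 : |t| / 2 ≤ |t - w * e| := by
                have := abs_sub_abs_le_abs_sub t (w * e); linarith
              have h6 : (|t| / 2) ^ 2 ≤ |t - w * e| ^ 2 := by gcongr
              rw [sq_abs, div_pow, sq_abs] at h6
              linarith
            have : |f1 (t - w * e)| ≤ 4 * C * psi t := by
              calc _ ≤ C * psi (t - w * e) := h2
                _ ≤ C * (4 * psi t) := by gcongr
                _ = _ := by ring
            gcongr)
        simp only [zero_mul, sub_zero, one_mul, mul_one] at this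
        refine this.trans ?_
        nlinarith [abs_nonneg e, mul_nonneg hCψ (abs_nonneg e), mul_nonneg hCψ (sub_nonneg.2 he.le),
          mul_nonneg (mul_nonneg hCψ (abs_nonneg e)) (sub_nonneg.2 he.le)]
    have h2 : |f1 t * e| ≤ C * psi t * |e| ^ 2 := by
      rw [abs_mul]
      have := H.b1 t
      calc _ ≤ C * psi t * |e| := by gcongr
        _ ≤ C * psi t * |e| ^ 2 := by gcongr; nlinarith
    have h3 : |f2 t * e ^ 2 / 2| ≤ C * psi t * |e| ^ 2 := by
      rw [abs_div, abs_mul, abs_pow, abs_two]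
      have := H.b2 t
      have : |f2 t| * |e| ^ 2 ≤ C * psi t * |e| ^ 2 := by gcongr
      have h0 : 0 ≤ |f2 t| * |e| ^ 2 := by positivity
      linarith
    have h4 : |f (t - e) - f t + f1 t * e - f2 t * e ^ 2 / 2| ≤
        |f (t - e) - f t| + |f1 t * e| + |f2 t * e ^ 2 / 2| :=
      (abs_sub _ _).trans (add_le_add (abs_add_le _ _) le_rfl)
    have : 0 ≤ C * psi t * |e| ^ 2 := by positivity
    calc _ ≤ 20 * (C * psi t) * |e| ^ 2 := by linarith
      _ ≤ 20 * (C * psi t) * |e| ^ (2 + ρ) := by gcongr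
      _ = _ := by ring

lemma time_deriv (f f1 : ℝ → ℝ) (h : ∀ t, HasDerivAt f (f1 t) t) (a t r : ℝ) (hr : 0 ≤ r) :
    HasDerivAt (fun r => (1 + r) ^ a * f (t * (1 + r) ^ (-(1/2) : ℝ)))
      ((1 + r) ^ (a - 1) * (a * f (t * (1 + r) ^ (-(1/2) : ℝ)) -
        1 / 2 * ((t * (1 + r) ^ (-(1/2) : ℝ)) * f1 (t * (1 + r) ^ (-(1/2) : ℝ))))) r := by
  have hL : (0:ℝ) < 1 + r := by linarith
  have h1 : ∀ b : ℝ, HasDerivAt (fun r : ℝ => (1 + r) ^ b) (b * (1 + r) ^ (b - 1)) r := by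
    intro b
    have := ((hasDerivAt_id r).const_add 1).rpow_const (p := b) (Or.inl hL.ne')
    simpa using this
  have h2 := (h1 a).mul ((h _).comp r ((h1 (-(1/2))).const_mul t))
  refine h2.congr_deriv ?_
  simp only [Function.comp]
  have e1 : (1 + r) ^ (-(1/2) - 1 : ℝ) = (1 + r) ^ (-(1/2) : ℝ) * (1 + r) ^ (-1 : ℝ) := by
    rw [← Real.rpow_add hL]; congr 1
  have e2 : (1 + r) ^ (a - 1) = (1 + r) ^ a * (1 + r) ^ (-1 : ℝ) := by
    rw [← Real.rpow_add hL]; congr 1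
  rw [e1, e2]
  ring

lemma Tay.time {q C : ℝ} {f f1 f2 f3 : ℝ → ℝ} (H : Tay q C f f1 f2 f3) (t r : ℝ)
    (hr : 0 ≤ r) (hr1 : r ≤ 1) :
    |(1 + r) ^ (-(q/2)) * f (t * (1 + r) ^ (-(1/2) : ℝ)) - f t + r / 2 * (q * f t + t * f1 t)|
      ≤ C * psi t * r ^ 2 := by
  have hC := H.C0
  have hq := H.q0
  have hψ := psi_pos t
  set a : ℝ := -(q / 2) with ha
  set F : ℝ → ℝ := fun t => a * f t - 1 / 2 * (t * f1 t) with hF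
  set F1 : ℝ → ℝ := fun t => a * f1 t - 1 / 2 * (f1 t + t * f2 t) with hF1
  have hFd : ∀ t, HasDerivAt F (F1 t) t := by
    intro t
    refine (((H.d0 t).const_mul a).sub (((hasDerivAt_id t).mul (H.d1 t)).const_mul (1/2))).congr_deriv ?_
    simp [hF1]
  set p1 : ℝ → ℝ := fun r => (1 + r) ^ (a - 1) * F (t * (1 + r) ^ (-(1/2) : ℝ)) with hp1
  have d1 : ∀ u, 0 ≤ u → HasDerivAt (fun r => (1 + r) ^ a * f (t * (1 + r) ^ (-(1/2) : ℝ))) (p1 u) u :=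
    fun u hu => time_deriv f f1 H.d0 a t u hu
  have d2 : ∀ u, 0 ≤ u → HasDerivAt p1 _ u :=
    fun u hu => time_deriv F F1 hFd (a - 1) t u hu
  have b2 : ∀ u, 0 ≤ u → u ≤ 1 → |(1 + u) ^ (a - 1 - 1) * ((a - 1) * F (t * (1 + u) ^ (-(1/2) : ℝ)) -
        1 / 2 * ((t * (1 + u) ^ (-(1/2) : ℝ)) * F1 (t * (1 + u) ^ (-(1/2) : ℝ))))| ≤ C * psi t := by
    intro u hu hu1
    set τ := t * (1 + u) ^ (-(1/2) : ℝ) with hτ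
    have hL : (1:ℝ) ≤ 1 + u := by linarith
    have h1 : (1 + u) ^ (a - 1 - 1) ≤ 1 := Real.rpow_le_one_of_one_le_of_nonpos hL (by rw [ha]; linarith)
    have h1' : 0 ≤ (1 + u) ^ (a - 1 - 1) := by positivity
    have e : (a - 1) * F τ - 1 / 2 * (τ * F1 τ) =
      1 / 4 * ((q + 2) * (q * f τ + τ * f1 τ) + τ * (q * f1 τ + f1 τ + τ * f2 τ)) := by
      simp only [hF, hF1, ha]; ring
    rw [e, abs_mul, abs_of_nonneg h1', abs_mul, abs_of_pos (by norm_num : (0:ℝ) < 1/4)]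
    have hb := H.bt τ
    have hps : psi τ ≤ 2 * psi t := by
      apply psi_comp _ _ _ (by norm_num)
      have : τ ^ 2 * (1 + u) = t ^ 2 := by
        rw [hτ, mul_pow, ← Real.rpow_natCast, ← Real.rpow_natCast, ← Real.rpow_mul (by linarith), mul_assoc]
        norm_num
        rw [Real.rpow_neg_one]; field_simp
      nlinarith [sq_nonneg τ]
    have h5 : C * psi τ ≤ 2 * (C * psi t) := by
      calc _ ≤ C * (2 * psi t) := by gcongr
        _ = _ := by ring
    set Y := |(q + 2) * (q * f τ + τ * f1 τ) + τ * (q * f1 τ + f1 τ + τ * f2 τ)|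
    have hY : 0 ≤ Y := abs_nonneg _
    have : 0 ≤ C * psi t := by positivity
    calc (1 + u) ^ (a - 1 - 1) * (1 / 4 * Y) ≤ 1 * (1/4 * Y) := by gcongr
      _ ≤ _ := by linarith
  have hB : 0 ≤ C * psi t := by positivity
  have s1 : ∀ u, 0 ≤ u → u ≤ r → |p1 u - p1 0| ≤ C * psi t * r := by
    intro u hu hur
    have := mvt01 p1 _ (C * psi t) u hu (fun w hw _ => d2 w hw)
      (fun w hw hw1 => b2 w hw (hw1.trans (hur.trans hr1)))
    refine this.trans (by gcongr)
  have s0 := mvt01 (fun r => (1 + r) ^ a * f (t * (1 + r) ^ (-(1/2) : ℝ)) - p1 0 * r) (fun u => p1 u - p1 0)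
    (C * psi t * r) r hr (fun w hw _ => (d1 w hw).sub (by simpa using (hasDerivAt_id w).const_mul (p1 0)))
    s1
  simp only [add_zero, Real.one_rpow, mul_one, one_mul, mul_zero, sub_zero] at s0
  have e1 : p1 0 = - (1/2) * (q * f t + t * f1 t) := by
    simp [hp1, hF, ha]; ring
  have e2 : (1 + r) ^ a * f (t * (1 + r) ^ (-(1/2) : ℝ)) - f t + r / 2 * (q * f t + t * f1 t) =
    (1 + r) ^ a * f (t * (1 + r) ^ (-(1/2) : ℝ)) - p1 0 * r - f t := by rw [e1]; ring
  rw [e2, pow_two, ← mul_assoc]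
  exact s0

lemma Tay.step {q C : ℝ} {f f1 f2 f3 : ℝ → ℝ} (H : Tay q C f f1 f2 f3) (ρ : ℝ) (hρ : 0 ≤ ρ)
    (hρ1 : ρ ≤ 1) (t e r : ℝ) (hr : 0 ≤ r) (hr1 : r ≤ 1) :
    |f (t - e) - (1 + r) ^ (-(q/2)) * f (t * (1 + r) ^ (-(1/2) : ℝ)) -
      (-(f1 t * e) + f2 t / 2 * (e ^ 2 - r) + r / 2 * (f2 t + t * f1 t + q * f t))|
      ≤ 20 * C * psi t * (|e| ^ (2 + ρ) + r ^ 2) := by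
  have h1 := H.space ρ hρ hρ1 t e
  have h2 := H.time t r hr hr1
  have hC := H.C0
  have hψ := psi_pos t
  have h3 : 0 ≤ C * psi t * r ^ 2 := by positivity
  rw [abs_le] at h1 h2 ⊢
  constructor <;> nlinarith

open MeasureTheory Filter
open scoped Topology ENNReal

noncomputable def ge (t : ℝ) : ℝ := Real.exp (-(t ^ 2) / 2)

lemma ge_pos (t : ℝ) : 0 < ge t := Real.exp_pos _
lemma ge_le_one (t : ℝ) : ge t ≤ 1 := by
  unfold ge; rw [Real.exp_le_one_iff]; nlinarith [sq_nonneg t]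

lemma ge_deriv (t : ℝ) : HasDerivAt ge (-t * ge t) t := by
  have h1 : HasDerivAt (fun t : ℝ => -(t ^ 2) / 2) (-t) t :=
    (((hasDerivAt_pow 2 t).neg).div_const 2).congr_deriv (by norm_num; ring)
  exact h1.exp.congr_deriv (by unfold ge; ring)

/-- `(1+t^2)^3 e^{-t²/2} ≤ 400` -/
lemma ge_decay (t : ℝ) : (1 + t ^ 2) ^ 3 * ge t ≤ 400 := by
  have h := Real.add_one_le_exp ((t ^ 2 + 1) / 6 - 1)
  have hexp : ((t ^ 2 + 1) / 6) ^ 3 ≤ Real.exp ((t ^ 2 + 1) / 6 - 1) ^ 3 := by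
    gcongr; linarith
  rw [← Real.exp_nat_mul] at hexp
  have e : Real.exp ((3:ℕ) * ((t ^ 2 + 1) / 6 - 1)) * ge t = Real.exp (-(5/2)) := by
    unfold ge; rw [← Real.exp_add]; congr 1; push_cast; ring
  have h2 : (1 + t ^ 2) ^ 3 * ge t ≤ 216 * Real.exp (-(5/2)) := by
    rw [← e]
    have := mul_le_mul_of_nonneg_right hexp (ge_pos t).le
    nlinarith
  have : Real.exp (-(5/2)) ≤ 1 := by rw [Real.exp_le_one_iff]; norm_num
  linarith

lemma ge_bd (t c : ℝ) (hc : |c| ≤ 8 * (1 + t ^ 2) ^ 2) : |c * ge t| ≤ 3200 * psi t := by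
  rw [abs_mul, abs_of_pos (ge_pos t)]
  have h1 := ge_decay t
  have h2 := ge_pos t
  have h3 : |c| * ge t ≤ 8 * (1 + t ^ 2) ^ 2 * ge t := by gcongr
  refine h3.trans ?_
  unfold psi
  rw [mul_one_div, le_div_iff₀ (by positivity)]
  nlinarith

lemma gpdf_eq_ge (t : ℝ) : gpdf t = gpdf 0 * ge t := by
  unfold gpdf ge; simp

lemma gpdf_deriv (t : ℝ) : HasDerivAt gpdf (-t * gpdf t) t := by
  have : gpdf = fun t => gpdf 0 * ge t := funext gpdf_eq_ge
  rw [this]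
  exact ((ge_deriv t).const_mul (gpdf 0)).congr_deriv (by simp; ring)

lemma tay_cdf : Tay 0 3200 stdNormalCDF gpdf (fun t => -t * gpdf t) (fun t => (t ^ 2 - 1) * gpdf t) := by
  have h0 : 0 < gpdf 0 := gpdf_pos 0
  have h1 : gpdf 0 ≤ 1 := by linarith [gpdf_le_half 0]
  have key : ∀ t c : ℝ, |c| ≤ 8 * (1 + t ^ 2) ^ 2 → |c * gpdf t| ≤ 3200 * psi t := by
    intro t c hc
    rw [gpdf_eq_ge, mul_left_comm, abs_mul, abs_of_pos h0]
    have := ge_bd t c hc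
    have h3 := abs_nonneg (c * ge t)
    nlinarith
  refine ⟨le_rfl, by norm_num, cdf_hasDerivAt, gpdf_deriv, ?_, ?_, ?_, ?_, ?_, ?_⟩
  · intro t
    refine (((hasDerivAt_id t).neg).mul (gpdf_deriv t)).congr_deriv ?_
    simp; ring
  · intro t
    rw [abs_of_nonneg (cdf_nonneg t)]; linarith [cdf_le_one t]
  · intro t
    have := key t 1 (by rw [abs_one]; nlinarith [sq_nonneg t])
    simpa using this
  · intro t
    exact key t _ (by rw [abs_le]; constructor <;> nlinarith [sq_nonneg t, sq_nonneg (t - 1), sq_nonneg (t + 1), sq_nonneg (t^2)])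
  · intro t
    exact key t _ (by rw [abs_le]; constructor <;> nlinarith [sq_nonneg t, sq_nonneg (t^2)])
  · intro t
    have := key t (2 * t + t * (1 - t ^ 2)) (by
      rw [abs_le]; constructor <;>
        nlinarith [sq_nonneg t, sq_nonneg (t - 1), sq_nonneg (t + 1), sq_nonneg (t^2), sq_nonneg (t ^2 - t), sq_nonneg (t^2+t)])
    have e : (0 + 2) * (0 * stdNormalCDF t + t * gpdf t) +
        t * (0 * gpdf t + gpdf t + t * (-t * gpdf t)) = (2 * t + t * (1 - t ^ 2)) * gpdf t := by ring
    rw [e]; exact this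

lemma psi_deriv (t : ℝ) : HasDerivAt psi (-(2 * t) / (1 + t ^ 2) ^ 2) t := by
  have h1 : HasDerivAt (fun t : ℝ => 1 + t ^ 2) (2 * t) t := by
    simpa using (hasDerivAt_pow 2 t).const_add 1
  refine ((hasDerivAt_const t (1:ℝ)).div h1 (by positivity)).congr_deriv ?_
  simp

lemma psi_deriv2 (t : ℝ) : HasDerivAt (fun t : ℝ => -(2 * t) / (1 + t ^ 2) ^ 2)
    ((6 * t ^ 2 - 2) / (1 + t ^ 2) ^ 3) t := by
  have h1 : HasDerivAt (fun t : ℝ => 1 + t ^ 2) (2 * t) t := by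
    simpa using (hasDerivAt_pow 2 t).const_add 1
  refine ((((hasDerivAt_id t).const_mul 2).neg).div (h1.pow 2) (by simp only [Pi.pow_apply]; positivity)).congr_deriv ?_
  simp only [id, Pi.pow_apply, Pi.neg_apply]
  norm_num
  field_simp
  ring

lemma psi_deriv3 (t : ℝ) : HasDerivAt (fun t : ℝ => (6 * t ^ 2 - 2) / (1 + t ^ 2) ^ 3)
    ((24 * t - 24 * t ^ 3) / (1 + t ^ 2) ^ 4) t := by
  have h1 : HasDerivAt (fun t : ℝ => 1 + t ^ 2) (2 * t) t := by
    simpa using (hasDerivAt_pow 2 t).const_add 1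
  have h2 : HasDerivAt (fun t : ℝ => 6 * t ^ 2 - 2) (12 * t) t :=
    (((hasDerivAt_pow 2 t).const_mul 6).sub_const 2).congr_deriv (by norm_num; ring)
  refine (h2.div (h1.pow 3) (by simp only [Pi.pow_apply]; positivity)).congr_deriv ?_
  norm_num
  field_simp
  ring

noncomputable def chiK (ρ : ℝ) : ℝ := 8 * Real.exp 8 / (1 - ρ)
noncomputable def chi (ρ t : ℝ) : ℝ := chiK ρ * ge t + psi t
noncomputable def chi1 (ρ t : ℝ) : ℝ := chiK ρ * (-t * ge t) + -(2 * t) / (1 + t ^ 2) ^ 2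
noncomputable def chi2 (ρ t : ℝ) : ℝ :=
  chiK ρ * ((t ^ 2 - 1) * ge t) + (6 * t ^ 2 - 2) / (1 + t ^ 2) ^ 3
noncomputable def chi3 (ρ t : ℝ) : ℝ :=
  chiK ρ * ((3 * t - t ^ 3) * ge t) + (24 * t - 24 * t ^ 3) / (1 + t ^ 2) ^ 4

noncomputable def chiC (ρ : ℝ) : ℝ := chiK ρ * 3200 + 100

lemma chiK_pos (ρ : ℝ) (h : ρ < 1) : 0 < chiK ρ := by
  unfold chiK; have : 0 < 1 - ρ := by linarith
  positivity

lemma chi_pos (ρ : ℝ) (h : ρ < 1) (t : ℝ) : 0 < chi ρ t := by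
  have := chiK_pos ρ h
  have := ge_pos t
  have := psi_pos t
  unfold chi; positivity

lemma chi_bd (ρ : ℝ) (h1 : ρ < 1) (t a b : ℝ) (k : ℕ) (ha : |a| ≤ 8 * (1 + t ^ 2) ^ 2)
    (hb : |b| ≤ 100 * (1 + t ^ 2) ^ k) :
    |chiK ρ * (a * ge t) + b / (1 + t ^ 2) ^ (k + 1)| ≤ chiC ρ * psi t := by
  have hK := chiK_pos ρ h1
  refine (abs_add_le _ _).trans ?_
  rw [abs_mul, abs_of_pos hK, abs_div, abs_of_pos (by positivity : (0:ℝ) < (1 + t ^ 2) ^ (k+1))]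
  have h2 := ge_bd t a ha
  have h3 : |b| / (1 + t ^ 2) ^ (k + 1) ≤ 100 * psi t := by
    unfold psi
    rw [div_le_iff₀ (by positivity), pow_succ _ k]
    have e : 100 * (1 / (1 + t ^ 2)) * ((1 + t ^ 2) ^ k * (1 + t ^ 2)) = 100 * (1 + t ^ 2) ^ k := by
      field_simp
    rw [e]; exact hb
  unfold chiC
  have := mul_le_mul_of_nonneg_left h2 hK.le
  linarith

lemma tay_chi (ρ : ℝ) (h0 : 0 ≤ ρ) (h1 : ρ < 1) :
    Tay ρ (chiC ρ) (chi ρ) (chi1 ρ) (chi2 ρ) (chi3 ρ) := by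
  have hK := chiK_pos ρ h1
  refine ⟨h0, by unfold chiC; positivity, ?_, ?_, ?_, ?_, ?_, ?_, ?_, ?_⟩
  · intro t
    exact ((ge_deriv t).const_mul _).add (psi_deriv t)
  · intro t
    refine ((((hasDerivAt_id t).neg.mul (ge_deriv t))).const_mul (chiK ρ)).add (psi_deriv2 t) |>.congr_deriv ?_
    simp only [chi2, id, Pi.neg_apply]; ring
  · intro t
    have h2 : HasDerivAt (fun t : ℝ => t ^ 2 - 1) (2 * t) t := by
      simpa using (hasDerivAt_pow 2 t).sub_const 1
    refine ((h2.mul (ge_deriv t)).const_mul (chiK ρ)).add (psi_deriv3 t) |>.congr_deriv ?_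
    simp only [chi3]; ring
  · intro t
    have h2 := ge_le_one t
    have h3 := ge_pos t
    have h4 := psi_pos t
    have h5 := psi_le_one t
    unfold chi chiC
    rw [abs_of_pos (by positivity)]
    nlinarith
  · intro t
    refine chi_bd ρ h1 t (-t) (-(2 * t)) 1 ?_ ?_
    · rw [abs_le]; constructor <;> nlinarith [sq_nonneg t, sq_nonneg (t - 1), sq_nonneg (t + 1), sq_nonneg (t^2)]
    · rw [abs_le]; constructor <;> nlinarith [sq_nonneg t, sq_nonneg (t - 1), sq_nonneg (t + 1), sq_nonneg (t^2)]
  · intro t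
    refine chi_bd ρ h1 t _ _ 2 ?_ ?_
    · rw [abs_le]; constructor <;> nlinarith [sq_nonneg t, sq_nonneg (t - 1), sq_nonneg (t + 1), sq_nonneg (t^2)]
    · rw [abs_le]; constructor <;> nlinarith [sq_nonneg t, sq_nonneg (t - 1), sq_nonneg (t + 1), sq_nonneg (t^2)]
  · intro t
    refine chi_bd ρ h1 t _ _ 3 ?_ ?_
    · rw [abs_le]; constructor <;> nlinarith [sq_nonneg t, sq_nonneg (t - 1), sq_nonneg (t + 1), sq_nonneg (t^2), sq_nonneg (t^2 - t), sq_nonneg (t^2 + t)]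
    · rw [abs_le]; constructor <;> nlinarith [sq_nonneg t, sq_nonneg (t - 1), sq_nonneg (t + 1), sq_nonneg (t^2), sq_nonneg (t^2 - t), sq_nonneg (t^2 + t), sq_nonneg (t^3)]
  · intro t
    have e : (ρ + 2) * (ρ * chi ρ t + t * chi1 ρ t) + t * (ρ * chi1 ρ t + chi1 ρ t + t * chi2 ρ t)
      = chiK ρ * (((ρ + 2) * (ρ - t ^ 2) - (ρ + 1) * t ^ 2 + t ^ 2 * (t ^ 2 - 1)) * ge t)
        + ((ρ + 2) * (ρ * (1 + t ^ 2) ^ 2 - 2 * t ^ 2 * (1 + t ^ 2)) - (ρ + 1) * 2 * t ^ 2 * (1 + t ^ 2)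
          + t ^ 2 * (6 * t ^ 2 - 2)) / (1 + t ^ 2) ^ (2 + 1) := by
      unfold chi chi1 chi2 psi
      field_simp
      ring
    rw [e]
    have hz : 0 ≤ t ^ 2 := sq_nonneg t
    have hρ2 : ρ * ρ ≤ 1 := by nlinarith
    refine chi_bd ρ h1 t _ _ 2 ?_ ?_
    · generalize t ^ 2 = y at hz
      have h3 : 0 ≤ ρ * y := mul_nonneg h0 hz
      have h4 : ρ * y ≤ y := by nlinarith
      rw [abs_le]; constructor <;> nlinarith [sq_nonneg y]
    · generalize t ^ 2 = y at hz
      have h3 : 0 ≤ ρ * (1 + y) ^ 2 := by positivity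
      have h4 : ρ * (1 + y) ^ 2 ≤ (1 + y) ^ 2 := by nlinarith [sq_nonneg (1 + y)]
      have h5 : ρ * ρ * (1 + y) ^ 2 ≤ (1 + y) ^ 2 := by nlinarith [sq_nonneg (1 + y)]
      have h6 : 0 ≤ ρ * ρ * (1 + y) ^ 2 := by positivity
      have h7 : 0 ≤ ρ * (y * (1 + y)) := by positivity
      have h8 : ρ * (y * (1 + y)) ≤ y * (1 + y) := by nlinarith [mul_nonneg hz hz]
      have h9 : 0 ≤ y * y := mul_nonneg hz hz
      rw [abs_le]; constructor <;> nlinarith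

lemma chi_pde (ρ : ℝ) (h1 : ρ < 1) (t : ℝ) :
    chi2 ρ t + t * chi1 ρ t + ρ * chi ρ t ≤ - (1 / 2) * psi t := by
  have hK := chiK_pos ρ h1
  have hz : 0 ≤ t ^ 2 := sq_nonneg t
  have e : chi2 ρ t + t * chi1 ρ t + ρ * chi ρ t + 1 / 2 * psi t =
    -(8 * Real.exp 8 * ge t) + ((6 * t ^ 2 - 2) - 2 * t ^ 2 * (1 + t ^ 2) + (ρ + 1/2) * (1 + t ^ 2) ^ 2) / (1 + t ^ 2) ^ 3 := by
    have hne : (1 - ρ) ≠ 0 := by linarith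
    unfold chi chi1 chi2 chiK psi
    field_simp
    ring
  suffices h : chi2 ρ t + t * chi1 ρ t + ρ * chi ρ t + 1 / 2 * psi t ≤ 0 by linarith
  rw [e]
  have hge := ge_pos t
  rcases le_or_gt (t ^ 2) 15 with ht | ht
  · have h2 : 1 ≤ Real.exp 8 * ge t := by
      unfold ge; rw [← Real.exp_add]; exact Real.one_le_exp (by linarith)
    have h3 : ((6 * t ^ 2 - 2) - 2 * t ^ 2 * (1 + t ^ 2) + (ρ + 1/2) * (1 + t ^ 2) ^ 2) / (1 + t ^ 2) ^ 3 ≤ 8 := by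
      rw [div_le_iff₀ (by positivity)]
      generalize t ^ 2 = y at *
      have : 0 ≤ y ^ 2 := sq_nonneg y
      have : 0 ≤ y ^ 3 := by positivity
      have : 0 ≤ (1 - ρ) * (1 + y) ^ 2 := mul_nonneg (by linarith) (sq_nonneg _)
      nlinarith
    linarith
  · have h3 : ((6 * t ^ 2 - 2) - 2 * t ^ 2 * (1 + t ^ 2) + (ρ + 1/2) * (1 + t ^ 2) ^ 2) / (1 + t ^ 2) ^ 3 ≤ 0 := by
      apply div_nonpos_of_nonpos_of_nonneg _ (by positivity)
      generalize t ^ 2 = y at *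
      have : 0 ≤ (1 - ρ) * (1 + y) ^ 2 := mul_nonneg (by linarith) (sq_nonneg _)
      nlinarith
    have : 0 < Real.exp 8 * ge t := by positivity
    linarith

open MeasureTheory Filter
open scoped Topology ENNReal

/-- bounded measurable functions w.r.t. a sub-sigma-algebra -/
def BM {Ω : Type} (m : MeasurableSpace Ω) (H : Ω → ℝ) : Prop :=
  Measurable[m] H ∧ ∃ B : ℝ, ∀ ω, |H ω| ≤ B

lemma BM.mul {Ω : Type} {m : MeasurableSpace Ω} {H G : Ω → ℝ} (hH : BM m H) (hG : BM m G) :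
    BM m (fun ω => H ω * G ω) := by
  obtain ⟨h1, B, hB⟩ := hH
  obtain ⟨g1, D, hD⟩ := hG
  refine ⟨h1.mul g1, B * D, fun ω => ?_⟩
  rw [abs_mul]
  have := (abs_nonneg _).trans (hB ω)
  exact mul_le_mul (hB ω) (hD ω) (abs_nonneg _) this

lemma BM.integrable_mul {Ω : Type} {m mΩ : MeasurableSpace Ω} (hm : m ≤ mΩ) {Q : Measure Ω}
    {H X : Ω → ℝ} (hH : BM m H) (hX : Integrable X Q) : Integrable (fun ω => H ω * X ω) Q := by
  obtain ⟨h1, B, hB⟩ := hH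
  exact hX.bdd_mul (h1.mono hm le_rfl).aestronglyMeasurable (ae_of_all _ fun ω => hB ω)

lemma BM.integrable {Ω : Type} {m mΩ : MeasurableSpace Ω} (hm : m ≤ mΩ) {Q : Measure Ω}
    [IsFiniteMeasure Q] {H : Ω → ℝ} (hH : BM m H) : Integrable H Q := by
  simpa using hH.integrable_mul hm (integrable_const (μ := Q) (1:ℝ))

lemma BM.rpow_neg {Ω : Type} {m : MeasurableSpace Ω} {W : Ω → ℝ} (hW : Measurable[m] W) {b a : ℝ}
    (hb : 0 < b) (ha : 0 ≤ a) (hWb : ∀ ω, b ≤ W ω) : BM m (fun ω => W ω ^ (-a)) := by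
  refine ⟨hW.pow_const _, b ^ (-a), fun ω => ?_⟩
  have : 0 < W ω := hb.trans_le (hWb ω)
  rw [abs_of_nonneg (by positivity)]
  exact Real.rpow_le_rpow_of_nonpos hb (hWb ω) (by linarith)

lemma BM.comp {Ω : Type} {m : MeasurableSpace Ω} {t : Ω → ℝ} (ht : Measurable[m] t) {f : ℝ → ℝ}
    (hf : Measurable f) {B : ℝ} (hB : ∀ u, |f u| ≤ B) : BM m (fun ω => f (t ω)) :=
  ⟨hf.comp ht, B, fun ω => hB (t ω)⟩

structure BES {Ω : Type} [mΩ : MeasurableSpace Ω] (Q : Measure Ω) (n : ℕ)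
    (F : ℕ → MeasurableSpace Ω) (ξ s : ℕ → Ω → ℝ) (ρ g δ : ℝ) : Prop where
  mono : Monotone F
  le : ∀ k, F k ≤ mΩ
  ξm : ∀ k, Measurable[F (k + 1)] (ξ k)
  sm : ∀ k, Measurable[F k] (s k)
  s0 : ∀ k ω, 0 ≤ s k ω
  sg : ∀ k ω, (s k ω) ^ (ρ / 2) ≤ g
  sT : ∀ k ω, k ≤ n → ∑ j ∈ Finset.range k, s j ω ≤ 1 + δ ^ 2
  sT' : ∀ᵐ ω ∂Q, 1 - δ ^ 2 ≤ ∑ j ∈ Finset.range n, s j ω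
  i1 : ∀ k, Integrable (ξ k) Q
  i2 : ∀ k, Integrable (fun ω => (ξ k ω) ^ 2) Q
  i3 : ∀ k, Integrable (fun ω => |ξ k ω| ^ (2 + ρ)) Q
  h1 : ∀ k, k < n → ∀ H, BM (F k) H → ∫ ω, H ω * ξ k ω ∂Q = 0
  h2 : ∀ k, k < n → ∀ H, BM (F k) H →
    |∫ ω, H ω * ((ξ k ω) ^ 2 - s k ω) ∂Q| ≤ g * ∫ ω, |H ω| * s k ω ∂Q
  h3 : ∀ k, k < n → ∀ H, BM (F k) H → (∀ ω, 0 ≤ H ω) →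
    ∫ ω, H ω * |ξ k ω| ^ (2 + ρ) ∂Q ≤ g * ∫ ω, H ω * s k ω ∂Q

section
variable {Ω : Type} [mΩ : MeasurableSpace Ω] {Q : Measure Ω} [IsProbabilityMeasure Q] {n : ℕ}
    {F : ℕ → MeasurableSpace Ω} {ξ s : ℕ → Ω → ℝ} {ρ g δ : ℝ}

/-- remaining variance -/
noncomputable def ww (s : ℕ → Ω → ℝ) (δ τ : ℝ) (k : ℕ) (ω : Ω) : ℝ :=
  1 + δ ^ 2 + τ ^ 2 - ∑ j ∈ Finset.range k, s j ω

noncomputable def MM (ξ : ℕ → Ω → ℝ) (k : ℕ) (ω : Ω) : ℝ := ∑ j ∈ Finset.range k, ξ j ω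

noncomputable def TH (ξ s : ℕ → Ω → ℝ) (δ τ z q : ℝ) (f : ℝ → ℝ) (k : ℕ) (ω : Ω) : ℝ :=
  ww s δ τ k ω ^ (-(q / 2)) * f ((z - MM ξ k ω) * ww s δ τ k ω ^ (-(1/2) : ℝ))

noncomputable def tt (ξ s : ℕ → Ω → ℝ) (δ τ z : ℝ) (k : ℕ) (ω : Ω) : ℝ :=
  (z - MM ξ k ω) * ww s δ τ (k + 1) ω ^ (-(1/2) : ℝ)

lemma BES.ww_ge (h : BES Q n F ξ s ρ g δ) (τ : ℝ) (k : ℕ) (hk : k ≤ n) (ω : Ω) :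
    τ ^ 2 ≤ ww s δ τ k ω := by
  unfold ww; linarith [h.sT k ω hk]

lemma BES.ww_le (h : BES Q n F ξ s ρ g δ) (τ : ℝ) (k : ℕ) (ω : Ω) :
    ww s δ τ k ω ≤ 1 + δ ^ 2 + τ ^ 2 := by
  unfold ww
  have : 0 ≤ ∑ j ∈ Finset.range k, s j ω := Finset.sum_nonneg fun j _ => h.s0 j ω
  linarith

lemma BES.ww_meas (h : BES Q n F ξ s ρ g δ) (τ : ℝ) (k : ℕ) :
    Measurable[F k] (ww s δ τ (k + 1)) := by
  have : Measurable[F k] (fun ω => ∑ j ∈ Finset.range (k + 1), s j ω) :=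
    Finset.measurable_sum _ fun j hj => (h.sm j).mono (h.mono (by simp at hj; omega)) le_rfl
  exact this.const_sub _

lemma BES.ww_meas' (h : BES Q n F ξ s ρ g δ) (τ : ℝ) (k : ℕ) :
    Measurable[F k] (ww s δ τ k) := by
  have : Measurable[F k] (fun ω => ∑ j ∈ Finset.range k, s j ω) :=
    Finset.measurable_sum _ fun j hj => (h.sm j).mono (h.mono (by simp at hj; omega)) le_rfl
  exact this.const_sub _

lemma BES.MM_meas (h : BES Q n F ξ s ρ g δ) (k : ℕ) : Measurable[F k] (MM ξ k) := by
  have : Measurable[F k] (fun ω => ∑ j ∈ Finset.range k, ξ j ω) :=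
    Finset.measurable_sum _ fun j hj => (h.ξm j).mono (h.mono (by simp at hj; omega)) le_rfl
  exact this

lemma BES.tt_meas (h : BES Q n F ξ s ρ g δ) (τ z : ℝ) (k : ℕ) :
    Measurable[F k] (tt ξ s δ τ z k) :=
  ((h.MM_meas k).const_sub z).mul ((h.ww_meas τ k).pow_const _)

lemma BES.TH_bm (h : BES Q n F ξ s ρ g δ) {τ : ℝ} (hτ : 0 < τ) (z : ℝ) {q B : ℝ} (hq : 0 ≤ q)
    {f : ℝ → ℝ} (hf : Measurable f) (hB : ∀ u, |f u| ≤ B) (k : ℕ) (hk : k ≤ n) :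
    BM (F k) (TH ξ s δ τ z q f k) :=
  (BM.rpow_neg (h.ww_meas' τ k) (by positivity : 0 < τ ^ 2) (by linarith) (h.ww_ge τ k hk)).mul
    (BM.comp (((h.MM_meas k).const_sub z).mul ((h.ww_meas' τ k).pow_const _)) hf hB)

/-- reward at step k -/
noncomputable def RW (ξ s : ℕ → Ω → ℝ) (δ τ z a : ℝ) (k : ℕ) (ω : Ω) : ℝ :=
  ww s δ τ (k + 1) ω ^ (-a) * psi (tt ξ s δ τ z k ω) * s k ω

/-- pointwise step -/
lemma BES.step_pt (h : BES Q n F ξ s ρ g δ) (hρ : 0 < ρ) (hρ1 : ρ ≤ 1) {τ : ℝ} (hτ : 0 < τ) (z : ℝ)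
    (hsτ : ∀ k ω, s k ω ≤ τ ^ 2) (hg : 0 ≤ g) (h4 : 1 + δ ^ 2 + τ ^ 2 ≤ 4)
    {q C : ℝ} {f f1 f2 f3 : ℝ → ℝ} (H : Tay q C f f1 f2 f3) (k : ℕ) (hk : k < n) (ω : Ω) :
    TH ξ s δ τ z q f (k + 1) ω - TH ξ s δ τ z q f k ω ≤
      (-(ww s δ τ (k + 1) ω ^ (-(q / 2 + 1 / 2)) * f1 (tt ξ s δ τ z k ω))) * ξ k ω
      + (ww s δ τ (k + 1) ω ^ (-(q / 2 + 1)) * (f2 (tt ξ s δ τ z k ω) / 2)) *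
          ((ξ k ω) ^ 2 - s k ω)
      + (ww s δ τ (k + 1) ω ^ (-(q / 2 + 1)) * (1 / 2 * (f2 (tt ξ s δ τ z k ω) +
          tt ξ s δ τ z k ω * f1 (tt ξ s δ τ z k ω) + q * f (tt ξ s δ τ z k ω)))) * s k ω
      + (20 * C * (ww s δ τ (k + 1) ω ^ (-(q / 2 + 1 + ρ / 2)) * psi (tt ξ s δ τ z k ω))) *
          |ξ k ω| ^ (2 + ρ)
      + 20 * C * g * RW ξ s δ τ z (q / 2 + 1 + ρ / 2) k ω := by
  unfold RW
  set W := ww s δ τ (k + 1) ω with hW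
  set t := tt ξ s δ τ z k ω with ht
  have hWτ : τ ^ 2 ≤ W := h.ww_ge τ (k + 1) hk ω
  have hW0 : 0 < W := lt_of_lt_of_le (by positivity) hWτ
  have hs0 := h.s0 k ω
  have hr1 : s k ω / W ≤ 1 := by
    rw [div_le_one hW0]; exact (hsτ k ω).trans hWτ
  have hr0 : 0 ≤ s k ω / W := by positivity
  set r := s k ω / W with hr
  set e := ξ k ω * W ^ (-(1/2) : ℝ) with he
  have hst := H.step ρ hρ.le hρ1 t e r hr0 hr1
  have hwk : ww s δ τ k ω = W * (1 + r) := by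
    rw [hr]; field_simp
    rw [hW]; unfold ww; rw [Finset.sum_range_succ]; ring
  have hsq : W ^ (-(1/2) : ℝ) * W ^ (-(1/2) : ℝ) = W⁻¹ := by
    rw [← Real.rpow_add hW0, ← Real.rpow_neg_one]; norm_num
  have e1 : TH ξ s δ τ z q f (k + 1) ω = W ^ (-(q/2)) * f (t - e) := by
    unfold TH
    rw [← hW]
    congr 2
    rw [ht, he]
    unfold tt MM
    rw [← hW, Finset.sum_range_succ]; ring
  have e2 : TH ξ s δ τ z q f k ω = W ^ (-(q/2)) * ((1 + r) ^ (-(q/2)) * f (t * (1 + r) ^ (-(1/2) : ℝ))) := by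
    unfold TH
    rw [hwk, Real.mul_rpow hW0.le (by linarith), Real.mul_rpow hW0.le (by linarith), mul_assoc]
    congr 3
    rw [ht]; unfold tt; rw [← hW]; ring
  have p0 : 0 < W ^ (-(q/2)) := Real.rpow_pos_of_pos hW0 _
  have p1 : W ^ (-(q / 2 + 1 / 2)) = W ^ (-(q/2)) * W ^ (-(1/2) : ℝ) := by
    rw [← Real.rpow_add hW0]; congr 1; ring
  have p2 : W ^ (-(q / 2 + 1)) = W ^ (-(q/2)) * W⁻¹ := by
    rw [← Real.rpow_neg_one, ← Real.rpow_add hW0]; congr 1; ring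
  have p3 : W ^ (-(q / 2 + 1 + ρ / 2)) = W ^ (-(q/2)) * W ^ (-(1 + ρ / 2)) := by
    rw [← Real.rpow_add hW0]; congr 1; ring
  have ee : e ^ 2 = ξ k ω ^ 2 * W⁻¹ := by rw [he, mul_pow, pow_two (W ^ _), hsq]
  have er : |e| ^ (2 + ρ) = |ξ k ω| ^ (2 + ρ) * W ^ (-(1 + ρ / 2)) := by
    rw [he, abs_mul, abs_of_pos (Real.rpow_pos_of_pos hW0 _), Real.mul_rpow (abs_nonneg _)
      (by positivity), ← Real.rpow_mul hW0.le]
    congr 2; ring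
  have hr2 : r ^ 2 ≤ g * (W ^ (-(1 + ρ / 2)) * s k ω) := by
    have q1 : r ^ 2 = r * r := pow_two r
    have q2 : r ≤ r ^ (ρ / 2) := by
      rcases hr0.eq_or_lt with h0 | h0
      · rw [← h0]; positivity
      · conv_lhs => rw [← Real.rpow_one r]
        exact Real.rpow_le_rpow_of_exponent_ge h0 hr1 (by linarith)
    have q3 : r ^ (ρ / 2) ≤ g * W ^ (-(ρ / 2)) := by
      rw [hr, Real.div_rpow hs0 hW0.le, Real.rpow_neg hW0.le, div_eq_mul_inv]
      have := h.sg k ω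
      gcongr
    have q4 : W ^ (-(1 + ρ / 2)) = W⁻¹ * W ^ (-(ρ / 2)) := by
      rw [← Real.rpow_neg_one, ← Real.rpow_add hW0]; congr 1; ring
    calc r ^ 2 = r * r := pow_two r
      _ ≤ r * (g * W ^ (-(ρ / 2))) := by gcongr; exact q2.trans q3
      _ = _ := by rw [q4]; simp only [hr]; ring
  have hψ := psi_pos t
  have hC := H.C0
  have hst' := (abs_le.1 hst).2
  have hst2 : f (t - e) - (1 + r) ^ (-(q / 2)) * f (t * (1 + r) ^ (-(1/2) : ℝ)) ≤
      (-(f1 t * e) + f2 t / 2 * (e ^ 2 - r) + r / 2 * (f2 t + t * f1 t + q * f t)) +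
      20 * C * psi t * (|ξ k ω| ^ (2 + ρ) * W ^ (-(1 + ρ / 2)) + g * (W ^ (-(1 + ρ / 2)) * s k ω)) := by
    have : 20 * C * psi t * (|e| ^ (2 + ρ) + r ^ 2) ≤
      20 * C * psi t * (|ξ k ω| ^ (2 + ρ) * W ^ (-(1 + ρ / 2)) + g * (W ^ (-(1 + ρ / 2)) * s k ω)) := by
      rw [er]; gcongr
    linarith
  rw [e1, e2, ← mul_sub]
  refine (mul_le_mul_of_nonneg_left hst2 p0.le).trans (le_of_eq ?_)
  rw [p1, p2, p3, ee, hr, he]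
  ring

lemma BES.step_int (h : BES Q n F ξ s ρ g δ) (hρ : 0 < ρ) (hρ1 : ρ ≤ 1) {τ : ℝ} (hτ : 0 < τ) (z : ℝ)
    (hsτ : ∀ k ω, s k ω ≤ τ ^ 2) (hg : 0 ≤ g) (h4 : 1 + δ ^ 2 + τ ^ 2 ≤ 4)
    {q C : ℝ} {f f1 f2 f3 : ℝ → ℝ} (H : Tay q C f f1 f2 f3) (k : ℕ) (hk : k < n) :
    ∫ ω, TH ξ s δ τ z q f (k + 1) ω ∂Q - ∫ ω, TH ξ s δ τ z q f k ω ∂Q ≤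
      ∫ ω, (ww s δ τ (k + 1) ω ^ (-(q / 2 + 1)) * (1 / 2 * (f2 (tt ξ s δ τ z k ω) +
          tt ξ s δ τ z k ω * f1 (tt ξ s δ τ z k ω) + q * f (tt ξ s δ τ z k ω)))) * s k ω ∂Q
      + 50 * C * g * ∫ ω, RW ξ s δ τ z (q / 2 + 1 + ρ / 2) k ω ∂Q := by
  have hC := H.C0
  have hq := H.q0
  have hFk := h.le k
  have cf : Measurable f := (continuous_iff_continuousAt.2 fun x => (H.d0 x).continuousAt).measurable
  have cf1 : Measurable f1 := (continuous_iff_continuousAt.2 fun x => (H.d1 x).continuousAt).measurable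
  have cf2 : Measurable f2 := (continuous_iff_continuousAt.2 fun x => (H.d2 x).continuousAt).measurable
  have hpsi : Measurable psi := psi_continuous.measurable
  have tm := h.tt_meas τ z k
  have bW : ∀ a : ℝ, 0 ≤ a → BM (F k) (fun ω => ww s δ τ (k + 1) ω ^ (-a)) := fun a ha =>
    BM.rpow_neg (h.ww_meas τ k) (by positivity : 0 < τ ^ 2) ha (h.ww_ge τ (k+1) hk)
  have Cψ : ∀ u, C * psi u ≤ C := fun u => by
    have := psi_le_one u; nlinarith
  have is : Integrable (s k) Q := by
    refine Integrable.mono' (integrable_const (τ ^ 2)) ((h.sm k).mono hFk le_rfl).aestronglyMeasurable ?_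
    exact ae_of_all _ fun ω => by rw [Real.norm_of_nonneg (h.s0 k ω)]; exact hsτ k ω
  have B1 : BM (F k) (fun ω => -(ww s δ τ (k + 1) ω ^ (-(q / 2 + 1 / 2)) * f1 (tt ξ s δ τ z k ω))) := by
    have := ((bW (q/2+1/2) (by positivity)).mul (BM.comp tm cf1 (B := C) fun u => (H.b1 u).trans (Cψ u)))
    obtain ⟨a, B, b⟩ := this
    exact ⟨a.neg, B, fun ω => by rw [abs_neg]; exact b ω⟩
  have B2 : BM (F k) (fun ω => ww s δ τ (k + 1) ω ^ (-(q / 2 + 1)) * (f2 (tt ξ s δ τ z k ω) / 2)) :=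
    (bW _ (by positivity)).mul (BM.comp tm (f := fun u => f2 u / 2) (cf2.div_const 2) (B := C)
      fun u => by
        rw [abs_div, abs_two]
        have := (H.b2 u).trans (Cψ u); linarith)
  have B3 : BM (F k) (fun ω => ww s δ τ (k + 1) ω ^ (-(q / 2 + 1)) * (1 / 2 * (f2 (tt ξ s δ τ z k ω) +
          tt ξ s δ τ z k ω * f1 (tt ξ s δ τ z k ω) + q * f (tt ξ s δ τ z k ω)))) :=
    (bW _ (by positivity)).mul (BM.comp tm (f := fun u => 1 / 2 * (f2 u + u * f1 u + q * f u))
      (((cf2.add (measurable_id.mul cf1)).add (cf.const_mul q)).const_mul (1/2))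
      (B := 1 / 2 * (C + C + q * C))
      fun u => by
        have e1 := (H.b2 u).trans (Cψ u)
        have e2 : |u * f1 u| ≤ C := by
          rw [abs_mul]
          have h5 := H.b1 u
          have h6 := psi_pos u
          have h7 : |u| * psi u ≤ 1 := by
            have := psi_mul u
            have h8 : |u| ≤ 1 + u ^ 2 := by rw [← sq_abs]; nlinarith [abs_nonneg u, sq_nonneg (|u| - 1)]
            nlinarith
          calc |u| * |f1 u| ≤ |u| * (C * psi u) := by gcongr
            _ = C * (|u| * psi u) := by ring
            _ ≤ C * 1 := by gcongr
            _ = C := mul_one C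
        have e3 : |q * f u| ≤ q * C := by
          rw [abs_mul, abs_of_nonneg hq]; gcongr; exact H.b0 u
        rw [abs_mul, abs_of_pos (by norm_num : (0:ℝ) < 1/2)]
        gcongr
        refine (abs_add_le _ _).trans (add_le_add ((abs_add_le _ _).trans (add_le_add e1 e2)) e3))
  have Bψ : BM (F k) (fun ω => psi (tt ξ s δ τ z k ω)) := BM.comp tm hpsi (B := 1)
    fun u => by rw [abs_of_pos (psi_pos u)]; exact psi_le_one u
  have B4' : BM (F k) (fun ω => ww s δ τ (k + 1) ω ^ (-(q / 2 + 1 + ρ / 2)) * psi (tt ξ s δ τ z k ω)) :=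
    (bW _ (by positivity)).mul Bψ
  have B4 : BM (F k) (fun ω => 20 * C *
      (ww s δ τ (k + 1) ω ^ (-(q / 2 + 1 + ρ / 2)) * psi (tt ξ s δ τ z k ω))) :=
    BM.mul (H := fun _ => 20 * C) ⟨measurable_const, |20 * C|, fun _ => le_rfl⟩ B4'
  have I1 := B1.integrable_mul hFk (h.i1 k)
  have I2 := B2.integrable_mul hFk ((h.i2 k).sub is)
  have I3 := B3.integrable_mul hFk is
  have I4 := B4.integrable_mul hFk (h.i3 k)
  have IR : Integrable (fun ω => RW ξ s δ τ z (q / 2 + 1 + ρ / 2) k ω) Q := B4'.integrable_mul hFk is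
  have I5 := IR.const_mul (20 * C * g)
  have J0 : ∀ j, j ≤ n → Integrable (fun ω => TH ξ s δ τ z q f j ω) Q := fun j hj =>
    (h.TH_bm hτ z hq cf H.b0 j hj).integrable (h.le j)
  rw [← integral_sub (J0 _ hk) (J0 _ hk.le)]
  have hmain := integral_mono ((J0 _ hk).sub (J0 _ hk.le)) ((((I1.add I2).add I3).add I4).add I5)
    (fun ω => h.step_pt hρ hρ1 hτ z hsτ hg h4 H k hk ω)
  refine hmain.trans ?_
  have hs1 := integral_add (((I1.add I2).add I3).add I4) I5
  have hs2 := integral_add ((I1.add I2).add I3) I4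
  have hs3 := integral_add (I1.add I2) I3
  have hs4 := integral_add I1 I2
  simp only [Pi.add_apply, Pi.sub_apply] at hs1 hs2 hs3 hs4 ⊢
  rw [hs1, hs2, hs3, hs4, h.h1 k hk _ B1, integral_const_mul]
  have k2 := (le_abs_self _).trans (h.h2 k hk _ B2)
  have k4 := h.h3 k hk _ B4 (fun ω => by
    have : 0 < ww s δ τ (k + 1) ω := lt_of_lt_of_le (by positivity) (h.ww_ge τ (k+1) hk ω)
    have := psi_pos (tt ξ s δ τ z k ω)
    positivity)
  have k2' : ∫ ω, |ww s δ τ (k + 1) ω ^ (-(q / 2 + 1)) * (f2 (tt ξ s δ τ z k ω) / 2)| * s k ω ∂Q ≤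
      ∫ ω, C * RW ξ s δ τ z (q / 2 + 1 + ρ / 2) k ω ∂Q := by
    refine integral_mono_of_nonneg (ae_of_all _ fun ω => mul_nonneg (abs_nonneg _) (h.s0 k ω))
      (IR.const_mul C) (ae_of_all _ fun ω => ?_)
    have hWτ := h.ww_ge τ (k+1) hk ω
    have hW4 := (h.ww_le τ (k+1) ω).trans h4
    unfold RW
    simp only
    set W := ww s δ τ (k + 1) ω
    have hW0 : 0 < W := lt_of_lt_of_le (by positivity) hWτ
    have p3 : W ^ (-(q / 2 + 1)) = W ^ (-(q / 2 + 1 + ρ / 2)) * W ^ (ρ / 2) := by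
      rw [← Real.rpow_add hW0]; congr 1; ring
    have p4 : W ^ (ρ / 2) ≤ 2 := by
      calc W ^ (ρ / 2) ≤ 4 ^ (ρ / 2) := Real.rpow_le_rpow hW0.le hW4 (by positivity)
        _ ≤ 4 ^ (1 / 2 : ℝ) := Real.rpow_le_rpow_of_exponent_le (by norm_num) (by linarith)
        _ = 2 := by
          rw [show (4:ℝ) = 2 ^ (2:ℝ) by norm_num, ← Real.rpow_mul (by norm_num)]; norm_num
    have hb2 := H.b2 (tt ξ s δ τ z k ω)
    have hs0 := h.s0 k ω
    have pp : 0 < W ^ (-(q / 2 + 1 + ρ / 2)) := Real.rpow_pos_of_pos hW0 _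
    have pp2 : 0 < W ^ (ρ / 2) := Real.rpow_pos_of_pos hW0 _
    rw [abs_mul, abs_of_pos (Real.rpow_pos_of_pos hW0 _), abs_div, abs_two, p3]
    calc W ^ (-(q / 2 + 1 + ρ / 2)) * W ^ (ρ / 2) * (|f2 (tt ξ s δ τ z k ω)| / 2) * s k ω
      ≤ W ^ (-(q / 2 + 1 + ρ / 2)) * 2 * ((C * psi (tt ξ s δ τ z k ω)) / 2) * s k ω := by gcongr
      _ = _ := by ring
  rw [integral_const_mul] at k2'
  have k4' : ∫ ω, 20 * C * (ww s δ τ (k + 1) ω ^ (-(q / 2 + 1 + ρ / 2)) * psi (tt ξ s δ τ z k ω)) * s k ω ∂Q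
    = 20 * C * ∫ ω, RW ξ s δ τ z (q / 2 + 1 + ρ / 2) k ω ∂Q := by
    rw [← integral_const_mul]
    congr 1
    ext ω
    unfold RW; ring
  rw [k4'] at k4
  have hR0 : 0 ≤ ∫ ω, RW ξ s δ τ z (q / 2 + 1 + ρ / 2) k ω ∂Q := by
    refine integral_nonneg fun ω => ?_
    have : 0 < ww s δ τ (k + 1) ω := lt_of_lt_of_le (by positivity) (h.ww_ge τ (k+1) hk ω)
    have := psi_pos (tt ξ s δ τ z k ω)
    have := h.s0 k ω
    unfold RW
    simp only [Pi.zero_apply]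
    positivity
  have k5 : g * (∫ ω, |ww s δ τ (k + 1) ω ^ (-(q / 2 + 1)) * (f2 (tt ξ s δ τ z k ω) / 2)| * s k ω ∂Q) ≤
    g * (C * ∫ ω, RW ξ s δ τ z (q / 2 + 1 + ρ / 2) k ω ∂Q) := by gcongr
  have k6 : 0 ≤ C * g * ∫ ω, RW ξ s δ τ z (q / 2 + 1 + ρ / 2) k ω ∂Q := by positivity
  linarith

end

open MeasureTheory Filter
open scoped Topology ENNReal

section
variable {Ω : Type} [mΩ : MeasurableSpace Ω] {Q : Measure Ω} [IsProbabilityMeasure Q] {n : ℕ}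
    {F : ℕ → MeasurableSpace Ω} {ξ s : ℕ → Ω → ℝ} {ρ g δ : ℝ}

lemma BES.RW_int (h : BES Q n F ξ s ρ g δ) {τ : ℝ} (hτ : 0 < τ) (z : ℝ)
    (hsτ : ∀ k ω, s k ω ≤ τ ^ 2) (a : ℝ) (ha : 0 ≤ a) (k : ℕ) (hk : k < n) :
    Integrable (fun ω => RW ξ s δ τ z a k ω) Q := by
  have hFk := h.le k
  have tm := h.tt_meas τ z k
  have is : Integrable (s k) Q := by
    refine Integrable.mono' (integrable_const (τ ^ 2)) ((h.sm k).mono hFk le_rfl).aestronglyMeasurable ?_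
    exact ae_of_all _ fun ω => by rw [Real.norm_of_nonneg (h.s0 k ω)]; exact hsτ k ω
  have Bψ : BM (F k) (fun ω => psi (tt ξ s δ τ z k ω)) := BM.comp tm psi_continuous.measurable (B := 1)
    fun u => by rw [abs_of_pos (psi_pos u)]; exact psi_le_one u
  exact ((BM.rpow_neg (h.ww_meas τ k) (by positivity : 0 < τ ^ 2) ha (h.ww_ge τ (k+1) hk)).mul
    Bψ).integrable_mul hFk is

lemma BES.reward (h : BES Q n F ξ s ρ g δ) (hρ : 0 < ρ) (hρ1 : ρ < 1) {τ : ℝ} (hτ : 0 < τ) (z : ℝ)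
    (hsτ : ∀ k ω, s k ω ≤ τ ^ 2) (hg : 0 < g) (h4 : 1 + δ ^ 2 + τ ^ 2 ≤ 4)
    (hK : τ ^ ρ = 400 * chiC ρ * g) :
    ∑ k ∈ Finset.range n, ∫ ω, RW ξ s δ τ z (ρ / 2 + 1) k ω ∂Q ≤ 8 * chiC ρ := by
  have H := tay_chi ρ hρ.le hρ1
  have hC0 : 0 < chiC ρ := by have := chiK_pos ρ hρ1; unfold chiC; positivity
  have key : ∀ k, k < n → ∫ ω, TH ξ s δ τ z ρ (chi ρ) (k + 1) ω ∂Q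
      - ∫ ω, TH ξ s δ τ z ρ (chi ρ) k ω ∂Q ≤ - (1/8) * ∫ ω, RW ξ s δ τ z (ρ / 2 + 1) k ω ∂Q := by
    intro k hk
    have h1 := h.step_int hρ hρ1.le hτ z hsτ hg.le h4 H k hk
    have IR := h.RW_int hτ z hsτ (ρ / 2 + 1) (by positivity) k hk
    have h2 : ∫ ω, (ww s δ τ (k + 1) ω ^ (-(ρ / 2 + 1)) * (1 / 2 * (chi2 ρ (tt ξ s δ τ z k ω) +
          tt ξ s δ τ z k ω * chi1 ρ (tt ξ s δ τ z k ω) + ρ * chi ρ (tt ξ s δ τ z k ω)))) * s k ω ∂Q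
          ≤ ∫ ω, -(1/4) * RW ξ s δ τ z (ρ / 2 + 1) k ω ∂Q := by
      by_cases hi : Integrable (fun ω => (ww s δ τ (k + 1) ω ^ (-(ρ / 2 + 1)) * (1 / 2 * (chi2 ρ (tt ξ s δ τ z k ω) +
          tt ξ s δ τ z k ω * chi1 ρ (tt ξ s δ τ z k ω) + ρ * chi ρ (tt ξ s δ τ z k ω)))) * s k ω) Q
      · refine integral_mono hi (IR.const_mul _) fun ω => ?_
        have h3 := chi_pde ρ hρ1 (tt ξ s δ τ z k ω)
        have hW0 : 0 < ww s δ τ (k + 1) ω := lt_of_lt_of_le (by positivity) (h.ww_ge τ (k+1) hk ω)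
        have p0 : 0 ≤ ww s δ τ (k + 1) ω ^ (-(ρ / 2 + 1)) * s k ω :=
          mul_nonneg (by positivity) (h.s0 k ω)
        have := mul_le_mul_of_nonneg_left h3 p0
        unfold RW
        simp only
        linarith
      · exfalso
        apply hi
        have hFk := h.le k
        have tm := h.tt_meas τ z k
        have is : Integrable (s k) Q := by
          refine Integrable.mono' (integrable_const (τ ^ 2)) ((h.sm k).mono hFk le_rfl).aestronglyMeasurable ?_
          exact ae_of_all _ fun ω => by rw [Real.norm_of_nonneg (h.s0 k ω)]; exact hsτ k ω
        have cf : Measurable (chi ρ) := (continuous_iff_continuousAt.2 fun x => (H.d0 x).continuousAt).measurable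
        have cf1 : Measurable (chi1 ρ) := (continuous_iff_continuousAt.2 fun x => (H.d1 x).continuousAt).measurable
        have cf2 : Measurable (chi2 ρ) := (continuous_iff_continuousAt.2 fun x => (H.d2 x).continuousAt).measurable
        have Cψ : ∀ u, chiC ρ * psi u ≤ chiC ρ := fun u => by
          have := psi_le_one u; nlinarith
        have B3 : BM (F k) (fun ω => ww s δ τ (k + 1) ω ^ (-(ρ / 2 + 1)) * (1 / 2 * (chi2 ρ (tt ξ s δ τ z k ω) +
          tt ξ s δ τ z k ω * chi1 ρ (tt ξ s δ τ z k ω) + ρ * chi ρ (tt ξ s δ τ z k ω)))) :=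
          (BM.rpow_neg (h.ww_meas τ k) (by positivity : 0 < τ ^ 2) (by positivity) (h.ww_ge τ (k+1) hk)).mul
            (BM.comp tm (f := fun u => 1 / 2 * (chi2 ρ u + u * chi1 ρ u + ρ * chi ρ u))
            (((cf2.add (measurable_id.mul cf1)).add (cf.const_mul ρ)).const_mul (1/2))
            (B := 1 / 2 * (chiC ρ + chiC ρ + ρ * chiC ρ))
            fun u => by
              have e1 := (H.b2 u).trans (Cψ u)
              have e2 : |u * chi1 ρ u| ≤ chiC ρ := by
                rw [abs_mul]
                have h5 := H.b1 u
                have h6 := psi_pos u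
                have h7 : |u| * psi u ≤ 1 := by
                  have := psi_mul u
                  have h8 : |u| ≤ 1 + u ^ 2 := by rw [← sq_abs]; nlinarith [abs_nonneg u, sq_nonneg (|u| - 1)]
                  nlinarith
                calc |u| * |chi1 ρ u| ≤ |u| * (chiC ρ * psi u) := by gcongr
                  _ = chiC ρ * (|u| * psi u) := by ring
                  _ ≤ chiC ρ * 1 := by gcongr
                  _ = chiC ρ := mul_one _
              have e3 : |ρ * chi ρ u| ≤ ρ * chiC ρ := by
                rw [abs_mul, abs_of_pos hρ]; gcongr; exact H.b0 u
              rw [abs_mul, abs_of_pos (by norm_num : (0:ℝ) < 1/2)]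
              gcongr
              refine (abs_add_le _ _).trans (add_le_add ((abs_add_le _ _).trans (add_le_add e1 e2)) e3))
        exact B3.integrable_mul hFk is
    rw [integral_const_mul] at h2
    have h3 : ∫ ω, RW ξ s δ τ z (ρ / 2 + 1 + ρ / 2) k ω ∂Q ≤
        ∫ ω, (τ ^ ρ)⁻¹ * RW ξ s δ τ z (ρ / 2 + 1) k ω ∂Q := by
      refine integral_mono (h.RW_int hτ z hsτ _ (by positivity) k hk) (IR.const_mul _) fun ω => ?_
      have hWτ := h.ww_ge τ (k+1) hk ω
      have hW0 : 0 < ww s δ τ (k + 1) ω := lt_of_lt_of_le (by positivity) hWτ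
      unfold RW
      simp only
      have e1 : ww s δ τ (k + 1) ω ^ (-(ρ / 2 + 1 + ρ / 2)) =
        ww s δ τ (k + 1) ω ^ (-(ρ / 2)) * ww s δ τ (k + 1) ω ^ (-(ρ / 2 + 1)) := by
        rw [← Real.rpow_add hW0]; congr 1; ring
      have e2 : ww s δ τ (k + 1) ω ^ (-(ρ / 2)) ≤ (τ ^ ρ)⁻¹ := by
        calc _ ≤ (τ ^ 2) ^ (-(ρ / 2)) := Real.rpow_le_rpow_of_nonpos (by positivity) hWτ (by linarith)
          _ = (τ ^ ρ)⁻¹ := by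
            rw [← Real.rpow_natCast, ← Real.rpow_mul hτ.le, ← Real.rpow_neg hτ.le]; congr 1; push_cast; ring
      have := psi_pos (tt ξ s δ τ z k ω)
      have := h.s0 k ω
      rw [e1, mul_assoc, mul_assoc, mul_assoc]
      gcongr
    rw [integral_const_mul, hK] at h3
    have h5 : 50 * chiC ρ * g * ∫ ω, RW ξ s δ τ z (ρ / 2 + 1 + ρ / 2) k ω ∂Q ≤
        1 / 8 * ∫ ω, RW ξ s δ τ z (ρ / 2 + 1) k ω ∂Q := by
      calc _ ≤ 50 * chiC ρ * g * ((400 * chiC ρ * g)⁻¹ * ∫ ω, RW ξ s δ τ z (ρ / 2 + 1) k ω ∂Q) := by gcongr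
        _ = _ := by
          generalize ∫ ω, RW ξ s δ τ z (ρ / 2 + 1) k ω ∂Q = I
          field_simp
          ring
    linarith
  have hsum := Finset.sum_le_sum (fun k (hk : k ∈ Finset.range n) => key k (Finset.mem_range.1 hk))
  rw [Finset.sum_range_sub (fun k => ∫ ω, TH ξ s δ τ z ρ (chi ρ) k ω ∂Q), ← Finset.mul_sum] at hsum
  have hn : 0 ≤ ∫ ω, TH ξ s δ τ z ρ (chi ρ) n ω ∂Q := by
    refine integral_nonneg fun ω => ?_
    have hW0 : 0 < ww s δ τ n ω := lt_of_lt_of_le (by positivity) (h.ww_ge τ n le_rfl ω)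
    have := chi_pos ρ hρ1 ((z - MM ξ n ω) * ww s δ τ n ω ^ (-(1/2) : ℝ))
    unfold TH
    simp only [Pi.zero_apply]
    positivity
  have h0 : ∫ ω, TH ξ s δ τ z ρ (chi ρ) 0 ω ∂Q ≤ chiC ρ := by
    have : ∀ ω, TH ξ s δ τ z ρ (chi ρ) 0 ω ≤ chiC ρ := by
      intro ω
      unfold TH ww
      simp only [Finset.range_zero, Finset.sum_empty, sub_zero]
      have h1 : (1 + δ ^ 2 + τ ^ 2) ^ (-(ρ / 2)) ≤ 1 :=
        Real.rpow_le_one_of_one_le_of_nonpos (by nlinarith [sq_nonneg δ, sq_nonneg τ]) (by linarith)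
      have h2 := (le_abs_self _).trans (H.b0 ((z - MM ξ 0 ω) * (1 + δ ^ 2 + τ ^ 2) ^ (-(1/2) : ℝ)))
      have h3 := (chi_pos ρ hρ1 ((z - MM ξ 0 ω) * (1 + δ ^ 2 + τ ^ 2) ^ (-(1/2) : ℝ))).le
      have h4 : (0:ℝ) ≤ (1 + δ ^ 2 + τ ^ 2) ^ (-(ρ / 2)) := by positivity
      nlinarith
    have cf : Measurable (chi ρ) := (continuous_iff_continuousAt.2 fun x => (H.d0 x).continuousAt).measurable
    have := integral_mono ((h.TH_bm hτ z hρ.le cf H.b0 0 (Nat.zero_le n)).integrable (h.le 0))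
      (integrable_const (μ := Q) (chiC ρ)) this
    simpa using this
  linarith

lemma Tay.neg {q C : ℝ} {f f1 f2 f3 : ℝ → ℝ} (H : Tay q C f f1 f2 f3) :
    Tay q C (fun t => -f t) (fun t => -f1 t) (fun t => -f2 t) (fun t => -f3 t) := by
  refine ⟨H.q0, H.C0, fun t => (H.d0 t).neg, fun t => (H.d1 t).neg, fun t => (H.d2 t).neg, ?_, ?_, ?_, ?_, ?_⟩
  · intro t; rw [abs_neg]; exact H.b0 t
  · intro t; rw [abs_neg]; exact H.b1 t
  · intro t; rw [abs_neg]; exact H.b2 t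
  · intro t; rw [abs_neg]; exact H.b3 t
  · intro t
    rw [← abs_neg]
    refine le_trans (le_of_eq ?_) (H.bt t)
    congr 1; ring

lemma BES.phi (h : BES Q n F ξ s ρ g δ) (hρ : 0 < ρ) (hρ1 : ρ < 1) {τ : ℝ} (hτ : 0 < τ) (z : ℝ)
    (hsτ : ∀ k ω, s k ω ≤ τ ^ 2) (hg : 0 < g) (h4 : 1 + δ ^ 2 + τ ^ 2 ≤ 4)
    (hK : τ ^ ρ = 400 * chiC ρ * g) :
    |∫ ω, stdNormalCDF ((z - MM ξ n ω) * ww s δ τ n ω ^ (-(1/2) : ℝ)) ∂Q -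
      stdNormalCDF (z * (1 + δ ^ 2 + τ ^ 2) ^ (-(1/2) : ℝ))| ≤ 1280000 * chiC ρ * g := by
  have hR := h.reward hρ hρ1 hτ z hsτ hg h4 hK
  have e : ∀ k, RW ξ s δ τ z (0 / 2 + 1 + ρ / 2) k = RW ξ s δ τ z (ρ / 2 + 1) k := by
    intro k; congr 1; ring
  have key : ∀ (f f1 f2 f3 : ℝ → ℝ), Tay 0 3200 f f1 f2 f3 → (∀ t, f2 t + t * f1 t = 0) →
      ∫ ω, TH ξ s δ τ z 0 f n ω ∂Q - ∫ ω, TH ξ s δ τ z 0 f 0 ω ∂Q ≤ 1280000 * chiC ρ * g := by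
    intro f f1 f2 f3 H hz
    have k1 : ∀ k ∈ Finset.range n, ∫ ω, TH ξ s δ τ z 0 f (k + 1) ω ∂Q - ∫ ω, TH ξ s δ τ z 0 f k ω ∂Q
        ≤ 160000 * g * ∫ ω, RW ξ s δ τ z (ρ / 2 + 1) k ω ∂Q := by
      intro k hk
      have h1 := h.step_int hρ hρ1.le hτ z hsτ hg.le h4 H k (Finset.mem_range.1 hk)
      simp only [hz, e, zero_mul, add_zero, mul_zero, integral_zero, zero_add] at h1
      have h2 : (fun ω => RW ξ s δ τ z (0 / 2 + 1 + ρ / 2) k ω) = RW ξ s δ τ z (ρ / 2 + 1) k := e k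
      refine h1.trans (le_of_eq ?_)
      have : (∫ ω, RW ξ s δ τ z (0 / 2 + 1 + ρ / 2) k ω ∂Q) = ∫ ω, RW ξ s δ τ z (ρ / 2 + 1) k ω ∂Q := by
        rw [e]
      ring_nf
    have hsum := Finset.sum_le_sum k1
    rw [Finset.sum_range_sub (fun k => ∫ ω, TH ξ s δ τ z 0 f k ω ∂Q), ← Finset.mul_sum] at hsum
    refine hsum.trans ?_
    calc _ ≤ 160000 * g * (8 * chiC ρ) := by gcongr
      _ = _ := by ring
  have t1 : ∀ f k, ∀ ω, TH ξ s δ τ z 0 f k ω = f ((z - MM ξ k ω) * ww s δ τ k ω ^ (-(1/2) : ℝ)) := by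
    intro f k ω; unfold TH; simp
  have t0 : ∀ f : ℝ → ℝ, ∫ ω, TH ξ s δ τ z 0 f 0 ω ∂Q = f (z * (1 + δ ^ 2 + τ ^ 2) ^ (-(1/2) : ℝ)) := by
    intro f
    have : ∀ ω, TH ξ s δ τ z 0 f 0 ω = f (z * (1 + δ ^ 2 + τ ^ 2) ^ (-(1/2) : ℝ)) := by
      intro ω; rw [t1]; unfold MM ww; simp
    simp [this]
  have a1 := key _ _ _ _ tay_cdf (fun t => by ring)
  have a2 := key _ _ _ _ tay_cdf.neg (fun t => by ring)
  rw [t0] at a1 a2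
  simp only [t1] at a1 a2
  rw [integral_neg] at a2
  rw [abs_le]
  constructor <;> linarith

end

open MeasureTheory Filter
open scoped Topology ENNReal

lemma cdf_scale (z w : ℝ) (hw : 1 ≤ w) :
    |stdNormalCDF (z * w ^ (-(1/2) : ℝ)) - stdNormalCDF z| ≤ w - 1 := by
  have hpos : ∀ z : ℝ, 0 ≤ z → stdNormalCDF z - stdNormalCDF (z * w ^ (-(1/2) : ℝ)) ≤ w - 1 := by
    intro z hz
    set v := w ^ (-(1/2) : ℝ) with hv
    have hw0 : 0 < w := by linarith
    have hv0 : 0 < v := Real.rpow_pos_of_pos hw0 _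
    have hvw : v * v * w = 1 := by
      rw [hv, ← Real.rpow_add hw0]; norm_num; rw [Real.rpow_neg_one]; field_simp
    have hv1 : v ≤ 1 := by nlinarith
    rcases hz.eq_or_lt with rfl | hz
    · simp; linarith
    rcases hv1.eq_or_lt with h1 | h1
    · rw [h1]; simp; linarith
    have hlt : z * v < z := by nlinarith
    obtain ⟨c, hc, hce⟩ := exists_hasDerivAt_eq_slope stdNormalCDF gpdf hlt
      cdf_continuous.continuousOn (fun x _ => cdf_hasDerivAt x)
    have hne : z - z * v ≠ 0 := by linarith
    have hce' : stdNormalCDF z - stdNormalCDF (z * v) = gpdf c * (z - z * v) := by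
      rw [hce]; field_simp
    rw [hce']
    have hcz : z * v < c := hc.1
    have hc0 : 0 < c := lt_trans (by positivity) hcz
    have h2 : c * gpdf c ≤ 1 := by
      have h3 := gpdf_le c
      have h4 : c * ge c ≤ 1 := by
        have h5 := Real.add_one_le_exp (c ^ 2 / 2)
        have h6 : ge c * Real.exp (c ^ 2 / 2) = 1 := by
          unfold ge; rw [← Real.exp_add]; simp; ring
        have := ge_pos c
        nlinarith [sq_nonneg (c - 1)]
      unfold ge at h4
      nlinarith [gpdf_pos c]
    have h7 := gpdf_pos c
    have h8 : gpdf c * (z - z * v) ≤ (c * gpdf c) * (w - 1) := by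
      have : z - z * v ≤ c * (w - 1) := by
        have e : z = z * v * v * w := by rw [mul_assoc z v v, mul_assoc, hvw, mul_one]
        have : z * v * v * w ≤ z * v * w := by
          have : 0 < z * v * w := by positivity
          nlinarith
        nlinarith
      nlinarith
    nlinarith
  have hmono : ∀ z : ℝ, 0 ≤ z → stdNormalCDF (z * w ^ (-(1/2) : ℝ)) ≤ stdNormalCDF z := by
    intro z hz
    apply cdf_mono
    have : w ^ (-(1/2) : ℝ) ≤ 1 := Real.rpow_le_one_of_one_le_of_nonpos hw (by norm_num)
    nlinarith
  rcases le_or_gt 0 z with hz | hz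
  · have := hpos z hz
    have := hmono z hz
    rw [abs_le]; constructor <;> linarith
  · have h1 := hpos (-z) (by linarith)
    have h2 := hmono (-z) (by linarith)
    rw [neg_mul, cdf_neg, cdf_neg] at h1 h2
    rw [abs_le]; constructor <;> linarith

lemma cdf_neg_exp (y : ℝ) (hy : 0 ≤ y) : stdNormalCDF (-y) ≤ 2 * Real.exp (-1 * y) := by
  have h1 := mills_upper y hy
  have h2 := one_sub_cdf_pos y
  rw [cdf_neg]
  have h3 : Real.exp (-(y ^ 2) / 2) ≤ Real.exp (1 / 2) * Real.exp (-1 * y) := by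
    rw [← Real.exp_add]; apply Real.exp_le_exp.2; nlinarith [sq_nonneg (y - 1)]
  have h4 : Real.exp (1/2) ≤ 2 := by
    have := Real.exp_one_lt_d9
    have h5 : Real.exp (1/2) * Real.exp (1/2) = Real.exp 1 := by rw [← Real.exp_add]; norm_num
    nlinarith [Real.exp_pos (1/2)]
  have h6 := Real.exp_pos (-1 * y)
  nlinarith

noncomputable def cc1 : ℝ := stdNormalCDF 1 - stdNormalCDF (-1)
lemma cc1_pos : 0 < cc1 := by
  unfold cc1; have := cdf_strictMono (show (-1:ℝ) < 1 by norm_num); linarith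

/-- abstract smoothing -/
lemma smoothing {Ω : Type} [MeasurableSpace Ω] (Q : Measure Ω) [IsProbabilityMeasure Q]
    (M v : Ω → ℝ) (hM : Measurable M) (hv : Measurable v) (h D : ℝ) (hh : 0 < h)
    (hv0 : ∀ᵐ ω ∂Q, 0 < v ω) (hvh : ∀ᵐ ω ∂Q, v ω ≤ h)
    (hD : ∀ z, |∫ ω, stdNormalCDF ((z - M ω) / v ω) ∂Q - stdNormalCDF z| ≤ D) (z : ℝ) :
    |Q.real {ω | M ω < z} - stdNormalCDF z| ≤ D + 16 * cc1⁻¹ * (h + D) := by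
  have hc := cc1_pos
  have hD0 : 0 ≤ D := (abs_nonneg _).trans (hD 0)
  have mu : ∀ z, Measurable (fun ω => stdNormalCDF ((z - M ω) / v ω)) := fun z =>
    cdf_continuous.measurable.comp ((hM.const_sub z).div hv)
  have iu : ∀ z, Integrable (fun ω => stdNormalCDF ((z - M ω) / v ω)) Q := fun z =>
    Integrable.mono' (integrable_const 1) (mu z).aestronglyMeasurable (ae_of_all _ fun ω => by
      rw [Real.norm_of_nonneg (cdf_nonneg _)]; exact cdf_le_one _)
  -- concentration
  have conc : ∀ t, 0 ≤ t → Q.real {ω | |M ω - z| / h < t} ≤ cc1⁻¹ * (2 * ((t + 1) * h) + 2 * D) := by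
    intro t ht
    have hS : MeasurableSet {ω | |M ω - z| / h < t} :=
      measurableSet_lt (((hM.sub_const z).abs).div_const h) measurable_const
    have h1 : ∫ ω, Set.indicator {ω | |M ω - z| / h < t} (fun _ => cc1) ω ∂Q ≤
        ∫ ω, (stdNormalCDF ((z + (t + 1) * h - M ω) / v ω) - stdNormalCDF ((z - (t + 1) * h - M ω) / v ω)) ∂Q := by
      refine integral_mono_ae ((integrable_const _).indicator hS) ((iu _).sub (iu _)) ?_
      filter_upwards [hv0, hvh] with ω w0 wh
      have hmono : (z - (t + 1) * h - M ω) / v ω ≤ (z + (t + 1) * h - M ω) / v ω := by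
        apply div_le_div_of_nonneg_right _ w0.le
        have : 0 ≤ (t + 1) * h := by positivity
        linarith
      by_cases hω : |M ω - z| / h < t
      · rw [Set.indicator_of_mem (by exact hω)]
        rw [div_lt_iff₀ hh, abs_lt] at hω
        have a1 : 1 ≤ (z + (t + 1) * h - M ω) / v ω := by
          rw [le_div_iff₀ w0]; linarith
        have a2 : (z - (t + 1) * h - M ω) / v ω ≤ -1 := by
          rw [div_le_iff₀ w0]; linarith
        have := cdf_mono a1
        have := cdf_mono a2
        unfold cc1; linarith
      · rw [Set.indicator_of_notMem (by exact hω)]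
        have := cdf_mono hmono
        linarith
    rw [integral_sub (iu _) (iu _), integral_indicator hS] at h1
    simp only [integral_const, smul_eq_mul, measureReal_restrict_apply MeasurableSet.univ, Set.univ_inter] at h1
    have d1 := abs_le.1 (hD (z + (t + 1) * h))
    have d2 := abs_le.1 (hD (z - (t + 1) * h))
    have d3 := (le_abs_self _).trans (cdf_lipschitz (z + (t + 1) * h) (z - (t + 1) * h))
    have d4 : |z + (t + 1) * h - (z - (t + 1) * h)| = 2 * ((t + 1) * h) := by
      rw [abs_of_nonneg] <;> [ring; skip]
      have : 0 ≤ (t + 1) * h := by positivity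
      linarith
    rw [d4] at d3
    rw [inv_mul_eq_div, le_div_iff₀ hc]
    linarith
  -- exponential moment
  have hY : Measurable (fun ω => |M ω - z| / h) := ((hM.sub_const z).abs).div_const h
  have : IsProbabilityMeasure (Q.map (fun ω => |M ω - z| / h)) :=
    Measure.isProbabilityMeasure_map hY.aemeasurable
  have lf := laplace_fubini (Q.map (fun ω => |M ω - z| / h)) 0 1 one_pos
  rw [setIntegral_map measurableSet_Ici (by fun_prop) hY.aemeasurable] at lf
  have huniv : (fun ω => |M ω - z| / h) ⁻¹' Set.Ici 0 = Set.univ := by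
    ext ω; simp; positivity
  rw [huniv, Measure.restrict_univ] at lf
  have hexp : ∫ ω, Real.exp (-1 * (|M ω - z| / h)) ∂Q ≤ 8 * cc1⁻¹ * (h + D) := by
    rw [lf]
    have hi : IntegrableOn (fun t : ℝ => 4 * cc1⁻¹ * (h + D) * Real.exp (-(1/2) * t)) (Set.Ioi 0) :=
      (integrableOn_exp_mul_Ioi (by norm_num) 0).const_mul _
    have hval : ∫ t in Set.Ioi (0:ℝ), 4 * cc1⁻¹ * (h + D) * Real.exp (-(1/2) * t) = 8 * cc1⁻¹ * (h + D) := by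
      rw [integral_const_mul, integral_exp_mul_Ioi (by norm_num : (-(1/2) : ℝ) < 0)]
      simp; ring
    rw [← hval]
    refine integral_mono_of_nonneg (ae_of_all _ fun t => by simp only [Pi.zero_apply]; positivity) hi ?_
    filter_upwards [ae_restrict_mem measurableSet_Ioi] with t ht
    have ht0 : (0:ℝ) < t := ht
    have m1 : (Q.map (fun ω => |M ω - z| / h)).real (Set.Ico 0 t) ≤ cc1⁻¹ * (2 * ((t + 1) * h) + 2 * D) := by
      rw [map_measureReal_apply hY measurableSet_Ico]
      exact (measureReal_mono (fun ω hω => hω.2)).trans (conc t ht0.le)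
    have m2 : Real.exp (-1 * t) = Real.exp (-(1/2) * t) * Real.exp (-(1/2) * t) := by
      rw [← Real.exp_add]; congr 1; ring
    have m3 : (t + 1) * Real.exp (-(1/2) * t) ≤ 2 := by
      have h5 := Real.add_one_le_exp (1/2 * t)
      have h6 : Real.exp (1/2 * t) * Real.exp (-(1/2) * t) = 1 := by rw [← Real.exp_add]; simp
      nlinarith [Real.exp_pos (-(1/2) * t)]
    have m4 := Real.exp_pos (-(1/2) * t)
    have m5 : 2 * ((t + 1) * h) + 2 * D ≤ 2 * (t + 1) * (h + D) := by nlinarith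
    rw [one_mul]
    calc _ ≤ Real.exp (-1 * t) * (cc1⁻¹ * (2 * (t + 1) * (h + D))) := by gcongr; exact m1.trans (by gcongr)
      _ = cc1⁻¹ * (h + D) * 2 * Real.exp (-(1/2) * t) * ((t + 1) * Real.exp (-(1/2) * t)) := by rw [m2]; ring
      _ ≤ cc1⁻¹ * (h + D) * 2 * Real.exp (-(1/2) * t) * 2 := by gcongr
      _ = _ := by ring
  have hMz : MeasurableSet {ω | M ω < z} := measurableSet_lt hM measurable_const
  have hie : Integrable (fun ω => Real.exp (-1 * (|M ω - z| / h))) Q :=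
    Integrable.mono' (integrable_const 1) (by
      exact (Real.measurable_exp.comp (hY.const_mul (-1))).aestronglyMeasurable) (ae_of_all _ fun ω => by
      rw [Real.norm_of_nonneg (Real.exp_pos _).le, Real.exp_le_one_iff]
      have : 0 ≤ |M ω - z| / h := by positivity
      linarith)
  have hind : Q.real {ω | M ω < z} = ∫ ω, Set.indicator {ω | M ω < z} (fun _ => (1:ℝ)) ω ∂Q := by
    rw [integral_indicator hMz]; simp
  have hdiff : |Q.real {ω | M ω < z} - ∫ ω, stdNormalCDF ((z - M ω) / v ω) ∂Q| ≤ 16 * cc1⁻¹ * (h + D) := by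
    rw [hind, ← integral_sub ((integrable_const _).indicator hMz) (iu z), ← Real.norm_eq_abs]
    have : ∫ ω, 2 * Real.exp (-1 * (|M ω - z| / h)) ∂Q ≤ 16 * cc1⁻¹ * (h + D) := by
      rw [integral_const_mul]; linarith
    refine le_trans (norm_integral_le_of_norm_le (hie.const_mul 2) ?_) this
    filter_upwards [hv0, hvh] with ω w0 wh
    have hle : |M ω - z| / h ≤ |M ω - z| / v ω := by gcongr
    have hb : stdNormalCDF (-(|M ω - z| / v ω)) ≤ 2 * Real.exp (-1 * (|M ω - z| / h)) :=
      (cdf_mono (neg_le_neg hle)).trans (cdf_neg_exp _ (by positivity))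
    by_cases hω : M ω < z
    · rw [Set.indicator_of_mem (by exact hω), Real.norm_of_nonneg (by linarith [cdf_le_one ((z - M ω) / v ω)]),
        ← cdf_neg]
      rw [abs_of_neg (by linarith : M ω - z < 0)] at hb ⊢
      simpa using hb
    · rw [Set.indicator_of_notMem (by exact hω), zero_sub, norm_neg, Real.norm_of_nonneg (cdf_nonneg _)]
      rw [abs_of_nonneg (by linarith : 0 ≤ M ω - z)] at hb ⊢
      refine le_trans (le_of_eq ?_) hb
      congr 1; ring
  have := abs_sub_le (Q.real {ω | M ω < z}) (∫ ω, stdNormalCDF ((z - M ω) / v ω) ∂Q) (stdNormalCDF z)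
  linarith [hD z]

/-- Berry-Esseen bound for the abstract scheme -/
theorem BES.main (ρ : ℝ) (hρ : 0 < ρ) (hρ1 : ρ < 1) : ∃ C : ℝ, 0 < C ∧
    ∀ {Ω : Type} [mΩ : MeasurableSpace Ω] {Q : Measure Ω} [IsProbabilityMeasure Q] {n : ℕ}
    {F : ℕ → MeasurableSpace Ω} {ξ s : ℕ → Ω → ℝ} {g δ : ℝ}, 0 < g → 0 ≤ δ → δ ≤ 1 →
    BES Q n F ξ s ρ g δ → ∀ z, |Q.real {ω | MM ξ n ω < z} - stdNormalCDF z| ≤ C * (g + δ) := by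
  have hC0 : 1 ≤ chiC ρ := by have := chiK_pos ρ hρ1; unfold chiC; linarith
  have hc := cc1_pos
  refine ⟨(1 + 16 * cc1⁻¹) * (2000000 * chiC ρ), by positivity, ?_⟩
  intro Ω mΩ Q _ n F ξ s g δ hg hδ hδ1 h z
  have hA : 1 ≤ 1 + 16 * cc1⁻¹ := by have : 0 < cc1⁻¹ := by positivity
                                     linarith
  rcases le_or_gt (400 * chiC ρ * g) 1 with hK1 | hK1
  swap
  · have h1 : |Q.real {ω | MM ξ n ω < z} - stdNormalCDF z| ≤ 1 := by
      have a1 : Q.real {ω | MM ξ n ω < z} ≤ 1 := measureReal_le_one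
      have a2 : 0 ≤ Q.real {ω | MM ξ n ω < z} := measureReal_nonneg
      have := cdf_nonneg z
      have := cdf_le_one z
      rw [abs_le]; constructor <;> linarith
    have h2 : 2000000 * chiC ρ * (g + δ) ≥ 1 := by nlinarith
    nlinarith
  set τ := (400 * chiC ρ * g) ^ (1 / ρ) with hτd
  have hb : 0 < 400 * chiC ρ * g := by positivity
  have hτ : 0 < τ := by positivity
  have hK : τ ^ ρ = 400 * chiC ρ * g := by
    rw [hτd, ← Real.rpow_mul hb.le]; field_simp; simp
  have hτ1 : τ ≤ 1 := Real.rpow_le_one hb.le hK1 (by positivity)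
  have hτg : τ ≤ 400 * chiC ρ * g := by
    rw [← hK]
    conv_lhs => rw [← Real.rpow_one τ]
    exact Real.rpow_le_rpow_of_exponent_ge hτ hτ1 hρ1.le
  have hsτ : ∀ k ω, s k ω ≤ τ ^ 2 := by
    intro k ω
    have h1 := h.sg k ω
    have h2 : (τ ^ 2) ^ (ρ / 2) = τ ^ ρ := by
      rw [← Real.rpow_natCast, ← Real.rpow_mul hτ.le]; congr 1; push_cast; ring
    have h3 : (s k ω) ^ (ρ / 2) ≤ (τ ^ 2) ^ (ρ / 2) := by
      rw [h2, hK]; nlinarith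
    exact (Real.rpow_le_rpow_iff (h.s0 k ω) (by positivity) (by positivity)).1 h3
  have h4 : 1 + δ ^ 2 + τ ^ 2 ≤ 4 := by nlinarith
  set v : Ω → ℝ := fun ω => ww s δ τ n ω ^ (1/2 : ℝ) with hvd
  have hsq : ∀ ω, 0 < ww s δ τ n ω := fun ω => lt_of_lt_of_le (by positivity) (h.ww_ge τ n le_rfl ω)
  have hMm : Measurable (MM ξ n) := (h.MM_meas n).mono (h.le n) le_rfl
  have hwm : Measurable (ww s δ τ n) := (h.ww_meas' τ n).mono (h.le n) le_rfl
  have hvh : ∀ᵐ ω ∂Q, v ω ≤ τ + 2 * δ := by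
    filter_upwards [h.sT'] with ω hω
    have h5 : ww s δ τ n ω ≤ (τ + 2 * δ) ^ 2 := by unfold ww; nlinarith [mul_nonneg hτ.le hδ, sq_nonneg δ]
    calc v ω ≤ ((τ + 2 * δ) ^ 2) ^ (1/2 : ℝ) := Real.rpow_le_rpow (hsq ω).le h5 (by norm_num)
      _ = τ + 2 * δ := by
        rw [← Real.rpow_natCast, ← Real.rpow_mul (by positivity)]; norm_num
  have hD : ∀ z, |∫ ω, stdNormalCDF ((z - MM ξ n ω) / v ω) ∂Q - stdNormalCDF z| ≤
      1280400 * chiC ρ * g + δ := by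
    intro z
    have h1 := h.phi hρ hρ1 hτ z hsτ hg h4 hK
    have h2 := cdf_scale z (1 + δ ^ 2 + τ ^ 2) (by nlinarith)
    have e : ∀ ω, (z - MM ξ n ω) / v ω = (z - MM ξ n ω) * ww s δ τ n ω ^ (-(1/2) : ℝ) := by
      intro ω; rw [Real.rpow_neg (hsq ω).le, hvd, div_eq_mul_inv]
    simp only [e]
    have h3 := (abs_sub_le _ _ _).trans (add_le_add h1 h2)
    have h5 : δ ^ 2 ≤ δ := by nlinarith
    have h6 : τ ^ 2 ≤ τ := by nlinarith
    linarith
  have hfin := smoothing Q (MM ξ n) v hMm (hwm.pow_const _) (τ + 2 * δ) (1280400 * chiC ρ * g + δ)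
    (by positivity) (ae_of_all _ fun ω => Real.rpow_pos_of_pos (hsq ω) _) hvh hD z
  refine hfin.trans ?_
  set D := 1280400 * chiC ρ * g + δ
  have h7 : τ + 2 * δ + D ≤ 2000000 * chiC ρ * (g + δ) := by
    have : δ ≤ chiC ρ * δ := by nlinarith
    have : 0 < chiC ρ * g := by positivity
    simp only [D]; nlinarith
  have h8 : D ≤ τ + 2 * δ + D := by linarith
  have h9 : 0 < cc1⁻¹ := by positivity
  have h10 : 16 * cc1⁻¹ * (τ + 2 * δ + D) ≤ 16 * cc1⁻¹ * (2000000 * chiC ρ * (g + δ)) := by gcongr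
  nlinarith

open MeasureTheory Filter
open scoped Topology ENNReal

/-- the tilting factor -/
noncomputable def phi (u : ℝ) : ℝ := Real.exp (u - u ^ 2 / 2)

lemma phi_pos (u : ℝ) : 0 < phi u := Real.exp_pos _

lemma exp_half_le : Real.exp (1/2) ≤ 2 := by
  have h := Real.abs_exp_sub_one_sub_id_le (x := 1/2) (by norm_num [abs_of_pos])
  have := (abs_le.1 h).2
  nlinarith

lemma phi_le (u : ℝ) : phi u ≤ 2 := by
  refine le_trans (Real.exp_le_exp.2 ?_) exp_half_le
  nlinarith [sq_nonneg (1 - u)]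

lemma phi_quart (u : ℝ) : (1 - u / 2) ^ 4 * phi u ≤ 4 := by
  have h : phi u = Real.exp (1/2) * Real.exp (-((1 - u)^2 / 2)) := by
    unfold phi; rw [← Real.exp_add]; congr 1; ring
  set t := (1 - u)^2 / 2 with ht
  have ht0 : 0 ≤ t := by positivity
  have h1 : (1 - u / 2) ^ 2 ≤ 1/2 + t := by rw [ht]; nlinarith [sq_nonneg (1 - u - 1)]
  have h2 : (1 - u / 2) ^ 4 ≤ (1/2 + t)^2 := by
    have : (1 - u / 2) ^ 4 = ((1 - u / 2) ^ 2)^2 := by ring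
    rw [this]; exact pow_le_pow_left₀ (by positivity) h1 2
  have h3 : (1/2 + t)^2 ≤ 2 * Real.exp t := by
    nlinarith [Real.quadratic_le_exp_of_nonneg ht0]
  have h4 : Real.exp t * Real.exp (-t) = 1 := by rw [← Real.exp_add]; simp
  rw [h]
  have := exp_half_le
  calc (1 - u / 2) ^ 4 * (Real.exp (1/2) * Real.exp (-t)) 
      ≤ (2 * Real.exp t) * (2 * Real.exp (-t)) := by
        apply mul_le_mul (h2.trans h3) _ (by positivity) (by positivity)
        gcongr
    _ = 4 := by linear_combination 4 * h4

lemma phi_small {u : ℝ} (hu : |u| ≤ 1/2) : |phi u - 1 - u| ≤ 2 * |u| ^ 3 := by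
  obtain ⟨h1, h2⟩ := abs_le.1 hu
  set v := u - u ^ 2 / 2 with hv
  have hv2 : |v| ≤ 5/4 * |u| := by
    have : v = u * (1 - u/2) := by rw [hv]; ring
    rw [this, abs_mul, mul_comm]
    apply mul_le_mul_of_nonneg_right _ (abs_nonneg _)
    rw [abs_le]; constructor <;> linarith
  have hv1 : |v| ≤ 1 := by linarith
  have h := Real.exp_bound hv1 (n := 3) (by norm_num)
  simp [Finset.sum_range_succ, Nat.factorial] at h
  have h5 : |v| ^ 3 ≤ (5/4 * |u|) ^ 3 := pow_le_pow_left₀ (abs_nonneg _) hv2 3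
  have h6 : phi u - 1 - u = (Real.exp v - (1 + v + v^2/2)) + (-u^3/2 + u^4/8) := by
    unfold phi; rw [← hv]; rw [hv]; ring
  have h7 : |-u^3/2 + u^4/8| ≤ 9/16 * |u|^3 := by
    have : -u^3/2 + u^4/8 = u^3 * (-1/2 + u/8) := by ring
    rw [this, abs_mul, abs_pow, mul_comm]
    apply mul_le_mul_of_nonneg_right _ (by positivity)
    rw [abs_le]; constructor <;> linarith
  rw [h6]
  refine (abs_add_le _ _).trans ?_
  have h8 : 0 ≤ |u|^3 := by positivity
  nlinarith

lemma pow_le_rpow_abs {u q : ℝ} {k : ℕ} (hu : |u| ≤ 1) (hq : 0 < q) (hk : q ≤ k) :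
    |u| ^ k ≤ |u| ^ q := by
  rcases eq_or_lt_of_le (abs_nonneg u) with h | h
  · rw [← h]
    have : (k:ℝ) ≠ 0 := by linarith
    have : k ≠ 0 := by exact_mod_cast this
    rw [zero_pow this, Real.zero_rpow hq.ne']
  · rw [← Real.rpow_natCast]
    exact Real.rpow_le_rpow_of_exponent_ge h hu hk

lemma big_rpow {u q : ℝ} (hu : 1/2 ≤ |u|) (hq : 0 ≤ q) (hq3 : q ≤ 3) : 1 ≤ 8 * |u| ^ q := by
  have h1 : (1/2 : ℝ) ^ q ≤ |u| ^ q := Real.rpow_le_rpow (by norm_num) hu hq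
  have h2 : (1/2 : ℝ) ^ (3:ℝ) ≤ (1/2 : ℝ) ^ q :=
    Real.rpow_le_rpow_of_exponent_ge (by norm_num) (by norm_num) hq3
  norm_num at h1 h2
  linarith

lemma big_rpow' {u q : ℝ} (hu : 1/2 ≤ |u|) (hq : 1 ≤ q) (hq3 : q ≤ 3) : |u| ≤ 8 * |u| ^ q := by
  have h := big_rpow hu (by linarith : 0 ≤ q - 1) (by linarith)
  have : |u| ^ q = |u| * |u| ^ (q - 1) := by
    rw [← Real.rpow_one_add' (abs_nonneg _) (by linarith)]; congr 1; ring
  rw [this]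
  nlinarith [abs_nonneg u]

lemma phi_i {ρ : ℝ} (hρ : 0 < ρ) (hρ1 : ρ < 1) (u : ℝ) :
    |phi u - 1 - u| ≤ 40 * |u| ^ (2 + ρ) := by
  rcases le_total |u| (1/2) with h | h
  · have h1 := phi_small h
    have h2 : |u| ^ 3 ≤ |u| ^ (2 + ρ) :=
      pow_le_rpow_abs (by linarith) (by linarith) (by push_cast; linarith)
    have : 0 ≤ |u| ^ (2 + ρ) := by positivity
    linarith
  · have h1 := big_rpow h (by linarith : 0 ≤ 2 + ρ) (by linarith)
    have h2 := big_rpow' h (by linarith : 1 ≤ 2 + ρ) (by linarith)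
    have h3 := phi_le u
    have h4 := phi_pos u
    have h5 := abs_le.1 (le_refl |u|)
    rw [abs_le]; constructor <;> linarith

lemma phi_ii {ρ : ℝ} (hρ : 0 < ρ) (hρ1 : ρ < 1) (u : ℝ) :
    |(1 - u/2) * phi u - 1 - u/2| ≤ 80 * |u| ^ (1 + ρ) := by
  rcases le_total |u| (1/2) with h | h
  · have h1 := phi_small h
    have h2 : |u| ^ 2 ≤ |u| ^ (1 + ρ) :=
      pow_le_rpow_abs (by linarith) (by linarith) (by push_cast; linarith)
    have h0 : (1 - u/2) * phi u - 1 - u/2 = -u^2/2 + (1 - u/2) * (phi u - 1 - u) := by ring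
    have h3 : |1 - u/2| ≤ 5/4 := by
      obtain ⟨h1, h2⟩ := abs_le.1 h
      rw [abs_le]; constructor <;> linarith
    have h4 : |(1 - u/2) * (phi u - 1 - u)| ≤ 5/4 * (2 * |u|^3) := by
      rw [abs_mul]; exact mul_le_mul h3 h1 (abs_nonneg _) (by norm_num)
    have h5 : |-u^2/2| = |u|^2/2 := by
      rw [neg_div, abs_neg, abs_div, abs_pow]; norm_num
    have h6 : |u|^3 ≤ |u|^2 * 1 := by
      rw [pow_succ]; exact mul_le_mul_of_nonneg_left (by linarith) (by positivity)
    rw [h0]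
    refine (abs_add_le _ _).trans ?_
    nlinarith [sq_nonneg |u|]
  · have h1 := big_rpow h (by linarith : 0 ≤ 1 + ρ) (by linarith)
    have h2 := big_rpow' h (by linarith : 1 ≤ 1 + ρ) (by linarith)
    have h3 := phi_le u
    have h4 := phi_pos u
    have h6 : |(1 - u/2) * phi u| ≤ 6 := by
      rw [abs_mul, abs_of_pos h4]
      have : |1 - u/2| ≤ 1 + (1-u/2)^4 := by
        have : (1-u/2)^4 = (|1-u/2|^2)^2 := by rw [sq_abs]; ring
        rw [this]; nlinarith [sq_nonneg (|1-u/2| - 1), sq_nonneg (|1-u/2|^2 - 1), abs_nonneg (1-u/2)]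
      nlinarith [phi_quart u]
    have h5 := abs_le.1 (le_refl |u|)
    have h7 := abs_le.1 h6
    rw [abs_le]; constructor <;> linarith

lemma phi_iii {ρ : ℝ} (hρ : 0 < ρ) (hρ1 : ρ < 1) (u : ℝ) :
    |(1 - u/2)^2 * phi u - 1| ≤ 80 * |u| ^ ρ := by
  rcases le_total |u| (1/2) with h | h
  · have h1 := phi_small h
    have h2 : |u| ^ 1 ≤ |u| ^ ρ :=
      pow_le_rpow_abs (by linarith) (by linarith) (by push_cast; linarith)
    have h0 : (1 - u/2)^2 * phi u - 1 = u * (-(3/4) * u + u^2/4) + (1 - u/2)^2 * (phi u - 1 - u) := by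
      ring
    obtain ⟨h3, h4⟩ := abs_le.1 h
    have h5 : |u * (-(3/4) * u + u^2/4)| ≤ |u| * 1 := by
      rw [abs_mul]; apply mul_le_mul_of_nonneg_left _ (abs_nonneg _)
      rw [abs_le]; constructor <;> nlinarith
    have h6 : |(1 - u/2)^2 * (phi u - 1 - u)| ≤ 2 * (2 * |u|^3) := by
      rw [abs_mul]; apply mul_le_mul _ h1 (abs_nonneg _) (by norm_num)
      rw [abs_le]; constructor <;> nlinarith
    have h7 : |u|^3 ≤ |u|^1 * 1 := by
      have : |u|^3 = |u|^1 * |u|^2 := by ring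
      rw [this]; exact mul_le_mul_of_nonneg_left (by nlinarith [abs_nonneg u]) (by positivity)
    rw [h0]
    refine (abs_add_le _ _).trans ?_
    rw [pow_one] at h2 h7
    nlinarith [abs_nonneg u]
  · have h1 := big_rpow h (by linarith : 0 ≤ ρ) (by linarith)
    have h3 := phi_le u
    have h4 := phi_pos u
    have h6 : (1 - u/2)^2 * phi u ≤ 6 := by
      have : (1-u/2)^2 ≤ 1 + (1-u/2)^4 := by nlinarith [sq_nonneg ((1-u/2)^2 - 1), sq_nonneg (1-u/2)]
      nlinarith [phi_quart u]
    have h7 : 0 ≤ (1 - u/2)^2 * phi u := by positivity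
    rw [abs_le]; constructor <;> linarith

lemma phi_iv {q : ℝ} (hq : 0 ≤ q) (hq4 : q ≤ 4) (u : ℝ) : |1 - u/2| ^ q * phi u ≤ 6 := by
  have : |1 - u/2| ^ q ≤ 1 + (1-u/2)^4 := by
    rcases le_total |1-u/2| 1 with h | h
    · have := Real.rpow_le_one (abs_nonneg _) h hq
      have : 0 ≤ (1-u/2)^4 := by positivity
      linarith
    · have h1 := Real.rpow_le_rpow_of_exponent_le h hq4
      have h2 : |1-u/2| ^ (4:ℝ) = (1-u/2)^4 := by
        rw [show (4:ℝ) = ((4:ℕ):ℝ) by norm_num, Real.rpow_natCast]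
        rw [← abs_pow, abs_of_nonneg (by positivity)]
      linarith
  nlinarith [phi_quart u, phi_le u, phi_pos u]

section ver
variable {Ω : Type} {m mΩ : MeasurableSpace Ω} {P : Measure Ω} [IsProbabilityMeasure P]

/-- pull out -/
lemma ce_int (hm : m ≤ mΩ) {H f g : Ω → ℝ} (hH : Measurable[m] H) (hf : Integrable f P)
    (hHf : Integrable (fun ω => H ω * f ω) P) (hg : P[f|m] =ᵐ[P] g) :
    ∫ ω, H ω * f ω ∂P = ∫ ω, H ω * g ω ∂P := by
  have h1 : P[(fun ω => H ω * f ω)|m] =ᵐ[P] fun ω => H ω * (P[f|m]) ω :=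
    condExp_mul_of_stronglyMeasurable_left hH.stronglyMeasurable hHf hf
  rw [← integral_condExp hm, integral_congr_ae h1]
  refine integral_congr_ae ?_
  filter_upwards [hg] with ω h
  rw [h]

/-- from approximations to everywhere bounded versions -/
lemma exists_version (hm : m ≤ mΩ) {f f0 r c w : Ω → ℝ} (hf : Integrable f P)
    (hf0 : Integrable f0 P) (hr : Integrable r P) (hfr : ∀ ω, |f ω - f0 ω| ≤ r ω)
    (hc : Measurable[m] c) (hw : Measurable[m] w) (hw0 : ∀ ω, 0 ≤ w ω)
    (h0 : P[f0|m] =ᵐ[P] c) (h1 : P[r|m] ≤ᵐ[P] w) :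
    ∃ g : Ω → ℝ, Measurable[m] g ∧ (∀ ω, |g ω - c ω| ≤ w ω) ∧ P[f|m] =ᵐ[P] g := by
  refine ⟨fun ω => max (c ω - w ω) (min (c ω + w ω) ((P[f|m]) ω)), ?_, ?_, ?_⟩
  · exact (hc.sub hw).max ((hc.add hw).min stronglyMeasurable_condExp.measurable)
  · intro ω
    have := hw0 ω
    rw [abs_le]
    constructor
    · have := le_max_left (c ω - w ω) (min (c ω + w ω) ((P[f|m]) ω)); linarith
    · have : max (c ω - w ω) (min (c ω + w ω) ((P[f|m]) ω)) ≤ c ω + w ω :=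
        max_le (by linarith) (min_le_left _ _)
      linarith
  · have e1 : P[f|m] ≤ᵐ[P] P[f0 + r|m] := condExp_mono hf (hf0.add hr)
      (ae_of_all _ fun ω => by have := (abs_le.1 (hfr ω)).2; simp; linarith)
    have e2 : P[f0 - r|m] ≤ᵐ[P] P[f|m] := condExp_mono (hf0.sub hr) hf
      (ae_of_all _ fun ω => by have := (abs_le.1 (hfr ω)).1; simp; linarith)
    filter_upwards [e1, e2, h0, h1, condExp_add hf0 hr m, condExp_sub hf0 hr m]
      with ω a1 a2 a3 a4 a5 a6
    rw [a5] at a1; rw [a6] at a2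
    simp only [Pi.add_apply, Pi.sub_apply, a3] at a1 a2
    rw [min_eq_right (by linarith), max_eq_right (by linarith)]
end ver

open MeasureTheory Filter
open scoped Topology ENNReal

/-- normalised setting, indexed from zero -/
structure Core {Ω : Type} [mΩ : MeasurableSpace Ω] (P : Measure Ω) (n : ℕ)
    (F : ℕ → MeasurableSpace Ω) (X s m : ℕ → Ω → ℝ) (ρ γ e δ : ℝ) : Prop where
  hρ : 0 < ρ
  hρ1 : ρ < 1
  γ0 : 0 < γ
  γ1 : γ ≤ 1 / 4
  δ0 : 0 ≤ δ
  δ1 : δ ≤ 1 / 4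
  mono : Monotone F
  le : ∀ k, F k ≤ mΩ
  Xm : ∀ k, Measurable[F (k + 1)] (X k)
  sm : ∀ k, Measurable[F k] (s k)
  mm : ∀ k, Measurable[F k] (m k)
  s0 : ∀ k ω, 0 ≤ s k ω
  sp : ∀ k ω, (s k ω) ^ (1 + ρ / 2) ≤ m k ω
  ms : ∀ k ω, m k ω ≤ γ ^ ρ * s k ω
  sT : ∀ k ω, ∑ j ∈ Finset.range k, s j ω ≤ 1 + δ ^ 2
  mT : ∀ k ω, ∑ j ∈ Finset.range k, m j ω ≤ e
  sT' : ∀ᵐ ω ∂P, 1 - δ ^ 2 ≤ ∑ j ∈ Finset.range n, s j ω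
  i3 : ∀ k, Integrable (fun ω => |X k ω| ^ (2 + ρ)) P
  c1 : ∀ k, P[X k|F k] =ᵐ[P] 0
  c2 : ∀ k, P[fun ω => (X k ω) ^ 2|F k] =ᵐ[P] s k
  c3 : ∀ k, P[fun ω => |X k ω| ^ (2 + ρ)|F k] =ᵐ[P] m k

lemma abs_rpow_le_one_add {t q r : ℝ} (hq : 0 ≤ q) (hqr : q ≤ r) (ht : 0 ≤ t) :
    t ^ q ≤ 1 + t ^ r := by
  rcases le_total t 1 with h | h
  · have := Real.rpow_le_one ht h hq
    have : 0 ≤ t ^ r := by positivity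
    linarith
  · have := Real.rpow_le_rpow_of_exponent_le h hqr
    linarith

namespace Core
variable {Ω : Type} [mΩ : MeasurableSpace Ω] {P : Measure Ω} [IsProbabilityMeasure P] {n : ℕ}
    {F : ℕ → MeasurableSpace Ω} {X s m : ℕ → Ω → ℝ} {ρ γ e δ : ℝ}

lemma Xm' (h : Core P n F X s m ρ γ e δ) (k : ℕ) : Measurable (X k) :=
  (h.Xm k).mono (h.le _) le_rfl

lemma i1 (h : Core P n F X s m ρ γ e δ) (k : ℕ) : Integrable (X k) P := by
  refine Integrable.mono' ((integrable_const 1).add (h.i3 k)) (h.Xm' k).aestronglyMeasurable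
    (ae_of_all _ fun ω => ?_)
  have := abs_rpow_le_one_add (q := 1) (r := 2 + ρ) (by norm_num) (by linarith [h.hρ])
    (abs_nonneg (X k ω))
  simpa using this

lemma i2 (h : Core P n F X s m ρ γ e δ) (k : ℕ) : Integrable (fun ω => (X k ω)^2) P := by
  refine Integrable.mono' ((integrable_const 1).add (h.i3 k))
    ((h.Xm' k).pow_const 2).aestronglyMeasurable (ae_of_all _ fun ω => ?_)
  have := abs_rpow_le_one_add (q := 2) (r := 2 + ρ) (by norm_num) (by linarith [h.hρ])
    (abs_nonneg (X k ω))
  simpa using this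

lemma m0 (h : Core P n F X s m ρ γ e δ) (k : ℕ) (ω : Ω) : 0 ≤ m k ω :=
  le_trans (Real.rpow_nonneg (h.s0 k ω) _) (h.sp k ω)

lemma sg (h : Core P n F X s m ρ γ e δ) (k : ℕ) (ω : Ω) : (s k ω) ^ (ρ / 2) ≤ γ ^ ρ := by
  have hρ := h.hρ
  rcases eq_or_lt_of_le (h.s0 k ω) with h0 | h0
  · rw [← h0, Real.zero_rpow (by linarith)]
    exact Real.rpow_nonneg h.γ0.le _
  · have h1 := (h.sp k ω).trans (h.ms k ω)
    rw [Real.rpow_add h0, Real.rpow_one, mul_comm] at h1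
    exact le_of_mul_le_mul_right h1 h0

lemma sγ (h : Core P n F X s m ρ γ e δ) (k : ℕ) (ω : Ω) : s k ω ≤ γ ^ 2 := by
  have hρ := h.hρ
  have h1 := h.sg k ω
  have h2 := Real.rpow_le_rpow (Real.rpow_nonneg (h.s0 k ω) _) h1 (by positivity : 0 ≤ 2 / ρ)
  rw [← Real.rpow_mul (h.s0 k ω), ← Real.rpow_mul h.γ0.le] at h2
  have e1 : ρ / 2 * (2 / ρ) = 1 := by field_simp
  have e2 : ρ * (2 / ρ) = 2 := by field_simp
  rw [e1, e2] at h2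
  simpa using h2

lemma mle (h : Core P n F X s m ρ γ e δ) (k : ℕ) (ω : Ω) : m k ω ≤ γ ^ ρ * γ ^ 2 :=
  (h.ms k ω).trans (mul_le_mul_of_nonneg_left (h.sγ k ω) (Real.rpow_nonneg h.γ0.le _))

lemma bms (h : Core P n F X s m ρ γ e δ) (k : ℕ) : BM (F k) (s k) :=
  ⟨h.sm k, γ ^ 2, fun ω => by rw [abs_of_nonneg (h.s0 k ω)]; exact h.sγ k ω⟩

lemma bmm (h : Core P n F X s m ρ γ e δ) (k : ℕ) : BM (F k) (m k) :=
  ⟨h.mm k, _, fun ω => by rw [abs_of_nonneg (h.m0 k ω)]; exact h.mle k ω⟩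

lemma e0 (h : Core P n F X s m ρ γ e δ) : 0 ≤ e := by
  have : Nonempty Ω := by
    by_contra hne
    rw [not_nonempty_iff] at hne
    have : P Set.univ = 0 := by rw [Set.univ_eq_empty_iff.2 hne]; simp
    simp at this
  obtain ⟨ω⟩ := this
  simpa using h.mT 0 ω

end Core

/-- versions of the tilted moments -/
structure TiltV {Ω : Type} [mΩ : MeasurableSpace Ω] (P : Measure Ω)
    (F : ℕ → MeasurableSpace Ω) (X s m : ℕ → Ω → ℝ) (ρ l : ℝ) (mu bb v d : ℕ → Ω → ℝ) : Prop where
  mum : ∀ k, Measurable[F k] (mu k)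
  bm : ∀ k, Measurable[F k] (bb k)
  vm : ∀ k, Measurable[F k] (v k)
  dm : ∀ k, Measurable[F k] (d k)
  mub : ∀ k ω, |mu k ω - 1| ≤ 40 * l ^ (2 + ρ) * m k ω
  bb' : ∀ k ω, |bb k ω - l / 2 * s k ω| ≤ 80 * l ^ (1 + ρ) * m k ω
  vb : ∀ k ω, |v k ω - s k ω| ≤ 80 * l ^ ρ * m k ω
  db : ∀ k ω, |d k ω| ≤ 6 * m k ω
  muc : ∀ k, P[fun ω => phi (l * X k ω)|F k] =ᵐ[P] mu k
  bc : ∀ k, P[fun ω => (X k ω - l / 2 * (X k ω)^2) * phi (l * X k ω)|F k] =ᵐ[P] bb k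
  vc : ∀ k, P[fun ω => (X k ω - l / 2 * (X k ω)^2)^2 * phi (l * X k ω)|F k] =ᵐ[P] v k
  dc : ∀ k, P[fun ω => |X k ω - l / 2 * (X k ω)^2|^(2 + ρ) * phi (l * X k ω)|F k] =ᵐ[P] d k
  ib : ∀ k, Integrable (fun ω => (X k ω - l / 2 * (X k ω)^2) * phi (l * X k ω)) P
  iv : ∀ k, Integrable (fun ω => (X k ω - l / 2 * (X k ω)^2)^2 * phi (l * X k ω)) P
  id : ∀ k, Integrable (fun ω => |X k ω - l / 2 * (X k ω)^2|^(2 + ρ) * phi (l * X k ω)) P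

lemma phi_meas : Measurable phi := by unfold phi; fun_prop

lemma condExp_const_mul_ae {Ω : Type} {m mΩ : MeasurableSpace Ω} {P : Measure Ω}
    {f g : Ω → ℝ} (c : ℝ) (h : P[f|m] =ᵐ[P] g) :
    P[fun ω => c * f ω|m] =ᵐ[P] fun ω => c * g ω := by
  have := condExp_smul (μ := P) c f m
  have h2 : (fun ω => c * f ω) = c • f := by ext; simp
  rw [h2]
  filter_upwards [this, h] with ω a b
  rw [a]; simp [b]

lemma condExp_add_ae {Ω : Type} {m mΩ : MeasurableSpace Ω} {P : Measure Ω}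
    {f g f' g' : Ω → ℝ} (hf : Integrable f P) (hg : Integrable g P)
    (h : P[f|m] =ᵐ[P] f') (h' : P[g|m] =ᵐ[P] g') :
    P[fun ω => f ω + g ω|m] =ᵐ[P] fun ω => f' ω + g' ω := by
  have h2 : (fun ω => f ω + g ω) = f + g := by ext; simp
  rw [h2]
  filter_upwards [condExp_add hf hg m, h, h'] with ω a b c
  rw [a]; simp [b, c]

lemma condExp_const_ae {Ω : Type} {m mΩ : MeasurableSpace Ω} {P : Measure Ω} [IsProbabilityMeasure P]
    (hm : m ≤ mΩ) (c : ℝ) : P[fun _ : Ω => c|m] =ᵐ[P] fun _ => c := by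
  rw [condExp_const hm]

lemma abs_mul_sq_rpow {x l r : ℝ} (hl : 0 ≤ l) (k : ℕ) (hr : 0 ≤ r) (hk : (k:ℝ) + r ≠ 0) :
    |x| ^ k * |l * x| ^ r = l ^ r * |x| ^ ((k:ℝ) + r) := by
  rw [abs_mul, abs_of_nonneg hl, Real.mul_rpow hl (abs_nonneg _), Real.rpow_add' (abs_nonneg _) hk,
    Real.rpow_natCast]
  ring

namespace Core
variable {Ω : Type} [mΩ : MeasurableSpace Ω] {P : Measure Ω} [IsProbabilityMeasure P] {n : ℕ}
    {F : ℕ → MeasurableSpace Ω} {X s m : ℕ → Ω → ℝ} {ρ γ e δ : ℝ}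

lemma exists_tilt (h : Core P n F X s m ρ γ e δ) {l : ℝ} (hl : 0 ≤ l) :
    ∃ mu bb v d, TiltV P F X s m ρ l mu bb v d := by
  have hρ := h.hρ
  have hρ1 := h.hρ1
  have hA : ∀ k ω, X k ω - l / 2 * (X k ω)^2 = X k ω * (1 - l * X k ω / 2) := fun k ω => by ring
  have ib1 : ∀ k, Integrable (fun ω => phi (l * X k ω)) P := fun k =>
    Integrable.mono' (integrable_const 2)
      (phi_meas.comp ((h.Xm' k).const_mul l)).aestronglyMeasurable
      (ae_of_all _ fun ω => by
        rw [Real.norm_eq_abs, abs_of_pos (phi_pos _)]; exact phi_le _)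
  have ib : ∀ k, Integrable (fun ω => (X k ω - l / 2 * (X k ω)^2) * phi (l * X k ω)) P := fun k =>
    Integrable.mono' ((h.i1 k).abs.const_mul 6)
      (by have := h.Xm' k; have := phi_meas; fun_prop)
      (ae_of_all _ fun ω => by
        rw [Real.norm_eq_abs, abs_mul, abs_of_pos (phi_pos _), hA, abs_mul]
        have := phi_iv (q := 1) (by norm_num) (by norm_num) (l * X k ω)
        rw [Real.rpow_one] at this
        nlinarith [abs_nonneg (X k ω)])
  have iv : ∀ k, Integrable (fun ω => (X k ω - l / 2 * (X k ω)^2)^2 * phi (l * X k ω)) P := fun k =>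
    Integrable.mono' ((h.i2 k).const_mul 6)
      (by have := h.Xm' k; have := phi_meas; fun_prop)
      (ae_of_all _ fun ω => by
        rw [Real.norm_eq_abs, abs_mul, abs_of_pos (phi_pos _), hA, abs_of_nonneg (by positivity), mul_pow]
        have := phi_iv (q := 2) (by norm_num) (by norm_num) (l * X k ω)
        rw [Real.rpow_two, sq_abs] at this
        nlinarith [sq_nonneg (X k ω)])
  have db0 : ∀ k ω, |X k ω - l / 2 * (X k ω)^2|^(2 + ρ) * phi (l * X k ω) ≤ 6 * |X k ω|^(2+ρ) := by
    intro k ω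
    rw [hA, abs_mul, Real.mul_rpow (abs_nonneg _) (abs_nonneg _)]
    have := phi_iv (q := 2 + ρ) (by linarith) (by linarith) (l * X k ω)
    have : 0 ≤ |X k ω|^(2+ρ) := by positivity
    nlinarith
  have id : ∀ k, Integrable (fun ω => |X k ω - l / 2 * (X k ω)^2|^(2 + ρ) * phi (l * X k ω)) P :=
    fun k => Integrable.mono' ((h.i3 k).const_mul 6)
      (by have := h.Xm' k; have := phi_meas; fun_prop)
      (ae_of_all _ fun ω => by
        rw [Real.norm_eq_abs, abs_of_nonneg (mul_nonneg (by positivity) (phi_pos _).le)]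
        exact db0 k ω)
  have z1 : ∀ k, P[fun ω => 1 + l * X k ω|F k] =ᵐ[P] fun _ => 1 := fun k => by
    have := condExp_add_ae (integrable_const 1) ((h.i1 k).const_mul l)
      (condExp_const_ae (P := P) (h.le k) 1) (condExp_const_mul_ae l (h.c1 k))
    simpa using this
  have z2 : ∀ k, P[fun ω => X k ω + l / 2 * (X k ω)^2|F k] =ᵐ[P] fun ω => l / 2 * s k ω := fun k => by
    have := condExp_add_ae (h.i1 k) ((h.i2 k).const_mul (l/2))
      (h.c1 k) (condExp_const_mul_ae (l/2) (h.c2 k))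
    simpa using this
  have w : ∀ (c : ℝ) k, P[fun ω => c * |X k ω| ^ (2 + ρ)|F k] =ᵐ[P] fun ω => c * m k ω :=
    fun c k => condExp_const_mul_ae c (h.c3 k)
  have H1 := fun k => exists_version (P := P) (h.le k) (ib1 k)
    ((integrable_const 1).add ((h.i1 k).const_mul l)) ((h.i3 k).const_mul (40 * l ^ (2 + ρ)))
    (fun ω => by
      have := phi_i hρ hρ1 (l * X k ω)
      have e := abs_mul_sq_rpow (x := X k ω) hl 0 (r := 2 + ρ) (by linarith) (by push_cast; linarith)
      simp only [pow_zero, one_mul, Nat.cast_zero, zero_add] at e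
      rw [e] at this
      simp only [Pi.add_apply]
      calc _ = |phi (l * X k ω) - 1 - l * X k ω| := by ring_nf
        _ ≤ _ := by linarith) (measurable_const) ((h.mm k).const_mul (40 * l ^ (2 + ρ)))
      (fun ω => by have := h.m0 k ω; positivity) (z1 k) (w _ k).le
  have H2 := fun k => exists_version (P := P) (h.le k) (ib k)
    ((h.i1 k).add ((h.i2 k).const_mul (l/2))) ((h.i3 k).const_mul (80 * l ^ (1 + ρ)))
    (fun ω => by
      have := phi_ii hρ hρ1 (l * X k ω)
      have e := abs_mul_sq_rpow (x := X k ω) hl 1 (r := 1 + ρ) (by linarith) (by push_cast; linarith)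
      rw [pow_one, show ((1:ℕ):ℝ) + (1 + ρ) = 2 + ρ by push_cast; ring] at e
      simp only [Pi.add_apply]
      calc _ = |X k ω * ((1 - l * X k ω/2) * phi (l * X k ω) - 1 - l * X k ω/2)| := by
            rw [hA]; congr 1; ring
        _ = |X k ω| * |(1 - l * X k ω/2) * phi (l * X k ω) - 1 - l * X k ω/2| := abs_mul _ _
        _ ≤ |X k ω| * (80 * |l * X k ω| ^ (1 + ρ)) := by gcongr
        _ = _ := by linear_combination 80 * e) ((h.sm k).const_mul (l/2))
      ((h.mm k).const_mul (80 * l ^ (1 + ρ)))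
      (fun ω => by have := h.m0 k ω; positivity) (z2 k) (w _ k).le
  have H3 := fun k => exists_version (P := P) (h.le k) (iv k)
    (h.i2 k) ((h.i3 k).const_mul (80 * l ^ ρ))
    (fun ω => by
      have := phi_iii hρ hρ1 (l * X k ω)
      have e := abs_mul_sq_rpow (x := X k ω) hl 2 (r := ρ) (by linarith) (by push_cast; linarith)
      rw [show ((2:ℕ):ℝ) + ρ = 2 + ρ by push_cast; ring] at e
      calc _ = |(X k ω)^2 * ((1 - l * X k ω/2)^2 * phi (l * X k ω) - 1)| := by
            rw [hA]; congr 1; ring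
        _ = |X k ω|^2 * |(1 - l * X k ω/2)^2 * phi (l * X k ω) - 1| := by rw [abs_mul, abs_pow]
        _ ≤ |X k ω|^2 * (80 * |l * X k ω| ^ ρ) := by gcongr
        _ = _ := by linear_combination 80 * e) (h.sm k)
      ((h.mm k).const_mul (80 * l ^ ρ))
      (fun ω => by have := h.m0 k ω; positivity) (h.c2 k) (w _ k).le
  have H4 := fun k => exists_version (P := P) (h.le k) (id k)
    (integrable_const 0) ((h.i3 k).const_mul 6)
    (fun ω => by
      rw [sub_zero, abs_of_nonneg (mul_nonneg (by positivity) (phi_pos _).le)]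
      exact db0 k ω) (measurable_const)
      ((h.mm k).const_mul 6)
      (fun ω => by have := h.m0 k ω; positivity) (condExp_const_ae (h.le k) 0) (w _ k).le
  choose mu a1 a2 a3 using H1
  choose bb b1 b2 b3 using H2
  choose v v1 v2 v3 using H3
  choose d d1 d2 d3 using H4
  exact ⟨mu, bb, v, d, a1, b1, v1, d1, a2, b2, v2, fun k ω => by simpa using d2 k ω,
    a3, b3, v3, d3, ib, iv, id⟩
end Core

open MeasureTheory Filter
open scoped Topology ENNReal

noncomputable def ZZ {Ω : Type} (X mu : ℕ → Ω → ℝ) (l : ℝ) (k : ℕ) (ω : Ω) : ℝ :=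
  ∏ j ∈ Finset.range k, (phi (l * X j ω) / mu j ω)

noncomputable def QQ {Ω : Type} [MeasurableSpace Ω] (P : Measure Ω) (X mu : ℕ → Ω → ℝ) (l : ℝ)
    (n : ℕ) : Measure Ω := P.withDensity (fun ω => ENNReal.ofReal (ZZ X mu l n ω))

namespace Core
variable {Ω : Type} [mΩ : MeasurableSpace Ω] {P : Measure Ω} [IsProbabilityMeasure P] {n : ℕ}
    {F : ℕ → MeasurableSpace Ω} {X s m : ℕ → Ω → ℝ} {ρ γ e δ l : ℝ} {mu bb v d : ℕ → Ω → ℝ}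

lemma l2s (h : Core P n F X s m ρ γ e δ) (hl : 0 ≤ l) (hlγ : l * γ ≤ 1/10) (k : ℕ) (ω : Ω) :
    l ^ 2 * s k ω ≤ 1/100 := by
  have h1 := h.sγ k ω
  have h2 : 0 ≤ l * γ := mul_nonneg hl h.γ0.le
  calc l ^ 2 * s k ω ≤ l ^ 2 * γ ^ 2 := by gcongr
    _ = (l * γ) ^ 2 := by ring
    _ ≤ (1/10)^2 := by gcongr
    _ = _ := by norm_num

lemma lgρ (h : Core P n F X s m ρ γ e δ) (hl : 0 ≤ l) (hlγ : l * γ ≤ 1/10) :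
    l ^ ρ * γ ^ ρ ≤ 1 := by
  rw [← Real.mul_rpow hl h.γ0.le]
  exact Real.rpow_le_one (mul_nonneg hl h.γ0.le) (by linarith) h.hρ.le

lemma lρm (h : Core P n F X s m ρ γ e δ) (hl : 0 ≤ l) (k : ℕ) (ω : Ω) :
    l ^ ρ * m k ω ≤ l ^ ρ * γ ^ ρ * s k ω := by
  have := h.ms k ω
  rw [mul_assoc]
  gcongr

lemma l2ρm (h : Core P n F X s m ρ γ e δ) (hl : 0 ≤ l) (hlγ : l * γ ≤ 1/10) (k : ℕ) (ω : Ω) :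
    l ^ (2 + ρ) * m k ω ≤ 1/100 := by
  have h1 := h.lρm hl k ω
  have h2 := h.lgρ hl hlγ
  have h3 := h.l2s hl hlγ k ω
  have h4 := h.s0 k ω
  rw [Real.rpow_add' hl (by linarith [h.hρ]), Real.rpow_two]
  calc l ^ 2 * l ^ ρ * m k ω = l ^ 2 * (l ^ ρ * m k ω) := by ring
    _ ≤ l ^ 2 * (1 * s k ω) := by
        exact mul_le_mul_of_nonneg_left (h1.trans (mul_le_mul_of_nonneg_right h2 h4)) (by positivity)
    _ ≤ _ := by linarith

variable (hT : TiltV P F X s m ρ l mu bb v d)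

lemma mu_half (h : Core P n F X s m ρ γ e δ) (hT : TiltV P F X s m ρ l mu bb v d)
    (hl : 0 ≤ l) (hlγ : l * γ ≤ 1/10) (k : ℕ) (ω : Ω) :
    1/2 ≤ mu k ω ∧ mu k ω ≤ 3/2 := by
  have h1 := h.l2ρm hl hlγ k ω
  have h2 := abs_le.1 (hT.mub k ω)
  constructor <;> linarith

lemma b_close (h : Core P n F X s m ρ γ e δ) (hT : TiltV P F X s m ρ l mu bb v d)
    (hl : 0 ≤ l) (hlγ : l * γ ≤ 1/10) (k : ℕ) (ω : Ω) :
    |bb k ω / mu k ω - l / 2 * s k ω| ≤ 162 * l ^ (1 + ρ) * m k ω := by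
  obtain ⟨hm1, hm2⟩ := h.mu_half hT hl hlγ k ω
  have hm0 : 0 < mu k ω := by linarith
  have e1 : bb k ω / mu k ω - l / 2 * s k ω
      = ((bb k ω - l / 2 * s k ω) + l / 2 * s k ω * (1 - mu k ω)) / mu k ω := by
    field_simp; ring
  rw [e1, abs_div, abs_of_pos hm0, div_le_iff₀ hm0]
  have h1 := hT.bb' k ω
  have h2 := hT.mub k ω
  have hs := h.s0 k ω
  have hm := h.m0 k ω
  have h3 : |l / 2 * s k ω * (1 - mu k ω)| ≤ l ^ (1 + ρ) * m k ω := by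
    rw [abs_mul, abs_of_nonneg (by positivity : 0 ≤ l / 2 * s k ω), abs_sub_comm]
    have h4 := h.l2s hl hlγ k ω
    have e2 : l ^ (2 + ρ) = l * l ^ (1 + ρ) := by
      rw [← Real.rpow_one_add' hl (by linarith [h.hρ])]; congr 1; ring
    have h5 : 0 ≤ l ^ (1 + ρ) * m k ω := by positivity
    calc l / 2 * s k ω * |mu k ω - 1| ≤ l / 2 * s k ω * (40 * l ^ (2 + ρ) * m k ω) := by gcongr
      _ = 20 * (l ^ 2 * s k ω) * (l ^ (1 + ρ) * m k ω) := by rw [e2]; ring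
      _ ≤ 1 * (l ^ (1 + ρ) * m k ω) := by
          apply mul_le_mul_of_nonneg_right _ h5; linarith
      _ = _ := one_mul _
  have h5 : 0 ≤ l ^ (1 + ρ) * m k ω := by positivity
  calc _ ≤ _ := abs_add_le _ _
    _ ≤ 81 * (l ^ (1 + ρ) * m k ω) := by linarith
    _ ≤ _ := by nlinarith

lemma b_abs (h : Core P n F X s m ρ γ e δ) (hT : TiltV P F X s m ρ l mu bb v d)
    (hl : 0 ≤ l) (hlγ : l * γ ≤ 1/10) (k : ℕ) (ω : Ω) :
    |bb k ω / mu k ω| ≤ 163 * (l * s k ω) := by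
  have h1 := h.b_close hT hl hlγ k ω
  have hs := h.s0 k ω
  have h2 := (h.lρm hl k ω).trans (mul_le_mul_of_nonneg_right (h.lgρ hl hlγ) hs)
  have e2 : l ^ (1 + ρ) = l * l ^ ρ := Real.rpow_one_add' hl (by linarith [h.hρ])
  have h3 : l ^ (1 + ρ) * m k ω ≤ l * s k ω := by
    rw [e2, mul_assoc]; exact mul_le_mul_of_nonneg_left (by linarith) hl
  have h4 := abs_sub_abs_le_abs_sub (bb k ω / mu k ω) (l / 2 * s k ω)
  rw [abs_of_nonneg (by positivity : 0 ≤ l / 2 * s k ω)] at h4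
  have h5 : 0 ≤ l * s k ω := by positivity
  linarith

lemma v_close (h : Core P n F X s m ρ γ e δ) (hT : TiltV P F X s m ρ l mu bb v d)
    (hl : 0 ≤ l) (hlγ : l * γ ≤ 1/10) (k : ℕ) (ω : Ω) :
    |v k ω / mu k ω - (bb k ω / mu k ω)^2 - s k ω| ≤ 30000 * (l ^ ρ * γ ^ ρ) * s k ω := by
  obtain ⟨hm1, hm2⟩ := h.mu_half hT hl hlγ k ω
  have hm0 : 0 < mu k ω := by linarith
  have hs := h.s0 k ω
  have hm := h.m0 k ω
  have h0 : 0 ≤ l ^ ρ * m k ω := by positivity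
  have h1 : |v k ω / mu k ω - s k ω| ≤ 162 * (l ^ ρ * m k ω) := by
    have e1 : v k ω / mu k ω - s k ω
      = ((v k ω - s k ω) + s k ω * (1 - mu k ω)) / mu k ω := by
      field_simp; ring
    rw [e1, abs_div, abs_of_pos hm0, div_le_iff₀ hm0]
    have h1 := hT.vb k ω
    have h2 := hT.mub k ω
    have h3 : |s k ω * (1 - mu k ω)| ≤ l ^ ρ * m k ω := by
      rw [abs_mul, abs_of_nonneg hs, abs_sub_comm]
      have h4 := h.l2s hl hlγ k ω
      have e2 : l ^ (2 + ρ) = l ^ 2 * l ^ ρ := by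
        rw [Real.rpow_add' hl (by linarith [h.hρ]), Real.rpow_two]
      calc s k ω * |mu k ω - 1| ≤ s k ω * (40 * l ^ (2 + ρ) * m k ω) := by gcongr
        _ = 40 * (l ^ 2 * s k ω) * (l ^ ρ * m k ω) := by rw [e2]; ring
        _ ≤ 1 * (l ^ ρ * m k ω) := by
            apply mul_le_mul_of_nonneg_right _ h0; linarith
        _ = _ := one_mul _
    calc _ ≤ _ := abs_add_le _ _
      _ ≤ 81 * (l ^ ρ * m k ω) := by linarith
      _ ≤ _ := by nlinarith
  have h2 : (bb k ω / mu k ω)^2 ≤ 26569 * (l ^ ρ * γ ^ ρ) * s k ω := by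
    have h3 := h.b_abs hT hl hlγ k ω
    have h4 : (l * γ)^2 ≤ l ^ ρ * γ ^ ρ := by
      rw [← Real.mul_rpow hl h.γ0.le]
      have : |l * γ| ^ 2 ≤ |l * γ| ^ ρ := pow_le_rpow_abs
        (by rw [abs_of_nonneg (mul_nonneg hl h.γ0.le)]; linarith) h.hρ
        (by push_cast; linarith [h.hρ1])
      rwa [abs_of_nonneg (mul_nonneg hl h.γ0.le)] at this
    rw [← sq_abs]
    calc |bb k ω / mu k ω|^2 ≤ (163 * (l * s k ω))^2 := by gcongr
      _ = 26569 * (l^2 * s k ω) * s k ω := by ring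
      _ ≤ 26569 * (l^2 * γ^2) * s k ω := by
          have := h.sγ k ω
          gcongr
      _ = 26569 * (l * γ)^2 * s k ω := by ring
      _ ≤ _ := by gcongr
  have h3 := h.lρm hl k ω
  have h4 : 0 ≤ l ^ ρ * γ ^ ρ * s k ω := h0.trans h3
  have h5 : 0 ≤ (bb k ω / mu k ω)^2 := sq_nonneg _
  have h6 := abs_le.1 h1
  rw [abs_le]; constructor <;> nlinarith

lemma d_close (h : Core P n F X s m ρ γ e δ) (hT : TiltV P F X s m ρ l mu bb v d)
    (hl : 0 ≤ l) (hlγ : l * γ ≤ 1/10) (k : ℕ) (ω : Ω) :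
    8 * (d k ω / mu k ω + |bb k ω / mu k ω|^(2 + ρ)) ≤ 10^8 * γ ^ ρ * s k ω := by
  obtain ⟨hm1, hm2⟩ := h.mu_half hT hl hlγ k ω
  have hm0 : 0 < mu k ω := by linarith
  have hs := h.s0 k ω
  have hm := h.m0 k ω
  have hρ := h.hρ
  have hρ1 := h.hρ1
  have hγ := h.γ0
  have h1 : d k ω / mu k ω ≤ 12 * γ ^ ρ * s k ω := by
    rw [div_le_iff₀ hm0]
    have := (abs_le.1 (hT.db k ω)).2
    have h2 := h.ms k ω
    have : 0 ≤ γ ^ ρ * s k ω := by positivity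
    nlinarith
  have h2 : |bb k ω / mu k ω|^(2 + ρ) ≤ 163^3 * γ ^ ρ * s k ω := by
    have h3 := h.b_abs hT hl hlγ k ω
    have h4 := Real.rpow_le_rpow (abs_nonneg _) h3 (by linarith : 0 ≤ 2 + ρ)
    rw [Real.mul_rpow (by norm_num) (by positivity)] at h4
    have h5 : (163:ℝ) ^ (2 + ρ) ≤ 163 ^ 3 := by
      rw [← Real.rpow_natCast]
      exact Real.rpow_le_rpow_of_exponent_le (by norm_num) (by push_cast; linarith)
    have h6 : (l * s k ω) ^ (2 + ρ) ≤ γ ^ ρ * s k ω := by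
      have e1 : l * s k ω = (l ^ 2 * s k ω) ^ (1/2:ℝ) * (s k ω) ^ (1/2:ℝ) := by
        rw [← Real.sqrt_eq_rpow, ← Real.sqrt_eq_rpow, Real.sqrt_mul (by positivity), Real.sqrt_sq hl,
          mul_assoc, Real.mul_self_sqrt hs]
      rw [e1, Real.mul_rpow (by positivity) (by positivity), ← Real.rpow_mul hs]
      have e2 : (1/2:ℝ) * (2 + ρ) = 1 + ρ / 2 := by ring
      rw [e2, Real.rpow_add' hs (by linarith), Real.rpow_one]
      have h7 : ((l ^ 2 * s k ω) ^ (1/2:ℝ)) ^ (2 + ρ) ≤ 1 := by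
        refine Real.rpow_le_one (by positivity) (Real.rpow_le_one (by positivity) ?_ (by norm_num)) (by linarith)
        linarith [h.l2s hl hlγ k ω]
      have h8 := h.sg k ω
      have h9 : s k ω * s k ω ^ (ρ/2) ≤ γ ^ ρ * s k ω := by
        rw [mul_comm]; gcongr
      have : 0 ≤ s k ω * s k ω ^ (ρ/2) := by positivity
      nlinarith
    calc _ ≤ _ := h4
      _ ≤ 163^3 * (γ ^ ρ * s k ω) := by gcongr
      _ = _ := by ring
  have : 0 ≤ γ ^ ρ * s k ω := by positivity
  nlinarith

lemma ZZ_meas (h : Core P n F X s m ρ γ e δ) (hT : TiltV P F X s m ρ l mu bb v d) (k : ℕ) :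
    Measurable[F k] (ZZ X mu l k) := by
  unfold ZZ
  refine Finset.measurable_prod _ fun j hj => ?_
  have hj' : j < k := by simpa using hj
  exact (phi_meas.comp (((h.Xm j).mono (h.mono hj') le_rfl).const_mul l)).div
    ((hT.mum j).mono (h.mono hj'.le) le_rfl)

lemma ZZ_pos (h : Core P n F X s m ρ γ e δ) (hT : TiltV P F X s m ρ l mu bb v d)
    (hl : 0 ≤ l) (hlγ : l * γ ≤ 1/10) (k : ℕ) (ω : Ω) : 0 < ZZ X mu l k ω :=
  Finset.prod_pos fun j _ => div_pos (phi_pos _) (by linarith [(h.mu_half hT hl hlγ j ω).1])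

lemma fac_le (h : Core P n F X s m ρ γ e δ) (hT : TiltV P F X s m ρ l mu bb v d)
    (hl : 0 ≤ l) (hlγ : l * γ ≤ 1/10) (k : ℕ) (ω : Ω) : phi (l * X k ω) / mu k ω ≤ 4 := by
  have := (h.mu_half hT hl hlγ k ω).1
  rw [div_le_iff₀ (by linarith)]
  linarith [phi_le (l * X k ω)]

lemma ZZ_bm (h : Core P n F X s m ρ γ e δ) (hT : TiltV P F X s m ρ l mu bb v d)
    (hl : 0 ≤ l) (hlγ : l * γ ≤ 1/10) (k : ℕ) : BM (F k) (ZZ X mu l k) := by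
  refine ⟨h.ZZ_meas hT k, 4 ^ k, fun ω => ?_⟩
  rw [abs_of_pos (h.ZZ_pos hT hl hlγ k ω)]
  unfold ZZ
  calc _ ≤ ∏ j ∈ Finset.range k, (4:ℝ) := Finset.prod_le_prod
        (fun j _ => (div_pos (phi_pos _) (by linarith [(h.mu_half hT hl hlγ j ω).1])).le)
        (fun j _ => h.fac_le hT hl hlγ j ω)
    _ = _ := by simp

lemma inv_mu_bm (h : Core P n F X s m ρ γ e δ) (hT : TiltV P F X s m ρ l mu bb v d)
    (hl : 0 ≤ l) (hlγ : l * γ ≤ 1/10) (k : ℕ) : BM (F k) (fun ω => (mu k ω)⁻¹) := by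
  refine ⟨(hT.mum k).inv, 2, fun ω => ?_⟩
  have := (h.mu_half hT hl hlγ k ω).1
  rw [abs_of_pos (by positivity)]
  rw [inv_le_comm₀ (by linarith) (by norm_num)]; linarith

lemma ib1 (h : Core P n F X s m ρ γ e δ) (k : ℕ) : Integrable (fun ω => phi (l * X k ω)) P :=
    Integrable.mono' (integrable_const 2)
      (phi_meas.comp ((h.Xm' k).const_mul l)).aestronglyMeasurable
      (ae_of_all _ fun ω => by
        rw [Real.norm_eq_abs, abs_of_pos (phi_pos _)]; exact phi_le _)

lemma ZZ_step (h : Core P n F X s m ρ γ e δ) (hT : TiltV P F X s m ρ l mu bb v d)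
    (hl : 0 ≤ l) (hlγ : l * γ ≤ 1/10) {k : ℕ} {H : Ω → ℝ} (hH : Measurable[F k] H)
    (hi : Integrable (fun ω => H ω * ZZ X mu l k ω) P) (j : ℕ) :
    Integrable (fun ω => H ω * ZZ X mu l (k + j) ω) P ∧
    ∫ ω, H ω * ZZ X mu l (k + j) ω ∂P = ∫ ω, H ω * ZZ X mu l k ω ∂P := by
  induction j with
  | zero => exact ⟨hi, rfl⟩
  | succ j ih =>
    obtain ⟨ih1, ih2⟩ := ih
    have e1 : ∀ ω, H ω * ZZ X mu l (k + (j + 1)) ω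
        = (H ω * ZZ X mu l (k + j) ω * (mu (k + j) ω)⁻¹) * phi (l * X (k + j) ω) := by
      intro ω
      rw [← add_assoc]; unfold ZZ; rw [Finset.prod_range_succ]; ring
    have hb := h.inv_mu_bm hT hl hlγ (k + j)
    have i0 : Integrable (fun ω => H ω * ZZ X mu l (k + j) ω * (mu (k + j) ω)⁻¹) P := by
      have := hb.integrable_mul (h.le _) ih1
      refine this.congr (ae_of_all _ fun ω => by simp; ring)
    have i1 : Integrable (fun ω => H ω * ZZ X mu l (k + (j + 1)) ω) P := by
      simp_rw [e1]
      have hb2 : BM mΩ (fun ω => phi (l * X (k + j) ω)) :=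
        ⟨phi_meas.comp ((h.Xm' _).const_mul l), 2, fun ω => by
          rw [abs_of_pos (phi_pos _)]; exact phi_le _⟩
      have := hb2.integrable_mul le_rfl i0
      refine this.congr (ae_of_all _ fun ω => by simp; ring)
    refine ⟨i1, ?_⟩
    rw [← ih2]
    simp_rw [e1] at i1 ⊢
    rw [ce_int (h.le (k + j)) (H := fun ω => H ω * ZZ X mu l (k + j) ω * (mu (k + j) ω)⁻¹) ?_
      (h.ib1 (k + j)) i1 (hT.muc (k + j))]
    · refine integral_congr_ae (ae_of_all _ fun ω => ?_)
      have := (h.mu_half hT hl hlγ (k + j) ω).1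
      have : mu (k + j) ω ≠ 0 := by linarith
      simp; field_simp
    · exact ((hH.mono (h.mono (by omega)) le_rfl).mul (h.ZZ_meas hT _)).mul (hT.mum _).inv

lemma QQ_integral (h : Core P n F X s m ρ γ e δ) (hT : TiltV P F X s m ρ l mu bb v d)
    (hl : 0 ≤ l) (hlγ : l * γ ≤ 1/10) (f : Ω → ℝ) :
    ∫ ω, f ω ∂(QQ P X mu l n) = ∫ ω, f ω * ZZ X mu l n ω ∂P := by
  unfold QQ
  rw [integral_withDensity_eq_integral_toReal_smul
    ((h.ZZ_meas hT n).mono (h.le n) le_rfl).ennreal_ofReal (ae_of_all _ fun ω => by simp)]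
  refine integral_congr_ae (ae_of_all _ fun ω => ?_)
  simp only [smul_eq_mul]
  rw [ENNReal.toReal_ofReal (h.ZZ_pos hT hl hlγ n ω).le, mul_comm]

lemma QQ_integrable (h : Core P n F X s m ρ γ e δ) (hT : TiltV P F X s m ρ l mu bb v d)
    (hl : 0 ≤ l) (hlγ : l * γ ≤ 1/10) (f : Ω → ℝ) :
    Integrable f (QQ P X mu l n) ↔ Integrable (fun ω => f ω * ZZ X mu l n ω) P := by
  unfold QQ
  rw [integrable_withDensity_iff
    ((h.ZZ_meas hT n).mono (h.le n) le_rfl).ennreal_ofReal (ae_of_all _ fun ω => by simp)]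
  refine integrable_congr (ae_of_all _ fun ω => ?_)
  simp only
  rw [ENNReal.toReal_ofReal (h.ZZ_pos hT hl hlγ n ω).le]

lemma QQ_prob (h : Core P n F X s m ρ γ e δ) (hT : TiltV P F X s m ρ l mu bb v d)
    (hl : 0 ≤ l) (hlγ : l * γ ≤ 1/10) : IsProbabilityMeasure (QQ P X mu l n) := by
  have h1 := (h.ZZ_step hT hl hlγ (k := 0) (H := fun _ => 1) measurable_const
    (by simp [ZZ]) n).2
  have h2 := (h.ZZ_bm hT hl hlγ n).integrable (Q := P) (h.le n)
  constructor
  unfold QQ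
  rw [withDensity_apply _ MeasurableSet.univ, Measure.restrict_univ,
    ← ofReal_integral_eq_lintegral_ofReal h2 (ae_of_all _ fun ω => (h.ZZ_pos hT hl hlγ n ω).le)]
  simp [ZZ] at h1
  simp [ZZ, h1]

lemma qmom (h : Core P n F X s m ρ γ e δ) (hT : TiltV P F X s m ρ l mu bb v d)
    (hl : 0 ≤ l) (hlγ : l * γ ≤ 1/10) {k : ℕ} (hk : k < n) {ψ c H : Ω → ℝ}
    (hψ : Measurable[F (k + 1)] ψ) (hi : Integrable (fun ω => ψ ω * phi (l * X k ω)) P)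
    (hcm : Measurable[F k] c)
    (hc : P[fun ω => ψ ω * phi (l * X k ω)|F k] =ᵐ[P] c) (hH : BM (F k) H) :
    Integrable (fun ω => H ω * ψ ω) (QQ P X mu l n) ∧
    Integrable (fun ω => H ω * (c ω / mu k ω)) (QQ P X mu l n) ∧
    ∫ ω, H ω * ψ ω ∂(QQ P X mu l n) = ∫ ω, H ω * (c ω / mu k ω) ∂(QQ P X mu l n) := by
  have hci : Integrable c P := integrable_condExp.congr hc
  have hW : BM (F k) (fun ω => H ω * (ZZ X mu l k ω * (mu k ω)⁻¹)) :=
    hH.mul ((h.ZZ_bm hT hl hlγ k).mul (h.inv_mu_bm hT hl hlγ k))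
  have j1 := hW.integrable_mul (h.le k) hi
  have j2 := hW.integrable_mul (h.le k) hci
  have e1 : ∀ ω, H ω * (ZZ X mu l k ω * (mu k ω)⁻¹) * (ψ ω * phi (l * X k ω))
      = (H ω * ψ ω) * ZZ X mu l (k + 1) ω := fun ω => by
    unfold ZZ; rw [Finset.prod_range_succ]; ring
  have e2 : ∀ ω, H ω * (ZZ X mu l k ω * (mu k ω)⁻¹) * c ω
      = (H ω * (c ω / mu k ω)) * ZZ X mu l k ω := fun ω => by ring
  have j3 := ce_int (h.le k) hW.1 hi j1 hc
  simp only [e1, e2] at j1 j2 j3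
  obtain ⟨a1, a2⟩ := h.ZZ_step hT hl hlγ
    ((hH.1.mono (h.mono (Nat.le_succ k)) le_rfl).mul hψ) j1 (n - (k + 1))
  obtain ⟨b1, b2⟩ := h.ZZ_step hT hl hlγ (hH.1.mul (hcm.div (hT.mum k))) j2 (n - k)
  rw [show k + 1 + (n - (k + 1)) = n by omega] at a1 a2
  rw [show k + (n - k) = n by omega] at b1 b2
  refine ⟨(h.QQ_integrable hT hl hlγ _).2 a1, (h.QQ_integrable hT hl hlγ _).2 b1, ?_⟩
  rw [h.QQ_integral hT hl hlγ, h.QQ_integral hT hl hlγ]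
  exact a2.trans (j3.trans b2.symm)

end Core

open MeasureTheory Filter
open scoped Topology ENNReal

noncomputable def xiT {Ω : Type} (X mu bb : ℕ → Ω → ℝ) (l : ℝ) (n k : ℕ) (ω : Ω) : ℝ :=
  if k < n then X k ω - l / 2 * (X k ω)^2 - bb k ω / mu k ω else 0

lemma abs_add_rpow_le8 {a b q : ℝ} (hq : 0 ≤ q) (hq3 : q ≤ 3) :
    |a - b| ^ q ≤ 8 * (|a| ^ q + |b| ^ q) := by
  have h1 : |a - b| ≤ 2 * max |a| |b| := by
    have := abs_sub a b
    have := le_max_left |a| |b|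
    have := le_max_right |a| |b|
    linarith
  have h2 := Real.rpow_le_rpow (abs_nonneg _) h1 hq
  rw [Real.mul_rpow (by norm_num) (by positivity)] at h2
  have h3 : (2:ℝ) ^ q ≤ 8 := by
    have := Real.rpow_le_rpow_of_exponent_le (by norm_num : (1:ℝ) ≤ 2) hq3
    norm_num at this; exact this
  have h4 : (max |a| |b|) ^ q ≤ |a| ^ q + |b| ^ q := by
    have h5 : 0 ≤ |a| ^ q := by positivity
    have h6 : 0 ≤ |b| ^ q := by positivity
    rcases max_choice |a| |b| with h | h <;> rw [h] <;> linarith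
  calc _ ≤ _ := h2
    _ ≤ _ := by gcongr

namespace Core
variable {Ω : Type} [mΩ : MeasurableSpace Ω] {P : Measure Ω} [IsProbabilityMeasure P] {n : ℕ}
    {F : ℕ → MeasurableSpace Ω} {X s m : ℕ → Ω → ℝ} {ρ γ e δ l : ℝ} {mu bb v d : ℕ → Ω → ℝ}

lemma b_bm (h : Core P n F X s m ρ γ e δ) (hT : TiltV P F X s m ρ l mu bb v d)
    (hl : 0 ≤ l) (hlγ : l * γ ≤ 1/10) (k : ℕ) : BM (F k) (fun ω => bb k ω / mu k ω) :=
  ⟨(hT.bm k).div (hT.mum k), 163 * (l * γ ^ 2), fun ω => by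
    have := h.b_abs hT hl hlγ k ω
    have := h.sγ k ω
    refine (h.b_abs hT hl hlγ k ω).trans ?_
    gcongr⟩

lemma bm_one {m : MeasurableSpace Ω} (c : ℝ) : BM m (fun _ : Ω => c) :=
  ⟨measurable_const, |c|, fun _ => le_rfl⟩

lemma bes (h : Core P n F X s m ρ γ e δ) (hT : TiltV P F X s m ρ l mu bb v d)
    (hl : 0 ≤ l) (hlγ : l * γ ≤ 1/10) :
    BES (QQ P X mu l n) n F (xiT X mu bb l n) s ρ (10^8 * ((1 + l) ^ ρ * γ ^ ρ)) δ := by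
  have hprob := h.QQ_prob hT hl hlγ
  have hρ := h.hρ
  have hγ := h.γ0
  have hg1 : γ ^ ρ ≤ (1 + l) ^ ρ * γ ^ ρ := by
    have : 1 ≤ (1 + l) ^ ρ := Real.one_le_rpow (by linarith) hρ.le
    have : 0 ≤ γ ^ ρ := by positivity
    nlinarith
  have hg2 : l ^ ρ * γ ^ ρ ≤ (1 + l) ^ ρ * γ ^ ρ := by
    gcongr; linarith
  have hA : ∀ k, Measurable[F (k + 1)] (fun ω => X k ω - l / 2 * (X k ω)^2) := fun k => 
    (h.Xm k).sub (((h.Xm k).pow_const 2).const_mul (l/2))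
  have hb' : ∀ k, Measurable[F (k+1)] (fun ω => bb k ω / mu k ω) := fun k =>
    ((hT.bm k).div (hT.mum k)).mono (h.mono (Nat.le_succ k)) le_rfl
  have hξ : ∀ k, k < n → xiT X mu bb l n k
      = fun ω => X k ω - l / 2 * (X k ω)^2 - bb k ω / mu k ω := fun k hk => by
    ext ω; simp [xiT, hk]
  have hξ' : ∀ k, ¬ k < n → xiT X mu bb l n k = fun ω => 0 := fun k hk => by
    ext ω; simp [xiT, hk]
  have bB := h.b_bm hT hl hlγ
  -- moments
  have q1 := fun k (hk : k < n) H (hH : BM (F k) H) =>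
    h.qmom hT hl hlγ hk (hA k) (hT.ib k) (hT.bm k) (hT.bc k) hH
  have q2 := fun k (hk : k < n) H (hH : BM (F k) H) =>
    h.qmom hT hl hlγ hk ((hA k).pow_const 2) (hT.iv k) (hT.vm k) (hT.vc k) hH
  have q3 := fun k (hk : k < n) H (hH : BM (F k) H) =>
    h.qmom hT hl hlγ hk (ψ := fun ω => |X k ω - l / 2 * (X k ω)^2| ^ (2 + ρ)) ((continuous_abs.measurable.comp (hA k)).pow_const (2 + ρ)) (hT.id k) (hT.dm k) (hT.dc k) hH
  have r2 : ∀ k, BM (F k) (fun ω => (bb k ω / mu k ω) * (bb k ω / mu k ω)) := fun k => (bB k).mul (bB k)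
  have r3 : ∀ k, BM (F k) (fun ω => |bb k ω / mu k ω| ^ (2 + ρ)) := fun k =>
    ⟨(continuous_abs.measurable.comp (bB k).1).pow_const _, (163 * (l * γ ^ 2)) ^ (2 + ρ), fun ω => by
      rw [abs_of_nonneg (by positivity)]
      refine Real.rpow_le_rpow (abs_nonneg _) ?_ (by linarith)
      have := h.sγ k ω
      refine (h.b_abs hT hl hlγ k ω).trans ?_
      gcongr⟩
  have ξm : ∀ k, Measurable[F (k+1)] (xiT X mu bb l n k) := fun k => by
    by_cases hk : k < n
    · rw [hξ k hk]; exact (hA k).sub (hb' k)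
    · rw [hξ' k hk]; exact measurable_const
  have i3 : ∀ k, Integrable (fun ω => |xiT X mu bb l n k ω| ^ (2 + ρ)) (QQ P X mu l n) := fun k => by
    by_cases hk : k < n
    · have a1 := (q3 k hk _ (bm_one 1)).1
      have a2 := (r3 k).integrable (Q := QQ P X mu l n) (h.le k)
      simp only [one_mul] at a1
      refine Integrable.mono' ((a1.add a2).const_mul 8)
        (((ξm k).mono (h.le _) le_rfl).abs.pow_const _).aestronglyMeasurable
        (ae_of_all _ fun ω => ?_)
      rw [Real.norm_eq_abs, abs_of_nonneg (by positivity), hξ k hk]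
      exact abs_add_rpow_le8 (by linarith) (by linarith [h.hρ1])
    · rw [hξ' k hk]; simp
  have i1 : ∀ k, Integrable (xiT X mu bb l n k) (QQ P X mu l n) := fun k => by
    refine Integrable.mono' ((integrable_const 1).add (i3 k))
      ((ξm k).mono (h.le _) le_rfl).aestronglyMeasurable (ae_of_all _ fun ω => ?_)
    have := abs_rpow_le_one_add (q := 1) (r := 2 + ρ) (by norm_num) (by linarith [h.hρ])
      (abs_nonneg (xiT X mu bb l n k ω))
    simpa using this
  have i2 : ∀ k, Integrable (fun ω => (xiT X mu bb l n k ω)^2) (QQ P X mu l n) := fun k => by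
    refine Integrable.mono' ((integrable_const 1).add (i3 k))
      (((ξm k).mono (h.le _) le_rfl).pow_const 2).aestronglyMeasurable (ae_of_all _ fun ω => ?_)
    have := abs_rpow_le_one_add (q := 2) (r := 2 + ρ) (by norm_num) (by linarith [h.hρ])
      (abs_nonneg (xiT X mu bb l n k ω))
    simpa using this
  refine ⟨h.mono, h.le, ξm, h.sm, h.s0, ?_, fun k ω _ => h.sT k ω, ?_, i1, i2, i3, ?_, ?_, ?_⟩
  · intro k ω
    have h1 := h.sg k ω
    have : 0 ≤ (1 + l) ^ ρ * γ ^ ρ := by positivity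
    linarith
  · exact (withDensity_absolutelyContinuous P _).ae_le h.sT'
  · intro k hk H hH
    obtain ⟨a1, a2, a3⟩ := q1 k hk H hH
    rw [hξ k hk]
    simp only [mul_sub _ _ (bb k _ / mu k _)]
    rw [integral_sub a1 a2, a3, sub_self]
  · intro k hk H hH
    obtain ⟨a1, a2, a3⟩ := q2 k hk H hH
    obtain ⟨b1, b2, b3⟩ := q1 k hk _ (hH.mul (bB k))
    have c1 := (hH.mul (r2 k)).integrable (Q := QQ P X mu l n) (h.le k)
    have c2 := (hH.mul (h.bms k)).integrable (Q := QQ P X mu l n) (h.le k)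
    have c3 : Integrable (fun ω => |H ω| * s k ω) (QQ P X mu l n) := by
      refine c2.abs.congr (ae_of_all _ fun ω => ?_)
      simp only [abs_mul, abs_of_nonneg (h.s0 k ω)]
    rw [hξ k hk]
    have e1 : ∫ ω, H ω * ((X k ω - l / 2 * (X k ω)^2 - bb k ω / mu k ω)^2 - s k ω) ∂QQ P X mu l n
        = ∫ ω, H ω * (v k ω / mu k ω - (bb k ω / mu k ω)^2 - s k ω) ∂QQ P X mu l n := by
      have e2 : ∀ ω, H ω * ((X k ω - l / 2 * (X k ω)^2 - bb k ω / mu k ω)^2 - s k ω)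
        = H ω * (X k ω - l / 2 * (X k ω)^2)^2
          - 2 * (H ω * (bb k ω / mu k ω) * (X k ω - l / 2 * (X k ω)^2))
          + (H ω * ((bb k ω / mu k ω) * (bb k ω / mu k ω)) - H ω * s k ω) := fun ω => by ring
      have e3 : ∀ ω, H ω * (v k ω / mu k ω - (bb k ω / mu k ω)^2 - s k ω)
        = H ω * (v k ω / mu k ω)
          - 2 * (H ω * (bb k ω / mu k ω) * (bb k ω / mu k ω))
          + (H ω * ((bb k ω / mu k ω) * (bb k ω / mu k ω)) - H ω * s k ω) := fun ω => by ring
      simp_rw [e2, e3]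
      have f1 : Integrable (fun ω => H ω * (X k ω - l / 2 * (X k ω)^2)^2
          - 2 * (H ω * (bb k ω / mu k ω) * (X k ω - l / 2 * (X k ω)^2))) (QQ P X mu l n) :=
        a1.sub (b1.const_mul 2)
      have f2 : Integrable (fun ω => H ω * (v k ω / mu k ω)
          - 2 * (H ω * (bb k ω / mu k ω) * (bb k ω / mu k ω))) (QQ P X mu l n) :=
        a2.sub (b2.const_mul 2)
      have f3 : Integrable (fun ω => H ω * ((bb k ω / mu k ω) * (bb k ω / mu k ω)) - H ω * s k ω)
        (QQ P X mu l n) := c1.sub c2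
      rw [integral_add f1 f3, integral_sub a1 (b1.const_mul 2),
        integral_add f2 f3, integral_sub a2 (b2.const_mul 2),
        integral_const_mul, integral_const_mul, a3, b3]
    rw [e1, ← integral_const_mul]
    refine (abs_integral_le_integral_abs).trans ?_
    refine integral_mono_of_nonneg (ae_of_all _ fun ω => abs_nonneg _) (c3.const_mul _)
      (ae_of_all _ fun ω => ?_)
    simp only [abs_mul]
    have h5 := h.v_close hT hl hlγ k ω
    have hs := h.s0 k ω
    have h6 : 0 ≤ l ^ ρ * γ ^ ρ := by positivity
    calc |H ω| * |v k ω / mu k ω - (bb k ω / mu k ω)^2 - s k ω| 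
        ≤ |H ω| * (10^8 * ((1 + l) ^ ρ * γ ^ ρ) * s k ω) := by
          gcongr
          refine h5.trans ?_
          gcongr
          norm_num
      _ = _ := by ring
  · intro k hk H hH hH0
    obtain ⟨a1, a2, a3⟩ := q3 k hk H hH
    have c1 := (hH.mul (r3 k)).integrable (Q := QQ P X mu l n) (h.le k)
    have c2 := (hH.mul (h.bms k)).integrable (Q := QQ P X mu l n) (h.le k)
    have e1 : ∫ ω, H ω * |xiT X mu bb l n k ω| ^ (2 + ρ) ∂QQ P X mu l n
        ≤ ∫ ω, 8 * (H ω * |X k ω - l / 2 * (X k ω)^2|^(2 + ρ)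
          + H ω * |bb k ω / mu k ω| ^ (2 + ρ)) ∂QQ P X mu l n := by
      refine integral_mono_of_nonneg (ae_of_all _ fun ω => mul_nonneg (hH0 ω) (by positivity))
        ((a1.add c1).const_mul 8) (ae_of_all _ fun ω => ?_)
      simp only [hξ k hk]
      have := abs_add_rpow_le8 (a := X k ω - l / 2 * (X k ω)^2) (b := bb k ω / mu k ω) (q := 2 + ρ)
        (by linarith) (by linarith [h.hρ1])
      have := mul_le_mul_of_nonneg_left this (hH0 ω)
      linarith
    refine e1.trans ?_
    rw [integral_const_mul, integral_add a1 c1, a3, ← integral_add a2 c1, ← integral_const_mul,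
      ← integral_const_mul]
    refine integral_mono ((a2.add c1).const_mul 8) (c2.const_mul _) fun ω => ?_
    have h5 := h.d_close hT hl hlγ k ω
    have hs := h.s0 k ω
    have h6 : 10^8 * γ ^ ρ * s k ω ≤ 10^8 * ((1 + l) ^ ρ * γ ^ ρ) * s k ω := by gcongr
    have := mul_le_mul_of_nonneg_left (h5.trans h6) (hH0 ω)
    simp only
    linarith
end Core

/-- second moment of the sum -/
lemma BES.second {Ω : Type} [mΩ : MeasurableSpace Ω] {Q : Measure Ω} [IsProbabilityMeasure Q] {n : ℕ}
    {F : ℕ → MeasurableSpace Ω} {ξ s : ℕ → Ω → ℝ} {ρ g δ : ℝ} (h : BES Q n F ξ s ρ g δ)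
    (hsi : ∀ k, BM (F k) (s k)) (k : ℕ) (hk : k ≤ n) :
    Integrable (fun ω => (MM ξ k ω)^2) Q ∧ ∫ ω, MM ξ k ω ∂Q = 0 ∧ Integrable (MM ξ k) Q ∧
      ∫ ω, (MM ξ k ω)^2 ∂Q ≤ (1 + g) * ∫ ω, ∑ j ∈ Finset.range k, s j ω ∂Q := by
  induction k with
  | zero =>
    have : MM ξ 0 = fun _ => 0 := by ext ω; simp [MM]
    rw [this]; simp
  | succ k ih =>
    obtain ⟨ih1, ih2, ih3, ih4⟩ := ih (by omega)
    have hk' : k < n := hk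
    have e1 : ∀ ω, MM ξ (k + 1) ω = MM ξ k ω + ξ k ω := fun ω => by
      unfold MM; rw [Finset.sum_range_succ]
    have z1 : ∫ ω, ξ k ω ∂Q = 0 := by
      have := h.h1 k hk' (fun _ => 1) ⟨measurable_const, 1, fun _ => by simp⟩
      simpa using this
    have hce : Q[ξ k|F k] =ᵐ[Q] 0 := by
      symm
      refine ae_eq_condExp_of_forall_setIntegral_eq (h.le k) (h.i1 k)
        (fun _ _ _ => integrableOn_zero) (fun A hA _ => ?_) stronglyMeasurable_zero.aestronglyMeasurable
      have hA' := h.le k _ hA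
      rw [← integral_indicator hA', ← integral_indicator hA']
      have := h.h1 k hk' (A.indicator fun _ => 1) ⟨(Measurable.indicator (m := F k) measurable_const hA), 1, fun ω => by
        by_cases hω : ω ∈ A <;> simp [hω]⟩
      have e : A.indicator (ξ k) = fun ω => A.indicator (fun _ => (1:ℝ)) ω * ξ k ω := by
        ext ω; by_cases hω : ω ∈ A <;> simp [hω]
      rw [e, this]; simp
    have hx : Integrable (fun ω => MM ξ k ω * ξ k ω) Q := by
      refine Integrable.mono' (ih1.add (h.i2 k))
        (((h.MM_meas k).mono (h.le k) le_rfl).mul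
          ((h.ξm k).mono (h.le _) le_rfl)).aestronglyMeasurable (ae_of_all _ fun ω => ?_)
      simp only [Pi.add_apply]
      rw [Real.norm_eq_abs, abs_le]
      constructor <;> nlinarith [sq_nonneg (MM ξ k ω + ξ k ω), sq_nonneg (MM ξ k ω - ξ k ω)]
    have hx0 : ∫ ω, MM ξ k ω * ξ k ω ∂Q = 0 := by
      rw [ce_int (h.le k) (h.MM_meas k) (h.i1 k) hx hce]; simp
    have e2 : ∀ ω, (MM ξ (k + 1) ω)^2 = (MM ξ k ω)^2 + 2 * (MM ξ k ω * ξ k ω) + (ξ k ω)^2 :=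
      fun ω => by rw [e1]; ring
    have si := fun k => (hsi k).integrable (Q := Q) (h.le k)
    have v1 : ∫ ω, (ξ k ω)^2 ∂Q ≤ (1 + g) * ∫ ω, s k ω ∂Q := by
      have := h.h2 k hk' (fun _ => 1) ⟨measurable_const, 1, fun _ => by simp⟩
      simp only [one_mul, abs_one] at this
      rw [integral_sub (h.i2 k) (si k)] at this
      have := (abs_le.1 this).2
      linarith
    refine ⟨?_, ?_, ?_, ?_⟩
    · simp_rw [e2]; exact (ih1.add (hx.const_mul 2)).add (h.i2 k)
    · simp_rw [e1]; rw [integral_add ih3 (h.i1 k), ih2, z1, add_zero]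
    · rw [show MM ξ (k+1) = fun ω => MM ξ k ω + ξ k ω from funext e1]; exact ih3.add (h.i1 k)
    · simp_rw [e2]
      have f1 : Integrable (fun ω => (MM ξ k ω)^2 + 2 * (MM ξ k ω * ξ k ω)) Q :=
        ih1.add (hx.const_mul 2)
      rw [integral_add f1 (h.i2 k), integral_add ih1 (hx.const_mul 2),
        integral_const_mul, hx0]
      simp_rw [Finset.sum_range_succ]
      rw [integral_add (integrable_finsetSum _ fun j _ => si j) (si k)]
      linarith

open MeasureTheory Filter
open scoped Topology ENNReal

noncomputable def SX {Ω : Type} (X : ℕ → Ω → ℝ) (n : ℕ) (ω : Ω) : ℝ := ∑ j ∈ Finset.range n, X j ω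
noncomputable def VX {Ω : Type} (X : ℕ → Ω → ℝ) (n : ℕ) (ω : Ω) : ℝ :=
  ∑ j ∈ Finset.range n, (X j ω)^2

/-- Output of the change of measure. -/
structure TiltOut {Ω : Type} [mΩ : MeasurableSpace Ω] (P Q : Measure Ω) (N β M : Ω → ℝ)
    (ρ γ e δ l C : ℝ) : Prop where
  prob : IsProbabilityMeasure Q
  βm : Measurable β
  Mm : Measurable M
  dec : ∀ ω, N ω = β ω + M ω
  βc : ∀ᵐ ω ∂Q, |β ω - l / 2| ≤ l * δ ^ 2 + C * l ^ (1 + ρ) * e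
  ei : Integrable (fun ω => Real.exp (-l * (β ω + M ω))) Q
  up : ∀ B, MeasurableSet B → P.real B ≤
    Real.exp (C * l ^ (2 + ρ) * e) * ∫ ω in B, Real.exp (-l * (β ω + M ω)) ∂Q
  lo : ∀ B, MeasurableSet B →
    Real.exp (-(C * l ^ (2 + ρ) * e)) * ∫ ω in B, Real.exp (-l * (β ω + M ω)) ∂Q ≤ P.real B
  be : ∀ z, |Q.real {ω | M ω < z} - stdNormalCDF z| ≤ C * ((1 + l) ^ ρ * γ ^ ρ + δ)
  i1 : Integrable M Q
  i2 : Integrable (fun ω => (M ω)^2) Q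
  m1 : ∫ ω, M ω ∂Q = 0
  m2 : ∫ ω, (M ω)^2 ∂Q ≤ C

lemma TiltOut.mono {Ω : Type} [mΩ : MeasurableSpace Ω] {P Q : Measure Ω} {N β M : Ω → ℝ}
    {ρ γ e δ l C C' : ℝ} (h : TiltOut P Q N β M ρ γ e δ l C) (hC : C ≤ C') (hl : 0 ≤ l) (he : 0 ≤ e)
    (hγ : 0 ≤ γ) (hδ : 0 ≤ δ) : TiltOut P Q N β M ρ γ e δ l C' where
  prob := h.prob
  βm := h.βm
  Mm := h.Mm
  dec := h.dec
  βc := h.βc.mono fun ω hω => hω.trans (by gcongr)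
  ei := h.ei
  up B hB := (h.up B hB).trans (by
    have : 0 ≤ ∫ ω in B, Real.exp (-l * (β ω + M ω)) ∂Q := integral_nonneg fun ω => by positivity
    gcongr)
  lo B hB := le_trans (by
    have : 0 ≤ ∫ ω in B, Real.exp (-l * (β ω + M ω)) ∂Q := integral_nonneg fun ω => by positivity
    gcongr) (h.lo B hB)
  be z := (h.be z).trans (by gcongr)
  i1 := h.i1
  i2 := h.i2
  m1 := h.m1
  m2 := h.m2.trans hC

lemma inv_mu_bounds {t y : ℝ} (h : |t - 1| ≤ y) (hy : y ≤ 1/2) :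
    Real.exp (-(2 * y)) ≤ t⁻¹ ∧ t⁻¹ ≤ Real.exp (2 * y) := by
  have hy0 : 0 ≤ y := (abs_nonneg _).trans h
  obtain ⟨h1, h2⟩ := abs_le.1 h
  have ht : 0 < t := by linarith
  constructor
  · rw [Real.exp_neg]
    apply inv_anti₀ ht
    have := Real.add_one_le_exp (2 * y)
    linarith
  · rw [inv_le_comm₀ ht (Real.exp_pos _), ← Real.exp_neg]
    have h3 : (1 - y) * Real.exp (2 * y) ≥ 1 := by
      have := Real.add_one_le_exp (2 * y)
      nlinarith
    have h4 : Real.exp (2 * y) * Real.exp (-(2 * y)) = 1 := by rw [← Real.exp_add]; simp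
    have h5 := Real.exp_pos (-(2 * y))
    nlinarith [Real.exp_pos (2 * y)]

theorem tilt_main (ρ : ℝ) (hρ : 0 < ρ) (hρ1 : ρ < 1) : ∃ C : ℝ, 1 ≤ C ∧
    ∀ {Ω : Type} [mΩ : MeasurableSpace Ω] {P : Measure Ω} [IsProbabilityMeasure P] {n : ℕ}
      {F : ℕ → MeasurableSpace Ω} {X s m : ℕ → Ω → ℝ} {γ e δ : ℝ},
      Core P n F X s m ρ γ e δ → ∀ l, 0 ≤ l → l * γ ≤ 1/10 →
      ∃ (Q : Measure Ω) (β M : Ω → ℝ),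
        TiltOut P Q (fun ω => SX X n ω - l / 2 * VX X n ω) β M ρ γ e δ l C := by
  obtain ⟨C0, hC0, hmain⟩ := BES.main ρ hρ hρ1
  refine ⟨C0 * 10^8 + 10^9, by nlinarith, ?_⟩
  intro Ω mΩ P _ n F X s m γ e δ h l hl hlγ
  set C := C0 * 10^8 + 10^9 with hC
  have hC9 : 10^9 ≤ C := by rw [hC]; nlinarith
  obtain ⟨mu, bb, v, d, hT⟩ := h.exists_tilt hl
  have hB := h.bes hT hl hlγ
  have hprob := h.QQ_prob hT hl hlγ
  have he := h.e0
  have hγ := h.γ0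
  have hδ := h.δ0
  have hlρ : (1 + l) ^ ρ * γ ^ ρ ≤ 1 := by
    rw [← Real.mul_rpow (by linarith) hγ.le]
    refine Real.rpow_le_one (by positivity) ?_ hρ.le
    nlinarith [h.γ1]
  have hpos : 0 < (1 + l) ^ ρ * γ ^ ρ := by positivity
  have hsec := hB.second h.bms n le_rfl
  have hMm : Measurable (MM (xiT X mu bb l n) n) := (hB.MM_meas n).mono (h.le n) le_rfl
  have hβm : Measurable (fun ω => ∑ j ∈ Finset.range n, bb j ω / mu j ω) :=
    Finset.measurable_sum _ fun j _ => ((hT.bm j).div (hT.mum j)).mono (h.le j) le_rfl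
  have hdec : ∀ ω, SX X n ω - l / 2 * VX X n ω = (∑ j ∈ Finset.range n, bb j ω / mu j ω)
      + MM (xiT X mu bb l n) n ω := by
    intro ω
    unfold SX VX MM
    rw [Finset.mul_sum, ← Finset.sum_sub_distrib, ← Finset.sum_add_distrib]
    refine Finset.sum_congr rfl fun j hj => ?_
    have : j < n := by simpa using hj
    simp [xiT, this]
  have hy : ∀ k ω, |mu k ω - 1| ≤ 40 * l ^ (2 + ρ) * m k ω ∧ 40 * l ^ (2 + ρ) * m k ω ≤ 1/2 :=
    fun k ω => ⟨hT.mub k ω, by have := h.l2ρm hl hlγ k ω; linarith⟩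
  have hZ : ∀ ω, Real.exp (-l * ((∑ j ∈ Finset.range n, bb j ω / mu j ω)
      + MM (xiT X mu bb l n) n ω)) * ZZ X mu l n ω = ∏ j ∈ Finset.range n, (mu j ω)⁻¹ := by
    intro ω
    rw [← hdec]
    unfold ZZ SX VX
    simp_rw [div_eq_mul_inv]
    rw [Finset.prod_mul_distrib, ← mul_assoc]
    unfold phi
    rw [← Real.exp_sum, ← Real.exp_add]
    have : -l * ((∑ j ∈ Finset.range n, X j ω) - l * 2⁻¹ * ∑ j ∈ Finset.range n, (X j ω)^2)
      + ∑ j ∈ Finset.range n, (l * X j ω - (l * X j ω)^2 * 2⁻¹) = 0 := by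
      rw [Finset.sum_sub_distrib, ← Finset.mul_sum, ← Finset.sum_mul]
      simp_rw [mul_pow]
      rw [← Finset.mul_sum]; ring
    simp only [div_eq_mul_inv] at this ⊢
    rw [this]; simp
  have hprodu : ∀ ω, ∏ j ∈ Finset.range n, (mu j ω)⁻¹ ≤ Real.exp (C * l ^ (2 + ρ) * e) := by
    intro ω
    calc _ ≤ ∏ j ∈ Finset.range n, Real.exp (2 * (40 * l ^ (2 + ρ) * m j ω)) :=
          Finset.prod_le_prod (fun j _ => by
            have := (h.mu_half hT hl hlγ j ω).1; positivity)
            (fun j _ => (inv_mu_bounds (hy j ω).1 (hy j ω).2).2)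
      _ = Real.exp (80 * l ^ (2 + ρ) * ∑ j ∈ Finset.range n, m j ω) := by
          rw [← Real.exp_sum, Finset.mul_sum]; congr 1
          exact Finset.sum_congr rfl fun j _ => by ring
      _ ≤ _ := by
          have := h.mT n ω
          have h0 : 0 ≤ ∑ j ∈ Finset.range n, m j ω := Finset.sum_nonneg fun j _ => h.m0 j ω
          gcongr
          linarith
  have hprodl : ∀ ω, Real.exp (-(C * l ^ (2 + ρ) * e)) ≤ ∏ j ∈ Finset.range n, (mu j ω)⁻¹ := by
    intro ω
    calc _ ≤ Real.exp (-(80 * l ^ (2 + ρ) * ∑ j ∈ Finset.range n, m j ω)) := by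
          have := h.mT n ω
          have h0 : 0 ≤ ∑ j ∈ Finset.range n, m j ω := Finset.sum_nonneg fun j _ => h.m0 j ω
          gcongr
          linarith
      _ = ∏ j ∈ Finset.range n, Real.exp (-(2 * (40 * l ^ (2 + ρ) * m j ω))) := by
          rw [← Real.exp_sum, Finset.mul_sum, ← Finset.sum_neg_distrib]; congr 1
          exact Finset.sum_congr rfl fun j _ => by ring
      _ ≤ _ := Finset.prod_le_prod (fun j _ => (Real.exp_pos _).le)
            (fun j _ => (inv_mu_bounds (hy j ω).1 (hy j ω).2).1)
  have hpm : Measurable (fun ω => ∏ j ∈ Finset.range n, (mu j ω)⁻¹) :=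
    Finset.measurable_prod _ fun j _ => ((hT.mum j).inv).mono (h.le j) le_rfl
  have hpi : Integrable (fun ω => ∏ j ∈ Finset.range n, (mu j ω)⁻¹) P := by
    refine Integrable.mono' (integrable_const (Real.exp (C * l ^ (2 + ρ) * e)))
      hpm.aestronglyMeasurable (ae_of_all _ fun ω => ?_)
    rw [Real.norm_eq_abs, abs_of_nonneg ((Real.exp_pos _).le.trans (hprodl ω))]
    exact hprodu ω
  have hInt0 : ∀ B, MeasurableSet B → ∫ ω in B, Real.exp (-l * ((∑ j ∈ Finset.range n, bb j ω / mu j ω)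
      + MM (xiT X mu bb l n) n ω)) ∂(QQ P X mu l n) = ∫ ω in B, ∏ j ∈ Finset.range n, (mu j ω)⁻¹ ∂P := by
    intro B hB
    rw [← integral_indicator hB, ← integral_indicator hB, h.QQ_integral hT hl hlγ]
    refine integral_congr_ae (ae_of_all _ fun ω => ?_)
    by_cases hω : ω ∈ B
    · simp only [Set.indicator_of_mem hω]; exact hZ ω
    · simp [Set.indicator_of_notMem hω]
  refine ⟨QQ P X mu l n, fun ω => ∑ j ∈ Finset.range n, bb j ω / mu j ω,
    MM (xiT X mu bb l n) n, hprob, hβm, hMm, hdec, ?_, ?_, ?_, ?_, ?_, hsec.2.2.1, hsec.1, hsec.2.1, ?_⟩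
  · filter_upwards [hB.sT'] with ω hω
    have h1 := h.sT n ω
    have h2 : |(∑ j ∈ Finset.range n, bb j ω / mu j ω) - l / 2 * ∑ j ∈ Finset.range n, s j ω|
        ≤ 162 * l ^ (1 + ρ) * e := by
      rw [Finset.mul_sum, ← Finset.sum_sub_distrib]
      calc _ ≤ ∑ j ∈ Finset.range n, |bb j ω / mu j ω - l / 2 * s j ω| :=
            Finset.abs_sum_le_sum_abs _ _
        _ ≤ ∑ j ∈ Finset.range n, 162 * l ^ (1 + ρ) * m j ω :=
            Finset.sum_le_sum fun j _ => h.b_close hT hl hlγ j ω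
        _ = 162 * l ^ (1 + ρ) * ∑ j ∈ Finset.range n, m j ω := by rw [Finset.mul_sum]
        _ ≤ _ := by
            have := h.mT n ω
            gcongr
    have h3 : |l / 2 * (∑ j ∈ Finset.range n, s j ω) - l / 2| ≤ l * δ ^ 2 := by
      have : l / 2 * (∑ j ∈ Finset.range n, s j ω) - l / 2
        = l / 2 * ((∑ j ∈ Finset.range n, s j ω) - 1) := by ring
      rw [this, abs_mul, abs_of_nonneg (by positivity)]
      have : |(∑ j ∈ Finset.range n, s j ω) - 1| ≤ δ ^ 2 := by
        rw [abs_le]; constructor <;> linarith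
      nlinarith [sq_nonneg δ]
    have h4 : 162 * l ^ (1 + ρ) * e ≤ C * l ^ (1 + ρ) * e := by
      gcongr; linarith
    have := abs_add_le ((∑ j ∈ Finset.range n, bb j ω / mu j ω) - l / 2 * ∑ j ∈ Finset.range n, s j ω)
      (l / 2 * (∑ j ∈ Finset.range n, s j ω) - l / 2)
    rw [sub_add_sub_cancel] at this
    linarith
  · rw [h.QQ_integrable hT hl hlγ]
    simp_rw [hZ]; exact hpi
  · intro B hBm
    rw [hInt0 B hBm]
    have h1 : ∫ ω in B, Real.exp (-(C * l ^ (2 + ρ) * e)) ∂P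
        ≤ ∫ ω in B, ∏ j ∈ Finset.range n, (mu j ω)⁻¹ ∂P :=
      setIntegral_mono (integrable_const _) hpi.integrableOn hprodl
    rw [setIntegral_const, smul_eq_mul] at h1
    have h2 := mul_le_mul_of_nonneg_left h1 (Real.exp_pos (C * l ^ (2 + ρ) * e)).le
    refine le_trans (le_of_eq ?_) h2
    rw [mul_left_comm, ← Real.exp_add]; simp
  · intro B hBm
    rw [hInt0 B hBm]
    have h1 : ∫ ω in B, ∏ j ∈ Finset.range n, (mu j ω)⁻¹ ∂P ≤ 
        ∫ ω in B, Real.exp (C * l ^ (2 + ρ) * e) ∂P :=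
      setIntegral_mono hpi.integrableOn (integrable_const _) hprodu
    rw [setIntegral_const, smul_eq_mul] at h1
    have h2 := mul_le_mul_of_nonneg_left h1 (Real.exp_pos (-(C * l ^ (2 + ρ) * e))).le
    refine le_trans h2 (le_of_eq ?_)
    rw [mul_left_comm, ← Real.exp_add]; simp
  · intro z
    refine (hmain (by positivity) hδ (by linarith [h.δ1]) hB z).trans ?_
    have : 0 ≤ C0 * δ := by positivity
    have : 0 ≤ C0 * ((1 + l) ^ ρ * γ ^ ρ) := by positivity
    rw [hC]
    nlinarith
  · have h1 := hsec.2.2.2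
    have h2 : ∫ ω, ∑ j ∈ Finset.range n, s j ω ∂(QQ P X mu l n) ≤ 2 := by
      calc _ ≤ ∫ ω, (2:ℝ) ∂(QQ P X mu l n) := by
            refine integral_mono_of_nonneg
              (ae_of_all _ fun ω => Finset.sum_nonneg fun j _ => h.s0 j ω) (integrable_const _)
              (ae_of_all _ fun ω => (h.sT n ω).trans ?_)
            nlinarith [h.δ1]
        _ = 2 := by simp
    have h3 : 0 ≤ ∫ ω, ∑ j ∈ Finset.range n, s j ω ∂(QQ P X mu l n) :=
      integral_nonneg fun ω => Finset.sum_nonneg fun j _ => h.s0 j ω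
    nlinarith

open MeasureTheory Filter
open scoped Topology ENNReal

lemma expY_le {a κ u : ℝ} (hκ : a^2/8 ≤ κ) : Real.exp (a*u - κ*u^2) ≤ 8 := by
  have h1 : a*u - κ*u^2 ≤ 2 := by nlinarith [sq_nonneg (a*u - 4), sq_nonneg u, mul_le_mul_of_nonneg_right hκ (sq_nonneg u)]
  have h2 : Real.exp 2 ≤ 8 := by
    have : Real.exp 2 = Real.exp 1 * Real.exp 1 := by rw [← Real.exp_add]; norm_num
    rw [this]; nlinarith [Real.exp_one_lt_d9, Real.exp_pos 1]
  exact (Real.exp_le_exp.2 h1).trans h2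

lemma expY_two {a κ u ρ : ℝ} (hρ : 0 < ρ) (hρ1 : ρ < 1) (ha : 0 ≤ a) (ha1 : a ≤ 1)
    (hκ : a^2/8 ≤ κ) (hκ1 : κ ≤ 1) :
    |Real.exp (a*u - κ*u^2) - (1 + a*u + (a^2/2-κ)*u^2)| ≤ 200 * |u|^(2+ρ) := by
  have hκ0 : 0 ≤ κ := le_trans (by positivity) hκ
  have hexp := expY_le (u := u) hκ
  have hpos := Real.exp_pos (a*u - κ*u^2)
  rcases le_total |u| (1/2) with h | h
  · have h2 : |u| ^ 3 ≤ |u| ^ (2 + ρ) := pow_le_rpow_abs (by linarith) (by linarith) (by push_cast; linarith)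
    have hu2 : u^2 = |u|^2 := (sq_abs u).symm
    have hY : |a*u - κ*u^2| ≤ 3/2*|u| := by
      calc _ ≤ |a*u| + |κ*u^2| := abs_sub _ _
        _ = a*|u| + κ*|u|^2 := by rw [abs_mul, abs_mul, abs_of_nonneg ha, abs_of_nonneg hκ0, abs_pow]
        _ ≤ 1*|u| + 1*|u|^2 := by gcongr
        _ ≤ _ := by nlinarith [abs_nonneg u]
    have hb := Real.exp_bound (x := a*u-κ*u^2) (by linarith) (n := 3) (by norm_num)
    simp [Finset.sum_range_succ, Nat.factorial] at hb
    have hY3 : |a*u-κ*u^2|^3 ≤ (3/2*|u|)^3 := by gcongr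
    have hr : |(a*u-κ*u^2)^2/2 - a^2/2*u^2| ≤ 2*|u|^3 := by
      have : (a*u-κ*u^2)^2/2 - a^2/2*u^2 = u^3*(-(a*κ) + κ^2*u/2) := by ring
      rw [this, abs_mul, abs_pow, mul_comm]
      gcongr
      obtain ⟨h5, h6⟩ := abs_le.1 h
      have h7 : 0 ≤ a*κ := by positivity
      have h8 : a*κ ≤ 1 := by nlinarith
      have h9 : κ^2 ≤ 1 := by nlinarith
      rw [abs_le]; constructor <;> nlinarith [sq_nonneg κ]
    have h3 : 0 ≤ |u|^3 := by positivity
    rw [abs_le] at hb hr ⊢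
    constructor <;> nlinarith [hb.1, hb.2, hr.1, hr.2]
  · have h1 := big_rpow h (q := 2+ρ) (by linarith) (by linarith)
    have h2 := big_rpow' h (q := 2+ρ) (by linarith) (by linarith)
    have h3 := big_rpow h (q := ρ) (by linarith) (by linarith)
    have h4 : u^2 ≤ 8*|u|^(2+ρ) := by
      have : |u|^(2+ρ) = u^2*|u|^ρ := by
        rw [Real.rpow_add (by linarith)]; congr 1; norm_cast; exact sq_abs u
      rw [this]; nlinarith [sq_nonneg u]
    have h5 : |a*u| ≤ |u| := by rw [abs_mul, abs_of_nonneg ha]; nlinarith [abs_nonneg u]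
    have h6 : |(a^2/2-κ)*u^2| ≤ u^2 := by
      rw [abs_mul, abs_of_nonneg (sq_nonneg u)]
      have : |a^2/2-κ| ≤ 1 := by rw [abs_le]; constructor <;> nlinarith
      nlinarith [sq_nonneg u]
    rw [abs_le] at h5 h6 ⊢
    constructor <;> linarith [h5.1, h5.2, h6.1, h6.2]

lemma expY_zero {a κ u ρ : ℝ} (hρ : 0 < ρ) (hρ1 : ρ < 1) (ha : 0 ≤ a) (ha1 : a ≤ 1)
    (hκ : a^2/8 ≤ κ) (hκ1 : κ ≤ 1) :
    |Real.exp (a*u - κ*u^2) - 1| ≤ 72 * |u|^ρ := by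
  have hκ0 : 0 ≤ κ := le_trans (by positivity) hκ
  have hexp := expY_le (u := u) hκ
  have hpos := Real.exp_pos (a*u - κ*u^2)
  rcases le_total |u| (1/2) with h | h
  · have h2 : |u| ^ 1 ≤ |u| ^ ρ := pow_le_rpow_abs (by linarith) (by linarith) (by push_cast; linarith)
    have hY : |a*u - κ*u^2| ≤ 3/2*|u| := by
      calc _ ≤ |a*u| + |κ*u^2| := abs_sub _ _
        _ = a*|u| + κ*|u|^2 := by rw [abs_mul, abs_mul, abs_of_nonneg ha, abs_of_nonneg hκ0, abs_pow]
        _ ≤ 1*|u| + 1*|u|^2 := by gcongr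
        _ ≤ _ := by nlinarith [abs_nonneg u]
    have hb := Real.abs_exp_sub_one_le (x := a*u-κ*u^2) (by linarith)
    simp at h2
    linarith [abs_nonneg u]
  · have h3 := big_rpow h (q := ρ) (by linarith) (by linarith)
    rw [abs_le]; constructor <;> linarith

lemma vbe {p Q q : ℝ} (hp : 1 < p) (hp2 : p < 2) :
    |Q+q|^p ≤ |Q|^p + p*(SignType.sign Q * |Q|^(p-1))*q + 4*|q|^p := by
  have young : ∀ y z : ℝ, 0 ≤ y → 0 ≤ z → p*(y^(p-1)*z) ≤ z^p + (p-1)*y^p := by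
    intro y z hy hz
    have h := Real.geom_mean_le_arith_mean2_weighted (w₁ := 1/p) (w₂ := (p-1)/p) (p₁ := z^p) (p₂ := y^p)
      (by positivity) (div_nonneg (by linarith) (by linarith)) (by positivity) (by positivity) (by field_simp; ring)
    rw [← Real.rpow_mul hz, ← Real.rpow_mul hy] at h
    have e1 : p*(1/p) = 1 := by field_simp
    have e2 : p*((p-1)/p) = p-1 := by field_simp
    rw [e1, e2, Real.rpow_one] at h
    have := mul_le_mul_of_nonneg_left h (by linarith : 0 ≤ p)
    calc _ = p*(z*y^(p-1)) := by ring
      _ ≤ _ := this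
      _ = _ := by field_simp
  have sub : ∀ y z : ℝ, 0 ≤ y → y ≤ z → z^(p-1) - y^(p-1) ≤ (z-y)^(p-1) := by
    intro y z hy hz
    have := Real.rpow_add_le_add_rpow hy (sub_nonneg.2 hz) (by linarith : 0 ≤ p-1) (by linarith)
    simp at this; linarith
  have pq : ∀ y : ℝ, 0 ≤ y → y^p = y^(p-1)*y := by
    intro y hy
    rw [← Real.rpow_add_one' hy (by linarith)]; congr 1; ring
  set f : ℝ → ℝ := fun y => SignType.sign y * |y|^(p-1) with hf
  have fpos : ∀ y, 0 ≤ y → f y = y^(p-1) := by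
    intro y hy
    rcases eq_or_lt_of_le hy with h | h
    · simp [hf, ← h, Real.zero_rpow (by linarith : p-1 ≠ 0)]
    · simp [hf, sign_pos h, abs_of_pos h]
  have fneg : ∀ y, y ≤ 0 → f y = -((-y)^(p-1)) := by
    intro y hy
    rcases eq_or_lt_of_le hy with h | h
    · simp [hf, h, Real.zero_rpow (by linarith : p-1 ≠ 0)]
    · simp [hf, sign_neg h, abs_of_neg h]
  have mono : ∀ y z : ℝ, 0 ≤ y → y ≤ z → y^(p-1) ≤ z^(p-1) := fun y z h1 h2 =>
    Real.rpow_le_rpow h1 h2 (by linarith)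
  have hol : ∀ y z, y ≤ z → |f z - f y| ≤ 2*(z-y)^(p-1) := by
    intro y z hyz
    have h00 : 0 ≤ (z-y)^(p-1) := Real.rpow_nonneg (by linarith) _
    rcases le_total 0 y with h | h
    · rw [fpos y h, fpos z (h.trans hyz), abs_of_nonneg (sub_nonneg.2 (mono _ _ h hyz))]
      linarith [sub y z h hyz]
    · rcases le_total 0 z with h' | h'
      · rw [fneg y h, fpos z h', abs_of_nonneg]
        · linarith [mono z (z-y) h' (by linarith), mono (-y) (z-y) (by linarith) (by linarith)]
        · linarith [Real.rpow_nonneg h' (p-1), Real.rpow_nonneg (neg_nonneg.2 h) (p-1)]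
      · rw [fneg y h, fneg z h', abs_of_nonneg]
        · have := sub (-z) (-y) (by linarith) (by linarith)
          rw [show -y - -z = z - y by ring] at this; linarith
        · linarith [mono (-z) (-y) (by linarith) (by linarith)]
  have hol' : (f (Q+q) - f Q)*q ≤ 2*|q|^p := by
    have : |f (Q+q) - f Q| ≤ 2*|q|^(p-1) := by
      rcases le_total 0 q with h | h
      · have := hol Q (Q+q) (by linarith); rw [abs_of_nonneg h]; simpa using this
      · have := hol (Q+q) Q (by linarith); rw [abs_of_nonpos h, abs_sub_comm]; simpa using this
    calc _ ≤ |f (Q+q) - f Q| * |q| := by rw [← abs_mul]; exact le_abs_self _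
      _ ≤ 2*|q|^(p-1)*|q| := by gcongr
      _ = _ := by rw [pq _ (abs_nonneg q)]; ring
  have tanh0 : |Q+q| ^ p ≤ |Q|^p + p*f (Q+q)*q := by
    have hy := young |Q+q| |Q| (abs_nonneg _) (abs_nonneg _)
    have h1 : f (Q+q)*(Q+q) = |Q+q|^p := by
      rw [pq _ (abs_nonneg _)]
      rcases le_total 0 (Q+q) with h | h
      · rw [fpos _ h, abs_of_nonneg h]
      · rw [fneg _ h, abs_of_nonpos h]; ring
    have h2 : f (Q+q)*Q ≤ |Q+q|^(p-1)*|Q| := by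
      have h3 : |f (Q+q)| = |Q+q|^(p-1) := by
        rcases le_total 0 (Q+q) with h | h
        · rw [fpos _ h, abs_of_nonneg h, abs_of_nonneg (Real.rpow_nonneg h _)]
        · rw [fneg _ h, abs_neg, abs_of_nonpos h, abs_of_nonneg (Real.rpow_nonneg (by linarith) _)]
      rw [← h3, ← abs_mul]; exact le_abs_self _
    have h3 : f (Q+q)*q = |Q+q|^p - f (Q+q)*Q := by rw [← h1]; ring
    have h4 : p*(f (Q+q)*q) = p*|Q+q|^p - p*(f (Q+q)*Q) := by rw [h3]; ring
    nlinarith [mul_le_mul_of_nonneg_left h2 (by linarith : 0 ≤ p)]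
  have hq0 : 0 ≤ |q|^p := by positivity
  have : p*((f (Q+q) - f Q)*q) ≤ p*(2*|q|^p) := mul_le_mul_of_nonneg_left hol' (by linarith)
  calc _ ≤ _ := tanh0
    _ = |Q|^p + p*f Q*q + p*((f (Q+q) - f Q)*q) := by ring
    _ ≤ |Q|^p + p*f Q*q + 4*|q|^p := by nlinarith

/-- |x^2 - s|^p bounded -/
lemma qp_le {X s ρ : ℝ} (hρ : 0 < ρ) (hs : 0 ≤ s) :
    |X^2 - s|^(1+ρ/2) ≤ |X|^(2+ρ) + s^(1+ρ/2) := by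
  have e1 : (X^2)^(1+ρ/2) = |X|^(2+ρ) := by
    rw [← sq_abs, ← Real.rpow_natCast, ← Real.rpow_mul (abs_nonneg _)]; congr 1; push_cast; ring
  have h0 : 0 ≤ (X^2)^(1+ρ/2) := by positivity
  have h1 : 0 ≤ s^(1+ρ/2) := by positivity
  rw [← e1]
  rcases le_total s (X^2) with h | h
  · rw [abs_of_nonneg (by linarith)]
    linarith [Real.rpow_le_rpow (sub_nonneg.2 h) (by linarith : X^2 - s ≤ X^2) (by linarith : 0 ≤ 1+ρ/2)]
  · rw [abs_of_nonpos (by linarith)]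
    linarith [Real.rpow_le_rpow (by linarith) (by nlinarith [sq_nonneg X] : -(X^2 - s) ≤ s) (by linarith : 0 ≤ 1+ρ/2)]

lemma xs_le {X s ρ : ℝ} (hρ : 0 < ρ) (hs : 0 ≤ s) :
    |X|^ρ * |X^2 - s| ≤ 2*|X|^(2+ρ) + s^(1+ρ/2) := by
  have e1 : |X|^(2+ρ) = |X|^ρ*X^2 := by
    rw [add_comm, Real.rpow_add' (abs_nonneg _) (by linarith)]; congr 1
    norm_cast; exact sq_abs X
  have e3 : |X|^ρ = (X^2)^(ρ/2) := by
    rw [← sq_abs, ← Real.rpow_natCast, ← Real.rpow_mul (abs_nonneg _)]; congr 1; push_cast; ring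
  have e2 : s^(1+ρ/2) = s^(ρ/2)*s := by
    rw [add_comm, Real.rpow_add_one' hs (by linarith)]
  have h0 : 0 ≤ |X|^ρ := by positivity
  have h1 : 0 ≤ s^(ρ/2) := by positivity
  have h2 : |X^2 - s| ≤ X^2 + s := by rw [abs_le]; constructor <;> nlinarith [sq_nonneg X]
  have h3 : |X|^ρ*s ≤ |X|^(2+ρ) + s^(1+ρ/2) := by
    rw [e1, e2]
    rcases le_total s (X^2) with h | h
    · nlinarith
    · have := Real.rpow_le_rpow (sq_nonneg X) h (by linarith : 0 ≤ ρ/2)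
      rw [← e3] at this
      nlinarith [sq_nonneg X]
  calc _ ≤ |X|^ρ*(X^2+s) := by gcongr
    _ = |X|^(2+ρ) + |X|^ρ*s := by rw [e1]; ring
    _ ≤ _ := by linarith

lemma qx_le {y x ρ : ℝ} (hρ : 0 < ρ) (hy : 0 ≤ y) (hx : 0 ≤ x) :
    y^(ρ/2)*x^ρ ≤ (1+x)^(2+ρ)*y^(1+ρ/2) + 1 := by
  have hr : ∀ r : ℝ, (y*(1+x)^2)^(r/2) = y^(r/2)*(1+x)^r := by
    intro r
    rw [Real.mul_rpow hy (by positivity), ← Real.rpow_natCast, ← Real.rpow_mul (by linarith)]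
    congr 2; push_cast; ring
  have h1 := abs_rpow_le_one_add (q := ρ/2) (r := (2+ρ)/2) (t := y*(1+x)^2) (by linarith) (by linarith) (by positivity)
  rw [hr, hr] at h1
  rw [show 1+ρ/2 = (2+ρ)/2 by ring]
  have h2 : x^ρ ≤ (1+x)^ρ := Real.rpow_le_rpow hx (by linarith) hρ.le
  have h3 : 0 ≤ y^(ρ/2) := by positivity
  nlinarith

open MeasureTheory Filter
open scoped Topology ENNReal

noncomputable def sgn (y : ℝ) : ℝ := SignType.sign y

lemma sgn_meas : Measurable sgn := by
  have : sgn = fun y => if 0 < y then 1 else if y < 0 then -1 else 0 := by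
    ext y; unfold sgn; rw [sign_apply]; split_ifs <;> simp
  rw [this]
  exact Measurable.ite measurableSet_Ioi measurable_const
    (Measurable.ite measurableSet_Iio measurable_const measurable_const)

lemma sgn_abs (y : ℝ) : |sgn y| ≤ 1 := by
  unfold sgn; rw [sign_apply]; split_ifs <;> simp

noncomputable def cA0 (p x s Q L K : ℝ) : ℝ :=
  |Q|^p + K*L + p*|Q|^(p-1)*(72*x^(2*p-2)*s^p) + 32*s^p - p*(sgn Q*|Q|^(p-1))*s
noncomputable def cA1 (p a x Q L K : ℝ) : ℝ := a*x*(|Q|^p + K*L)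
noncomputable def cA2 (p a κ x Q L K : ℝ) : ℝ :=
  (a^2/2-κ)*x^2*(|Q|^p + K*L) + p*(sgn Q*|Q|^(p-1))
noncomputable def cA3 (p x Q L K : ℝ) : ℝ :=
  200*x^(2*p)*(|Q|^p + K*L) + 144*p*|Q|^(p-1)*x^(2*p-2) + 32

lemma step_pt {ρ a κ x X s Q L K : ℝ} (hρ : 0 < ρ) (hρ1 : ρ < 1) (ha : 0 ≤ a) (ha1 : a ≤ 1)
    (hκ : a^2/8 ≤ κ) (hκ1 : κ ≤ 1) (hx : 0 ≤ x) (hs : 0 ≤ s) (hL : 0 ≤ L) (hK : 0 ≤ K) :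
    Real.exp (a*(x*X) - κ*(x*X)^2) * (|Q + (X^2 - s)|^(1+ρ/2) + K*L) ≤
      cA0 (1+ρ/2) x s Q L K + cA1 (1+ρ/2) a x Q L K * X + cA2 (1+ρ/2) a κ x Q L K * X^2
        + cA3 (1+ρ/2) x Q L K * |X|^(2+ρ) := by
  set p := 1+ρ/2 with hp
  have hxr : ∀ r : ℝ, |x*X|^r = x^r*|X|^r := fun r => by
    rw [abs_mul, abs_of_nonneg hx, Real.mul_rpow hx (abs_nonneg _)]
  have e8 := expY_le (u := x*X) hκ
  have e2 := expY_two (u := x*X) hρ hρ1 ha ha1 hκ hκ1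
  have ez := expY_zero (u := x*X) hρ hρ1 ha ha1 hκ hκ1
  rw [hxr] at e2 ez
  have hpos := Real.exp_pos (a*(x*X) - κ*(x*X)^2)
  set Y := Real.exp (a*(x*X) - κ*(x*X)^2)
  have hv := vbe (p := p) (Q := Q) (q := X^2-s) (by linarith) (by linarith)
  have hq := qp_le (X := X) hρ hs
  have hxs := xs_le (X := X) hρ hs
  have e2p : 2*p = 2+ρ := by rw [hp]; ring
  have e2p2 : 2*p-2 = ρ := by rw [hp]; ring
  have e3 := (abs_le.1 e2).2
  set U := |Q|^p + K*L with hU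
  have hU0 : 0 ≤ U := by positivity
  have hQ1 : 0 ≤ |Q|^(p-1) := by positivity
  have t1 : Y*U ≤ (1 + a*(x*X) + (a^2/2-κ)*(x*X)^2 + 200*(x^(2+ρ)*|X|^(2+ρ)))*U := by
    gcongr; linarith
  have t2 : Y*(p*(sgn Q*|Q|^(p-1))*(X^2-s)) ≤ p*(sgn Q*|Q|^(p-1))*(X^2-s)
      + p*|Q|^(p-1)*(72*x^ρ*(2*|X|^(2+ρ) + s^p)) := by
    have : (Y-1)*(p*(sgn Q*|Q|^(p-1))*(X^2-s)) ≤ p*|Q|^(p-1)*(72*x^ρ*(2*|X|^(2+ρ) + s^p)) := by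
      calc _ ≤ |(Y-1)*(p*(sgn Q*|Q|^(p-1))*(X^2-s))| := le_abs_self _
        _ = |Y-1| *(p*(|sgn Q| *|Q|^(p-1))*|X^2-s|) := by
            simp only [abs_mul]; rw [abs_of_nonneg (by linarith : 0 ≤ p), abs_of_nonneg hQ1]
        _ ≤ (72*(x^ρ*|X|^ρ)) *(p*(1*|Q|^(p-1))*|X^2-s|) := by
            gcongr
            exact sgn_abs Q
        _ = p*|Q|^(p-1)*(72*x^ρ*(|X|^ρ*|X^2-s|)) := by ring
        _ ≤ _ := by gcongr
    linarith
  have t3 : Y*(4*|X^2-s|^p) ≤ 32*(|X|^(2+ρ)+s^p) := by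
    calc _ ≤ 8*(4*(|X|^(2+ρ)+s^p)) := by gcongr
      _ = _ := by ring
  have t4 : Y*(|Q + (X^2 - s)|^p + K*L) ≤ Y*U + Y*(p*(sgn Q*|Q|^(p-1))*(X^2-s)) + Y*(4*|X^2-s|^p) := by
    rw [← mul_add, ← mul_add]
    refine mul_le_mul_of_nonneg_left ?_ hpos.le
    unfold sgn; rw [hU]; linarith
  unfold cA0 cA1 cA2 cA3
  rw [e2p2, e2p, ← hU]
  nlinarith [t1, t2, t3, t4]

set_option maxHeartbeats 800000 in
lemma step_pt2 {ρ a κ x s m Q L c : ℝ} (hρ : 0 < ρ) (hρ1 : ρ < 1) (ha : 0 ≤ a) (ha1 : a ≤ 1)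
    (hκ : a^2/8 ≤ κ) (hκ1 : κ ≤ 1) (hx : 0 ≤ x) (hs : 0 ≤ s) (hL : 0 ≤ L)
    (hsx : x^2*s ≤ 1) (hsm : s^(1+ρ/2) ≤ m) (hc : c = 2000*(1+x)^(2+ρ)) :
    Real.exp (-((a^2/2-κ)*x^2*s) - c*m) * (cA0 (1+ρ/2) x s Q L 2000
      + cA2 (1+ρ/2) a κ x Q L 2000 * s + cA3 (1+ρ/2) x Q L 2000 * m) ≤
      |Q|^(1+ρ/2) + 2000*(L+m) := by
  have hm : 0 ≤ m := le_trans (by positivity) hsm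
  set p := 1+ρ/2 with hp
  have e2p : 2*p = 2+ρ := by rw [hp]; ring
  have e2p2 : 2*p-2 = ρ := by rw [hp]; ring
  have ep1 : p-1 = ρ/2 := by rw [hp]; ring
  set D := (a^2/2-κ)*x^2*s with hD
  have hqx := qx_le (y := |Q|) hρ (abs_nonneg Q) hx
  rw [← hp, ← ep1] at hqx
  have hD1 : |D| ≤ 1 := by
    have : |a^2/2-κ| ≤ 1 := by
      have h0 : a^2 ≤ 1 := pow_le_one₀ ha ha1
      have h0' := sq_nonneg a
      rw [abs_le]; constructor <;> linarith
    rw [hD, mul_assoc, abs_mul, abs_of_nonneg (by positivity : 0 ≤ x^2*s)]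
    exact mul_le_one₀ this (by positivity) hsx
  have hED : 1 ≤ 3*Real.exp D := by
    have h1 : Real.exp (-1) ≤ Real.exp D := Real.exp_le_exp.2 (abs_le.1 hD1).1
    have h2 : Real.exp (-1) * Real.exp 1 = 1 := by rw [← Real.exp_add]; simp
    nlinarith [Real.exp_one_lt_d9, Real.exp_pos (-1)]
  set U := |Q|^p + 2000*L with hU
  have hQp : 0 ≤ |Q|^p := by positivity
  have hU0 : 0 ≤ U := by positivity
  set w := (1+x)^(2+ρ) with hw
  have hw0 : 0 ≤ w := by positivity
  have hxw : x^(2+ρ) ≤ w := Real.rpow_le_rpow hx (by linarith) (by linarith)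
  set y := |Q|^(p-1)*x^ρ with hy
  have hy0 : 0 ≤ y := by positivity
  -- expand
  have hexp : cA0 p x s Q L 2000 + cA2 p a κ x Q L 2000 * s + cA3 p x Q L 2000 * m
      = U*(1 + D + 200*x^(2+ρ)*m) + p*y*(72*s^p+144*m) + 32*s^p + 32*m := by
    unfold cA0 cA2 cA3; rw [e2p2, e2p, ← hU, hy, hD]; ring
  have h1 : U*(1 + D + 200*x^(2+ρ)*m) ≤ U*(1 + D + 200*w*m) := by gcongr
  have h2 : p*y*(72*s^p+144*m) ≤ 432*(w*|Q|^p+1)*m := by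
    calc _ ≤ 2*(w*|Q|^p+1)*(72*m+144*m) := by
          gcongr
          · linarith
      _ = _ := by ring
  have h3 : U*(1 + D + 200*w*m) + 432*(w*|Q|^p+1)*m + 64*m ≤
      U*(1+D+632*w*m) + 496*m := by
    have : w*|Q|^p*m ≤ w*U*m := by
      have : |Q|^p ≤ U := by rw [hU]; linarith
      gcongr
    (first | linarith | nlinarith)
  have h4 : 1+D+632*w*m ≤ Real.exp D * Real.exp (2000*w*m) := by
    have a1 := Real.add_one_le_exp D
    have a2 := Real.add_one_le_exp (2000*w*m)
    have a3 : 632*(w*m) ≤ 2000*(w*m)*Real.exp D := by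
      have : 0 ≤ w*m := by positivity
      linarith [mul_le_mul_of_nonneg_left hED this]
    linarith [mul_le_mul_of_nonneg_left a2 (Real.exp_pos D).le]
  have h5 : 496*m ≤ 2000*m*(Real.exp D * Real.exp (2000*w*m)) := by
    have a1 : 1 ≤ Real.exp (2000*w*m) := Real.one_le_exp (by positivity)
    have a2 : Real.exp D ≤ Real.exp D * Real.exp (2000*w*m) := le_mul_of_one_le_right (Real.exp_pos _).le a1
    linarith [mul_le_mul_of_nonneg_left a2 hm, mul_le_mul_of_nonneg_left hED hm]
  have h6 : cA0 p x s Q L 2000 + cA2 p a κ x Q L 2000 * s + cA3 p x Q L 2000 * m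
      ≤ (Real.exp D * Real.exp (2000*w*m)) * (U + 2000*m) := by
    rw [hexp]
    have h7 := mul_le_mul_of_nonneg_left h4 hU0
    have h8 : (Real.exp D * Real.exp (2000*w*m)) * (U + 2000*m) =
      U * (Real.exp D * Real.exp (2000*w*m)) + 2000*m*(Real.exp D * Real.exp (2000*w*m)) := by ring
    rw [h8]
    linarith
  calc _ ≤ Real.exp (-D - c*m) * ((Real.exp D * Real.exp (2000*w*m)) * (U + 2000*m)) :=
        mul_le_mul_of_nonneg_left h6 (Real.exp_pos _).le
    _ = Real.exp ((-D - c*m) + (D + 2000*w*m)) * (U+2000*m) := by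
        rw [Real.exp_add (-D-c*m), Real.exp_add D]; ring
    _ = U + 2000*m := by
        rw [hc, show (-D - 2000*w*m) + (D + 2000*w*m) = 0 by ring]; simp
    _ = _ := by rw [hU]; ring

open MeasureTheory Filter
open scoped Topology ENNReal

/-- measurable and bounded on a set -/
def LB {Ω : Type} (m : MeasurableSpace Ω) (A : Set Ω) (U : Ω → ℝ) : Prop :=
  Measurable[m] U ∧ ∃ B : ℝ, ∀ ω ∈ A, |U ω| ≤ B

namespace LB
variable {Ω : Type} {m : MeasurableSpace Ω} {A : Set Ω} {U V : Ω → ℝ}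

lemma add (hU : LB m A U) (hV : LB m A V) : LB m A (fun ω => U ω + V ω) := by
  obtain ⟨h1, B, hB⟩ := hU
  obtain ⟨h2, D, hD⟩ := hV
  exact ⟨h1.add h2, B + D, fun ω hω => (abs_add_le _ _).trans (add_le_add (hB ω hω) (hD ω hω))⟩

lemma mul (hU : LB m A U) (hV : LB m A V) : LB m A (fun ω => U ω * V ω) := by
  obtain ⟨h1, B, hB⟩ := hU
  obtain ⟨h2, D, hD⟩ := hV
  refine ⟨h1.mul h2, B * D, fun ω hω => ?_⟩
  rw [abs_mul]
  exact mul_le_mul (hB ω hω) (hD ω hω) (abs_nonneg _) ((abs_nonneg _).trans (hB ω hω))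

lemma const (c : ℝ) : LB m A (fun _ => c) := ⟨measurable_const, |c|, fun _ _ => le_rfl⟩

lemma neg (hU : LB m A U) : LB m A (fun ω => - U ω) := by
  simpa using (const (-1)).mul hU

lemma sub (hU : LB m A U) (hV : LB m A V) : LB m A (fun ω => U ω - V ω) := by
  simpa [sub_eq_add_neg] using hU.add hV.neg

lemma comp (hU : LB m A U) {g : ℝ → ℝ} (hg : Continuous g) : LB m A (fun ω => g (U ω)) := by
  obtain ⟨h1, B, hB⟩ := hU
  obtain ⟨D, hD⟩ := (isCompact_Icc (a := -B) (b := B)).exists_bound_of_continuousOn hg.continuousOn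
  exact ⟨hg.measurable.comp h1, D, fun ω hω => hD _ (abs_le.1 (hB ω hω))⟩

lemma abs_rpow (hU : LB m A U) {r : ℝ} (hr : 0 ≤ r) : LB m A (fun ω => |U ω|^r) :=
  hU.comp (g := fun y => |y|^r) (continuous_abs.rpow_const fun _ => Or.inr hr)

lemma sgn (hU : LB m A U) : LB m A (fun ω => _root_.sgn (U ω)) :=
  ⟨sgn_meas.comp hU.1, 1, fun _ _ => sgn_abs _⟩

lemma of_BM (hU : BM m U) : LB m A U := ⟨hU.1, hU.2.choose, fun ω _ => hU.2.choose_spec ω⟩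

lemma ind (hU : LB m A U) (hA : MeasurableSet[m] A) : BM m (A.indicator U) := by
  obtain ⟨h1, B, hB⟩ := hU
  refine ⟨Measurable.indicator (m := m) h1 hA, |B|, fun ω => ?_⟩
  by_cases h : ω ∈ A
  · rw [Set.indicator_of_mem h]; exact (hB ω h).trans (le_abs_self _)
  · rw [Set.indicator_of_notMem h]; simp

end LB

section
variable {Ω : Type} [mΩ : MeasurableSpace Ω] {P : Measure Ω} [IsProbabilityMeasure P] {n : ℕ}
    {F : ℕ → MeasurableSpace Ω} {X s m : ℕ → Ω → ℝ} {ρ γ e δ : ℝ}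

lemma Core.poly_int (h : Core P n F X s m ρ γ e δ) (k : ℕ) {A0 A1 A2 A3 : Ω → ℝ}
    (h0 : BM (F k) A0) (h1 : BM (F k) A1) (h2 : BM (F k) A2) (h3 : BM (F k) A3) :
    Integrable (fun ω => A0 ω + A1 ω * X k ω + A2 ω * (X k ω)^2 + A3 ω * |X k ω|^(2+ρ)) P ∧
    Integrable (fun ω => A0 ω + A2 ω * s k ω + A3 ω * m k ω) P ∧
    ∫ ω, (A0 ω + A1 ω * X k ω + A2 ω * (X k ω)^2 + A3 ω * |X k ω|^(2+ρ)) ∂P =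
      ∫ ω, (A0 ω + A2 ω * s k ω + A3 ω * m k ω) ∂P := by
  have i0 : Integrable A0 P := h0.integrable (h.le k)
  have i1 : Integrable (fun ω => A1 ω * X k ω) P := h1.integrable_mul (h.le k) (h.i1 k)
  have i2 : Integrable (fun ω => A2 ω * (X k ω)^2) P := h2.integrable_mul (h.le k) (h.i2 k)
  have i3 : Integrable (fun ω => A3 ω * |X k ω|^(2+ρ)) P := h3.integrable_mul (h.le k) (h.i3 k)
  have j2 : Integrable (fun ω => A2 ω * s k ω) P := (h2.mul (h.bms k)).integrable (h.le k)
  have j3 : Integrable (fun ω => A3 ω * m k ω) P := (h3.mul (h.bmm k)).integrable (h.le k)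
  have i01 : Integrable (fun ω => A0 ω + A1 ω * X k ω) P := i0.add i1
  have i012 : Integrable (fun ω => A0 ω + A1 ω * X k ω + A2 ω * (X k ω)^2) P := i01.add i2
  have j02 : Integrable (fun ω => A0 ω + A2 ω * s k ω) P := i0.add j2
  refine ⟨i012.add i3, j02.add j3, ?_⟩
  rw [integral_add i012 i3, integral_add i01 i2, integral_add i0 i1, integral_add j02 j3,
    integral_add i0 j2]
  rw [ce_int (h.le k) h1.1 (h.i1 k) i1 (h.c1 k), ce_int (h.le k) h2.1 (h.i2 k) i2 (h.c2 k),
    ce_int (h.le k) h3.1 (h.i3 k) i3 (h.c3 k)]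
  simp

noncomputable def EE (X s m : ℕ → Ω → ℝ) (ρ a κ x : ℝ) (k : ℕ) (ω : Ω) : ℝ :=
  Real.exp (a*x*SX X k ω - κ*x^2*VX X k ω - (a^2/2-κ)*x^2*SX s k ω
    - 2000*(1+x)^(2+ρ)*SX m k ω)

noncomputable def RRk (X s m : ℕ → Ω → ℝ) (ρ e a κ x : ℝ) (L : ℝ) (k : ℕ) : Ω → ℝ :=
  Set.indicator {ω | VX X k ω ≤ L} (fun ω => EE X s m ρ a κ x k ω *
    (|VX X k ω - SX s k ω|^(1+ρ/2) + 2000*(e - SX m k ω)))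

lemma VX_succ (k : ℕ) (ω : Ω) : VX X (k+1) ω = VX X k ω + (X k ω)^2 := by
  unfold VX; rw [Finset.sum_range_succ]
lemma SX_succ (k : ℕ) (ω : Ω) : SX X (k+1) ω = SX X k ω + X k ω := by
  unfold SX; rw [Finset.sum_range_succ]
lemma VX_nonneg (k : ℕ) (ω : Ω) : 0 ≤ VX X k ω := Finset.sum_nonneg fun _ _ => sq_nonneg _
lemma SX_le_VX (k : ℕ) (ω : Ω) : |SX X k ω| ≤ k + VX X k ω := by
  unfold SX VX
  calc _ ≤ ∑ j ∈ Finset.range k, |X j ω| := Finset.abs_sum_le_sum_abs _ _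
    _ ≤ ∑ j ∈ Finset.range k, (1 + (X j ω)^2) := Finset.sum_le_sum fun j _ => by
        rw [← sq_abs]; nlinarith [sq_nonneg (|X j ω| - 1)]
    _ = _ := by rw [Finset.sum_add_distrib]; simp

lemma Core.SX_meas (h : Core P n F X s m ρ γ e δ) (k : ℕ) : Measurable[F k] (SX X k) := by
  unfold SX
  exact Finset.measurable_sum _ fun j hj => (h.Xm j).mono (h.mono (Finset.mem_range.1 hj)) le_rfl
lemma Core.VX_meas (h : Core P n F X s m ρ γ e δ) (k : ℕ) : Measurable[F k] (VX X k) := by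
  unfold VX
  exact Finset.measurable_sum _ fun j hj =>
    ((h.Xm j).mono (h.mono (Finset.mem_range.1 hj)) le_rfl).pow_const 2
lemma Core.Ss_meas (h : Core P n F X s m ρ γ e δ) (k : ℕ) : Measurable[F k] (SX s (k+1)) := by
  unfold SX
  exact Finset.measurable_sum _ fun j hj => (h.sm j).mono (h.mono (by
    have := Finset.mem_range.1 hj; omega)) le_rfl
lemma Core.Sm_meas (h : Core P n F X s m ρ γ e δ) (k : ℕ) : Measurable[F k] (SX m (k+1)) := by
  unfold SX
  exact Finset.measurable_sum _ fun j hj => (h.mm j).mono (h.mono (by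
    have := Finset.mem_range.1 hj; omega)) le_rfl
lemma Core.Ss_meas' (h : Core P n F X s m ρ γ e δ) (k : ℕ) : Measurable[F k] (SX s k) := by
  unfold SX
  exact Finset.measurable_sum _ fun j hj => (h.sm j).mono (h.mono (Finset.mem_range.1 hj).le) le_rfl
lemma Core.Sm_meas' (h : Core P n F X s m ρ γ e δ) (k : ℕ) : Measurable[F k] (SX m k) := by
  unfold SX
  exact Finset.measurable_sum _ fun j hj => (h.mm j).mono (h.mono (Finset.mem_range.1 hj).le) le_rfl
lemma Core.Ss_bd (h : Core P n F X s m ρ γ e δ) (k : ℕ) (ω : Ω) :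
    0 ≤ SX s k ω ∧ SX s k ω ≤ 1 + δ^2 := ⟨Finset.sum_nonneg fun j _ => h.s0 j ω, h.sT k ω⟩
lemma Core.Sm_bd (h : Core P n F X s m ρ γ e δ) (k : ℕ) (ω : Ω) :
    0 ≤ SX m k ω ∧ SX m k ω ≤ e := ⟨Finset.sum_nonneg fun j _ => h.m0 j ω, h.mT k ω⟩

lemma Core.RR_step (h : Core P n F X s m ρ γ e δ) {a κ x L : ℝ} (ha : 0 ≤ a) (ha1 : a ≤ 1)
    (hκ : a^2/8 ≤ κ) (hκ1 : κ ≤ 1) (hx : 0 ≤ x) (hxγ : x * γ ≤ 1) (k : ℕ) :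
    Integrable (RRk X s m ρ e a κ x L k) P ∧
    ∫ ω, RRk X s m ρ e a κ x L (k+1) ω ∂P ≤ ∫ ω, RRk X s m ρ e a κ x L k ω ∂P := by
  have hρ := h.hρ
  have hρ1 := h.hρ1
  set A : Set Ω := {ω | VX X k ω ≤ L} with hA
  have hAm : MeasurableSet[F k] A := measurableSet_le (h.VX_meas k) measurable_const
  have lV : LB (F k) A (VX X k) := ⟨h.VX_meas k, L, fun ω hω => by
    rw [abs_of_nonneg (VX_nonneg k ω)]; exact hω⟩
  have lS : LB (F k) A (SX X k) := ⟨h.SX_meas k, k + L, fun ω hω =>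
    (SX_le_VX k ω).trans (by have : VX X k ω ≤ L := hω
                             linarith)⟩
  have ls : LB (F k) A (SX s k) := ⟨h.Ss_meas' k, 1+δ^2, fun ω _ => by
    rw [abs_of_nonneg (h.Ss_bd k ω).1]; exact (h.Ss_bd k ω).2⟩
  have lm : LB (F k) A (SX m k) := ⟨h.Sm_meas' k, e, fun ω _ => by
    rw [abs_of_nonneg (h.Sm_bd k ω).1]; exact (h.Sm_bd k ω).2⟩
  have lm' : LB (F k) A (SX m (k+1)) := ⟨h.Sm_meas k, e, fun ω _ => by
    rw [abs_of_nonneg (h.Sm_bd (k+1) ω).1]; exact (h.Sm_bd (k+1) ω).2⟩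
  have lsk : LB (F k) A (s k) := LB.of_BM (h.bms k)
  have lmk : LB (F k) A (m k) := LB.of_BM (h.bmm k)
  have lE : LB (F k) A (EE X s m ρ a κ x k) :=
    (((((LB.const (a*x)).mul lS).sub ((LB.const (κ*x^2)).mul lV)).sub
      ((LB.const ((a^2/2-κ)*x^2)).mul ls)).sub
      ((LB.const (2000*(1+x)^(2+ρ))).mul lm)).comp Real.continuous_exp
  have lQ : LB (F k) A (fun ω => VX X k ω - SX s k ω) := lV.sub ls
  have lQp : LB (F k) A (fun ω => |VX X k ω - SX s k ω|^(1+ρ/2)) := lQ.abs_rpow (by linarith)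
  have lQp1 : LB (F k) A (fun ω => |VX X k ω - SX s k ω|^(1+ρ/2-1)) := lQ.abs_rpow (by linarith)
  have lR : LB (F k) A (fun ω => EE X s m ρ a κ x k ω *
    (|VX X k ω - SX s k ω|^(1+ρ/2) + 2000*(e - SX m k ω))) :=
    lE.mul (lQp.add ((LB.const 2000).mul ((LB.const e).sub lm)))
  refine ⟨(lR.ind hAm).integrable (h.le k), ?_⟩
  -- coefficients
  set W : Ω → ℝ := fun ω => EE X s m ρ a κ x k ω *
    Real.exp (-((a^2/2-κ)*x^2*s k ω) - 2000*(1+x)^(2+ρ)*m k ω) with hW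
  have lW : LB (F k) A W := lE.mul ((((LB.const ((a^2/2-κ)*x^2)).mul lsk).neg.sub
    ((LB.const (2000*(1+x)^(2+ρ))).mul lmk)).comp Real.continuous_exp)
  have lsp : LB (F k) A (fun ω => (s k ω)^(1+ρ/2)) :=
    lsk.comp (g := fun y => y^(1+ρ/2)) (Real.continuous_rpow_const (by linarith))
  have lL : LB (F k) A (fun ω => e - SX m (k+1) ω) := (LB.const e).sub lm'
  have lU : LB (F k) A (fun ω => |VX X k ω - SX s k ω|^(1+ρ/2) + 2000*(e - SX m (k+1) ω)) :=
    lQp.add ((LB.const 2000).mul lL)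
  have l0 : LB (F k) A (fun ω => W ω * cA0 (1+ρ/2) x (s k ω) (VX X k ω - SX s k ω)
      (e - SX m (k+1) ω) 2000) :=
    lW.mul (((lU.add (((LB.const (1+ρ/2)).mul lQp1).mul
      ((LB.const (72*x^(2*(1+ρ/2)-2))).mul lsp))).add ((LB.const 32).mul lsp)).sub
      (((LB.const (1+ρ/2)).mul (lQ.sgn.mul lQp1)).mul lsk))
  have l1 : LB (F k) A (fun ω => W ω * cA1 (1+ρ/2) a x (VX X k ω - SX s k ω)
      (e - SX m (k+1) ω) 2000) := lW.mul ((LB.const (a*x)).mul lU)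
  have l2 : LB (F k) A (fun ω => W ω * cA2 (1+ρ/2) a κ x (VX X k ω - SX s k ω)
      (e - SX m (k+1) ω) 2000) := lW.mul (((LB.const ((a^2/2-κ)*x^2)).mul lU).add
        ((LB.const (1+ρ/2)).mul (lQ.sgn.mul lQp1)))
  have l3 : LB (F k) A (fun ω => W ω * cA3 (1+ρ/2) x (VX X k ω - SX s k ω)
      (e - SX m (k+1) ω) 2000) := lW.mul ((((LB.const (200*x^(2*(1+ρ/2)))).mul lU).add
        (((LB.const (144*(1+ρ/2))).mul lQp1).mul (LB.const (x^(2*(1+ρ/2)-2))))).add (LB.const 32))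
  obtain ⟨I1, I2, I3⟩ := h.poly_int k (l0.ind hAm) (l1.ind hAm) (l2.ind hAm) (l3.ind hAm)
  have hE0 : ∀ k ω, 0 < EE X s m ρ a κ x k ω := fun k ω => Real.exp_pos _
  have hR0 : ∀ ω, 0 ≤ RRk X s m ρ e a κ x L (k+1) ω := by
    intro ω
    refine Set.indicator_nonneg (fun ω _ => ?_) ω
    have := (hE0 (k+1) ω).le
    have := (h.Sm_bd (k+1) ω).2
    have : 0 ≤ 2000*(e - SX m (k+1) ω) := by linarith
    positivity
  calc _ ≤ _ := integral_mono_of_nonneg (ae_of_all _ hR0) I1 (ae_of_all _ fun ω => ?_)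
    _ = _ := I3
    _ ≤ _ := integral_mono I2 ((lR.ind hAm).integrable (h.le k)) fun ω => ?_
  · by_cases hω : ω ∈ A
    · simp only [Set.indicator_of_mem hω]
      have hpt := step_pt (X := X k ω) (s := s k ω) (Q := VX X k ω - SX s k ω)
        (L := e - SX m (k+1) ω) (K := 2000) hρ hρ1 ha ha1 hκ hκ1 hx (h.s0 k ω)
        (by linarith [(h.Sm_bd (k+1) ω).2]) (by norm_num)
      have hWp : 0 < W ω := mul_pos (hE0 k ω) (Real.exp_pos _)
      have hU0 : 0 ≤ |VX X (k+1) ω - SX s (k+1) ω|^(1+ρ/2) + 2000*(e - SX m (k+1) ω) := by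
        have := (h.Sm_bd (k+1) ω).2
        have : 0 ≤ 2000*(e - SX m (k+1) ω) := by linarith
        positivity
      calc RRk X s m ρ e a κ x L (k+1) ω ≤ EE X s m ρ a κ x (k+1) ω *
          (|VX X (k+1) ω - SX s (k+1) ω|^(1+ρ/2) + 2000*(e - SX m (k+1) ω)) := by
            exact Set.indicator_le_self' (fun _ _ => mul_nonneg (hE0 _ _).le hU0) ω
        _ = W ω * (Real.exp (a*(x*X k ω) - κ*(x*X k ω)^2) *
            (|VX X k ω - SX s k ω + ((X k ω)^2 - s k ω)|^(1+ρ/2) + 2000*(e - SX m (k+1) ω))) := by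
            rw [← mul_assoc]
            congr 1
            · rw [hW]; unfold EE; simp only [VX_succ, SX_succ]
              rw [← Real.exp_add, ← Real.exp_add]; congr 1; ring
            · simp only [VX_succ, SX_succ]; congr 3; ring
        _ ≤ W ω * _ := mul_le_mul_of_nonneg_left hpt hWp.le
        _ = _ := by ring
    · have : RRk X s m ρ e a κ x L (k+1) ω = 0 := by
        refine Set.indicator_of_notMem (fun h' => hω ?_) _
        have h' : VX X (k+1) ω ≤ L := h'
        rw [VX_succ] at h'
        show VX X k ω ≤ L
        nlinarith [sq_nonneg (X k ω)]
      simp only [Set.indicator_of_notMem hω, this]; simp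
  · by_cases hω : ω ∈ A
    · simp only [Set.indicator_of_mem hω, hW]
      have hsx : x^2 * s k ω ≤ 1 := by
        have := h.sγ k ω
        calc x^2 * s k ω ≤ x^2*γ^2 := by gcongr
          _ = (x*γ)^2 := by ring
          _ ≤ 1 := by have := mul_nonneg hx h.γ0.le; nlinarith
      have hpt := step_pt2 (Q := VX X k ω - SX s k ω)
        (L := e - SX m (k+1) ω) hρ hρ1 ha ha1 hκ hκ1 hx (h.s0 k ω)
        (by linarith [(h.Sm_bd (k+1) ω).2]) hsx (h.sp k ω) rfl
      have := mul_le_mul_of_nonneg_left hpt (hE0 k ω).le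
      rw [SX_succ, show e - (SX m k ω + m k ω) + m k ω = e - SX m k ω by ring] at this
      simp only [SX_succ]
      refine le_trans (le_of_eq ?_) this
      ring
    · simp only [Set.indicator_of_notMem hω]; simp

lemma Core.RR_bound (h : Core P n F X s m ρ γ e δ) {a κ x L : ℝ} (ha : 0 ≤ a) (ha1 : a ≤ 1)
    (hκ : a^2/8 ≤ κ) (hκ1 : κ ≤ 1) (hx : 0 ≤ x) (hxγ : x * γ ≤ 1) (k : ℕ) :
    ∫ ω, RRk X s m ρ e a κ x L k ω ∂P ≤ 2000 * e := by
  have he := h.e0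
  induction k with
  | zero =>
    calc _ ≤ ∫ ω, (2000 * e) ∂P := by
          refine integral_mono (h.RR_step ha ha1 hκ hκ1 hx hxγ 0).1 (integrable_const _) fun ω => ?_
          unfold RRk
          refine Set.indicator_apply_le' (fun _ => ?_) (fun _ => by positivity)
          have : (0:ℝ)^(1+ρ/2) = 0 := Real.zero_rpow (by linarith [h.hρ])
          simp [EE, VX, SX, this]
      _ = _ := by simp
  | succ k ih => exact (h.RR_step ha ha1 hκ hκ1 hx hxγ k).2.trans ih

/-- Markov step -/
lemma Core.tail_gen (h : Core P n F X s m ρ γ e δ) {a κ x L g τ : ℝ} (ha : 0 ≤ a) (ha1 : a ≤ 1)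
    (hκ : a^2/8 ≤ κ) (hκ1 : κ ≤ 1) (hx : 0 ≤ x) (hxγ : x * γ ≤ 1) (hτ : 0 < τ)
    (B : Set Ω) (hB : ∀ ω ∈ B, VX X n ω ≤ L ∧ τ ≤ |VX X n ω - SX s n ω| ∧
      g ≤ a*x*SX X n ω - κ*x^2*VX X n ω) :
    P.real B ≤ 2000 * e * τ^(-(1+ρ/2)) *
      Real.exp ((a^2/2-κ)*x^2 - g + x^2*δ^2 + 2000*(1+x)^(2+ρ)*e) := by
  have hρ := h.hρ
  set K := (a^2/2-κ)*x^2 - g + x^2*δ^2 + 2000*(1+x)^(2+ρ)*e with hK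
  have hI := (h.RR_step ha ha1 hκ hκ1 hx hxγ (L := L) n).1
  have hb := h.RR_bound ha ha1 hκ hκ1 hx hxγ (L := L) n
  have h0 : 0 ≤ᵐ[P] RRk X s m ρ e a κ x L n := ae_of_all _ fun ω => by
    refine Set.indicator_nonneg (fun ω _ => ?_) ω
    have : 0 < EE X s m ρ a κ x n ω := Real.exp_pos _
    have := (h.Sm_bd n ω).2
    have : 0 ≤ 2000*(e - SX m n ω) := by linarith
    positivity
  have hmk := mul_meas_ge_le_integral_of_nonneg h0 hI (Real.exp (-K) * τ^(1+ρ/2))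
  have hsub : B ≤ᵐ[P] {ω | Real.exp (-K) * τ^(1+ρ/2) ≤ RRk X s m ρ e a κ x L n ω} := by
    filter_upwards [h.sT'] with ω hs hω
    obtain ⟨h1, h2, h3⟩ := hB ω hω
    show Real.exp (-K) * τ^(1+ρ/2) ≤ RRk X s m ρ e a κ x L n ω
    unfold RRk
    rw [Set.indicator_of_mem (show ω ∈ {ω | VX X n ω ≤ L} from h1)]
    have hm := h.Sm_bd n ω
    have hss : |SX s n ω - 1| ≤ δ^2 := by
      have := (h.Ss_bd n ω).2
      have hs : 1 - δ^2 ≤ SX s n ω := hs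
      rw [abs_le]; constructor <;> linarith
    have hd : (a^2/2-κ)*x^2*SX s n ω ≤ (a^2/2-κ)*x^2 + x^2*δ^2 := by
      have h4 : |a^2/2-κ| ≤ 1 := by rw [abs_le]; constructor <;> nlinarith
      have h5 : (a^2/2-κ)*(SX s n ω - 1) ≤ δ^2 := by
        calc _ ≤ |(a^2/2-κ)*(SX s n ω - 1)| := le_abs_self _
          _ = |a^2/2-κ| * |SX s n ω - 1| := abs_mul _ _
          _ ≤ 1 * δ^2 := by gcongr
          _ = _ := one_mul _
      nlinarith [mul_le_mul_of_nonneg_left h5 (sq_nonneg x)]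
    have hc : 2000*(1+x)^(2+ρ)*SX m n ω ≤ 2000*(1+x)^(2+ρ)*e := by
      have := hm.2
      gcongr
    unfold EE
    have h6 : 0 ≤ 2000*(e - SX m n ω) := by linarith
    have h7 : τ^(1+ρ/2) ≤ |VX X n ω - SX s n ω|^(1+ρ/2) := by gcongr
    apply mul_le_mul (Real.exp_le_exp.2 _) (by linarith) (by positivity) (by positivity)
    rw [hK]; linarith
  have h8 : P.real B ≤ P.real {ω | Real.exp (-K) * τ^(1+ρ/2) ≤ RRk X s m ρ e a κ x L n ω} :=
    ENNReal.toReal_mono (measure_ne_top _ _) (measure_mono_ae hsub)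
  have h9 : Real.exp (-K) * τ^(1+ρ/2) * P.real B ≤ 2000*e :=
    le_trans (mul_le_mul_of_nonneg_left h8 (by positivity)) (hmk.trans hb)
  calc P.real B = (Real.exp (-K) * τ^(1+ρ/2) * P.real B) * (τ^(-(1+ρ/2)) * Real.exp K) := by
        rw [Real.exp_neg, Real.rpow_neg hτ.le]
        have : τ^(1+ρ/2) ≠ 0 := by positivity
        have := (Real.exp_pos K).ne'
        field_simp
    _ ≤ 2000*e * (τ^(-(1+ρ/2)) * Real.exp K) := by gcongr
    _ = _ := by ring
end

open MeasureTheory Filter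
open scoped Topology ENNReal

section
variable {Ω : Type} [mΩ : MeasurableSpace Ω] {P : Measure Ω} [IsProbabilityMeasure P] {n : ℕ}
    {F : ℕ → MeasurableSpace Ω} {X s m : ℕ → Ω → ℝ} {ρ γ e δ : ℝ}

lemma real_iUnion_geom (B : ℕ → Set Ω) (K : ℝ) (hK : 0 ≤ K)
    (hB : ∀ j, P.real (B j) ≤ K * (1/2)^j) : P.real (⋃ j, B j) ≤ 2 * K := by
  have hs : Summable fun j : ℕ => K * (1/2 : ℝ)^j := summable_geometric_two.mul_left K
  have h1 : P (⋃ j, B j) ≤ ENNReal.ofReal (2 * K) := by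
    calc _ ≤ ∑' j, P (B j) := measure_iUnion_le _
      _ ≤ ∑' j, ENNReal.ofReal (K * (1/2)^j) := ENNReal.tsum_le_tsum fun j =>
          (ENNReal.le_ofReal_iff_toReal_le (measure_ne_top _ _) (by positivity)).2 (hB j)
      _ = ENNReal.ofReal (∑' j : ℕ, K * (1/2)^j) :=
          (ENNReal.ofReal_tsum_of_nonneg (fun j => by positivity) hs).symm
      _ = _ := by rw [tsum_mul_left, tsum_geometric_two, mul_comm]
  exact ENNReal.toReal_le_of_le_ofReal (by positivity) h1

set_option maxHeartbeats 1000000 in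
lemma Core.tail (h : Core P n F X s m ρ γ e δ) {x τ : ℝ} (hx : 0 ≤ x) (hxγ : x * γ ≤ 1)
    (hτ : 0 < τ) (hτ1 : τ ≤ 1) :
    P.real {ω | x * √(VX X n ω) ≤ SX X n ω ∧ τ ≤ |VX X n ω - SX s n ω|} ≤
      10000 * e * τ^(-(1+ρ/2)) * Real.exp (- x^2/2 + x^2*δ^2 + 2000*(1+x)^(2+ρ)*e) := by
  have hρ := h.hρ
  have he := h.e0
  set T := τ^(-(1+ρ/2)) with hT
  have hT0 : 0 < T := by positivity
  have hT1 : 1 ≤ T := Real.one_le_rpow_of_pos_of_le_one_of_nonpos hτ hτ1 (by linarith)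
  set E := Real.exp (- x^2/2 + x^2*δ^2 + 2000*(1+x)^(2+ρ)*e) with hE
  have hE0 : 0 < E := Real.exp_pos _
  set B0 : Set Ω := {ω | x * √(VX X n ω) ≤ SX X n ω ∧ τ ≤ |VX X n ω - SX s n ω| ∧ VX X n ω ≤ 1}
  set B1 : Set Ω := {ω | x * √(VX X n ω) ≤ SX X n ω ∧ τ ≤ |VX X n ω - SX s n ω| ∧ 1 ≤ VX X n ω ∧
    VX X n ω ≤ 4}
  set BB : ℕ → Set Ω := fun j => {ω | x * √(VX X n ω) ≤ SX X n ω ∧ 4^(j+1) ≤ VX X n ω ∧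
    VX X n ω ≤ 4^(j+2)}
  have b0 : P.real B0 ≤ 2000*e*T*E := by
    refine (h.tail_gen (a := 1) (κ := 1) (L := 1) (g := 0) (τ := τ) (by norm_num) (by norm_num)
      (by norm_num) le_rfl hx hxγ hτ B0 ?_).trans (le_of_eq ?_)
    · rintro ω ⟨h1, h2, h3⟩
      refine ⟨h3, h2, ?_⟩
      have hv := VX_nonneg (X := X) n ω
      have h4 := Real.sq_sqrt hv
      have h5 : √(VX X n ω) ≤ 1 := by rw [Real.sqrt_le_left (by norm_num)]; linarith
      have h6 := Real.sqrt_nonneg (VX X n ω)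
      set v := √(VX X n ω)
      rw [← h4]
      have : x*(x*v) ≤ x * SX X n ω := mul_le_mul_of_nonneg_left h1 hx
      nlinarith [mul_nonneg (sq_nonneg x) (mul_nonneg h6 (sub_nonneg.2 h5))]
    · rw [hE]; congr 2; ring
  have b1 : P.real B1 ≤ 2000*e*T*E := by
    refine (h.tail_gen (a := 1) (κ := 1/4) (L := 4) (g := 3/4*x^2) (τ := τ) (by norm_num) (by norm_num)
      (by norm_num) (by norm_num) hx hxγ hτ B1 ?_).trans (le_of_eq ?_)
    · rintro ω ⟨h1, h2, h3, h3'⟩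
      refine ⟨h3', h2, ?_⟩
      have hv := VX_nonneg (X := X) n ω
      have h4 := Real.sq_sqrt hv
      have h5 : 1 ≤ √(VX X n ω) := by rw [Real.one_le_sqrt]; exact h3
      have h6 : √(VX X n ω) ≤ 2 := by rw [Real.sqrt_le_left (by norm_num)]; linarith
      set v := √(VX X n ω)
      rw [← h4]
      have : x*(x*v) ≤ x * SX X n ω := mul_le_mul_of_nonneg_left h1 hx
      nlinarith [mul_nonneg (sq_nonneg x) (mul_nonneg (sub_nonneg.2 h5) (sub_nonneg.2 h6)),
        mul_nonneg (sq_nonneg x) (sub_nonneg.2 h5)]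
    · rw [hE]; congr 2; ring
  have bj : ∀ j, P.real (BB j) ≤ (2000*e*T*E) * (1/2)^j := by
    intro j
    set q : ℝ := 2^(j+1) with hq
    have hq2 : 2 ≤ q := by
      rw [hq, pow_succ]; have : (1:ℝ) ≤ 2^j := one_le_pow₀ (by norm_num)
      linarith
    have hq0 : 0 < q := by linarith
    have e1 : (4:ℝ)^(j+1) = q^2 := by rw [hq, ← pow_mul, mul_comm, pow_mul]; norm_num
    have e2 : (4:ℝ)^(j+2) = 4*q^2 := by rw [← e1]; ring
    have hqi : 1/q ≤ 1/2 := by gcongr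
    have hqi0 : 0 < 1/q := by positivity
    have hq4 : 4 ≤ q^2 := by (first | linarith | nlinarith)
    have := (h.tail_gen (a := 2*(1/q)) (κ := (1/q)^2/2) (L := 4*q^2) (g := 3/2*x^2) (τ := q^2/2)
      (by positivity) (by linarith) (by apply le_of_eq; ring) (by (first | linarith | nlinarith)) hx hxγ (by positivity) (BB j) ?_)
    · refine this.trans ?_
      have t1 : (q^2/2)^(-(1+ρ/2)) ≤ T*(1/2)^j := by
        calc (q^2/2)^(-(1+ρ/2)) ≤ (q^2/2)^(-1:ℝ) :=
              Real.rpow_le_rpow_of_exponent_le (by linarith) (by linarith)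
          _ = 2*(1/q)^2 := by rw [Real.rpow_neg_one]; field_simp
          _ ≤ (1/q) := by (first | linarith | nlinarith)
          _ = (1/2)^(j+1) := by rw [hq, div_pow, one_pow]
          _ ≤ 1*(1/2)^j := by
              rw [pow_succ]; have : (0:ℝ) < (1/2)^j := by positivity
              linarith
          _ ≤ T*(1/2)^j := by gcongr
      have t2 : Real.exp (((2*(1/q))^2/2-(1/q)^2/2)*x^2 - 3/2*x^2 + x^2*δ^2 + 2000*(1+x)^(2+ρ)*e) ≤ E := by
        rw [hE]
        apply Real.exp_le_exp.2
        have : ((2*(1/q))^2/2-(1/q)^2/2)*x^2 ≤ 3/8*x^2 := by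
          apply mul_le_mul_of_nonneg_right _ (sq_nonneg x); (first | linarith | nlinarith)
        nlinarith [sq_nonneg x]
      calc _ ≤ 2000*e*(T*(1/2)^j)*E := by gcongr
        _ = _ := by ring
    · rintro ω ⟨h1, h2, h3⟩
      rw [e1] at h2
      rw [e2] at h3
      refine ⟨h3, ?_, ?_⟩
      · have h5 := (h.Ss_bd n ω).2
        have h6 := h.δ1
        have h7 := h.δ0
        have : δ^2 ≤ 1/16 := by (first | linarith | nlinarith)
        rw [abs_of_nonneg (by linarith)]
        linarith
      · have hv := VX_nonneg (X := X) n ω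
        have h4 := Real.sq_sqrt hv
        have h5 : q ≤ √(VX X n ω) := Real.le_sqrt_of_sq_le h2
        have h6 : √(VX X n ω) ≤ 2*q := by
          rw [Real.sqrt_le_left (by positivity)]; linarith
        set v := √(VX X n ω)
        rw [← h4]
        set w := v/q with hw
        have hvw : v = q*w := by rw [hw]; field_simp
        have hw1 : 1 ≤ w := by rw [hw, le_div_iff₀ hq0]; linarith
        have hw2 : w ≤ 2 := by rw [hw, div_le_iff₀ hq0]; linarith
        have h8 : 2*(1/q)*x*(x*v) ≤ 2*(1/q)*x * SX X n ω := mul_le_mul_of_nonneg_left h1 (by positivity)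
        have h9 : 2*(1/q)*x*(x*v) = 2*x^2*w := by rw [hvw]; field_simp
        have h10 : (1/q)^2/2*x^2*v^2 = x^2*w^2/2 := by rw [hvw]; field_simp
        rw [h10]
        nlinarith [mul_nonneg (sq_nonneg x) (mul_nonneg (sub_nonneg.2 hw1) (sub_nonneg.2 hw2)),
          mul_nonneg (sq_nonneg x) (sub_nonneg.2 hw1)]
  have hu := real_iUnion_geom (P := P) BB _ (by positivity) bj
  have hsub : {ω | x * √(VX X n ω) ≤ SX X n ω ∧ τ ≤ |VX X n ω - SX s n ω|} ⊆ B0 ∪ (B1 ∪ ⋃ j, BB j) := by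
    rintro ω ⟨h1, h2⟩
    rcases le_total (VX X n ω) 1 with h3 | h3
    · exact Or.inl ⟨h1, h2, h3⟩
    · right
      rcases le_total (VX X n ω) 4 with h4 | h4
      · exact Or.inl ⟨h1, h2, h3, h4⟩
      · right
        obtain ⟨k, hk1, hk2⟩ := exists_nat_pow_near h3 (by norm_num : (1:ℝ) < 4)
        rcases k with _ | k
        · norm_num at hk2; linarith
        · exact Set.mem_iUnion.2 ⟨k, h1, hk1, hk2.le⟩
  calc _ ≤ P.real (B0 ∪ (B1 ∪ ⋃ j, BB j)) := measureReal_mono hsub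
    _ ≤ P.real B0 + (P.real B1 + P.real (⋃ j, BB j)) :=
        (measureReal_union_le _ _).trans (add_le_add le_rfl (measureReal_union_le _ _))
    _ ≤ 2000*e*T*E + (2000*e*T*E + 2*(2000*e*T*E)) := add_le_add b0 (add_le_add b1 hu)
    _ = 8000*(e*T*E) := by ring
    _ ≤ 10000*(e*T*E) := by
      have h5 : 0 ≤ e*T*E := by positivity
      linarith
    _ = _ := by ring
end

open MeasureTheory Filter
open scoped Topology ENNReal

section
variable {Ω : Type} [mΩ : MeasurableSpace Ω] {P Q : Measure Ω} {N β M : Ω → ℝ}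
    {ρ γ e δ l C : ℝ}

lemma TiltOut.iM (h : TiltOut P Q N β M ρ γ e δ l C) (hl : 0 ≤ l) :
    Integrable (fun ω => Real.exp (-l * M ω)) Q := by
  set y := l * δ ^ 2 + C * l ^ (1 + ρ) * e with hy
  refine Integrable.mono' (h.ei.const_mul (Real.exp (l*(l/2+y))))
    ((h.Mm.const_mul (-l)).exp).aestronglyMeasurable ?_
  filter_upwards [h.βc] with ω hω
  rw [Real.norm_of_nonneg (Real.exp_pos _).le, ← Real.exp_add]
  apply Real.exp_le_exp.2
  have := (abs_le.1 hω).2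
  have : l*(β ω) ≤ l*(l/2+y) := mul_le_mul_of_nonneg_left (by linarith) hl
  linarith

lemma TiltOut.upG (h : TiltOut P Q N β M ρ γ e δ l C) (hl : 0 ≤ l) (t y : ℝ)
    (hy : y = l * δ ^ 2 + C * l ^ (1 + ρ) * e) :
    P.real {ω | l/2 - t ≤ N ω} ≤ Real.exp (C*l^(2+ρ)*e - l^2/2 + l*y) *
      ∫ ω in {ω | -t-y ≤ M ω}, Real.exp (-l * M ω) ∂Q := by
  have hNm : Measurable N := by
    have : N = fun ω => β ω + M ω := funext h.dec
    rw [this]; exact h.βm.add h.Mm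
  have hB : MeasurableSet {ω | l/2 - t ≤ N ω} := measurableSet_le measurable_const hNm
  have hA : MeasurableSet {ω | -t-y ≤ M ω} := measurableSet_le measurable_const h.Mm
  have h1 := h.up _ hB
  have h2 : ∫ ω in {ω | l/2 - t ≤ N ω}, Real.exp (-l * (β ω + M ω)) ∂Q ≤
      Real.exp (- l^2/2 + l*y) * ∫ ω in {ω | -t-y ≤ M ω}, Real.exp (-l * M ω) ∂Q := by
    rw [← integral_const_mul, ← integral_indicator hB, ← integral_indicator hA]
    refine integral_mono_ae (h.ei.indicator hB) (((h.iM hl).const_mul _).indicator hA) ?_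
    filter_upwards [h.βc] with ω hω
    rw [← hy] at hω
    obtain ⟨h3, h4⟩ := abs_le.1 hω
    by_cases hb : ω ∈ {ω | l/2 - t ≤ N ω}
    · have hb' : l/2 - t ≤ N ω := hb
      rw [h.dec] at hb'
      have ha : ω ∈ {ω | -t-y ≤ M ω} := show -t-y ≤ M ω by linarith
      rw [Set.indicator_of_mem hb, Set.indicator_of_mem ha, ← Real.exp_add]
      apply Real.exp_le_exp.2
      have : l*(l/2-y) ≤ l*(β ω) := mul_le_mul_of_nonneg_left (by linarith) hl
      nlinarith
    · rw [Set.indicator_of_notMem hb]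
      exact Set.indicator_nonneg (fun ω _ => by positivity) ω
  calc _ ≤ _ := h1
    _ ≤ Real.exp (C*l^(2+ρ)*e) * (Real.exp (- l^2/2 + l*y) *
        ∫ ω in {ω | -t-y ≤ M ω}, Real.exp (-l * M ω) ∂Q) := by gcongr
    _ = _ := by rw [← mul_assoc, ← Real.exp_add]; congr 2; ring

lemma TiltOut.loG (h : TiltOut P Q N β M ρ γ e δ l C) (hl : 0 ≤ l) (t y b : ℝ)
    (hy : y = l * δ ^ 2 + C * l ^ (1 + ρ) * e) (hb : b ≤ l/2 - y - t) (J : Set ℝ)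
    (hJ : MeasurableSet J) (hJt : ∀ z ∈ J, -t ≤ z) :
    Real.exp (-(C*l^(2+ρ)*e + l^2/2 + l*y)) *
      ∫ ω in {ω | M ω ∈ J}, Real.exp (-l * M ω) ∂Q ≤ P.real {ω | b ≤ N ω} := by
  have hNm : Measurable N := by
    have : N = fun ω => β ω + M ω := funext h.dec
    rw [this]; exact h.βm.add h.Mm
  have hB : MeasurableSet {ω | b ≤ N ω} := measurableSet_le measurable_const hNm
  have hA : MeasurableSet {ω | M ω ∈ J} := h.Mm hJ
  have h1 := h.lo _ hB
  have h2 : Real.exp (-(l^2/2 + l*y)) * ∫ ω in {ω | M ω ∈ J}, Real.exp (-l * M ω) ∂Q ≤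
      ∫ ω in {ω | b ≤ N ω}, Real.exp (-l * (β ω + M ω)) ∂Q := by
    rw [← integral_const_mul, ← integral_indicator hB, ← integral_indicator hA]
    refine integral_mono_ae (((h.iM hl).const_mul _).indicator hA) (h.ei.indicator hB) ?_
    filter_upwards [h.βc] with ω hω
    rw [← hy] at hω
    obtain ⟨h3, h4⟩ := abs_le.1 hω
    by_cases ha : ω ∈ {ω | M ω ∈ J}
    · have ha' := hJt _ ha
      have hb' : ω ∈ {ω | b ≤ N ω} := show b ≤ N ω by rw [h.dec]; linarith
      rw [Set.indicator_of_mem hb', Set.indicator_of_mem ha, ← Real.exp_add]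
      apply Real.exp_le_exp.2
      have : l*(β ω) ≤ l*(l/2+y) := mul_le_mul_of_nonneg_left (by linarith) hl
      nlinarith
    · rw [Set.indicator_of_notMem ha]
      exact Set.indicator_nonneg (fun ω _ => by positivity) ω
  calc _ = Real.exp (-(C*l^(2+ρ)*e)) * (Real.exp (-(l^2/2 + l*y)) *
        ∫ ω in {ω | M ω ∈ J}, Real.exp (-l * M ω) ∂Q) := by
        rw [← mul_assoc, ← Real.exp_add]; congr 2; ring
    _ ≤ _ := by gcongr
    _ ≤ _ := h1

lemma TiltOut.loJ (h : TiltOut P Q N β M ρ γ e δ l C) (hl : 0 ≤ l) (a k : ℝ) :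
    Real.exp (-(l*k)) * Q.real {ω | M ω ∈ Set.Icc a k} ≤
      ∫ ω in {ω | M ω ∈ Set.Icc a k}, Real.exp (-l * M ω) ∂Q := by
  have := h.prob
  have hA : MeasurableSet {ω | M ω ∈ Set.Icc a k} := h.Mm measurableSet_Icc
  have : Real.exp (-(l*k)) * Q.real {ω | M ω ∈ Set.Icc a k} =
      ∫ ω in {ω | M ω ∈ Set.Icc a k}, Real.exp (-(l*k)) ∂Q := by
    rw [setIntegral_const, smul_eq_mul, mul_comm]
  rw [this]
  refine setIntegral_mono_on (integrable_const _).integrableOn (h.iM hl).integrableOn hA fun ω hω => ?_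
  apply Real.exp_le_exp.2
  have : l * M ω ≤ l*k := mul_le_mul_of_nonneg_left hω.2 hl
  linarith

/-- Cantelli -/
lemma TiltOut.cantelli (h : TiltOut P Q N β M ρ γ e δ l C) (hC : 0 < C) {t : ℝ} (ht : 0 < t) :
    Q.real {ω | M ω < -t} ≤ C/(C+t^2) := by
  have := h.prob
  have hi : Integrable (fun ω => (C/t - M ω)^2) Q := by
    have : (fun ω => (C/t - M ω)^2) = fun ω => (C/t)^2 - 2*(C/t)*M ω + (M ω)^2 := by
      ext ω; ring
    rw [this]
    exact ((integrable_const _).sub (h.i1.const_mul _)).add h.i2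
  have hv : ∫ ω, (C/t - M ω)^2 ∂Q ≤ (C/t)^2 + C := by
    have e1 : (fun ω => (C/t - M ω)^2) = fun ω => ((C/t)^2 - 2*(C/t)*M ω) + (M ω)^2 := by
      ext ω; ring
    have i0 : Integrable (fun ω => (C/t)^2 - 2*(C/t)*M ω) Q := (integrable_const _).sub (h.i1.const_mul _)
    rw [e1, integral_add i0 h.i2, integral_sub (integrable_const _) (h.i1.const_mul _),
      integral_const_mul, h.m1]
    simp
    exact h.m2
  have hm := mul_meas_ge_le_integral_of_nonneg (ae_of_all _ fun ω => sq_nonneg (C/t - M ω)) hi ((C/t+t)^2)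
  have hsub : Q.real {ω | M ω < -t} ≤ Q.real {ω | (C/t+t)^2 ≤ (C/t - M ω)^2} := by
    refine measureReal_mono fun ω hω => ?_
    have hω : M ω < -t := hω
    show (C/t+t)^2 ≤ (C/t - M ω)^2
    have : 0 < C/t := by positivity
    apply pow_le_pow_left₀ (by positivity); linarith
  have h2 : (C/t+t)^2 * Q.real {ω | M ω < -t} ≤ (C/t)^2 + C :=
    (mul_le_mul_of_nonneg_left hsub (by positivity)).trans (hm.trans hv)
  rw [le_div_iff₀ (by positivity)]
  have e2 : (C/t+t)^2 = (C+t^2)^2/t^2 := by field_simp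
  have e3 : (C/t)^2+C = C*(C+t^2)/t^2 := by field_simp
  rw [e2, e3] at h2
  have h3 : ((C+t^2)/t^2) * (Q.real {ω | M ω < -t} * (C+t^2)) ≤ ((C+t^2)/t^2) * C := by
    calc _ = (C+t^2)^2/t^2 * Q.real {ω | M ω < -t} := by ring
      _ ≤ _ := h2
      _ = _ := by ring
  exact le_of_mul_le_mul_left h3 (by positivity)

lemma TiltOut.cheb (h : TiltOut P Q N β M ρ γ e δ l C) {k : ℝ} (hk : 0 < k) :
    Q.real {ω | k < M ω} ≤ C/k^2 := by
  have := h.prob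
  have hm := mul_meas_ge_le_integral_of_nonneg (ae_of_all _ fun ω => sq_nonneg (M ω)) h.i2 (k^2)
  have hsub : Q.real {ω | k < M ω} ≤ Q.real {ω | k^2 ≤ (M ω)^2} := by
    refine measureReal_mono fun ω hω => ?_
    have hω : k < M ω := hω
    show k^2 ≤ (M ω)^2
    apply pow_le_pow_left₀ hk.le hω.le
  rw [le_div_iff₀ (by positivity), mul_comm]
  exact (mul_le_mul_of_nonneg_left hsub (by positivity)).trans (hm.trans h.m2)

lemma TiltOut.mid (h : TiltOut P Q N β M ρ γ e δ l C) (hC : 0 < C) {t k : ℝ} (ht : 0 < t)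
    (hk : 0 < k) : t^2/(C+t^2) - C/k^2 ≤ Q.real {ω | M ω ∈ Set.Icc (-t) k} := by
  have := h.prob
  have h1 := h.cantelli hC ht
  have h2 := h.cheb hk
  have h3 : Q.real Set.univ ≤ Q.real {ω | M ω < -t} + (Q.real {ω | M ω ∈ Set.Icc (-t) k} +
      Q.real {ω | k < M ω}) := by
    refine le_trans (measureReal_mono (s₂ := {ω | M ω < -t} ∪ ({ω | M ω ∈ Set.Icc (-t) k} ∪ {ω | k < M ω}))
      fun ω _ => ?_) ((measureReal_union_le _ _).trans (add_le_add le_rfl (measureReal_union_le _ _)))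
    rcases lt_or_ge (M ω) (-t) with h | h
    · exact Or.inl h
    · rcases lt_or_ge k (M ω) with h' | h'
      · exact Or.inr (Or.inr h')
      · exact Or.inr (Or.inl ⟨h, h'⟩)
  rw [probReal_univ] at h3
  have e : t^2/(C+t^2) = 1 - C/(C+t^2) := by field_simp; ring
  rw [e]; linarith

end

open MeasureTheory Filter
open scoped Topology ENNReal

/-- abstract bracket -/
structure Brk (ρ γ e δ x E τ : ℝ) : Prop where
  E0 : 0 < E
  x0 : 0 ≤ x
  b1 : x^2*δ^2 ≤ E
  b2 : (1+x)*((1+x)^ρ*γ^ρ) ≤ E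
  b3 : (1+x)*δ ≤ E
  b4 : (1+x)^(2+ρ)*e ≤ 16*E
  τ0 : 0 < τ
  τ1 : τ ≤ 1
  t1 : (1+x)^2*τ^2 ≤ 8*E
  t2 : (1+x)*(e*τ^(-(1+ρ/2))) ≤ 8*E

section
variable {Ω : Type} [mΩ : MeasurableSpace Ω] {P : Measure Ω} [IsProbabilityMeasure P] {n : ℕ}
    {F : ℕ → MeasurableSpace Ω} {X s m : ℕ → Ω → ℝ} {ρ γ e δ x E τ C : ℝ}

lemma Brk.d2 (hb : Brk ρ γ e δ x E τ) (h0 : 0 ≤ δ) (h1 : δ ≤ 1/4) : (1+x)^2*δ^2 ≤ 4*E := by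
  have := hb.b1
  have := hb.b3
  have hx := hb.x0
  have h2 : δ^2 ≤ δ := by (first | linarith | nlinarith)
  have h3 : δ ≤ (1+x)*δ := by (first | linarith | nlinarith)
  nlinarith [mul_nonneg (sq_nonneg (1-x)) (sq_nonneg δ)]

/-- `(1+x) x^(1+ρ) e ≤ 16 E` -/
lemma Brk.e1 (hb : Brk ρ γ e δ x E τ) (hρ : 0 < ρ) (he : 0 ≤ e) : (1+x)*(x^(1+ρ)*e) ≤ 16*E := by
  have hx := hb.x0
  refine le_trans ?_ hb.b4
  have : (1+x)^(2+ρ) = (1+x)*(1+x)^(1+ρ) := by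
    rw [show 2+ρ = 1+(1+ρ) by ring, Real.rpow_add (by linarith), Real.rpow_one]
  rw [this, mul_assoc]
  have : x^(1+ρ) ≤ (1+x)^(1+ρ) := Real.rpow_le_rpow hx (by linarith) (by linarith)
  gcongr

lemma Brk.e2 (hb : Brk ρ γ e δ x E τ) (hρ : 0 < ρ) (he : 0 ≤ e) : x^(2+ρ)*e ≤ 16*E := by
  have hx := hb.x0
  refine le_trans ?_ hb.b4
  have : x^(2+ρ) ≤ (1+x)^(2+ρ) := Real.rpow_le_rpow hx (by linarith) (by linarith)
  gcongr

lemma sqrt_lower {x V S τ : ℝ} (hx : 0 ≤ x) (hV : 0 ≤ V) (hS : x * √V ≤ S) (hτ : |V - 1| ≤ τ) :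
    x/2 - x*τ^2/2 ≤ S - x/2*V := by
  have h1 := Real.sq_sqrt hV
  have h0 := Real.sqrt_nonneg V
  set w := √V
  have h2 : |w - 1| ≤ τ := by
    refine le_trans ?_ hτ
    rw [← h1, show w^2 - 1 = (w-1)*(w+1) by ring, abs_mul]
    have : 1 ≤ |w+1| := by rw [abs_of_nonneg (by linarith)]; linarith
    nlinarith [abs_nonneg (w-1)]
  have h3 : (w-1)^2 ≤ τ^2 := by
    rw [← sq_abs]; exact pow_le_pow_left₀ (abs_nonneg _) h2 2
  nlinarith [mul_le_mul_of_nonneg_left h3 hx]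

lemma Core.incl (h : Core P n F X s m ρ γ e δ) (hx : 0 ≤ x) (hτ : 0 < τ) :
    P.real {ω | x * √(VX X n ω) ≤ SX X n ω} ≤
      P.real {ω | x * √(VX X n ω) ≤ SX X n ω ∧ τ ≤ |VX X n ω - SX s n ω|} +
      P.real {ω | x/2 - x*(τ+δ^2)^2/2 ≤ SX X n ω - x/2*VX X n ω} := by
  refine le_trans ?_ (measureReal_union_le _ _)
  refine ENNReal.toReal_mono (measure_ne_top _ _) (measure_mono_ae ?_)
  filter_upwards [h.sT'] with ω h1
  intro h2
  have h2 : x * √(VX X n ω) ≤ SX X n ω := h2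
  rcases le_or_gt τ (|VX X n ω - SX s n ω|) with h3 | h3
  · exact Or.inl ⟨h2, h3⟩
  · right
    refine sqrt_lower hx (VX_nonneg ..) h2 ?_
    have h4 : |SX s n ω - 1| ≤ δ^2 := by
      rw [abs_le]
      have := h.sT n ω
      unfold SX
      constructor <;> linarith
    calc |VX X n ω - 1| = |(VX X n ω - SX s n ω) + (SX s n ω - 1)| := by ring_nf
      _ ≤ _ := abs_add_le _ _
      _ ≤ _ := by linarith

set_option maxHeartbeats 1000000 in
lemma upper_main (h : Core P n F X s m ρ γ e δ) (hb : Brk ρ γ e δ x E τ) (hC : 1 ≤ C)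
    (hxγ : x*γ ≤ 1) {Q : Measure Ω} {β M : Ω → ℝ}
    (hT : TiltOut P Q (fun ω => SX X n ω - x / 2 * VX X n ω) β M ρ γ e δ x C) :
    P.real {ω | x * √(VX X n ω) ≤ SX X n ω} ≤ (1 - stdNormalCDF x) * Real.exp (2000000*C*E) := by
  have hx := hb.x0
  have hE := hb.E0
  have hρ := h.hρ
  have he := h.e0
  have hδ := h.δ0
  have hp := one_sub_cdf_pos x
  set p := 1 - stdNormalCDF x with hpd
  have hm := mills_lower x hx
  have hQ := hT.prob
  refine (h.incl hx hb.τ0).trans ?_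
  have hCE : E ≤ C*E := le_mul_of_one_le_left hE.le hC
  -- term 1
  have T1 : P.real {ω | x * √(VX X n ω) ≤ SX X n ω ∧ τ ≤ |VX X n ω - SX s n ω|} ≤
      p * (1200000*C*E*Real.exp (40000*C*E)) := by
    refine (h.tail hx hxγ hb.τ0 hb.τ1).trans ?_
    have e1 : Real.exp (- x^2/2 + x^2*δ^2 + 2000*(1+x)^(2+ρ)*e) ≤
        15*(1+x)*p * Real.exp (40000*C*E) := by
      calc _ = Real.exp (-(x^2)/2) * Real.exp (x^2*δ^2 + 2000*((1+x)^(2+ρ)*e)) := by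
            rw [← Real.exp_add]; congr 1; ring
        _ ≤ 15*(1+x)*p * Real.exp (40000*C*E) := by
            have : x^2*δ^2 + 2000*((1+x)^(2+ρ)*e) ≤ 40000*C*E := by
              linarith [hb.b1, hb.b4]
            gcongr
    have hτ0 := hb.τ0
    have q0 : 0 ≤ e*τ^(-(1+ρ/2)) := by positivity
    calc _ ≤ 10000 * e * τ^(-(1+ρ/2)) * (15*(1+x)*p * Real.exp (40000*C*E)) := by gcongr
      _ = (p * Real.exp (40000*C*E)) * 150000 * ((1+x)*(e*τ^(-(1+ρ/2)))) := by ring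
      _ ≤ (p * Real.exp (40000*C*E)) * 150000 * (8*(C*E)) := by
          have := hb.t2
          exact mul_le_mul_of_nonneg_left (by linarith) (by positivity)
      _ = _ := by ring
  -- term 2
  set y := x*δ^2 + C*x^(1+ρ)*e with hy
  set t := x*(τ+δ^2)^2/2 with ht
  have hy0 : 0 ≤ y := by positivity
  have ht0 : 0 ≤ t := by positivity
  have hd2 := hb.d2 h.δ0 h.δ1
  have k1 : (1+x)*(t+y) ≤ 32*C*E := by
    have a1 : (1+x)*t ≤ 12*E := by
      have : (τ+δ^2)^2 ≤ 2*(τ^2+δ^2) := by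
        have : δ^2 ≤ 1 := by nlinarith [h.δ1]
        nlinarith [sq_nonneg (τ-δ^2), sq_nonneg δ]
      calc (1+x)*t = ((1+x)*x)*(τ+δ^2)^2/2 := by rw [ht]; ring
        _ ≤ (1+x)^2*(2*(τ^2+δ^2))/2 := by gcongr; (first | linarith | nlinarith)
        _ ≤ _ := by linarith [hb.t1]
    have a2 : (1+x)*y ≤ 4*E + 16*(C*E) := by
      calc (1+x)*y = ((1+x)*x)*δ^2 + C*((1+x)*(x^(1+ρ)*e)) := by rw [hy]; ring
        _ ≤ (1+x)^2*δ^2 + C*(16*E) := by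
          have := hb.e1 hρ he
          gcongr; (first | linarith | nlinarith)
        _ ≤ _ := by linarith
    linarith
  have k2 : x*(t+y) ≤ 32*C*E := by
    refine le_trans ?_ k1
    (first | linarith | nlinarith)
  have k3 : C*x^(2+ρ)*e + x*y ≤ 64*C*E := by
    have := mul_le_mul_of_nonneg_left (hb.e2 hρ he) (by linarith : (0:ℝ) ≤ C)
    (first | linarith | nlinarith)
  have hup := hT.upG hx t y hy
  have hL := laplace_compare' Q M hT.Mm _ hT.be (-t-y) x hx
  set I := ∫ ω in {ω | -t-y ≤ M ω}, Real.exp (-x*M ω) ∂Q with hI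
  have hL2 := (abs_le.1 hL).2
  have hsh := cdf_shift (-t-y+x) x hx (by linarith)
  set D := C * ((1 + x) ^ ρ * γ ^ ρ + δ) with hD
  have hγ := h.γ0
  have hD0 : 0 ≤ D := by positivity
  have hDE : (1+x)*D ≤ 2*C*E := by
    have := mul_le_mul_of_nonneg_left (add_le_add hb.b2 hb.b3) (by linarith : (0:ℝ) ≤ C)
    rw [hD]; linarith
  have I1 : I ≤ Real.exp (x^2/2)*p*Real.exp (256*C*E) + Real.exp (x^2/2)*p*(60*C*E)*Real.exp (32*C*E) := by
    have c1 : Real.exp (x^2/2)*(1 - stdNormalCDF (-t-y+x)) ≤ Real.exp (x^2/2)*p*Real.exp (256*C*E) := by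
      rw [mul_assoc]
      refine mul_le_mul_of_nonneg_left (hsh.trans ?_) (Real.exp_pos _).le
      refine mul_le_mul_of_nonneg_left (Real.exp_le_exp.2 ?_) hp.le
      (first | linarith | nlinarith)
    have c2 : 2*D*Real.exp (-x*(-t-y)) ≤ Real.exp (x^2/2)*p*(60*C*E)*Real.exp (32*C*E) := by
      have d1 : Real.exp (-x*(-t-y)) ≤ Real.exp (32*C*E) := Real.exp_le_exp.2 (by (first | linarith | nlinarith))
      have d2 : 1 ≤ Real.exp (x^2/2) * (15*(1+x)*p) := by
        calc (1:ℝ) = Real.exp (x^2/2) * Real.exp (-(x^2)/2) := by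
              rw [← Real.exp_add]; rw [show x^2/2 + -(x^2)/2 = 0 by ring, Real.exp_zero]
          _ ≤ _ := by gcongr
      calc _ ≤ 2*D*Real.exp (32*C*E) := by gcongr
        _ = (2*D*Real.exp (32*C*E))*1 := by ring
        _ ≤ (2*D*Real.exp (32*C*E))*(Real.exp (x^2/2) * (15*(1+x)*p)) := by gcongr
        _ = (Real.exp (x^2/2)*p*Real.exp (32*C*E)*30)*((1+x)*D) := by ring
        _ ≤ (Real.exp (x^2/2)*p*Real.exp (32*C*E)*30)*(2*C*E) := by gcongr
        _ = _ := by ring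
    linarith
  have T2 : P.real {ω | x/2 - t ≤ SX X n ω - x/2*VX X n ω} ≤ p * (Real.exp (320*C*E)*(1+60*C*E)) := by
    refine hup.trans ?_
    have hI0 : 0 ≤ I := integral_nonneg fun ω => (Real.exp_pos _).le
    have c3 : Real.exp (C*x^(2+ρ)*e - x^2/2 + x*y) ≤ Real.exp (64*C*E) * Real.exp (-(x^2)/2) := by
      rw [← Real.exp_add]; apply Real.exp_le_exp.2; linarith
    have c4 : I ≤ Real.exp (x^2/2)*p*(Real.exp (256*C*E)*(1+60*C*E)) := by
      refine I1.trans ?_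
      have : Real.exp (32*C*E) ≤ Real.exp (256*C*E) := Real.exp_le_exp.2 (by (first | linarith | nlinarith))
      calc _ ≤ Real.exp (x^2/2)*p*Real.exp (256*C*E) + Real.exp (x^2/2)*p*(60*C*E)*Real.exp (256*C*E) := by
            gcongr
        _ = _ := by ring
    calc _ ≤ (Real.exp (64*C*E) * Real.exp (-(x^2)/2)) * (Real.exp (x^2/2)*p*(Real.exp (256*C*E)*(1+60*C*E))) := by
          gcongr
      _ = p * ((Real.exp (-(x^2)/2) * Real.exp (x^2/2)) * (Real.exp (64*C*E) * Real.exp (256*C*E)) * (1+60*C*E)) := by ring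
      _ = _ := by
          rw [← Real.exp_add, ← Real.exp_add, show -(x^2)/2 + x^2/2 = 0 by ring, Real.exp_zero, one_mul,
            show 64*C*E+256*C*E = 320*C*E by ring]
  have g1 : Real.exp (320*C*E) ≤ Real.exp (40000*C*E) := Real.exp_le_exp.2 (by (first | linarith | nlinarith))
  have hCE0 : 0 ≤ C*E := by linarith
  calc _ ≤ p * (1200000*C*E*Real.exp (40000*C*E)) + p * (Real.exp (320*C*E)*(1+60*C*E)) := add_le_add T1 T2
    _ ≤ p * (1200000*C*E*Real.exp (40000*C*E)) + p * (Real.exp (40000*C*E)*(1+60*C*E)) := by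
        have : 0 ≤ 1+60*C*E := by (first | linarith | nlinarith)
        gcongr
    _ = p * (Real.exp (40000*C*E) * (1 + 1200060*C*E)) := by ring
    _ ≤ p * (Real.exp (40000*C*E) * Real.exp (1200060*C*E)) := by
        have := Real.add_one_le_exp (1200060*C*E)
        gcongr; linarith
    _ = p * Real.exp (1240060*C*E) := by rw [← Real.exp_add]; congr 2; ring
    _ ≤ _ := by
        refine mul_le_mul_of_nonneg_left (Real.exp_le_exp.2 ?_) hp.le
        (first | linarith | nlinarith)
end

open MeasureTheory Filter
open scoped Topology ENNReal

section
variable {Ω : Type} [mΩ : MeasurableSpace Ω] {P : Measure Ω} [IsProbabilityMeasure P] {n : ℕ}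
    {F : ℕ → MeasurableSpace Ω} {X s m : ℕ → Ω → ℝ} {ρ γ e δ x E τ C : ℝ}

lemma SX_zero_of_VX {X : ℕ → Ω → ℝ} {n : ℕ} {ω : Ω} (h : VX X n ω = 0) : SX X n ω = 0 := by
  unfold VX at h
  rw [Finset.sum_eq_zero_iff_of_nonneg (fun _ _ => sq_nonneg _)] at h
  unfold SX
  exact Finset.sum_eq_zero fun j hj => by simpa using h j hj

lemma W_ge {X : ℕ → Ω → ℝ} {n : ℕ} {ω : Ω} {l b x : ℝ} (hx : 0 ≤ x)
    (hv : ∀ v, 0 ≤ v → x * v ≤ l/2*v^2 + b) (hb : 0 < x → 0 < b)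
    (hN : b ≤ SX X n ω - l/2*VX X n ω) : x ≤ SX X n ω / √(VX X n ω) := by
  rcases eq_or_lt_of_le (VX_nonneg (X := X) n ω) with h | h
  · have h1 := SX_zero_of_VX h.symm
    rw [h1, ← h] at hN ⊢
    have : ¬ 0 < x := fun hx => by have := hb hx; linarith
    simp; linarith
  · have h1 := Real.sqrt_pos.2 h
    rw [le_div_iff₀ h1]
    have h2 := hv _ h1.le
    rw [Real.sq_sqrt h.le] at h2
    linarith

lemma W_le {X : ℕ → Ω → ℝ} {n : ℕ} {ω : Ω} {x : ℝ}
    (hN : x ≤ SX X n ω / √(VX X n ω)) : x * √(VX X n ω) ≤ SX X n ω := by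
  rcases eq_or_lt_of_le (VX_nonneg (X := X) n ω) with h | h
  · have h1 := SX_zero_of_VX h.symm
    rw [h1, ← h]; simp
  · have h1 := Real.sqrt_pos.2 h
    rwa [le_div_iff₀ h1] at hN

lemma TiltOut.loW {Q : Measure Ω} {β M : Ω → ℝ} {l : ℝ}
    (hT : TiltOut P Q (fun ω => SX X n ω - l / 2 * VX X n ω) β M ρ γ e δ l C) (hl : 0 ≤ l)
    (hx : 0 ≤ x) {b t : ℝ} (hv : ∀ v, 0 ≤ v → x * v ≤ l/2*v^2 + b) (hb0 : 0 < x → 0 < b)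
    {y : ℝ} (hy : y = l*δ^2 + C*l^(1+ρ)*e) (hb : b ≤ l/2 - y - t) {J : Set ℝ}
    (hJ : MeasurableSet J) (hJt : ∀ z ∈ J, -t ≤ z) :
    Real.exp (-(C*l^(2+ρ)*e + l^2/2 + l*y)) * ∫ ω in {ω | M ω ∈ J}, Real.exp (-l*M ω) ∂Q ≤
      P.real {ω | x ≤ SX X n ω / √(VX X n ω)} := by
  refine (hT.loG hl t y b hy hb J hJ hJt).trans ?_
  exact measureReal_mono fun ω hω => W_ge hx hv hb0 hω

/-- the parameters of the first lower bounds -/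
structure LoP (ρ γ e δ x E C l y b : ℝ) : Prop where
  l0 : 0 ≤ l
  xl : x ≤ l
  l2 : l ≤ 2*x
  hy : y = l*δ^2 + C*l^(1+ρ)*e
  hb : b ≤ l/2 - y - 0
  hv : ∀ v, 0 ≤ v → x * v ≤ l/2*v^2 + b
  hb0 : 0 < x → 0 < b
  k1 : (1+x)*(l-x) ≤ 120*C*E
  k2 : C*l^(2+ρ)*e + l^2/2 + l*y ≤ x^2/2 + 500*C*E
  k3 : C*l^(2+ρ)*e + l*y ≤ 300*C*E
  k4 : (1+x)*(C*((1+l)^ρ*γ^ρ+δ)) ≤ 4*C*E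
  k5 : C*((1+l)^ρ*γ^ρ+δ) ≤ 2*C*((1+x)^ρ*γ^ρ+δ)

set_option maxHeartbeats 1000000 in
lemma exists_LoP (hb : Brk ρ γ e δ x E τ) (hρ : 0 < ρ) (hρ1 : ρ < 1) (hγ : 0 < γ) (he : 0 ≤ e) (hδ : 0 ≤ δ)
    (hδ1 : δ ≤ 1/4) (hC : 1 ≤ C)
    (hη : 6*C*(x^ρ*e + δ^2) ≤ 1) : ∃ l y b, LoP ρ γ e δ x E C l y b := by
  have hx := hb.x0
  have hE := hb.E0
  have hxr : 0 ≤ x^ρ := by positivity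
  set η := 6*C*(x^ρ*e + δ^2) with hηd
  have hη0 : 0 ≤ η := by positivity
  have hp1 : x^(1+ρ) = x * x^ρ := by
    rw [Real.rpow_add' hx (by linarith), Real.rpow_one]
  have hp2 : x^(2+ρ) = x^2 * x^ρ := by
    rw [Real.rpow_add' hx (by linarith), Real.rpow_two]
  set l := x*(1+η) with hl
  have l0 : 0 ≤ l := by positivity
  have l2 : l ≤ 2*x := by (first | linarith | nlinarith)
  have xl : x ≤ l := by (first | linarith | nlinarith)
  have hd2 := hb.d2 hδ hδ1
  have hlr : l^ρ ≤ 2*x^ρ := by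
    calc l^ρ ≤ (2*x)^ρ := Real.rpow_le_rpow l0 l2 hρ.le
      _ = 2^ρ*x^ρ := Real.mul_rpow (by norm_num) hx
      _ ≤ 2^(1:ℝ)*x^ρ := by gcongr; norm_num
      _ = _ := by norm_num
  have hl1 : l^(1+ρ) ≤ 4*(x*x^ρ) := by
    rw [Real.rpow_add' l0 (by linarith), Real.rpow_one]
    calc l*l^ρ ≤ (2*x)*(2*x^ρ) := by gcongr
      _ = _ := by ring
  have hl2 : l^(2+ρ) ≤ 8*(x^2*x^ρ) := by
    rw [Real.rpow_add' l0 (by linarith), Real.rpow_two]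
    calc l^2*l^ρ ≤ (2*x)^2*(2*x^ρ) := by gcongr
      _ = _ := by ring
  have E1 := hb.e1 hρ he
  have E2 := hb.e2 hρ he
  rw [hp1] at E1
  rw [hp2] at E2
  have hCE : E ≤ C*E := by (first | linarith | nlinarith)
  have C0 : 0 ≤ C := by linarith
  have yb : l*δ^2 + C*l^(1+ρ)*e ≤ 2*x*δ^2 + 4*C*(x*x^ρ*e) := by
    have : C*l^(1+ρ)*e ≤ C*(4*(x*x^ρ))*e := by gcongr
    have : l*δ^2 ≤ 2*x*δ^2 := by gcongr
    linarith
  have f1 : C*l^(2+ρ)*e ≤ 128*(C*E) := by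
    calc C*l^(2+ρ)*e ≤ C*(8*(x^2*x^ρ))*e := by gcongr
      _ = C*8*(x^2*x^ρ*e) := by ring
      _ ≤ C*8*(16*E) := by gcongr
      _ = _ := by ring
  have f2 : l*(l*δ^2 + C*l^(1+ρ)*e) ≤ 4*E + 128*(C*E) := by
    calc _ ≤ (2*x)*(2*x*δ^2 + 4*C*(x*x^ρ*e)) := by gcongr
      _ = 4*(x^2*δ^2) + C*8*(x^2*x^ρ*e) := by ring
      _ ≤ 4*E + C*8*(16*E) := by gcongr; exact hb.b1
      _ = _ := by ring
  have f3 : (1+x)*(l-x) ≤ 120*(C*E) := by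
    calc (1+x)*(l-x) = 6*C*((1+x)*(x*x^ρ*e) + ((1+x)*x)*δ^2) := by rw [hl, hηd]; ring
      _ ≤ 6*C*(16*E + (1+x)^2*δ^2) := by gcongr; (first | linarith | nlinarith)
      _ ≤ 6*C*(16*E + 4*E) := by gcongr
      _ = _ := by ring
  have k5 : C*((1+l)^ρ*γ^ρ+δ) ≤ 2*C*((1+x)^ρ*γ^ρ+δ) := by
    have : (1+l)^ρ ≤ 2*(1+x)^ρ := by
      calc (1+l)^ρ ≤ (2*(1+x))^ρ := Real.rpow_le_rpow (by linarith) (by linarith) hρ.le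
        _ = 2^ρ*(1+x)^ρ := Real.mul_rpow (by norm_num) (by linarith)
        _ ≤ 2^(1:ℝ)*(1+x)^ρ := by gcongr; norm_num
        _ = _ := by norm_num
    calc _ ≤ C*(2*(1+x)^ρ*γ^ρ+2*δ) := by gcongr; linarith
      _ = _ := by ring
  refine ⟨l, _, x/(2*(1+η)), l0, xl, l2, rfl, ?_, ?_, ?_, ?_, ?_, ?_, ?_, k5⟩
  · have g1 : x/(2*(1+η)) ≤ x/2*(1-η/2) := by
      rw [div_le_iff₀ (by positivity)]
      nlinarith [mul_nonneg hx (mul_nonneg hη0 (sub_nonneg.2 hη))]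
    have g2 : 2*x*δ^2 + 4*C*(x*x^ρ*e) ≤ 3*x*η/4 := by
      rw [hηd]
      have : 0 ≤ C*(x*x^ρ*e) := by positivity
      have : x*δ^2 ≤ C*(x*δ^2) := by
        have : 0 ≤ x*δ^2 := by positivity
        (first | linarith | nlinarith)
      (first | linarith | nlinarith)
    rw [hl] at *
    linarith
  · intro v hv
    have : l/2*v^2 + x/(2*(1+η)) - x*v = x/(2*(1+η))*((1+η)*v-1)^2 := by
      rw [hl]; field_simp; ring
    have : 0 ≤ x/(2*(1+η))*((1+η)*v-1)^2 := by positivity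
    linarith
  · intro hx; positivity
  · linarith
  · have : l^2/2 ≤ x^2/2 + 180*(C*E) := by
      have : l + x ≤ 3*(1+x) := by linarith
      have : (l-x)*(l+x) ≤ (l-x)*(3*(1+x)) := mul_le_mul_of_nonneg_left this (by linarith)
      (first | linarith | nlinarith)
    linarith
  · linarith
  · calc _ ≤ (1+x)*(2*C*((1+x)^ρ*γ^ρ+δ)) := by gcongr
      _ = 2*C*((1+x)*((1+x)^ρ*γ^ρ)+(1+x)*δ) := by ring
      _ ≤ 2*C*(E+E) := by gcongr; exact hb.b2; exact hb.b3
      _ = _ := by ring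

lemma exp_neg_two_le {y : ℝ} (h0 : 0 ≤ y) (hy : y ≤ 1/2) : Real.exp (-(2*y)) ≤ 1 - y := by
  rw [Real.exp_neg]
  have := Real.add_one_le_exp (2*y)
  rw [inv_le_comm₀ (Real.exp_pos _) (by linarith)]
  refine le_trans ?_ this
  rw [inv_le_iff_one_le_mul₀ (by linarith)]
  (first | linarith | nlinarith)

set_option maxHeartbeats 1000000 in
lemma lower1 {l y b : ℝ} (hb : Brk ρ γ e δ x E τ) (hL : LoP ρ γ e δ x E C l y b) (hC : 1 ≤ C)
    (hγ : 0 < γ) (hδ : 0 ≤ δ)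
    {Q : Measure Ω} {β M : Ω → ℝ}
    (hT : TiltOut P Q (fun ω => SX X n ω - l / 2 * VX X n ω) β M ρ γ e δ l C)
    (hE1 : 240*C*E ≤ 1/2) :
    (1 - stdNormalCDF x) * Real.exp (-(3000*C*E)) ≤ P.real {ω | x ≤ SX X n ω / √(VX X n ω)} := by
  have hx := hb.x0
  have hE := hb.E0
  have hQ := hT.prob
  have hl0 := hL.l0
  have h1 := hT.loW hL.l0 hx hL.hv hL.hb0 hL.hy hL.hb (J := Set.Ici 0) measurableSet_Ici
    (fun z hz => by simpa using hz)
  refine le_trans ?_ h1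
  have h2 := laplace_compare' Q M hT.Mm _ hT.be 0 l hL.l0
  set D := C * ((1 + l) ^ ρ * γ ^ ρ + δ) with hD
  have hD0 : 0 ≤ D := by positivity
  have h3 := (abs_le.1 h2).1
  change _ ≤ (∫ ω in {ω | (0:ℝ) ≤ M ω}, Real.exp (-l*M ω) ∂Q) - _ at h3
  change _ ≤ _ * ∫ ω in {ω | (0:ℝ) ≤ M ω}, Real.exp (-l*M ω) ∂Q
  set I := ∫ ω in {ω | (0:ℝ) ≤ M ω}, Real.exp (-l*M ω) ∂Q
  rw [mul_zero, Real.exp_zero, zero_add, mul_one] at h3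
  have hm := mills_lower l hL.l0
  have hsh := cdf_shift x l hL.l0 hL.xl
  have hp := one_sub_cdf_pos l
  set p := 1 - stdNormalCDF l
  have k4 := hL.k4
  have k3 := hL.k3
  have hCE0 : 0 ≤ C*E := by (first | linarith | nlinarith)
  have j1 : Real.exp (l^2/2)*p*Real.exp (-(480*C*E)) ≤ I := by
    have j2 : 2*D ≤ Real.exp (l^2/2)*p*(240*C*E) := by
      have d2 : 1 ≤ Real.exp (l^2/2) * (15*(2*(1+x))*p) := by
        calc (1:ℝ) = Real.exp (l^2/2) * Real.exp (-(l^2)/2) := by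
              rw [← Real.exp_add]; rw [show l^2/2 + -(l^2)/2 = 0 by ring, Real.exp_zero]
          _ ≤ Real.exp (l^2/2) * (15*(1+l)*p) := by gcongr
          _ ≤ _ := by gcongr; linarith [hL.l2]
      calc 2*D = 2*D*1 := by ring
        _ ≤ 2*D*(Real.exp (l^2/2) * (15*(2*(1+x))*p)) := by gcongr
        _ = Real.exp (l^2/2)*p*60*((1+x)*D) := by ring
        _ ≤ Real.exp (l^2/2)*p*60*(4*C*E) := by gcongr
        _ = _ := by ring
    have j3 := exp_neg_two_le (y := 240*C*E) (by linarith) hE1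
    calc _ ≤ Real.exp (l^2/2)*p*(1-240*C*E) := by
          refine mul_le_mul_of_nonneg_left (le_trans (le_of_eq ?_) j3) (by positivity)
          congr 1; ring
      _ = Real.exp (l^2/2)*p - Real.exp (l^2/2)*p*(240*C*E) := by ring
      _ ≤ _ := by linarith
  calc _ ≤ (p * Real.exp (8*(1+l)*(l-x))) * Real.exp (-(3000*C*E)) := by gcongr
    _ = p * (Real.exp (8*(1+l)*(l-x)-3000*C*E)) := by rw [mul_assoc, ← Real.exp_add]; ring_nf
    _ ≤ p * Real.exp (-(300*C*E) - 480*C*E) := by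
        refine mul_le_mul_of_nonneg_left (Real.exp_le_exp.2 ?_) hp.le
        have := hL.k1
        have : (1+l)*(l-x) ≤ 2*((1+x)*(l-x)) := by nlinarith [hL.l2, hL.xl]
        (first | linarith | nlinarith)
    _ ≤ p * (Real.exp (-(C*l^(2+ρ)*e + l*y)-480*C*E)) := by
        refine mul_le_mul_of_nonneg_left (Real.exp_le_exp.2 ?_) hp.le
        linarith
    _ = Real.exp (-(C*l^(2+ρ)*e + l^2/2 + l*y)) * (Real.exp (l^2/2)*p*Real.exp (-(480*C*E))) := by
        rw [show Real.exp (l^2/2)*p*Real.exp (-(480*C*E)) = p*(Real.exp (l^2/2)*Real.exp (-(480*C*E))) by ring,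
          ← Real.exp_add, mul_left_comm, ← Real.exp_add]
        congr 2; ring
    _ ≤ _ := by gcongr
end

open MeasureTheory Filter
open scoped Topology ENNReal

section
variable {Ω : Type} [mΩ : MeasurableSpace Ω] {P : Measure Ω} [IsProbabilityMeasure P] {n : ℕ}
    {F : ℕ → MeasurableSpace Ω} {X s m : ℕ → Ω → ℝ} {ρ γ e δ x E τ C : ℝ}

lemma cdf_near_zero {k : ℝ} (h0 : 0 < k) (h1 : k ≤ 1) : k/6 ≤ stdNormalCDF k - stdNormalCDF 0 := by
  obtain ⟨c, hc, h⟩ := exists_cdf_sub 0 k h0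
  rw [h, sub_zero]
  have h2 := gpdf_ge c
  have h3 : Real.exp (-(1/2)) ≤ Real.exp (-c^2/2) := Real.exp_le_exp.2 (by nlinarith [hc.1, hc.2])
  have h4 : (1:ℝ)/2 ≤ Real.exp (-(1/2)) := by
    rw [Real.exp_neg]
    have := exp_half_le
    rw [show (1:ℝ)/2 = 2⁻¹ by norm_num] at this ⊢
    exact inv_anti₀ (Real.exp_pos _) this
  have h5 : 1/6 ≤ gpdf c := by
    have e1 : -c^2/2 = -(c^2)/2 := by ring
    first
      | linarith
      | (rw [e1] at h3; linarith)
  (first | linarith | nlinarith)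

set_option maxHeartbeats 1000000 in
lemma lower2 {l y b : ℝ} (hb : Brk ρ γ e δ x E τ) (hL : LoP ρ γ e δ x E C l y b) (hC : 1 ≤ C)
    (hγ : 0 < γ) (hδ : 0 ≤ δ)
    {Q : Measure Ω} {β M : Ω → ℝ}
    (hT : TiltOut P Q (fun ω => SX X n ω - l / 2 * VX X n ω) β M ρ γ e δ l C)
    (hE1 : 1 ≤ 480*C*E) (hD1 : (1+x)^ρ*γ^ρ+δ ≤ 1/(100*C)) :
    (1 - stdNormalCDF x) * Real.exp (-(50000*C^2*E)) ≤ P.real {ω | x ≤ SX X n ω / √(VX X n ω)} := by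
  have hx := hb.x0
  have hE := hb.E0
  have hQ := hT.prob
  have hl0 := hL.l0
  set D := C * ((1 + l) ^ ρ * γ ^ ρ + δ) with hD
  have hD0 : 0 ≤ D := by positivity
  have hD2 : D ≤ 1/50 := by
    refine hL.k5.trans ?_
    calc _ ≤ 2*C*(1/(100*C)) := by gcongr
      _ = _ := by field_simp; norm_num
  set d0 := 1/(100*C) with hd0
  have hd0p : 0 < d0 := by positivity
  have hd1 : d0 ≤ 1/100 := by rw [hd0, div_le_div_iff₀ (by positivity) (by norm_num)]; linarith
  set r := d0/(1+x) with hr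
  have hr0 : 0 < r := by positivity
  have hr1 : r ≤ d0 := div_le_self hd0p.le (by linarith)
  have hxr : x*r ≤ d0 := by
    rw [hr, mul_div_assoc', div_le_iff₀ (by positivity)]; (first | linarith | nlinarith)
  set k := 24*(D+r) with hk
  have hk0 : 0 < k := by positivity
  have hk1 : k ≤ 1 := by linarith
  have h1 := hT.loW hL.l0 hx hL.hv hL.hb0 hL.hy hL.hb (J := Set.Icc 0 k) measurableSet_Icc
    (fun z hz => by simpa using hz.1)
  refine le_trans ?_ h1
  have h2 := hT.loJ hL.l0 0 k
  set I := ∫ ω in {ω | M ω ∈ Set.Icc 0 k}, Real.exp (-l*M ω) ∂Q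
  have hMm := hT.Mm
  have h3 : 4*r ≤ Q.real {ω | M ω ∈ Set.Icc 0 k} := by
    have a1 := (abs_le.1 (hT.be k)).1
    have a2 := (abs_le.1 (hT.be 0)).2
    have a3 : Q.real {ω | M ω < k} ≤ Q.real {ω | M ω < 0} + Q.real {ω | M ω ∈ Set.Icc 0 k} := by
      refine le_trans (measureReal_mono fun ω hω => ?_) (measureReal_union_le _ _)
      have hω : M ω < k := hω
      rcases lt_or_ge (M ω) 0 with h | h
      · exact Or.inl h
      · exact Or.inr ⟨h, hω.le⟩
    have a4 := cdf_near_zero hk0 hk1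
    linarith
  have hm := mills_upper x hx
  have k4 := hL.k4
  have k2 := hL.k2
  have hCE0 : 0 ≤ C*E := by (first | linarith | nlinarith)
  have hlk : l*k ≤ 25000*(C*E) := by
    calc l*k ≤ (2*x)*k := by gcongr; exact hL.l2
      _ = 48*(x*D) + 48*(x*r) := by rw [hk]; ring
      _ ≤ 48*(4*C*E) + 48*(480*C*E) := by
          have : x*D ≤ (1+x)*D := by gcongr; linarith
          have := k4
          linarith
      _ ≤ _ := by linarith
  have hdd : Real.exp (-(25*C)) ≤ 4*d0 := by
    have := Real.add_one_le_exp (25*C)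
    rw [Real.exp_neg, hd0, show 4*(1/(100*C)) = (25*C)⁻¹ by field_simp; norm_num]
    exact inv_anti₀ (by positivity) (by linarith)
  have hCC : C*E ≤ C^2*E := by (first | linarith | nlinarith)
  have hC25 : 25*C ≤ 12000*(C^2*E) := by (first | linarith | nlinarith)
  calc _ ≤ (Real.exp (-(x^2)/2)/(1+x)) * Real.exp (-(500*C*E) - 25000*(C*E) - 25*C) := by
        have e1 : 1 - stdNormalCDF x ≤ Real.exp (-(x^2)/2)/(1+x) := by
          rw [le_div_iff₀ (by linarith)]; linarith
        have e2 : Real.exp (-(50000*C^2*E)) ≤ Real.exp (-(500*C*E) - 25000*(C*E) - 25*C) :=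
          Real.exp_le_exp.2 (by linarith)
        gcongr
    _ = (Real.exp (-(x^2)/2 - 500*C*E) * Real.exp (-(25000*(C*E)))) * (Real.exp (-(25*C))/(1+x)) := by
        rw [← Real.exp_add, div_mul_eq_mul_div, ← Real.exp_add, mul_div_assoc', ← Real.exp_add]
        congr 2; ring
    _ ≤ (Real.exp (-(C*l^(2+ρ)*e + l^2/2 + l*y)) * Real.exp (-(l*k))) * (4*r) := by
        have e3 : Real.exp (-(25*C))/(1+x) ≤ 4*r := by
          rw [hr, mul_div_assoc']; gcongr
        have e4 : Real.exp (-(x^2)/2 - 500*C*E) ≤ Real.exp (-(C*l^(2+ρ)*e + l^2/2 + l*y)) :=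
          Real.exp_le_exp.2 (by linarith)
        have e5 : Real.exp (-(25000*(C*E))) ≤ Real.exp (-(l*k)) := Real.exp_le_exp.2 (by linarith)
        gcongr
    _ = Real.exp (-(C*l^(2+ρ)*e + l^2/2 + l*y)) * (Real.exp (-(l*k)) * (4*r)) := by ring
    _ ≤ _ := by
        refine mul_le_mul_of_nonneg_left (le_trans ?_ h2) (Real.exp_pos _).le
        exact mul_le_mul_of_nonneg_left h3 (Real.exp_pos _).le

/-- constants for the crude regime -/
noncomputable def loQ (C ι : ℝ) : ℝ := ι^2/(C+ι^2)
noncomputable def loK (C ι : ℝ) : ℝ := √(2*C/loQ C ι)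

lemma E_ge_sq (hb : Brk ρ γ e δ x E τ) (hρ : 0 < ρ) (hγ : 0 < γ) (hδ : 0 ≤ δ) (hδ1 : δ ≤ 1/4) {d ι : ℝ}
    (hd : 0 < d) (hd1 : d ≤ 1) (hι : 0 < ι) (hιd : (6*ι)^ρ ≤ d/2) (hxγ : x*γ ≤ ι)
    (hD1 : d ≤ (1+x)^ρ*γ^ρ+δ) : d^2*(1+x)^2 ≤ 16*E := by
  have hx := hb.x0
  have hd2 := hb.d2 hδ hδ1
  rcases le_or_gt (d/2) δ with h | h
  · have : (d/2)^2 ≤ δ^2 := pow_le_pow_left₀ (by positivity) h 2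
    have : (1+x)^2*(d/2)^2 ≤ (1+x)^2*δ^2 := by gcongr
    (first | linarith | nlinarith)
  · have h1 : d/2 ≤ (1+x)^ρ*γ^ρ := by linarith
    have h1' := h1
    rw [← Real.mul_rpow (by linarith) hγ.le] at h1
    have h2 : 6*ι ≤ (1+x)*γ := by
      by_contra hc
      push Not at hc
      have := Real.rpow_lt_rpow (by positivity) hc hρ
      linarith
    have h3 : 5*ι ≤ γ := by linarith
    have h4 : x ≤ 1 := by
      by_contra hc
      push Not at hc
      (first | linarith | nlinarith)
    have h5 : (1+x)*(d/2) ≤ E := le_trans (by gcongr) hb.b2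
    nlinarith [mul_nonneg hd.le (sub_nonneg.2 hd1), mul_nonneg (mul_nonneg hd.le (sub_nonneg.2 hd1)) (sq_nonneg (1+x)),
      mul_nonneg hd.le (mul_nonneg (by linarith : (0:ℝ) ≤ 1+x) (sub_nonneg.2 h4))]

set_option maxHeartbeats 1000000 in
lemma lower3 {l ι : ℝ} (hρ : 0 < ρ) (hl : l = 4*x+8*ι) (hx : 0 ≤ x) (hι : 0 < ι) (hι1 : ι ≤ 1/60) (hC : 1 ≤ C)
    (he : 0 ≤ e) (hγ : 0 < γ) (hγ1 : γ ≤ 1/4) (heγ : e ≤ 2*γ^ρ) (hιC : 32*C*(6*ι)^ρ ≤ 1) (hxγ : x*γ ≤ ι)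
    (hδ : 0 ≤ δ) (hδ1 : δ ≤ 1/4)
    {Q : Measure Ω} {β M : Ω → ℝ}
    (hT : TiltOut P Q (fun ω => SX X n ω - l / 2 * VX X n ω) β M ρ γ e δ l C) :
    loQ C ι/2 * Real.exp (-((16+4*loK C ι)*(1+x)^2)) ≤ P.real {ω | x ≤ SX X n ω / √(VX X n ω)} := by
  have hQ := hT.prob
  have l0 : 0 < l := by linarith
  set y := l*δ^2 + C*l^(1+ρ)*e with hy
  have hδ2 : δ^2 ≤ 1/16 := by (first | linarith | nlinarith)
  have hle : C*(l^ρ*e) ≤ 1/16 := by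
    have : l*γ ≤ 6*ι := by rw [hl]; (first | linarith | nlinarith)
    have h1 : (l*γ)^ρ ≤ (6*ι)^ρ := Real.rpow_le_rpow (by positivity) this hρ.le
    rw [Real.mul_rpow l0.le hγ.le] at h1
    calc C*(l^ρ*e) ≤ C*(l^ρ*(2*γ^ρ)) := by gcongr
      _ = 2*C*(l^ρ*γ^ρ) := by ring
      _ ≤ 2*C*(6*ι)^ρ := by gcongr
      _ ≤ _ := by linarith
  have hp1 : l^(1+ρ) = l * l^ρ := by rw [Real.rpow_add l0, Real.rpow_one]
  have hp2 : l^(2+ρ) = l^2 * l^ρ := by rw [Real.rpow_add l0, Real.rpow_two]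
  have hyl : y ≤ l/8 := by
    rw [hy, hp1]
    have := mul_le_mul_of_nonneg_left hle l0.le
    have := mul_le_mul_of_nonneg_left hδ2 l0.le
    (first | linarith | nlinarith)
  have hC2 : C*l^(2+ρ)*e ≤ l^2/16 := by
    rw [hp2]
    have := mul_le_mul_of_nonneg_left hle (sq_nonneg l)
    (first | linarith | nlinarith)
  have hly : l*y ≤ l^2/8 := by (first | linarith | nlinarith)
  have hbb : x^2/(2*l) ≤ l/2 - y - l/8 := by
    rw [div_le_iff₀ (by positivity)]
    have : x ≤ l/4 := by linarith
    have : x^2 ≤ (l/4)^2 := pow_le_pow_left₀ hx this 2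
    (first | linarith | nlinarith)
  have hv : ∀ v, 0 ≤ v → x * v ≤ l/2*v^2 + x^2/(2*l) := by
    intro v _
    have : l/2*v^2 + x^2/(2*l) - x*v = (l*v-x)^2/(2*l) := by field_simp; ring
    have : 0 ≤ (l*v-x)^2/(2*l) := by positivity
    linarith
  set q := loQ C ι with hq
  set k := loK C ι with hk
  have hq0 : 0 < q := by rw [hq, loQ]; positivity
  have hk0 : 0 < k := by rw [hk, loK]; exact Real.sqrt_pos.2 (by positivity)
  have hk2 : C/k^2 = q/2 := by
    have hk3 : k^2 = 2*C/q := by rw [hk, loK, Real.sq_sqrt (by rw [← hq]; positivity)]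
    have : 0 < C := by linarith
    rw [hk3]; field_simp
  have h1 := hT.loW l0.le hx (b := x^2/(2*l)) (t := l/8) hv (fun h => by positivity) hy hbb (J := Set.Icc (-(l/8)) k)
    measurableSet_Icc (fun z hz => hz.1)
  refine le_trans ?_ h1
  have h2 := hT.loJ l0.le (-(l/8)) k
  have h3 := hT.mid (by linarith) (by positivity : 0 < l/8) hk0
  have h4 : q ≤ (l/8)^2/(C+(l/8)^2) := by
    rw [hq, loQ, div_le_div_iff₀ (by positivity) (by positivity)]
    have : ι ≤ l/8 := by linarith
    have : ι^2 ≤ (l/8)^2 := pow_le_pow_left₀ hι.le this 2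
    (first | linarith | nlinarith)
  have h5 : q/2 ≤ Q.real {ω | M ω ∈ Set.Icc (-(l/8)) k} := by
    rw [hk2] at h3; linarith
  have hl4 : l ≤ 4*(1+x) := by linarith
  have hl16 : l^2 ≤ 16*(1+x)^2 := by
    have := pow_le_pow_left₀ l0.le hl4 2
    (first | linarith | nlinarith)
  have h6 : C*l^(2+ρ)*e + l^2/2 + l*y + l*k ≤ (16+4*k)*(1+x)^2 := by
    have : l*k ≤ 4*(1+x)^2*k := by
      have : 4*(1+x) ≤ 4*(1+x)^2 := by (first | linarith | nlinarith)
      gcongr; linarith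
    (first | linarith | nlinarith)
  calc _ ≤ q/2 * Real.exp (-(C*l^(2+ρ)*e + l^2/2 + l*y) + (-(l*k))) := by
        refine mul_le_mul_of_nonneg_left (Real.exp_le_exp.2 ?_) (by positivity)
        linarith
    _ = Real.exp (-(C*l^(2+ρ)*e + l^2/2 + l*y)) * (Real.exp (-(l*k)) * (q/2)) := by
        rw [Real.exp_add]; ring
    _ ≤ _ := by
        refine mul_le_mul_of_nonneg_left (le_trans ?_ h2) (Real.exp_pos _).le
        exact mul_le_mul_of_nonneg_left h5 (Real.exp_pos _).le
end

open MeasureTheory Filter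
open scoped Topology ENNReal

set_option maxHeartbeats 2000000 in
theorem two_sided (ρ : ℝ) (hρ : 0 < ρ) (hρ1 : ρ < 1) : ∃ K ι : ℝ, 0 < K ∧ 0 < ι ∧
    ∀ {Ω : Type} [mΩ : MeasurableSpace Ω] {P : Measure Ω} [IsProbabilityMeasure P] {n : ℕ}
      {F : ℕ → MeasurableSpace Ω} {X s m : ℕ → Ω → ℝ} {γ e δ x E τ : ℝ},
      Core P n F X s m ρ γ e δ → e ≤ 2*γ^ρ → Brk ρ γ e δ x E τ → x*γ ≤ ι →
      (1 - stdNormalCDF x) * Real.exp (-(K*E)) ≤ P.real {ω | x ≤ SX X n ω / √(VX X n ω)} ∧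
      P.real {ω | x ≤ SX X n ω / √(VX X n ω)} ≤ (1 - stdNormalCDF x) * Real.exp (K*E) := by
  obtain ⟨C, hC, hmain⟩ := tilt_main ρ hρ hρ1
  set d := 1/(100*C) with hd
  have hd0 : 0 < d := by positivity
  have hd1 : d ≤ 1/100 := by rw [hd, div_le_div_iff₀ (by positivity) (by norm_num)]; linarith
  have hdC : C*d = 1/100 := by rw [hd]; field_simp
  obtain ⟨ι, hι, hι60, hιd⟩ : ∃ ι : ℝ, 0 < ι ∧ ι ≤ 1/60 ∧ (6*ι)^ρ ≤ d/2 := by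
    refine ⟨min (1/60) ((d/2)^(1/ρ)/6), by positivity, min_le_left _ _, ?_⟩
    calc (6*min (1/60) ((d/2)^(1/ρ)/6))^ρ ≤ ((d/2)^(1/ρ))^ρ := by
          apply Real.rpow_le_rpow (by positivity) _ hρ.le
          have := min_le_right (1/60) ((d/2)^(1/ρ)/6)
          linarith
      _ = d/2 := by rw [← Real.rpow_mul (by positivity)]; rw [one_div_mul_cancel hρ.ne', Real.rpow_one]
  set q := loQ C ι with hq
  have hq0 : 0 < q := by rw [hq, loQ]; positivity
  set k := loK C ι with hk
  have hk0 : 0 ≤ k := by rw [hk, loK]; positivity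
  set K3 := 16*(16+4*k+2/q)/d^2 with hK3
  have hK30 : 0 < K3 := by positivity
  refine ⟨2000000*C^2 + K3, ι, by positivity, hι, ?_⟩
  intro Ω mΩ P _ n F X s m γ e δ x E τ h heγ hb hxι
  have hx := hb.x0
  have hE := hb.E0
  have hγ := h.γ0
  have he := h.e0
  have hp := one_sub_cdf_pos x
  have hCC : C ≤ C^2 := by (first | linarith | nlinarith)
  have hCE : C*E ≤ C^2*E := by gcongr
  have hK3E : 0 ≤ K3*E := by positivity
  have hιC : C*(6*ι)^ρ ≤ 1/200 := by
    have := mul_le_mul_of_nonneg_left hιd (by linarith : (0:ℝ) ≤ C)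
    linarith
  constructor
  · -- lower
    have hxe : x^ρ*e ≤ 2*(6*ι)^ρ := by
      calc x^ρ*e ≤ x^ρ*(2*γ^ρ) := by gcongr
        _ = 2*(x*γ)^ρ := by rw [Real.mul_rpow hx hγ.le]; ring
        _ ≤ _ := by
          have : (x*γ)^ρ ≤ (6*ι)^ρ := Real.rpow_le_rpow (by positivity) (by linarith) hρ.le
          linarith
    have hδ0 := h.δ0
    have wrap : ∀ K' : ℝ, K'*E ≤ (2000000*C^2+K3)*E → (1 - stdNormalCDF x) * Real.exp (-((2000000*C^2+K3)*E)) ≤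
        (1 - stdNormalCDF x) * Real.exp (-(K'*E)) := fun K' hK' =>
      mul_le_mul_of_nonneg_left (Real.exp_le_exp.2 (by linarith)) hp.le
    have low : δ ≤ d → ∃ l y b, LoP ρ γ e δ x E C l y b := fun hδd => by
      refine exists_LoP hb hρ hρ1 hγ he h.δ0 h.δ1 hC ?_
      have : δ^2 ≤ d := by (first | linarith | nlinarith)
      have : C*δ^2 ≤ 1/100 := by rw [← hdC]; gcongr
      have : C*(x^ρ*e) ≤ 1/100 := by (first | linarith | nlinarith)
      linarith
    have tl : ∀ {l y b}, LoP ρ γ e δ x E C l y b → l*γ ≤ 1/10 := fun hL => by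
      have := mul_le_mul_of_nonneg_right hL.l2 hγ.le
      linarith
    by_cases h1 : 240*C*E ≤ 1/2
    · have hδd : δ ≤ d := by
        have : δ ≤ (1+x)*δ := by (first | linarith | nlinarith)
        have : δ ≤ E := this.trans hb.b3
        have h2 : 240*(C*E) ≤ 50*(C*d) := by rw [hdC]; linarith
        have : C*E ≤ C*d := by (first | linarith | nlinarith)
        have : E ≤ d := le_of_mul_le_mul_left this (by linarith)
        linarith
      obtain ⟨l, y, b, hL⟩ := low hδd
      obtain ⟨Q, β, M, hT⟩ := hmain h l hL.l0 (tl hL)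
      refine le_trans (wrap (3000*C) ?_) (lower1 hb hL hC hγ hδ0 hT h1)
      (first | linarith | nlinarith)
    · by_cases h2 : (1+x)^ρ*γ^ρ+δ ≤ d
      · have hδd : δ ≤ d := by
          have : 0 ≤ (1+x)^ρ*γ^ρ := by positivity
          linarith
        obtain ⟨l, y, b, hL⟩ := low hδd
        obtain ⟨Q, β, M, hT⟩ := hmain h l hL.l0 (tl hL)
        refine le_trans (wrap (50000*C^2) ?_) (lower2 hb hL hC hγ hδ0 hT (by linarith) h2)
        (first | linarith | nlinarith)
      · have hEs := E_ge_sq hb hρ hγ h.δ0 h.δ1 hd0 (by linarith) hι hιd hxι (by linarith)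
        obtain ⟨Q, β, M, hT⟩ := hmain h (4*x+8*ι) (by positivity) (by
          have := h.γ1
          (first | linarith | nlinarith))
        refine le_trans ?_ (lower3 hρ rfl hx hι hι60 hC he hγ h.γ1 heγ (by linarith) hxι h.δ0 h.δ1 hT)
        have hp1 : 1 - stdNormalCDF x ≤ 1 := by linarith [cdf_nonneg x]
        have e1 : Real.exp (-(2/q)) ≤ q/2 := by
          rw [Real.exp_neg, show q/2 = (2/q)⁻¹ by rw [inv_div]]
          exact inv_anti₀ (by positivity) (by linarith [Real.add_one_le_exp (2/q)])
        have hEs' : (16+4*k+2/q)*(1+x)^2 ≤ K3*E := by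
          have : (1+x)^2 ≤ 16*E/d^2 := by rw [le_div_iff₀ (by positivity)]; linarith
          calc _ ≤ (16+4*k+2/q)*(16*E/d^2) := by gcongr
            _ = _ := by rw [hK3]; ring
        have : 2/q ≤ 2/q*(1+x)^2 := by
          exact le_mul_of_one_le_right (by positivity) (one_le_pow₀ (by linarith))
        calc _ ≤ 1 * Real.exp (-((2000000*C^2+K3)*E)) := by gcongr
          _ ≤ Real.exp (-(2/q) + -((16+4*k)*(1+x)^2)) := by
              rw [one_mul]; apply Real.exp_le_exp.2
              have : 0 ≤ C^2*E := by positivity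
              (first | linarith | nlinarith)
          _ = Real.exp (-(2/q)) * Real.exp (-((16+4*k)*(1+x)^2)) := Real.exp_add _ _
          _ ≤ _ := by gcongr
  · obtain ⟨Q, β, M, hT⟩ := hmain h x hx (by linarith)
    refine le_trans (measureReal_mono fun ω hω => W_le hω)
      ((upper_main h hb hC (by linarith) hT).trans ?_)
    refine mul_le_mul_of_nonneg_left (Real.exp_le_exp.2 ?_) hp.le
    linarith

open MeasureTheory Filter
open scoped Topology ENNReal

lemma E0_bound {ρ f x E : ℝ} (hρ : 0 < ρ) (hρ1 : ρ < 1) (hf : 0 < f) (hf1 : f ≤ 1) (hx : 0 ≤ x)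
    (hA : x^(2+ρ)*f ≤ E) (hB : (1+x)*(f^((2-ρ)/4)/(1+x^(ρ*(2+ρ)/4))) ≤ E) :
    (1+x)^((8+2*ρ)/(6+ρ)) * f^(4/(6+ρ)) ≤ 8*E := by
  have a2 : (8+2*ρ)/(6+ρ) ≤ 2 := by rw [div_le_iff₀ (by linarith)]; linarith
  have a0 : 0 ≤ (8+2*ρ)/(6+ρ) := by positivity
  have hg : 0 < f^((2-ρ)/4) := by positivity
  rcases le_total x 1 with h | h
  · have h1 : (1+x)^((8+2*ρ)/(6+ρ)) ≤ 4 := by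
      calc (1+x)^((8+2*ρ)/(6+ρ)) ≤ (1+x)^(2:ℝ) := Real.rpow_le_rpow_of_exponent_le (by linarith) a2
        _ = (1+x)^2 := Real.rpow_two _
        _ ≤ 4 := by nlinarith
    have h2 : f^(4/(6+ρ)) ≤ f^((2-ρ)/4) := by
      apply Real.rpow_le_rpow_of_exponent_ge hf hf1
      rw [div_le_div_iff₀ (by norm_num) (by linarith)]
      nlinarith
    have h3 : x^(ρ*(2+ρ)/4) ≤ 1 := Real.rpow_le_one hx h (by positivity)
    have h4 : f^((2-ρ)/4)/2 ≤ E := by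
      refine le_trans ?_ hB
      have : f^((2-ρ)/4)/2 ≤ f^((2-ρ)/4)/(1+x^(ρ*(2+ρ)/4)) := by gcongr; linarith
      have h5 : 0 ≤ f^((2-ρ)/4)/(1+x^(ρ*(2+ρ)/4)) := by positivity
      nlinarith
    calc _ ≤ 4 * f^((2-ρ)/4) := by gcongr
      _ ≤ _ := by linarith
  · have hx0 : 0 < x := by linarith
    have h1 : (1+x)^((8+2*ρ)/(6+ρ)) ≤ 4 * x^((8+2*ρ)/(6+ρ)) := by
      calc (1+x)^((8+2*ρ)/(6+ρ)) ≤ (2*x)^((8+2*ρ)/(6+ρ)) := Real.rpow_le_rpow (by linarith) (by linarith) a0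
        _ = 2^((8+2*ρ)/(6+ρ)) * x^((8+2*ρ)/(6+ρ)) := Real.mul_rpow (by norm_num) hx
        _ ≤ 2^(2:ℝ) * x^((8+2*ρ)/(6+ρ)) := by
            have := Real.rpow_le_rpow_of_exponent_le (x := 2) (by norm_num) a2
            gcongr
        _ = _ := by norm_num
    have hh1 : 1 ≤ x^(ρ*(2+ρ)/4) := Real.one_le_rpow h (by positivity)
    set B := x^(1-ρ*(2+ρ)/4) * f^((2-ρ)/4) with hBd
    have hBE : B ≤ 2*E := by
      have e1 : B = x * (f^((2-ρ)/4)/x^(ρ*(2+ρ)/4)) := by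
        rw [hBd, Real.rpow_sub hx0, Real.rpow_one]; ring
      have e2 : f^((2-ρ)/4)/x^(ρ*(2+ρ)/4) ≤ 2*(f^((2-ρ)/4)/(1+x^(ρ*(2+ρ)/4))) := by
        rw [mul_div_assoc', div_le_div_iff₀ (by linarith) (by linarith)]
        nlinarith
      have h5 : 0 ≤ f^((2-ρ)/4)/(1+x^(ρ*(2+ρ)/4)) := by positivity
      rw [e1]
      calc _ ≤ x*(2*(f^((2-ρ)/4)/(1+x^(ρ*(2+ρ)/4)))) := by gcongr
        _ ≤ _ := by nlinarith
    have hB0 : 0 < B := by positivity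
    have hE : 0 < E := by linarith
    have hA0 : 0 < x^(2+ρ)*f := by positivity
    have key : x^((8+2*ρ)/(6+ρ)) * f^(4/(6+ρ)) = (x^(2+ρ)*f)^((2+ρ)/(6+ρ)) * B^(4/(6+ρ)) := by
      have c1 : (8+2*ρ)/(6+ρ) = (2+ρ)*((2+ρ)/(6+ρ)) + (1-ρ*(2+ρ)/4)*(4/(6+ρ)) := by field_simp; ring
      have c2 : 4/(6+ρ) = (2+ρ)/(6+ρ) + (2-ρ)/4*(4/(6+ρ)) := by field_simp; ring
      rw [hBd, Real.mul_rpow (by positivity) hf.le, Real.mul_rpow (by positivity) (by positivity),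
        ← Real.rpow_mul hx, ← Real.rpow_mul hx, ← Real.rpow_mul hf.le]
      calc _ = x^((2+ρ)*((2+ρ)/(6+ρ)) + (1-ρ*(2+ρ)/4)*(4/(6+ρ))) * f^((2+ρ)/(6+ρ) + (2-ρ)/4*(4/(6+ρ))) := by
            rw [← c1, ← c2]
        _ = _ := by rw [Real.rpow_add hx0, Real.rpow_add hf]; ring
    have k2 : (x^(2+ρ)*f)^((2+ρ)/(6+ρ)) * B^(4/(6+ρ)) ≤ 2*E := by
      calc _ ≤ (2*E)^((2+ρ)/(6+ρ)) * (2*E)^(4/(6+ρ)) := by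
            have hA2 : x^(2+ρ)*f ≤ 2*E := by linarith
            exact mul_le_mul (Real.rpow_le_rpow hA0.le hA2 (by positivity))
              (Real.rpow_le_rpow hB0.le hBE (by positivity)) (by positivity) (by positivity)
        _ = (2*E)^(1:ℝ) := by
            rw [← Real.rpow_add (by positivity)]; congr 1; field_simp; ring
        _ = _ := Real.rpow_one _
    calc _ ≤ 4 * x^((8+2*ρ)/(6+ρ)) * f^(4/(6+ρ)) := by gcongr
      _ = 4*(x^((8+2*ρ)/(6+ρ)) * f^(4/(6+ρ))) := by ring
      _ ≤ 4*(2*E) := by rw [key]; gcongr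
      _ = _ := by ring

lemma exists_Brk {ρ γ e δ x f E : ℝ} (hρ : 0 < ρ) (hρ1 : ρ < 1) (hγ : 0 < γ) (hδ : 0 ≤ δ)
    (hf : 0 < f) (hf1 : f ≤ 1) (he : 0 ≤ e) (hef : e ≤ f) (heγ : e ≤ 2*γ^ρ) (hx : 0 ≤ x)
    (hE : E = x^(2+ρ)*f + x^2*δ^2 + (1+x)*(x^ρ*γ^ρ + γ^ρ + δ + f^((2-ρ)/4)/(1+x^(ρ*(2+ρ)/4)))) :
    ∃ τ, Brk ρ γ e δ x E τ := by
  have p1 : 0 ≤ x^(2+ρ)*f := by positivity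
  have p2 : 0 ≤ x^2*δ^2 := by positivity
  have p3 : 0 ≤ (1+x)*(x^ρ*γ^ρ) := by positivity
  have p4 : 0 < γ^ρ := by positivity
  have p4' : 0 ≤ x*γ^ρ := by positivity
  have p5 : 0 ≤ (1+x)*δ := by positivity
  have p6 : 0 ≤ (1+x)*(f^((2-ρ)/4)/(1+x^(ρ*(2+ρ)/4))) := by positivity
  have hE' : E = x^(2+ρ)*f + x^2*δ^2 + (1+x)*(x^ρ*γ^ρ) + (γ^ρ + x*γ^ρ) + (1+x)*δ +
    (1+x)*(f^((2-ρ)/4)/(1+x^(ρ*(2+ρ)/4))) := by rw [hE]; ring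
  have hu : 0 < 1+x := by linarith
  have hE0 := E0_bound (E := E) hρ hρ1 hf hf1 hx (by linarith) (by linarith)
  have hfu : 0 < f/(1+x) := by positivity
  have q1 : (1+x)^2*((f/(1+x))^(2/(6+ρ)))^2 = (1+x)^((8+2*ρ)/(6+ρ)) * f^(4/(6+ρ)) := by
    rw [← Real.rpow_natCast _ 2, ← Real.rpow_natCast (_ ^ _) 2, ← Real.rpow_mul hfu.le,
      Real.div_rpow hf.le hu.le, mul_div_assoc', mul_comm, mul_div_assoc, ← Real.rpow_sub hu, mul_comm]
    congr 2
    · push_cast; field_simp; ring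
    · push_cast; field_simp; norm_num
  have q2 : (1+x)*(f*((f/(1+x))^(2/(6+ρ)))^(-(1+ρ/2))) = (1+x)^((8+2*ρ)/(6+ρ)) * f^(4/(6+ρ)) := by
    rw [← Real.rpow_mul hfu.le, Real.div_rpow hf.le hu.le]
    have e1 : (1+x)^((8+2*ρ)/(6+ρ)) = (1+x) / (1+x)^(2/(6+ρ)*(-(1+ρ/2))) := by
      conv_rhs => rw [← Real.rpow_one (1+x), ← Real.rpow_mul hu.le, ← Real.rpow_sub hu]
      congr 1; field_simp; ring
    have e2 : f^(4/(6+ρ)) = f * f^(2/(6+ρ)*(-(1+ρ/2))) := by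
      conv_rhs => rw [← Real.rpow_one f, ← Real.rpow_mul hf.le, ← Real.rpow_add hf]
      congr 1; field_simp; ring
    rw [e1, e2]; ring
  refine ⟨(f/(1+x))^(2/(6+ρ)), ⟨by linarith, hx, by linarith, ?_, by linarith, ?_, by positivity, ?_, ?_, ?_⟩⟩
  · have : (1+x)^ρ ≤ 1 + x^ρ := by
      have := Real.rpow_add_le_add_rpow (a := 1) (b := x) (p := ρ) (by norm_num) hx hρ.le hρ1.le
      simpa using this
    calc _ ≤ (1+x)*((1+x^ρ)*γ^ρ) := by gcongr
      _ = (1+x)*(x^ρ*γ^ρ) + (γ^ρ + x*γ^ρ) := by ring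
      _ ≤ _ := by linarith
  · rcases le_total x 1 with h | h
    · have : (1+x)^(2+ρ) ≤ 8 := by
        calc (1+x)^(2+ρ) ≤ 2^(2+ρ) := Real.rpow_le_rpow hu.le (by linarith) (by linarith)
          _ ≤ 2^(3:ℝ) := Real.rpow_le_rpow_of_exponent_le (by norm_num) (by linarith)
          _ = 8 := by norm_num
      calc _ ≤ 8*(2*γ^ρ) := by gcongr
        _ ≤ _ := by linarith
    · have : (1+x)^(2+ρ) ≤ 8*x^(2+ρ) := by
        calc (1+x)^(2+ρ) ≤ (2*x)^(2+ρ) := Real.rpow_le_rpow hu.le (by linarith) (by linarith)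
          _ = 2^(2+ρ)*x^(2+ρ) := Real.mul_rpow (by norm_num) hx
          _ ≤ 2^(3:ℝ)*x^(2+ρ) := by
              have := Real.rpow_le_rpow_of_exponent_le (x := 2) (by norm_num) (by linarith : 2+ρ ≤ 3)
              gcongr
          _ = _ := by norm_num
      calc _ ≤ 8*x^(2+ρ)*f := by gcongr
        _ ≤ _ := by linarith
  · apply Real.rpow_le_one hfu.le _ (by positivity)
    rw [div_le_one hu]; linarith
  · rw [q1]; exact hE0
  · refine le_trans ?_ (q2.le.trans hE0)
    gcongr

open MeasureTheory Filter
open scoped Topology ENNReal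

section
variable {Ω : Type} [mΩ : MeasurableSpace Ω] {P : Measure Ω} [IsProbabilityMeasure P] {n : ℕ}
    {F : ℕ → MeasurableSpace Ω} {X s m : ℕ → Ω → ℝ} {ρ γ e δ : ℝ}

lemma cond_jensen {G : MeasurableSpace Ω} (hG : G ≤ mΩ) {Y : Ω → ℝ} (hρ : 0 < ρ)
    (i2 : Integrable (fun ω => (Y ω)^2) P) (i3 : Integrable (fun ω => |Y ω|^(2+ρ)) P) :
    ∀ᵐ ω ∂P, (P[fun ω => (Y ω)^2|G] ω)^(1+ρ/2) ≤ P[fun ω => |Y ω|^(2+ρ)|G] ω := by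
  have hfe : (fun t : ℝ => t^(1+ρ/2)) ∘ (fun ω => (Y ω)^2) = fun ω => |Y ω|^(2+ρ) := by
    ext ω
    simp only [Function.comp_apply]
    rw [← sq_abs, ← Real.rpow_natCast, ← Real.rpow_mul (abs_nonneg _)]
    congr 1; push_cast; ring
  have := ConvexOn.map_condExp_le (μ := P) (f := fun ω => (Y ω)^2) hG (convexOn_rpow (p := 1+ρ/2) (by linarith))
    ((Real.continuous_rpow_const (by linarith)).lowerSemicontinuous.lowerSemicontinuousOn _)
    (ae_of_all _ fun ω => sq_nonneg (Y ω)) isClosed_Ici i2 (by rw [hfe]; exact i3)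
  rw [hfe] at this
  exact this

lemma Core.min (h : Core P n F X s m ρ γ e δ) : Core P n F X s m ρ γ (min e (2*γ^ρ)) δ :=
  { h with
    mT := fun k ω => le_min (h.mT k ω) (by
      have h1 : ∑ j ∈ Finset.range k, m j ω ≤ γ^ρ * ∑ j ∈ Finset.range k, s j ω := by
        rw [Finset.mul_sum]; exact Finset.sum_le_sum fun j _ => h.ms j ω
      have h2 := h.sT k ω
      have h3 : δ^2 ≤ 1 := by nlinarith [h.δ0, h.δ1]
      have h4 : 0 ≤ γ^ρ := Real.rpow_nonneg h.γ0.le _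
      nlinarith) }

lemma sum_range_le_of_zero {f : ℕ → ℝ} (h0 : ∀ j, 0 ≤ f j) (hz : ∀ j, n ≤ j → f j = 0) (k : ℕ) :
    ∑ j ∈ Finset.range k, f j ≤ ∑ j ∈ Finset.range n, f j := by
  have h1 : ∑ j ∈ Finset.range k, f j ≤ ∑ j ∈ Finset.range (max k n), f j :=
    Finset.sum_le_sum_of_subset_of_nonneg (Finset.range_mono (le_max_left _ _)) fun j _ _ => h0 j
  refine h1.trans (le_of_eq ?_)
  symm
  apply Finset.sum_subset (Finset.range_mono (le_max_right _ _))
  intro j _ hj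
  exact hz j (by simpa using hj)

lemma sum_indicator_le {a : ℕ → Ω → ℝ} {G : ℕ → Set Ω} (hG : ∀ j k, j ≤ k → G k ⊆ G j) {c : ℝ} (hc : 0 ≤ c)
    (h : ∀ k, ∀ ω ∈ G k, ∑ j ∈ Finset.range (k+1), a j ω ≤ c) (k : ℕ) (ω : Ω) :
    ∑ j ∈ Finset.range k, (G j).indicator (a j) ω ≤ c := by
  induction k with
  | zero => simpa using hc
  | succ k ih =>
    by_cases hk : ω ∈ G k
    · refine le_trans (le_of_eq (Finset.sum_congr rfl fun j hj => ?_)) (h k ω hk)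
      exact Set.indicator_of_mem (hG j k (by simpa [Nat.lt_succ_iff] using hj) hk) _
    · rw [Finset.sum_range_succ, Set.indicator_of_notMem hk, add_zero]; exact ih

set_option maxHeartbeats 1000000 in
lemma Core.build (hρ : 0 < ρ) (hρ1 : ρ < 1) (γ0 : 0 < γ) (γ1 : γ ≤ 1/4) (δ0 : 0 ≤ δ) (δ1 : δ ≤ 1/4) (he : 0 ≤ e)
    (mono : Monotone F) (le : ∀ k, F k ≤ mΩ) (Xm : ∀ k, Measurable[F (k + 1)] (X k))
    (i2 : ∀ k, Integrable (fun ω => (X k ω)^2) P)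
    (i3 : ∀ k, Integrable (fun ω => |X k ω| ^ (2 + ρ)) P)
    (c1 : ∀ k, P[X k|F k] =ᵐ[P] 0)
    (hz : ∀ k, n ≤ k → X k = fun _ => 0)
    (hms : ∀ k, ∀ᵐ ω ∂P, P[fun ω => |X k ω| ^ (2 + ρ)|F k] ω ≤ γ^ρ * P[fun ω => (X k ω)^2|F k] ω)
    (hsT : ∀ᵐ ω ∂P, |∑ j ∈ Finset.range n, P[fun ω => (X j ω)^2|F j] ω - 1| ≤ δ^2)
    (hmT : ∀ᵐ ω ∂P, ∑ j ∈ Finset.range n, P[fun ω => |X j ω| ^ (2 + ρ)|F j] ω ≤ e) :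
    ∃ s m, Core P n F X s m ρ γ e δ := by
  set a : ℕ → Ω → ℝ := fun k => P[fun ω => (X k ω)^2|F k] with ha
  set b : ℕ → Ω → ℝ := fun k => P[fun ω => |X k ω| ^ (2 + ρ)|F k] with hb
  have am : ∀ k, Measurable[F k] (a k) := fun k => stronglyMeasurable_condExp.measurable
  have bm : ∀ k, Measurable[F k] (b k) := fun k => stronglyMeasurable_condExp.measurable
  set R : ℕ → Set Ω := fun j => {ω | 0 ≤ a j ω} ∩ {ω | (a j ω)^(1+ρ/2) ≤ b j ω} ∩ {ω | b j ω ≤ γ^ρ * a j ω} ∩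
    {ω | ∑ i ∈ Finset.range (j+1), a i ω ≤ 1+δ^2} ∩ {ω | ∑ i ∈ Finset.range (j+1), b i ω ≤ e} with hR
  have Rm : ∀ j, MeasurableSet[F j] (R j) := fun j => by
    have sa : Measurable[F j] (fun ω => ∑ i ∈ Finset.range (j+1), a i ω) :=
      Finset.measurable_fun_sum _ fun i hi =>
        (am i).mono (mono (by simpa [Nat.lt_succ_iff] using hi)) le_rfl
    have sb : Measurable[F j] (fun ω => ∑ i ∈ Finset.range (j+1), b i ω) :=
      Finset.measurable_fun_sum _ fun i hi =>
        (bm i).mono (mono (by simpa [Nat.lt_succ_iff] using hi)) le_rfl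
    have pa : Measurable[F j] (fun ω => (a j ω)^(1+ρ/2)) :=
      (Real.continuous_rpow_const (by linarith)).measurable.comp (am j)
    exact ((((measurableSet_le measurable_const (am j)).inter
      (measurableSet_le pa (bm j))).inter
      (measurableSet_le (bm j) ((am j).const_mul _))).inter
      (measurableSet_le sa measurable_const)).inter
      (measurableSet_le sb measurable_const)
  set G : ℕ → Set Ω := fun k => ⋂ j ∈ Finset.range (k+1), R j with hGd
  have Gm : ∀ k, MeasurableSet[F k] (G k) := fun k =>
    Finset.measurableSet_biInter _ fun j hj => mono (by simpa [Nat.lt_succ_iff] using hj) _ (Rm j)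
  have GR : ∀ k, G k ⊆ R k := fun k ω hω => by
    simp only [hGd, Set.mem_iInter] at hω
    exact hω k (by simp)
  have Gmono : ∀ j k, j ≤ k → G k ⊆ G j := fun j k hjk ω hω => by
    simp only [hGd, Set.mem_iInter] at hω ⊢
    intro i hi
    exact hω i (by simp at hi ⊢; omega)
  have az : ∀ k, n ≤ k → a k = 0 := fun k hk => by
    simp only [ha, hz k hk]
    rw [show (fun _ : Ω => (0:ℝ)^2) = 0 by ext; simp]
    exact condExp_zero
  have bz : ∀ k, n ≤ k → b k = 0 := fun k hk => by
    simp only [hb, hz k hk]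
    rw [show (fun _ : Ω => |(0:ℝ)|^(2+ρ)) = 0 by ext; simp [Real.zero_rpow (by linarith : 2+ρ ≠ 0)]]
    exact condExp_zero
  have full : ∀ᵐ ω ∂P, ∀ k, ω ∈ R k := by
    have a0 : ∀ᵐ ω ∂P, ∀ k, 0 ≤ a k ω := ae_all_iff.2 fun k =>
      condExp_nonneg (ae_of_all _ fun ω => sq_nonneg (X k ω))
    have b0 : ∀ᵐ ω ∂P, ∀ k, 0 ≤ b k ω := ae_all_iff.2 fun k =>
      condExp_nonneg (ae_of_all _ fun ω => Real.rpow_nonneg (abs_nonneg (X k ω)) _)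
    have j0 : ∀ᵐ ω ∂P, ∀ k, (a k ω)^(1+ρ/2) ≤ b k ω := ae_all_iff.2 fun k =>
      cond_jensen (le k) hρ (i2 k) (i3 k)
    have m0 := ae_all_iff.2 hms
    filter_upwards [a0, b0, j0, m0, hsT, hmT] with ω h1 h2 h3 h4 h5 h6 k
    refine ⟨⟨⟨⟨h1 k, h3 k⟩, h4 k⟩, ?_⟩, ?_⟩
    · have := sum_range_le_of_zero (n := n) (f := fun j => a j ω) h1 (fun j hj => by simp [az j hj]) (k+1)
      have := (abs_le.1 h5).2
      show ∑ i ∈ Finset.range (k+1), a i ω ≤ 1+δ^2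
      linarith
    · exact (sum_range_le_of_zero (n := n) (f := fun j => b j ω) h2 (fun j hj => by simp [bz j hj]) (k+1)).trans h6
  have fullG : ∀ᵐ ω ∂P, ∀ k, ω ∈ G k := by
    filter_upwards [full] with ω hω k
    simp only [hGd, Set.mem_iInter]
    intro j _; exact hω j
  refine ⟨fun k => (G k).indicator (a k), fun k => (G k).indicator (b k),
    hρ, hρ1, γ0, γ1, δ0, δ1, mono, le, Xm, fun k => Measurable.indicator (m := F k) (am k) (Gm k),
    fun k => Measurable.indicator (m := F k) (bm k) (Gm k), ?_, ?_, ?_, ?_, ?_, ?_, i3, c1, ?_, ?_⟩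
  · intro k ω
    by_cases h : ω ∈ G k
    · simp only [Set.indicator_of_mem h]; exact (GR k h).1.1.1.1
    · simp only [Set.indicator_of_notMem h]; exact le_rfl
  · intro k ω
    by_cases h : ω ∈ G k
    · simp only [Set.indicator_of_mem h]; exact (GR k h).1.1.1.2
    · simp only [Set.indicator_of_notMem h]; rw [Real.zero_rpow (by linarith)]
  · intro k ω
    by_cases h : ω ∈ G k
    · simp only [Set.indicator_of_mem h]; exact (GR k h).1.1.2
    · simp only [Set.indicator_of_notMem h]; simp
  · exact fun k ω => sum_indicator_le Gmono (by positivity) (fun k ω h => (GR k h).1.2) k ω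
  · exact fun k ω => sum_indicator_le Gmono he (fun k ω h => (GR k h).2) k ω
  · filter_upwards [fullG, hsT] with ω h1 h2
    rw [Finset.sum_congr rfl fun j _ => Set.indicator_of_mem (h1 j) _]
    have := (abs_le.1 h2).1
    linarith
  · intro k
    filter_upwards [fullG] with ω h1
    rw [Set.indicator_of_mem (h1 k)]
  · intro k
    filter_upwards [fullG] with ω h1
    rw [Set.indicator_of_mem (h1 k)]
end

open MeasureTheory Filter
open scoped Topology ENNReal

noncomputable section

lemma sum_Icc_eq_range (f : ℕ → ℝ) (n : ℕ) : ∑ i ∈ Finset.Icc 1 n, f i = ∑ k ∈ Finset.range n, f (k+1) := by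
  induction n with
  | zero => simp
  | succ n ih => rw [Finset.sum_Icc_succ_top (by omega), ih, Finset.sum_range_succ]

namespace MDS
variable {Ω : Type} [mΩ : MeasurableSpace Ω] {P : Measure Ω} [IsProbabilityMeasure P]

lemma Bsq_pos (A : MDS Ω P) : 0 < A.Bsq := by
  unfold Bsq
  refine Finset.sum_pos (fun i hi => ?_) ⟨1, by simpa using Nat.succ_le_of_lt A.npos⟩
  rw [Finset.mem_Icc] at hi
  exact A.var_pos i hi.1 hi.2

def scal (A : MDS Ω P) (c : ℝ) : ℕ → Ω → ℝ := fun k => if k < A.n then (fun ω => c * A.X (k+1) ω) else fun _ => 0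

lemma scal_lt (A : MDS Ω P) (c : ℝ) {k : ℕ} (hk : k < A.n) : A.scal c k = fun ω => c * A.X (k+1) ω := by
  simp [scal, hk]

lemma scal_ge (A : MDS Ω P) (c : ℝ) {k : ℕ} (hk : A.n ≤ k) : A.scal c k = fun _ => 0 := by
  simp [scal, not_lt.2 hk]

lemma scal_c2 (A : MDS Ω P) (c : ℝ) {k : ℕ} (hk : k < A.n) :
    P[fun ω => (A.scal c k ω)^2|A.F k] =ᵐ[P] fun ω => c^2 * P[fun ω => (A.X (k+1) ω)^2|A.F k] ω := by
  rw [A.scal_lt c hk]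
  rw [show (fun ω => (c * A.X (k+1) ω)^2) = fun ω => c^2 * (A.X (k+1) ω)^2 by ext; ring]
  exact condExp_const_mul_ae (c^2) (f := fun ω => (A.X (k+1) ω)^2) EventuallyEq.rfl

lemma scal_c3 (A : MDS Ω P) (c : ℝ) {k : ℕ} (hk : k < A.n) (ρ : ℝ) :
    P[fun ω => |A.scal c k ω|^(2+ρ)|A.F k] =ᵐ[P] fun ω => |c|^(2+ρ) * P[fun ω => |A.X (k+1) ω|^(2+ρ)|A.F k] ω := by
  rw [A.scal_lt c hk]
  rw [show (fun ω => |c * A.X (k+1) ω|^(2+ρ)) = fun ω => |c|^(2+ρ) * |A.X (k+1) ω|^(2+ρ) by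
    ext; rw [abs_mul, Real.mul_rpow (abs_nonneg _) (abs_nonneg _)]]
  exact condExp_const_mul_ae (|c|^(2+ρ)) (f := fun ω => |A.X (k+1) ω|^(2+ρ)) EventuallyEq.rfl

lemma core (A : MDS Ω P) {ρ δ ε γ c : ℝ} (hρ : 0 < ρ) (hρ1 : ρ < 1) (h1 : A.CondA1 δ) (h2 : A.CondA2 ρ ε)
    (h4 : A.CondA4 ρ γ) (hc : |c| = (√A.Bsq)⁻¹) :
    ∃ s m, Core P A.n A.F (A.scal c) s m ρ γ (ε^ρ) δ := by
  obtain ⟨δ0, δ1, hA1⟩ := h1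
  obtain ⟨ε0, ε1, hi3, hA2⟩ := h2
  obtain ⟨γ0, γ1, -, hA4⟩ := h4
  have hB := A.Bsq_pos
  have hsB : 0 < √A.Bsq := Real.sqrt_pos.2 hB
  have hc0 : 0 < |c| := by rw [hc]; positivity
  have hc2 : c^2 * A.Bsq = 1 := by
    rw [← sq_abs, hc, inv_pow, Real.sq_sqrt hB.le]; field_simp
  have hc3 : |c|^(2+ρ) * A.Bsq^((2+ρ)/2) = 1 := by
    rw [show A.Bsq^((2+ρ)/2) = (√A.Bsq)^(2+ρ) by
      rw [Real.sqrt_eq_rpow, ← Real.rpow_mul hB.le]; congr 1; ring]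
    rw [← Real.mul_rpow (abs_nonneg _) hsB.le, hc, inv_mul_cancel₀ hsB.ne', Real.one_rpow]
  have hc4 : |c|^(2+ρ) * (γ * √A.Bsq)^ρ = γ^ρ * c^2 := by
    rw [Real.rpow_add hc0, Real.rpow_two, sq_abs, Real.mul_rpow γ0.le hsB.le]
    have : |c|^ρ * (√A.Bsq)^ρ = 1 := by
      rw [← Real.mul_rpow (abs_nonneg _) hsB.le, hc, inv_mul_cancel₀ hsB.ne', Real.one_rpow]
    linear_combination (c^2 * γ^ρ) * this
  have hall2 : ∀ᵐ ω ∂P, ∀ k, k < A.n → P[fun ω => (A.scal c k ω)^2|A.F k] ω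
      = c^2 * P[fun ω => (A.X (k+1) ω)^2|A.F k] ω := by
    refine ae_all_iff.2 fun k => ?_
    by_cases hk : k < A.n
    · filter_upwards [A.scal_c2 c hk] with ω h _ using h
    · exact ae_of_all _ fun ω h => absurd h hk
  have hall3 : ∀ᵐ ω ∂P, ∀ k, k < A.n → P[fun ω => |A.scal c k ω|^(2+ρ)|A.F k] ω
      = |c|^(2+ρ) * P[fun ω => |A.X (k+1) ω|^(2+ρ)|A.F k] ω := by
    refine ae_all_iff.2 fun k => ?_
    by_cases hk : k < A.n
    · filter_upwards [A.scal_c3 c hk ρ] with ω h _ using h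
    · exact ae_of_all _ fun ω h => absurd h hk
  refine Core.build hρ hρ1 γ0 γ1 δ0 δ1 (by positivity) A.F_mono A.F_le ?_ ?_ ?_ ?_ (fun k hk => A.scal_ge c hk) ?_ ?_ ?_
  · intro k
    by_cases hk : k < A.n
    · rw [A.scal_lt c hk]
      exact (A.meas (k+1) (by omega) (by omega)).measurable.const_mul c
    · rw [A.scal_ge c (not_lt.1 hk)]; exact measurable_const
  · intro k
    by_cases hk : k < A.n
    · rw [A.scal_lt c hk]
      simp only [mul_pow]
      exact (A.sq_int (k+1) (by omega) (by omega)).const_mul _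
    · rw [A.scal_ge c (not_lt.1 hk)]; exact integrable_const _
  · intro k
    by_cases hk : k < A.n
    · rw [A.scal_lt c hk]
      simp only [abs_mul, Real.mul_rpow (abs_nonneg _) (abs_nonneg _)]
      exact (hi3 (k+1) (by omega) (by omega)).const_mul _
    · rw [A.scal_ge c (not_lt.1 hk)]; exact integrable_const _
  · intro k
    by_cases hk : k < A.n
    · rw [A.scal_lt c hk]
      have := condExp_const_mul_ae c (A.mean_zero (k+1) (by omega) (by omega))
      simp only [Nat.add_sub_cancel] at this
      refine this.trans (ae_of_all _ fun ω => by simp)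
    · rw [A.scal_ge c (not_lt.1 hk)]
      exact EventuallyEq.of_eq condExp_zero
  · intro k
    by_cases hk : k < A.n
    · have := hA4 (k+1) (by omega) (by omega)
      simp only [Nat.add_sub_cancel] at this
      filter_upwards [hall2, hall3, this] with ω e2 e3 h
      rw [e2 k hk, e3 k hk, ← mul_assoc, ← hc4, mul_assoc]
      exact mul_le_mul_of_nonneg_left h (by positivity)
    · rw [A.scal_ge c (not_lt.1 hk)]
      rw [show (fun _ : Ω => |(0:ℝ)|^(2+ρ)) = 0 by ext; simp [Real.zero_rpow (by linarith : 2+ρ ≠ 0)]]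
      rw [show (fun _ : Ω => (0:ℝ)^2) = 0 by ext; simp]
      rw [condExp_zero]
      simp
  · filter_upwards [hall2, hA1] with ω e2 h
    rw [Finset.sum_congr rfl fun k hk => e2 k (Finset.mem_range.1 hk), ← Finset.mul_sum]
    unfold CV at h
    rw [sum_Icc_eq_range] at h
    simp only [Nat.add_sub_cancel] at h
    rw [← hc2, ← mul_sub, abs_mul, abs_of_nonneg (sq_nonneg c)]
    calc _ ≤ c^2 * (δ^2 * A.Bsq) := mul_le_mul_of_nonneg_left h (sq_nonneg c)
      _ = δ^2 := by linear_combination δ^2 * hc2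
  · filter_upwards [hall3, hA2] with ω e3 h
    rw [Finset.sum_congr rfl fun k hk => e3 k (Finset.mem_range.1 hk), ← Finset.mul_sum]
    rw [sum_Icc_eq_range] at h
    simp only [Nat.add_sub_cancel] at h
    calc _ ≤ |c|^(2+ρ) * (ε^ρ * A.Bsq^((2+ρ)/2)) := mul_le_mul_of_nonneg_left h (by positivity)
      _ = ε^ρ := by linear_combination ε^ρ * hc3

lemma scal_ratio (A : MDS Ω P) {c : ℝ} (hc : c ≠ 0) (ω : Ω) :
    SX (A.scal c) A.n ω / √(VX (A.scal c) A.n ω) = c/|c| * A.W ω := by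
  have h1 : SX (A.scal c) A.n ω = c * A.S ω := by
    unfold SX S
    rw [sum_Icc_eq_range, Finset.mul_sum]
    exact Finset.sum_congr rfl fun k hk => by rw [A.scal_lt c (Finset.mem_range.1 hk)]
  have h2 : VX (A.scal c) A.n ω = c^2 * A.QV ω := by
    unfold VX QV
    rw [sum_Icc_eq_range, Finset.mul_sum]
    exact Finset.sum_congr rfl fun k hk => by rw [A.scal_lt c (Finset.mem_range.1 hk)]; ring
  rw [h1, h2, Real.sqrt_mul (sq_nonneg c), Real.sqrt_sq_eq_abs, W, mul_div_mul_comm]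

end MDS

lemma exp_theta {K E p q : ℝ} (hK : 0 < K) (hE : 0 < E) (hq : 0 < q) (h1 : q * Real.exp (-(K*E)) ≤ p)
    (h2 : p ≤ q * Real.exp (K*E)) : ∃ θ : ℝ, |θ| ≤ 1 ∧ p / q = Real.exp (θ * K * E) := by
  have hp : 0 < p := lt_of_lt_of_le (by positivity) h1
  have hr : 0 < p / q := by positivity
  have hKE : 0 < K * E := by positivity
  refine ⟨Real.log (p/q) / (K*E), ?_, ?_⟩
  · rw [abs_le, le_div_iff₀ hKE, div_le_iff₀ hKE]
    constructor
    · rw [neg_one_mul, Real.le_log_iff_exp_le hr, le_div_iff₀ hq]; linarith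
    · rw [one_mul, Real.log_le_iff_le_exp hr, div_le_iff₀ hq]; linarith
  · rw [mul_assoc, div_mul_cancel₀ _ hKE.ne', Real.exp_log hr]

end

/-- Theorem 2.4 [i]: Cramér type expansion under (A1), (A2), (A4), for `ρ ∈ (0,1)`. -/
theorem cramer_expansion_A1A2A4_rho_lt_one (ρ : ℝ) (hρ : 0 < ρ) (hρ' : ρ < 1) :
    ∃ c : ℝ, 0 < c ∧
      ∀ (Ω : Type) [MeasurableSpace Ω] (P : Measure Ω), IsProbabilityMeasure P →
        ∀ (A : ℕ → MDS Ω P) (δ ε γ x : ℕ → ℝ),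
          (∀ n, (A n).CondA1 (δ n)) →
          (∀ n, (A n).CondA2 ρ (ε n)) →
          (∀ n, (A n).CondA4 ρ (γ n)) →
          (∀ n, 0 ≤ x n) →
          Tendsto (fun n => x n * γ n) atTop (nhds 0) →
          ∀ᶠ n in atTop,
            (∃ θ : ℝ, |θ| ≤ 1 ∧
                (P {ω | x n ≤ (A n).W ω}).toReal / (1 - stdNormalCDF (x n)) =
                  Real.exp (θ * c * (x n ^ (2 + ρ) * ε n ^ ρ + x n ^ 2 * δ n ^ 2 + (1 + x n) * (x n ^ ρ * γ n ^ ρ + γ n ^ ρ + δ n + ε n ^ (ρ * (2 - ρ) / 4) / (1 + x n ^ (ρ * (2 + ρ) / 4)))))) ∧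
            (∃ θ : ℝ, |θ| ≤ 1 ∧
                (P {ω | (A n).W ω ≤ -x n}).toReal / stdNormalCDF (-x n) =
                  Real.exp (θ * c * (x n ^ (2 + ρ) * ε n ^ ρ + x n ^ 2 * δ n ^ 2 + (1 + x n) * (x n ^ ρ * γ n ^ ρ + γ n ^ ρ + δ n + ε n ^ (ρ * (2 - ρ) / 4) / (1 + x n ^ (ρ * (2 + ρ) / 4)))))) := by
  obtain ⟨K, ι, hK, hι, key⟩ := two_sided ρ hρ hρ'
  refine ⟨K, hK, ?_⟩
  intro Ω _ P hP A δ ε γ x h1 h2 h4 hx hlim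
  filter_upwards [hlim.eventually (Iic_mem_nhds hι)] with n hn
  have hn' : x n * γ n ≤ ι := hn
  obtain ⟨ε0, ε1, -, -⟩ := id (h2 n)
  obtain ⟨γ0, γ1, -, -⟩ := id (h4 n)
  obtain ⟨δ0, δ1, -⟩ := id (h1 n)
  have hf : 0 < ε n ^ ρ := Real.rpow_pos_of_pos ε0 _
  have hf1 : ε n ^ ρ ≤ 1 := Real.rpow_le_one ε0.le (by linarith) hρ.le
  have hpw : ε n ^ (ρ * (2 - ρ) / 4) = (ε n ^ ρ) ^ ((2 - ρ) / 4) := by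
    rw [← Real.rpow_mul ε0.le]; congr 1; ring
  rw [hpw]
  generalize hE : x n ^ (2 + ρ) * ε n ^ ρ + x n ^ 2 * δ n ^ 2 + (1 + x n) * (x n ^ ρ * γ n ^ ρ + γ n ^ ρ + δ n + (ε n ^ ρ) ^ ((2 - ρ) / 4) / (1 + x n ^ (ρ * (2 + ρ) / 4))) = E
  have hγρ : 0 ≤ 2 * γ n ^ ρ := by positivity
  obtain ⟨τ, hτ⟩ := exists_Brk (e := min (ε n ^ ρ) (2 * γ n ^ ρ)) hρ hρ' γ0 δ0 hf hf1 (le_min hf.le hγρ)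
    (min_le_left _ _) (min_le_right _ _) (hx n) hE.symm
  have hB := (A n).Bsq_pos
  have hsB : 0 < √(A n).Bsq := Real.sqrt_pos.2 hB
  have main : ∀ c : ℝ, |c| = (√(A n).Bsq)⁻¹ →
      (1 - stdNormalCDF (x n)) * Real.exp (-(K*E)) ≤ P.real {ω | x n ≤ c/|c| * (A n).W ω} ∧
      P.real {ω | x n ≤ c/|c| * (A n).W ω} ≤ (1 - stdNormalCDF (x n)) * Real.exp (K*E) := by
    intro c hc
    have hc0 : c ≠ 0 := by
      rw [← abs_pos, hc]; positivity
    obtain ⟨s, m, hcore⟩ := (A n).core hρ hρ' (h1 n) (h2 n) (h4 n) hc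
    have := key hcore.min (min_le_right _ _) hτ hn'
    simpa only [(A n).scal_ratio hc0] using this
  have hq := one_sub_cdf_pos (x n)
  constructor
  · have := main (√(A n).Bsq)⁻¹ (abs_of_pos (by positivity))
    rw [abs_of_pos (by positivity : 0 < (√(A n).Bsq)⁻¹), div_self (by positivity)] at this
    simp only [one_mul] at this
    exact exp_theta hK hτ.E0 hq this.1 this.2
  · have := main (-(√(A n).Bsq)⁻¹) (by rw [abs_neg]; exact abs_of_pos (by positivity))
    rw [abs_neg, abs_of_pos (by positivity : 0 < (√(A n).Bsq)⁻¹), neg_div, div_self (by positivity)] at this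
    simp only [neg_mul, one_mul] at this
    simp only [le_neg (a := x n)] at this
    rw [cdf_neg]
    exact exp_theta hK hτ.E0 hq this.1 this.2
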